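/- There exist constants C, c > 0 depending only on Ω such that for all ε ∈ (0, 1]: inf_{θ⋆ ∈ D} P( (1/N)‖θ̂_{λ̂^{EST}} − θ⋆‖² ≤ inf_{λ ∈ [λ_min, λ_max]} (1/N)‖θ̂_λ − θ⋆‖² + ε ) ≥ 1 − C ε^{−6} N^q exp(−cNε⁶), where λ̂^{EST} = argmin_{λ ∈ [λ_min, λ_max]} τ̂(λ). -/

import Mathlib

open MeasureTheory ProbabilityTheory
open scoped ENNReal NNReal

noncomputable section

/-- Standard Gaussian density φ. -/
def gphi (x : ℝ) : ℝ := Real.exp (-x ^ 2 / 2) / Real.sqrt (2 * Real.pi)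

/-- Standard Gaussian CDF Φ. -/
def gPhi (x : ℝ) : ℝ := ∫ t in Set.Iic x, gphi t

/-- Soft thresholding η(x; b) = sign(x)(|x| − b)₊. -/
def eta (x b : ℝ) : ℝ := Real.sign x * max (|x| - b) 0

/-- Derivative in x of soft thresholding: η′(x; b) = 1_{|x| > b}. -/
def eta' (x b : ℝ) : ℝ := if b < |x| then 1 else 0

/-- The ℓ_p ball F_p(ξ) = {x : (1/N) ∑ |xᵢ|^p ≤ ξ^p}. -/
def Fball (N : ℕ) (p ξ : ℝ) : Set (Fin N → ℝ) :=
  {x | (1 / (N : ℝ)) * ∑ i, |x i| ^ p ≤ ξ ^ p}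

/-- Number of nonzero entries ‖x‖₀. -/
def l0 {N : ℕ} (x : Fin N → ℝ) : ℕ := (Finset.univ.filter fun i => x i ≠ 0).card

/-- The ℓ₀ ball F_0(s) = {x : ‖x‖₀ ≤ sN}. -/
def F0ball (N : ℕ) (s : ℝ) : Set (Fin N → ℝ) := {x | (l0 x : ℝ) ≤ s * N}

/-- The critical sparsity s_max(δ). -/
def smax (δ : ℝ) : ℝ :=
  δ * sSup ((fun α : ℝ =>
      (1 - (2 / δ) * ((1 + α ^ 2) * gPhi (-α) - α * gphi α)) /
      (1 + α ^ 2 - 2 * ((1 + α ^ 2) * gPhi (-α) - α * gphi α))) '' Set.Ici 0)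

/-- Empirical distribution of the entries of a vector. -/
def empDist {N : ℕ} (θ : Fin N → ℝ) : Measure ℝ :=
  ((N : ℝ≥0∞))⁻¹ • ∑ i : Fin N, Measure.dirac (θ i)

/-- Empirical distribution of pairs of entries of two vectors. -/
def empDist2 {N : ℕ} (u v : Fin N → ℝ) : Measure (ℝ × ℝ) :=
  ((N : ℝ≥0∞))⁻¹ • ∑ i : Fin N, Measure.dirac (u i, v i)

/-- Squared order-2 Wasserstein distance between measures on ℝ². -/
def W2sq (μ ν : Measure (ℝ × ℝ)) : ℝ :=
  sInf {r : ℝ | ∃ γ : Measure ((ℝ × ℝ) × (ℝ × ℝ)),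
    γ.map Prod.fst = μ ∧ γ.map Prod.snd = ν ∧
    r = ∫ q, ((q.1.1 - q.2.1) ^ 2 + (q.1.2 - q.2.2) ^ 2) ∂γ}

/-- Order-2 Wasserstein distance. -/
def W2 (μ ν : Measure (ℝ × ℝ)) : ℝ := Real.sqrt (W2sq μ ν)

/-- Standard Gaussian measure on ℝ. -/
def stdG : Measure ℝ := gaussianReal 0 1

/-- The state-evolution fixed point equations (for (Θ,Z) ∼ μ ⊗ N(0,1)),
together with positivity of (β, τ). -/
def StateEvo (δ σ : ℝ) (μ : Measure ℝ) (lam β τ : ℝ) : Prop :=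
  0 < β ∧ 0 < τ ∧
  τ ^ 2 = σ ^ 2 + (1 / δ) *
    ∫ q : ℝ × ℝ, (eta (q.1 + τ * q.2) (τ * lam / β) - q.1) ^ 2 ∂(μ.prod stdG) ∧
  β = τ * (1 - (1 / δ) *
    ∫ q : ℝ × ℝ, eta' (q.1 + τ * q.2) (τ * lam / β) ∂(μ.prod stdG))

/-- s⋆ = P(|Θ + τZ| ≥ ατ) for (Θ,Z) ∼ μ ⊗ N(0,1). -/
def sStar (μ : Measure ℝ) (τ α : ℝ) : ℝ :=
  ((μ.prod stdG) {q : ℝ × ℝ | α * τ ≤ |q.1 + τ * q.2|}).toReal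

/-- The limit law μ⋆: law of (η(Θ + τZ; ατ), Θ) for (Θ,Z) ∼ μ ⊗ N(0,1). -/
def muStar (μ : Measure ℝ) (τ α : ℝ) : Measure (ℝ × ℝ) :=
  (μ.prod stdG).map (fun q => (eta (q.1 + τ * q.2) (α * τ), q.1))

/-- The limit law for the debiased Lasso: law of (Θ + τZ, Θ). -/
def muStarD (μ : Measure ℝ) (τ : ℝ) : Measure (ℝ × ℝ) :=
  (μ.prod stdG).map (fun q => (q.1 + τ * q.2, q.1))

/-- Law of the design matrix: i.i.d. N(0, 1/n) entries. -/
def PX (n N : ℕ) : Measure (Fin n → Fin N → ℝ) :=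
  Measure.pi fun _ => Measure.pi fun _ => gaussianReal 0 ((n : ℝ≥0))⁻¹

/-- Law of the noise: i.i.d. standard Gaussian entries. -/
def Pz (n : ℕ) : Measure (Fin n → ℝ) :=
  Measure.pi fun _ => gaussianReal 0 1

/-- Joint law of (X, z). -/
def Pmodel (n N : ℕ) : Measure ((Fin n → Fin N → ℝ) × (Fin n → ℝ)) :=
  (PX n N).prod (Pz n)

/-- The response y = Xθ⋆ + σz. -/
def yvec {n N : ℕ} (σ : ℝ) (θstar : Fin N → ℝ) (X : Fin n → Fin N → ℝ)
    (z : Fin n → ℝ) : Fin n → ℝ :=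
  fun i => (∑ j, X i j * θstar j) + σ * z i

/-- The Lasso cost (1/(2n))‖y − Xθ‖² + (λ/n)‖θ‖₁. -/
def lassoCost {n N : ℕ} (X : Fin n → Fin N → ℝ) (y : Fin n → ℝ) (lam : ℝ)
    (θ : Fin N → ℝ) : ℝ :=
  (1 / (2 * (n : ℝ))) * ∑ i, (y i - ∑ j, X i j * θ j) ^ 2
    + (lam / (n : ℝ)) * ∑ j, |θ j|

/-- The uniformity class: D is either an ℓ_p ball F_p(ξ) or an ℓ₀ ball F_0(s) with
s below the critical sparsity, with the corresponding exponent q. -/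
def DFamSpec (δ : ℝ) (Dfam : (M : ℕ) → Set (Fin M → ℝ)) (q : ℝ) : Prop :=
  (∃ p ξ : ℝ, 0 < p ∧ 0 < ξ ∧ (∀ M, Dfam M = Fball M p ξ) ∧ q = max (1 / p - 1) 0) ∨
  (∃ s : ℝ, 0 ≤ s ∧ s < smax δ ∧ (∀ M, Dfam M = F0ball M s) ∧ q = 0)

/-- The estimator τ̂(λ) = √n ‖y − Xθ̂_λ‖ / (n − ‖θ̂_λ‖₀). -/
def tauHat {n N : ℕ} (X : Fin n → Fin N → ℝ) (y : Fin n → ℝ) (θ : Fin N → ℝ) : ℝ :=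
  Real.sqrt (n : ℝ) * Real.sqrt (∑ i, (y i - ∑ j, X i j * θ j) ^ 2)
    / ((n : ℝ) - (l0 θ : ℝ))

set_option linter.unusedSectionVars false

local notation "𝔼" => EuclideanSpace ℝ

section GaussianDensity

variable {E : Type*} [NormedAddCommGroup E] [InnerProductSpace ℝ E] [FiniteDimensional ℝ E]
  [MeasurableSpace E] [BorelSpace E]

/-- The density of the standard Gaussian measure on a Euclidean space. -/
def gaussDens (E : Type*) [NormedAddCommGroup E] [InnerProductSpace ℝ E] (x : E) : ℝ :=
  (2 * Real.pi) ^ (-(Module.finrank ℝ E : ℝ) / 2) * Real.exp (-‖x‖ ^ 2 / 2)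

lemma gaussDens_pos (x : E) : 0 < gaussDens E x := by unfold gaussDens; positivity

lemma continuous_gaussDens : Continuous (gaussDens E) := by unfold gaussDens; fun_prop

lemma integral_cexp_gaussDens (t : E) :
    ∫ x, (gaussDens E x : ℂ) * Complex.exp (inner ℝ x t * Complex.I) =
      Complex.exp (-(‖t‖ ^ 2 / 2 : ℝ)) := by
  have h := GaussianFourier.integral_cexp_neg_mul_sq_norm_add (V := E) (b := 1/2) (by norm_num)
    Complex.I t
  have h2 : ∀ x : E, (gaussDens E x : ℂ) * Complex.exp (inner ℝ x t * Complex.I) =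
      ((2 * Real.pi) ^ (-(Module.finrank ℝ E : ℝ) / 2) : ℝ) *
      Complex.exp (-(1/2) * ‖x‖ ^ 2 + Complex.I * inner ℝ t x) := by
    intro x
    unfold gaussDens
    push_cast
    rw [mul_assoc, ← Complex.exp_add, real_inner_comm]
    congr 2
    ring
  simp_rw [h2]
  rw [integral_const_mul, h]
  have h3 : (Real.pi / (1/2) : ℂ) ^ ((Module.finrank ℝ E : ℂ) / 2) =
      ((2 * Real.pi) ^ ((Module.finrank ℝ E : ℝ) / 2) : ℝ) := by
    rw [Complex.ofReal_cpow (by positivity)]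
    push_cast
    congr 1
    ring
  rw [h3, ← mul_assoc, ← Complex.ofReal_mul, neg_div, Real.rpow_neg (by positivity),
    inv_mul_cancel₀ (by positivity)]
  simp
  congr 1
  ring

lemma stdGaussian_eq_withDensity :
    stdGaussian E = volume.withDensity (fun x => ENNReal.ofReal (gaussDens E x)) := by
  have hInt : Integrable (gaussDens E) := by
    have h : ∫ x, (gaussDens E x : ℂ) = 1 := by simpa using integral_cexp_gaussDens (0 : E)
    have : Integrable (fun x => (gaussDens E x : ℂ)) := by
      by_contra hc
      rw [integral_undef hc] at h
      simp at h
    simpa using this.re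
  have hfin : IsFiniteMeasure (volume.withDensity (fun x => ENNReal.ofReal (gaussDens E x))) :=
    isFiniteMeasure_withDensity_ofReal hInt.2
  apply Measure.ext_of_charFun
  ext t
  rw [charFun_stdGaussian, charFun_apply,
    integral_withDensity_eq_integral_toReal_smul
      (by exact continuous_gaussDens.measurable.ennreal_ofReal) (by simp)]
  rw [← Complex.ofReal_pow, show (-((‖t‖ ^ 2 : ℝ) : ℂ) / 2) = -((‖t‖ ^ 2 / 2 : ℝ) : ℂ) by push_cast; ring,
    ← integral_cexp_gaussDens]
  congr 1
  ext x
  rw [ENNReal.toReal_ofReal (gaussDens_pos x).le]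
  simp

lemma integral_stdGaussian_eq {F : Type*} [NormedAddCommGroup F] [NormedSpace ℝ F] (f : E → F) :
    ∫ x, f x ∂(stdGaussian E) = ∫ x, gaussDens E x • f x := by
  rw [stdGaussian_eq_withDensity, integral_withDensity_eq_integral_toReal_smul
      (by exact continuous_gaussDens.measurable.ennreal_ofReal) (by simp)]
  simp [ENNReal.toReal_ofReal (gaussDens_pos _).le]

lemma integrable_stdGaussian_iff (f : E → ℝ) :
    Integrable f (stdGaussian E) ↔ Integrable (fun x => gaussDens E x * f x) := by
  rw [stdGaussian_eq_withDensity, integrable_withDensity_iff_integrable_smul'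
      (by exact continuous_gaussDens.measurable.ennreal_ofReal) (by simp)]
  simp [ENNReal.toReal_ofReal (gaussDens_pos _).le]

lemma lintegral_stdGaussian_eq (f : E → ℝ≥0∞) :
    ∫⁻ x, f x ∂(stdGaussian E) = ∫⁻ x, ENNReal.ofReal (gaussDens E x) * f x := by
  rw [stdGaussian_eq_withDensity, lintegral_withDensity_eq_lintegral_mul_non_measurable _
    (by exact continuous_gaussDens.measurable.ennreal_ofReal) (by simp)]
  rfl

lemma stdGaussian_absolutelyContinuous : stdGaussian E ≪ volume := by
  rw [stdGaussian_eq_withDensity]; exact withDensity_absolutelyContinuous _ _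

lemma hasFDerivAt_gaussDens (x : E) :
    HasFDerivAt (gaussDens E) ((-gaussDens E x) • innerSL ℝ x) x := by
  have h1 := (((hasStrictFDerivAt_norm_sq x).hasFDerivAt.const_mul (-1/2 : ℝ)).exp).const_mul
    ((2 * Real.pi) ^ (-(Module.finrank ℝ E : ℝ) / 2))
  have e : gaussDens E = fun y => (2 * Real.pi) ^ (-(Module.finrank ℝ E : ℝ) / 2) *
      Real.exp (-1 / 2 * ‖y‖ ^ 2) := by
    ext y; simp only [gaussDens]; congr 2; ring
  rw [e]
  refine h1.congr_fderiv ?_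
  ext y
  simp
  ring

lemma fderiv_gaussDens (x v : E) :
    fderiv ℝ (gaussDens E) x v = -(inner ℝ v x) * gaussDens E x := by
  rw [(hasFDerivAt_gaussDens x).fderiv]
  simp [real_inner_comm]
  ring

lemma differentiable_gaussDens : Differentiable ℝ (gaussDens E) := fun x =>
  (hasFDerivAt_gaussDens x).differentiableAt

/-- Gaussian integration by parts. -/
lemma stdGaussian_stein (v : E) (f : E → ℝ) (hf : Differentiable ℝ f)
    (h1 : Integrable f (stdGaussian E)) (h2 : Integrable (fun x => inner ℝ v x * f x) (stdGaussian E))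
    (h3 : Integrable (fun x => fderiv ℝ f x v) (stdGaussian E)) :
    ∫ x, inner ℝ v x * f x ∂(stdGaussian E) = ∫ x, fderiv ℝ f x v ∂(stdGaussian E) := by
  rw [integrable_stdGaussian_iff] at h1 h2 h3
  rw [integral_stdGaussian_eq, integral_stdGaussian_eq]
  have := integral_mul_fderiv_eq_neg_fderiv_mul_of_integrable (μ := (volume : Measure E)) (v := v)
    (f := f) (g := gaussDens E) (by simpa [mul_comm] using h3)
    (by simp_rw [fderiv_gaussDens]; exact h2.neg.congr (.of_forall fun x => by simp; ring))
    (by simpa [mul_comm] using h1) (fun x _ => hf x) (fun x _ => differentiable_gaussDens x)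
  simp_rw [fderiv_gaussDens] at this
  have e1 : ∫ x, f x * (-inner ℝ v x * gaussDens E x) =
      -∫ x, gaussDens E x • (inner ℝ v x * f x) := by
    rw [← integral_neg]; congr 1; ext x; simp only [smul_eq_mul]; ring
  rw [e1, neg_inj] at this
  rw [this]
  congr 1; ext x; simp only [smul_eq_mul]; ring

end GaussianDensity

section GaussianConcentration

open Filter Topology

variable {E : Type*} [NormedAddCommGroup E] [InnerProductSpace ℝ E] [FiniteDimensional ℝ E]
  [MeasurableSpace E] [BorelSpace E]

lemma integrable_exp_norm_stdGaussian (s : ℝ) :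
    Integrable (fun x => Real.exp (s * ‖x‖)) (stdGaussian E) := by
  obtain ⟨C, hC, h⟩ := IsGaussian.exists_integrable_exp_sq (stdGaussian E)
  refine (h.const_mul (Real.exp (s ^ 2 / (4 * C)))).mono' (by fun_prop) (.of_forall fun x => ?_)
  rw [Real.norm_eq_abs, abs_of_pos (Real.exp_pos _), ← Real.exp_add, Real.exp_le_exp]
  have : 0 ≤ C * (‖x‖ - s / (2 * C)) ^ 2 := by positivity
  have e : C * (‖x‖ - s / (2 * C)) ^ 2 = s ^ 2 / (4 * C) + C * ‖x‖ ^ 2 - s * ‖x‖ := by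
    field_simp; ring
  linarith

lemma map_strongDual_stdGaussian (L : StrongDual ℝ E) :
    (stdGaussian E).map L = gaussianReal 0 (‖L‖₊ ^ 2) := by
  rw [IsGaussian.map_eq_gaussianReal, variance_dual_stdGaussian, integral_strongDual_stdGaussian]
  congr 1
  ext; simp

lemma integral_exp_strongDual_stdGaussian (L : StrongDual ℝ E) :
    ∫ x, Real.exp (L x) ∂(stdGaussian E) = Real.exp (‖L‖ ^ 2 / 2) := by
  have h := mgf_gaussianReal (map_strongDual_stdGaussian L) 1
  rw [mgf] at h
  simpa using h

lemma integrable_exp_norm_add_norm (s : ℝ) :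
    Integrable (fun p : E × E => Real.exp (s * (‖p.1‖ + ‖p.2‖)))
      ((stdGaussian E).prod (stdGaussian E)) := by
  simp_rw [mul_add, Real.exp_add]
  exact (integrable_exp_norm_stdGaussian s).mul_prod (integrable_exp_norm_stdGaussian s)

lemma integrable_exp_lipschitz {f : E → ℝ} {K : ℝ≥0} (hf : LipschitzWith K f) (s : ℝ) :
    Integrable (fun x => Real.exp (s * f x)) (stdGaussian E) := by
  refine ((integrable_exp_norm_stdGaussian (|s| * K)).const_mul (Real.exp (|s| * |f 0|))).mono'
    (by have := hf.continuous; fun_prop) (.of_forall fun x => ?_)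
  rw [Real.norm_eq_abs, abs_of_pos (Real.exp_pos _), ← Real.exp_add, Real.exp_le_exp]
  have h1 := hf.dist_le_mul x 0
  rw [Real.dist_eq, dist_zero_right] at h1
  have h2 : |f x| ≤ |f 0| + K * ‖x‖ := by
    have := abs_sub_abs_le_abs_sub (f x) (f 0); linarith
  calc s * f x ≤ |s| * |f x| := by rw [← abs_mul]; exact le_abs_self _
    _ ≤ |s| * (|f 0| + K * ‖x‖) := by gcongr
    _ = _ := by ring

lemma integrable_lipschitz {f : E → ℝ} {K : ℝ≥0} (hf : LipschitzWith K f) :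
    Integrable f (stdGaussian E) := by
  refine ((integrable_exp_lipschitz hf 1).add (integrable_exp_lipschitz hf (-1))).mono'
    hf.continuous.aestronglyMeasurable (.of_forall fun x => ?_)
  rw [Real.norm_eq_abs, Pi.add_apply]
  have h1 := Real.add_one_le_exp (1 * f x)
  have h2 := Real.add_one_le_exp (-1 * f x)
  have h3 := Real.exp_pos (1 * f x)
  have h4 := Real.exp_pos (-1 * f x)
  rw [abs_le]; constructor <;> linarith

/-- The rotated point `cos a • x + sin a • y`. -/
def rotPt (a : ℝ) (p : E × E) : E := Real.cos a • p.1 + Real.sin a • p.2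

lemma rotPt_eq (a : ℝ) (p : E × E) : rotPt a p = (ContinuousLinearMap.rotation a p).1 := by
  simp [rotPt, ContinuousLinearMap.rotation_apply]

lemma rotPt_rotation (a b : ℝ) (p : E × E) :
    rotPt a (ContinuousLinearMap.rotation b p) = rotPt (a + b) p := by
  simp only [rotPt, ContinuousLinearMap.rotation_apply, Real.cos_add, Real.sin_add]
  module

lemma measurePreserving_rotation (a : ℝ) :
    MeasurePreserving (ContinuousLinearMap.rotation a : E × E → E × E)
      ((stdGaussian E).prod (stdGaussian E)) ((stdGaussian E).prod (stdGaussian E)) :=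
  ⟨by fun_prop, IsGaussian.map_rotation_eq_self (by simp) a⟩

lemma norm_rotPt_sub_le {a : ℝ} (h0 : 0 ≤ a) (h2 : a ≤ 2) (p : E × E) :
    ‖rotPt a p - p.1‖ ≤ a * (‖p.1‖ + ‖p.2‖) := by
  have e : rotPt a p - p.1 = (Real.cos a - 1) • p.1 + Real.sin a • p.2 := by
    simp only [rotPt]; module
  rw [e]
  refine (norm_add_le _ _).trans ?_
  rw [norm_smul, norm_smul, mul_add]
  have h3 := Real.one_sub_sq_div_two_le_cos (x := a)
  have h4 : ‖Real.cos a - 1‖ ≤ a := by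
    rw [Real.norm_eq_abs, abs_sub_comm, abs_of_nonneg (by linarith [Real.cos_le_one a])]
    nlinarith
  have h5 : ‖Real.sin a‖ ≤ a := by
    rw [Real.norm_eq_abs]; simpa [abs_of_nonneg h0] using Real.abs_sin_le_abs (x := a)
  gcongr

lemma exp_rot_bound {f : E → ℝ} {K : ℝ≥0} (hf : LipschitzWith K f) (s : ℝ) {m : ℕ} (hm : 0 < m)
    (p : E × E) :
    s * m * (f (rotPt (Real.pi / 2 / m) p) - f p.1) ≤ (2 * |s| * K) * (‖p.1‖ + ‖p.2‖) := by
  have hm' : (0 : ℝ) < m := by exact_mod_cast hm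
  have hm1 : (1 : ℝ) ≤ m := by exact_mod_cast hm
  have hpi := Real.pi_lt_four
  have ha : Real.pi / 2 / m ≤ 2 := by rw [div_le_iff₀ hm']; linarith
  have h := norm_rotPt_sub_le (by positivity) ha p
  have h1 := hf.dist_le_mul (rotPt (Real.pi / 2 / m) p) p.1
  rw [Real.dist_eq, dist_eq_norm] at h1
  calc s * m * (f (rotPt (Real.pi / 2 / m) p) - f p.1)
      ≤ |s * m * (f (rotPt (Real.pi / 2 / m) p) - f p.1)| := le_abs_self _
    _ = |s| * m * |f (rotPt (Real.pi / 2 / m) p) - f p.1| := by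
        rw [abs_mul, abs_mul, abs_of_pos hm']
    _ ≤ |s| * m * (K * (Real.pi / 2 / m * (‖p.1‖ + ‖p.2‖))) := by gcongr; exact h1.trans (by gcongr)
    _ = (|s| * K * (‖p.1‖ + ‖p.2‖)) * (Real.pi / 2) := by field_simp
    _ ≤ (|s| * K * (‖p.1‖ + ‖p.2‖)) * 2 := by gcongr; linarith
    _ = _ := by ring

lemma integrable_exp_rot {f : E → ℝ} {K : ℝ≥0} (hf : LipschitzWith K f) (s : ℝ) {m : ℕ}
    (hm : 0 < m) :
    Integrable (fun p : E × E => Real.exp (s * m * (f (rotPt (Real.pi / 2 / m) p) - f p.1)))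
      ((stdGaussian E).prod (stdGaussian E)) := by
  refine (integrable_exp_norm_add_norm (2 * |s| * K)).mono' ?_ (.of_forall fun p => ?_)
  · have := hf.continuous
    unfold rotPt
    fun_prop
  · rw [Real.norm_eq_abs, abs_of_pos (Real.exp_pos _), Real.exp_le_exp]
    exact exp_rot_bound hf s hm p

lemma integral_exp_sub_le_rot {f : E → ℝ} {K : ℝ≥0} (hf : LipschitzWith K f) (s : ℝ) {m : ℕ}
    (hm : 0 < m) :
    ∫ p : E × E, Real.exp (s * (f p.2 - f p.1)) ∂((stdGaussian E).prod (stdGaussian E)) ≤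
      ∫ p : E × E, Real.exp (s * m * (f (rotPt (Real.pi / 2 / m) p) - f p.1))
        ∂((stdGaussian E).prod (stdGaussian E)) := by
  set a := Real.pi / 2 / m with ha
  have hm' : (0 : ℝ) < m := by exact_mod_cast hm
  set F : E × E → ℝ := fun p => Real.exp (s * m * (f (rotPt a p) - f p.1)) with hF
  have hFi : Integrable F ((stdGaussian E).prod (stdGaussian E)) := integrable_exp_rot hf s hm
  have hFk : ∀ k : ℕ, Integrable (fun p => F (ContinuousLinearMap.rotation (k * a) p))
      ((stdGaussian E).prod (stdGaussian E)) := fun k =>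
    (measurePreserving_rotation (E := E) (k * a)).integrable_comp_of_integrable hFi
  have hFI : ∀ k : ℕ, ∫ p, F (ContinuousLinearMap.rotation (k * a) p)
      ∂((stdGaussian E).prod (stdGaussian E)) = ∫ p, F p ∂((stdGaussian E).prod (stdGaussian E)) :=
    fun k => by
      conv_rhs => rw [← (measurePreserving_rotation (E := E) (k * a)).map_eq]
      rw [integral_map (by fun_prop)]
      rw [(measurePreserving_rotation (E := E) (k * a)).map_eq]
      exact hFi.1
  have key : ∀ p : E × E, Real.exp (s * (f p.2 - f p.1)) ≤
      ∑ k ∈ Finset.range m, (1 / m : ℝ) * F (ContinuousLinearMap.rotation (k * a) p) := by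
    intro p
    have hs : s * (f p.2 - f p.1) = ∑ k ∈ Finset.range m, (1 / m : ℝ) •
        (s * m * (f (rotPt ((k + 1 : ℕ) * a) p) - f (rotPt (k * a) p))) := by
      simp_rw [smul_eq_mul]
      have : ∀ k : ℕ, (1 / m : ℝ) * (s * m * (f (rotPt ((k + 1 : ℕ) * a) p) - f (rotPt (k * a) p))) =
          s * (f (rotPt ((k + 1 : ℕ) * a) p) - f (rotPt (k * a) p)) := by
        intro k; field_simp
      simp_rw [this, ← Finset.mul_sum]
      rw [Finset.sum_range_sub (fun k : ℕ => f (rotPt (k * a) p))]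
      congr 3
      · rw [ha, mul_div_cancel₀ _ hm'.ne']; simp [rotPt]
      · simp [rotPt]
    rw [hs]
    refine (convexOn_exp.map_sum_le (fun k _ => by positivity) ?_ (fun _ _ => Set.mem_univ _)).trans_eq ?_
    · simp; field_simp
    · refine Finset.sum_congr rfl fun k _ => ?_
      rw [hF, smul_eq_mul]
      simp only
      rw [rotPt_rotation, ← rotPt_eq]
      congr 5
      push_cast; ring_nf
  calc _ ≤ ∫ p, ∑ k ∈ Finset.range m, (1 / m : ℝ) * F (ContinuousLinearMap.rotation (k * a) p)
        ∂((stdGaussian E).prod (stdGaussian E)) :=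
        integral_mono_of_nonneg (.of_forall fun p => (Real.exp_pos _).le)
          (integrable_finsetSum _ fun k _ => (hFk k).const_mul _) (.of_forall key)
    _ = _ := by
        rw [integral_finsetSum _ fun k _ => (hFk k).const_mul _]
        simp_rw [integral_const_mul, hFI]
        simp; field_simp

lemma integral_exp_sub_le {f : E → ℝ} {K : ℝ≥0} (hf : LipschitzWith K f) (s : ℝ) :
    ∫ p : E × E, Real.exp (s * (f p.2 - f p.1)) ∂((stdGaussian E).prod (stdGaussian E)) ≤
      Real.exp ((s * (Real.pi / 2) * K) ^ 2 / 2) := by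
  have hbd := integrable_exp_norm_add_norm (E := E) (2 * |s| * K)
  have hlim : ∀ᵐ p : E × E ∂((stdGaussian E).prod (stdGaussian E)),
      Tendsto (fun m : ℕ => Real.exp (s * m * (f (rotPt (Real.pi / 2 / m) p) - f p.1))) atTop
        (𝓝 (Real.exp (s * (Real.pi / 2) * fderiv ℝ f p.1 p.2))) := by
    have hd : ∀ᵐ x ∂(stdGaussian E), DifferentiableAt ℝ f x :=
      stdGaussian_absolutelyContinuous.ae_le hf.ae_differentiableAt
    have hd2 : ∀ᵐ p : E × E ∂((stdGaussian E).prod (stdGaussian E)), DifferentiableAt ℝ f p.1 :=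
      Measure.quasiMeasurePreserving_fst.ae hd
    filter_upwards [hd2] with p hp
    refine (Real.continuous_exp.tendsto _).comp ?_
    have h1 : HasDerivAt (fun a => rotPt a p) p.2 0 := by
      have := ((Real.hasDerivAt_cos 0).smul_const p.1).add ((Real.hasDerivAt_sin 0).smul_const p.2)
      simpa [rotPt] using! this
    have h0 : rotPt 0 p = p.1 := by simp [rotPt]
    have h2 : HasDerivAt (fun a => f (rotPt a p)) (fderiv ℝ f p.1 p.2) 0 := by
      have hfd := hp.hasFDerivAt
      rw [← h0] at hfd
      have := hfd.comp_hasDerivAt (0 : ℝ) h1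
      rw [h0] at this
      exact this
    have h3 : Tendsto (fun m : ℕ => Real.pi / 2 / (m : ℝ)) atTop (𝓝[≠] 0) := by
      refine tendsto_nhdsWithin_iff.2 ⟨tendsto_const_div_atTop_nhds_zero_nat _, ?_⟩
      filter_upwards [eventually_gt_atTop 0] with m hm
      have : (0 : ℝ) < m := by exact_mod_cast hm
      simp only [Set.mem_compl_iff, Set.mem_singleton_iff]
      positivity
    have h4 := (hasDerivAt_iff_tendsto_slope.1 h2).comp h3
    have h5 := h4.const_mul (s * (Real.pi / 2))
    refine h5.congr' ?_
    filter_upwards [eventually_gt_atTop 0] with m hm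
    have : (0 : ℝ) < m := by exact_mod_cast hm
    simp only [Function.comp, slope_def_field, sub_zero, h0]
    field_simp
  have hT : Tendsto (fun m : ℕ => ∫ p : E × E,
      Real.exp (s * m * (f (rotPt (Real.pi / 2 / m) p) - f p.1))
        ∂((stdGaussian E).prod (stdGaussian E))) atTop
      (𝓝 (∫ p : E × E, Real.exp (s * (Real.pi / 2) * fderiv ℝ f p.1 p.2)
        ∂((stdGaussian E).prod (stdGaussian E)))) := by
    refine tendsto_integral_filter_of_dominated_convergence _ ?_ ?_ hbd hlim
    · filter_upwards [eventually_gt_atTop 0] with m hm using (integrable_exp_rot hf s hm).1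
    · filter_upwards [eventually_gt_atTop 0] with m hm
      refine .of_forall fun p => ?_
      rw [Real.norm_eq_abs, abs_of_pos (Real.exp_pos _), Real.exp_le_exp]
      exact exp_rot_bound hf s hm p
  have hle : ∫ p : E × E, Real.exp (s * (f p.2 - f p.1)) ∂((stdGaussian E).prod (stdGaussian E)) ≤
      ∫ p : E × E, Real.exp (s * (Real.pi / 2) * fderiv ℝ f p.1 p.2)
        ∂((stdGaussian E).prod (stdGaussian E)) :=
    ge_of_tendsto hT (by
      filter_upwards [eventually_gt_atTop 0] with m hm using integral_exp_sub_le_rot hf s hm)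
  refine hle.trans ?_
  have hK : ∀ x, ‖fderiv ℝ f x‖ ≤ K := fun x => norm_fderiv_le_of_lipschitz ℝ hf
  have hInt : Integrable (fun p : E × E => Real.exp (s * (Real.pi / 2) * fderiv ℝ f p.1 p.2))
      ((stdGaussian E).prod (stdGaussian E)) := by
    refine hbd.mono' (aestronglyMeasurable_of_tendsto_ae atTop
      (f := fun m : ℕ => fun p : E × E => Real.exp (s * (m + 1 : ℕ) * (f (rotPt (Real.pi / 2 / (m + 1 : ℕ)) p) - f p.1)))
      (fun m => (integrable_exp_rot hf s m.succ_pos).1) ?_) (.of_forall fun p => ?_)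
    · filter_upwards [hlim] with p hp
      exact hp.comp (tendsto_add_atTop_nat 1)
    · rw [Real.norm_eq_abs, abs_of_pos (Real.exp_pos _), Real.exp_le_exp]
      have h1 : |fderiv ℝ f p.1 p.2| ≤ K * ‖p.2‖ :=
        ((fderiv ℝ f p.1).le_opNorm p.2).trans (by gcongr; exact hK _)
      calc s * (Real.pi / 2) * fderiv ℝ f p.1 p.2 ≤ |s * (Real.pi / 2) * fderiv ℝ f p.1 p.2| :=
            le_abs_self _
        _ = |s| * (Real.pi / 2) * |fderiv ℝ f p.1 p.2| := by
            rw [abs_mul, abs_mul, abs_of_pos (by positivity : 0 < Real.pi / 2)]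
        _ ≤ |s| * 2 * (K * (‖p.1‖ + ‖p.2‖)) := by
            gcongr
            · linarith [Real.pi_lt_four]
            · exact h1.trans (by gcongr; linarith [norm_nonneg p.1])
        _ = _ := by ring
  rw [integral_prod _ hInt]
  calc _ ≤ ∫ x, Real.exp ((s * (Real.pi / 2) * K) ^ 2 / 2) ∂(stdGaussian E) := by
        refine integral_mono_of_nonneg (.of_forall fun x => integral_nonneg fun y => (Real.exp_pos _).le)
          (integrable_const _) (.of_forall fun x => ?_)
        have := integral_exp_strongDual_stdGaussian ((s * (Real.pi / 2)) • fderiv ℝ f x)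
        simp only [FunLike.coe_smul, Pi.smul_apply, smul_eq_mul] at this
        simp only
        rw [this, norm_smul, Real.exp_le_exp, mul_pow, mul_pow, Real.norm_eq_abs, sq_abs]
        gcongr
        exact hK x
    _ = _ := by simp

/-- Gaussian concentration for Lipschitz functions. -/
theorem hasSubgaussianMGF_lipschitz {f : E → ℝ} {K : ℝ≥0} (hf : LipschitzWith K f) :
    HasSubgaussianMGF (fun x => f x - ∫ y, f y ∂(stdGaussian E)) (5 / 2 * K ^ 2)
      (stdGaussian E) := by
  have hi := integrable_exp_lipschitz hf
  refine ⟨fun t => ?_, fun t => ?_⟩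
  · simp_rw [mul_sub, Real.exp_sub]
    exact (hi t).div_const _
  · have h1 := integral_exp_sub_le hf t
    have h2 : ∫ p : E × E, Real.exp (t * (f p.2 - f p.1)) ∂((stdGaussian E).prod (stdGaussian E)) =
        (∫ x, Real.exp (-t * f x) ∂(stdGaussian E)) * ∫ x, Real.exp (t * f x) ∂(stdGaussian E) := by
      rw [← integral_prod_mul]
      congr 1; ext p
      rw [← Real.exp_add]; congr 1; ring
    have h3 : Real.exp (∫ x, -t * f x ∂(stdGaussian E)) ≤ ∫ x, Real.exp (-t * f x) ∂(stdGaussian E) :=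
      convexOn_exp.map_integral_le Real.continuous_exp.continuousOn isClosed_univ (by simp)
        ((integrable_lipschitz hf).const_mul _) (hi (-t))
    rw [integral_const_mul] at h3
    have h4 : mgf (fun x => f x - ∫ y, f y ∂(stdGaussian E)) (stdGaussian E) t =
        Real.exp (-t * ∫ y, f y ∂(stdGaussian E)) * ∫ x, Real.exp (t * f x) ∂(stdGaussian E) := by
      rw [mgf, ← integral_const_mul]
      congr 1; ext x; rw [← Real.exp_add]; ring_nf
    rw [h4]
    refine (mul_le_mul_of_nonneg_right h3 (integral_nonneg fun x => (Real.exp_pos _).le)).trans ?_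
    rw [← h2]
    refine h1.trans (Real.exp_le_exp.2 ?_)
    have hpi : Real.pi ^ 2 ≤ 10 := by nlinarith [Real.pi_lt_d2, Real.pi_pos]
    push_cast
    nlinarith [mul_nonneg (sq_nonneg t) (sq_nonneg (K : ℝ))]

lemma measure_ge_lipschitz {f : E → ℝ} {K : ℝ≥0} (hf : LipschitzWith K f) {t : ℝ} (ht : 0 ≤ t) :
    stdGaussian E {x | ∫ y, f y ∂(stdGaussian E) + t ≤ f x} ≤
      ENNReal.ofReal (Real.exp (-t ^ 2 / (5 * K ^ 2))) := by
  have := (hasSubgaussianMGF_lipschitz hf).measure_ge_le ht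
  rw [← ofReal_measureReal]
  refine ENNReal.ofReal_le_ofReal ?_
  convert this using 3
  · ext x; constructor <;> intro h <;> linarith
  · push_cast; ring

lemma measure_le_lipschitz {f : E → ℝ} {K : ℝ≥0} (hf : LipschitzWith K f) {t : ℝ} (ht : 0 ≤ t) :
    stdGaussian E {x | f x ≤ ∫ y, f y ∂(stdGaussian E) - t} ≤
      ENNReal.ofReal (Real.exp (-t ^ 2 / (5 * K ^ 2))) := by
  have := measure_ge_lipschitz hf.neg ht
  convert this using 3
  ext x
  simp only [Pi.neg_apply, integral_neg]
  constructor <;> intro h <;> linarith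

end GaussianConcentration

section FiniteGordon

variable {I J : Type*} [Fintype I] [Fintype J] [Nonempty I] [Nonempty J]

/-- Row partition function of the smooth min-max. -/
def rowSum (β : ℝ) (v : I → J → ℝ) (i : I) : ℝ := ∑ j, Real.exp (β * v i j)

/-- Total partition function of the smooth min-max. -/
def totSum (β : ℝ) (v : I → J → ℝ) : ℝ := ∑ i, (rowSum β v i)⁻¹

/-- Smooth approximation of `min_i max_j v i j`. -/
def softMinMax (β : ℝ) (v : I → J → ℝ) : ℝ := -β⁻¹ * Real.log (totSum β v)

/-- The Gibbs weights, i.e. the gradient of `softMinMax`. -/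
def gibbs (β : ℝ) (v : I → J → ℝ) (i : I) (j : J) : ℝ :=
  Real.exp (β * v i j) * ((rowSum β v i)⁻¹) ^ 2 * (totSum β v)⁻¹

lemma rowSum_pos (β : ℝ) (v : I → J → ℝ) (i : I) : 0 < rowSum β v i :=
  Finset.sum_pos (fun _ _ => Real.exp_pos _) Finset.univ_nonempty

lemma totSum_pos (β : ℝ) (v : I → J → ℝ) : 0 < totSum β v :=
  Finset.sum_pos (fun i _ => inv_pos.2 (rowSum_pos β v i)) Finset.univ_nonempty

lemma gibbs_nonneg (β : ℝ) (v : I → J → ℝ) (i : I) (j : J) : 0 ≤ gibbs β v i j := by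
  have := rowSum_pos β v i
  have := totSum_pos β v
  unfold gibbs; positivity

lemma sum_gibbs_row (β : ℝ) (v : I → J → ℝ) (i : I) :
    ∑ j, gibbs β v i j = (rowSum β v i)⁻¹ * (totSum β v)⁻¹ := by
  have := rowSum_pos β v i
  simp only [gibbs]
  rw [← Finset.sum_mul, ← Finset.sum_mul]
  change rowSum β v i * _ * _ = _
  field_simp

lemma sum_gibbs (β : ℝ) (v : I → J → ℝ) : ∑ i, ∑ j, gibbs β v i j = 1 := by
  simp_rw [sum_gibbs_row]
  rw [← Finset.sum_mul]
  exact mul_inv_cancel₀ (totSum_pos β v).ne'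

lemma gibbs_le_one (β : ℝ) (v : I → J → ℝ) (i : I) (j : J) : gibbs β v i j ≤ 1 := by
  rw [← sum_gibbs β v]
  exact (Finset.single_le_sum (f := fun j => gibbs β v i j) (fun j _ => gibbs_nonneg β v i j)
    (Finset.mem_univ j)).trans (Finset.single_le_sum (f := fun i => ∑ j, gibbs β v i j)
    (fun i _ => Finset.sum_nonneg fun j _ => gibbs_nonneg β v i j) (Finset.mem_univ i))

lemma hasDerivAt_rowSum {β : ℝ} {v : I → J → ℝ → ℝ} {d : I → J → ℝ} {t : ℝ}
    (h : ∀ i j, HasDerivAt (v i j) (d i j) t) (i : I) :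
    HasDerivAt (fun s => rowSum β (fun i j => v i j s) i)
      (∑ j, Real.exp (β * v i j t) * (β * d i j)) t := by
  unfold rowSum
  exact HasDerivAt.fun_sum fun j _ => ((h i j).const_mul β).exp

lemma hasDerivAt_totSum {β : ℝ} {v : I → J → ℝ → ℝ} {d : I → J → ℝ} {t : ℝ}
    (h : ∀ i j, HasDerivAt (v i j) (d i j) t) :
    HasDerivAt (fun s => totSum β (fun i j => v i j s))
      (-β * totSum β (fun i j => v i j t) * ∑ i, ∑ j, gibbs β (fun i j => v i j t) i j * d i j) t := by
  have hW := totSum_pos β (fun i j => v i j t)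
  have := HasDerivAt.fun_sum (u := Finset.univ) fun i _ =>
    (hasDerivAt_rowSum (β := β) h i).fun_inv (rowSum_pos β _ i).ne'
  refine this.congr_deriv ?_
  rw [Finset.mul_sum]
  refine Finset.sum_congr rfl fun i _ => ?_
  have hR := rowSum_pos β (fun i j => v i j t) i
  rw [Finset.mul_sum, ← Finset.sum_neg_distrib, Finset.sum_div]
  refine Finset.sum_congr rfl fun j _ => ?_
  unfold gibbs
  field_simp

lemma hasDerivAt_softMinMax {β : ℝ} (hβ : 0 < β) {v : I → J → ℝ → ℝ} {d : I → J → ℝ} {t : ℝ}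
    (h : ∀ i j, HasDerivAt (v i j) (d i j) t) :
    HasDerivAt (fun s => softMinMax β (fun i j => v i j s))
      (∑ i, ∑ j, gibbs β (fun i j => v i j t) i j * d i j) t := by
  have hW := totSum_pos β (fun i j => v i j t)
  refine (((hasDerivAt_totSum (β := β) h).log hW.ne').const_mul (-β⁻¹)).congr_deriv ?_
  field_simp

lemma hasDerivAt_gibbs {β : ℝ} {v : I → J → ℝ → ℝ} {d : I → J → ℝ} {t : ℝ}
    (h : ∀ i j, HasDerivAt (v i j) (d i j) t) (i₀ : I) (j₀ : J) :
    HasDerivAt (fun s => gibbs β (fun i j => v i j s) i₀ j₀)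
      (β * gibbs β (fun i j => v i j t) i₀ j₀ * (d i₀ j₀
        - 2 * (∑ j, Real.exp (β * v i₀ j t) * d i₀ j) / rowSum β (fun i j => v i j t) i₀
        + ∑ i, ∑ j, gibbs β (fun i j => v i j t) i j * d i j)) t := by
  have hW := totSum_pos β (fun i j => v i j t)
  have hR := rowSum_pos β (fun i j => v i j t) i₀
  have h1 := ((h i₀ j₀).const_mul β).exp
  have h2 := ((hasDerivAt_rowSum (β := β) h i₀).fun_inv hR.ne').fun_pow 2
  have h3 := (hasDerivAt_totSum (β := β) h).fun_inv hW.ne'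
  refine ((h1.mul h2).mul h3).congr_deriv ?_
  have h4 : ∑ j, Real.exp (β * v i₀ j t) * (β * d i₀ j) =
      β * ∑ j, Real.exp (β * v i₀ j t) * d i₀ j := by
    rw [Finset.mul_sum]; exact Finset.sum_congr rfl fun j _ => by ring
  simp only [h4]
  conv_rhs => enter [1, 2]; unfold gibbs
  generalize ∑ i, ∑ j, gibbs β (fun i j => v i j t) i j * d i j = S
  generalize ∑ j, Real.exp (β * v i₀ j t) * d i₀ j = S'
  simp only [Pi.mul_apply, Nat.reduceSub, pow_one]
  field_simp
  push_cast
  ring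

lemma softMinMax_le (β : ℝ) (hβ : 0 < β) (v : I → J → ℝ) :
    softMinMax β v ≤ (⨅ i, ⨆ j, v i j) + Real.log (Fintype.card J) / β := by
  obtain ⟨i, hi⟩ := exists_eq_ciInf_of_finite (f := fun i => ⨆ j, v i j)
  have hR := rowSum_pos β v i
  have h1 : (rowSum β v i)⁻¹ ≤ totSum β v :=
    Finset.single_le_sum (f := fun i => (rowSum β v i)⁻¹)
      (fun i _ => (inv_pos.2 (rowSum_pos β v i)).le) (Finset.mem_univ i)
  have h2 : rowSum β v i ≤ Fintype.card J * Real.exp (β * ⨆ j, v i j) := by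
    rw [rowSum, ← nsmul_eq_mul, ← Finset.card_univ]
    refine Finset.sum_le_card_nsmul _ _ _ fun j _ => ?_
    gcongr
    exact le_ciSup (Set.finite_range _).bddAbove j
  have h3 := Real.log_le_log (inv_pos.2 hR) h1
  have h4 := Real.log_le_log hR h2
  rw [Real.log_inv] at h3
  rw [Real.log_mul (by simp) (Real.exp_pos _).ne', Real.log_exp] at h4
  rw [← hi, softMinMax, ← sub_nonneg]
  have : 0 ≤ β⁻¹ * (Real.log (totSum β v) + (Real.log (Fintype.card J) + β * ⨆ j, v i j)) :=
    mul_nonneg (inv_pos.2 hβ).le (by linarith)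
  convert this using 1
  field_simp
  ring

lemma le_softMinMax (β : ℝ) (hβ : 0 < β) (v : I → J → ℝ) :
    (⨅ i, ⨆ j, v i j) - Real.log (Fintype.card I) / β ≤ softMinMax β v := by
  set m := ⨅ i, ⨆ j, v i j
  have h2 : ∀ i, Real.exp (β * m) ≤ rowSum β v i := fun i => by
    obtain ⟨j, hj⟩ := exists_eq_ciSup_of_finite (f := fun j => v i j)
    have h3 : m ≤ v i j := by rw [hj]; exact ciInf_le (Set.finite_range _).bddBelow i
    exact (Real.exp_le_exp.2 (by gcongr)).trans
      (Finset.single_le_sum (f := fun j => Real.exp (β * v i j))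
        (fun j _ => (Real.exp_pos _).le) (Finset.mem_univ j))
  have h1 : totSum β v ≤ Fintype.card I * (Real.exp (β * m))⁻¹ := by
    rw [totSum, ← nsmul_eq_mul, ← Finset.card_univ]
    exact Finset.sum_le_card_nsmul _ _ _ fun i _ => inv_anti₀ (Real.exp_pos _) (h2 i)
  have h4 := Real.log_le_log (totSum_pos β v) h1
  rw [Real.log_mul (by simp) (by positivity), Real.log_inv, Real.log_exp] at h4
  rw [softMinMax, ← sub_nonneg]
  have : 0 ≤ β⁻¹ * (Real.log (Fintype.card I) - β * m - Real.log (totSum β v)) :=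
    mul_nonneg (inv_pos.2 hβ).le (by linarith)
  convert this using 1
  field_simp
  ring

variable {E : Type*} [NormedAddCommGroup E] [InnerProductSpace ℝ E] [FiniteDimensional ℝ E]
  [MeasurableSpace E] [BorelSpace E]

lemma continuous_softMinMax (β : ℝ) : Continuous (softMinMax β : (I → J → ℝ) → ℝ) := by
  unfold softMinMax
  refine continuous_const.mul (Continuous.log ?_ fun v => (totSum_pos β v).ne')
  unfold totSum
  refine continuous_finsetSum _ fun i _ => Continuous.inv₀ ?_ fun v => (rowSum_pos β v i).ne'
  unfold rowSum
  fun_prop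

lemma continuous_gibbs (β : ℝ) (i : I) (j : J) :
    Continuous (fun v : I → J → ℝ => gibbs β v i j) := by
  have h1 : ∀ i, Continuous (fun v : I → J → ℝ => (rowSum β v i)⁻¹) := fun i =>
    Continuous.inv₀ (by unfold rowSum; fun_prop) fun v => (rowSum_pos β v i).ne'
  have h2 : Continuous (fun v : I → J → ℝ => (totSum β v)⁻¹) :=
    Continuous.inv₀ (by unfold totSum; exact continuous_finsetSum _ fun i _ => h1 i)
      fun v => (totSum_pos β v).ne'
  unfold gibbs
  exact ((by fun_prop : Continuous fun v : I → J → ℝ => Real.exp (β * v i j)).mul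
    ((h1 i).pow 2)).mul h2

/-- The affine fields `⟨z i j, ξ⟩ + c i j`. -/
def gaussField (z : I → J → E) (c : I → J → ℝ) (ξ : E) (i : I) (j : J) : ℝ :=
  inner ℝ (z i j) ξ + c i j

lemma continuous_gaussField (z : I → J → E) (c : I → J → ℝ) : Continuous (gaussField z c) := by
  unfold gaussField; fun_prop

lemma differentiable_gibbs_gaussField (β : ℝ) (z : I → J → E) (c : I → J → ℝ) (i : I) (j : J) :
    Differentiable ℝ (fun ξ => gibbs β (gaussField z c ξ) i j) := by
  have h0 : ∀ i j, Differentiable ℝ (fun ξ => Real.exp (β * gaussField z c ξ i j)) := fun i j => by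
    exact (((innerSL ℝ (z i j)).differentiable.add_const (c i j)).const_mul β).exp
  have h1 : ∀ i, Differentiable ℝ (fun ξ => (rowSum β (gaussField z c ξ) i)⁻¹) := fun i =>
    Differentiable.fun_inv (by unfold rowSum; exact Differentiable.fun_sum fun j _ => h0 i j)
      fun ξ => (rowSum_pos β _ i).ne'
  have h2 : Differentiable ℝ (fun ξ => (totSum β (gaussField z c ξ))⁻¹) :=
    Differentiable.fun_inv (by unfold totSum; exact Differentiable.fun_sum fun i _ => h1 i)
      fun ξ => (totSum_pos β _).ne'
  unfold gibbs
  exact ((h0 i j).fun_mul ((h1 i).fun_pow 2)).fun_mul h2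

/-- Directional derivative of the Gibbs weights along `d`. -/
def gibbsDir (β : ℝ) (v d : I → J → ℝ) (i₀ : I) (j₀ : J) : ℝ :=
  β * gibbs β v i₀ j₀ * (d i₀ j₀ - 2 * (∑ j, Real.exp (β * v i₀ j) * d i₀ j) / rowSum β v i₀
    + ∑ i, ∑ j, gibbs β v i j * d i j)

lemma fderiv_gibbs_gaussField (β : ℝ) (z : I → J → E) (c : I → J → ℝ) (i : I) (j : J) (ξ e : E) :
    fderiv ℝ (fun ξ => gibbs β (gaussField z c ξ) i j) ξ e =
      gibbsDir β (gaussField z c ξ) (fun i j => inner ℝ (z i j) e) i j := by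
  have h1 := (differentiable_gibbs_gaussField β z c i j ξ).hasFDerivAt.hasLineDerivAt e
  have h2 : ∀ i j, HasDerivAt (fun t : ℝ => gaussField z c (ξ + t • e) i j)
      (inner ℝ (z i j) e) 0 := fun i j => by
    simp only [gaussField, inner_add_right, inner_smul_right]
    simpa using (((hasDerivAt_id (0 : ℝ)).mul_const (inner ℝ (z i j) e)).const_add
      (inner ℝ (z i j) ξ)).add_const (c i j)
  have h3 := hasDerivAt_gibbs (β := β) h2 i j
  have := HasDerivAt.unique h1 h3
  simpa [gibbsDir] using this

lemma continuous_gibbsDir (β : ℝ) (d : I → J → ℝ) (i : I) (j : J) :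
    Continuous (fun v : I → J → ℝ => gibbsDir β v d i j) := by
  unfold gibbsDir
  refine (continuous_const.mul (continuous_gibbs β i j)).mul (Continuous.add (Continuous.sub
    continuous_const (Continuous.div ?_ ?_ fun v => (rowSum_pos β v i).ne')) ?_)
  · fun_prop
  · unfold rowSum; fun_prop
  · exact continuous_finsetSum _ fun i _ => continuous_finsetSum _ fun j _ =>
      (continuous_gibbs β i j).mul continuous_const

lemma abs_gibbsDir_le {β : ℝ} (hβ : 0 < β) (v d : I → J → ℝ) {M : ℝ} (hd : ∀ i j, |d i j| ≤ M)
    (i : I) (j : J) : |gibbsDir β v d i j| ≤ β * (4 * M) := by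
  have h0 := gibbs_nonneg β v i j
  have h1 := gibbs_le_one β v i j
  have h2 : |(∑ j, Real.exp (β * v i j) * d i j) / rowSum β v i| ≤ M := by
    rw [abs_div, abs_of_pos (rowSum_pos β v i), div_le_iff₀ (rowSum_pos β v i)]
    refine (Finset.abs_sum_le_sum_abs _ _).trans ?_
    rw [rowSum, Finset.mul_sum]
    refine Finset.sum_le_sum fun j _ => ?_
    rw [abs_mul, abs_of_pos (Real.exp_pos _), mul_comm]
    exact mul_le_mul_of_nonneg_right (hd i j) (Real.exp_pos _).le
  have h3 : |∑ i, ∑ j, gibbs β v i j * d i j| ≤ M := by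
    calc _ ≤ ∑ i, ∑ j, gibbs β v i j * M := by
          refine (Finset.abs_sum_le_sum_abs _ _).trans (Finset.sum_le_sum fun i _ => ?_)
          refine (Finset.abs_sum_le_sum_abs _ _).trans (Finset.sum_le_sum fun j _ => ?_)
          rw [abs_mul, abs_of_nonneg (gibbs_nonneg β v i j)]
          exact mul_le_mul_of_nonneg_left (hd i j) (gibbs_nonneg β v i j)
      _ = _ := by simp_rw [← Finset.sum_mul]; rw [sum_gibbs, one_mul]
  rw [gibbsDir, abs_mul, abs_mul, abs_of_pos hβ, abs_of_nonneg h0, mul_assoc]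
  refine mul_le_mul_of_nonneg_left ?_ hβ.le
  rw [mul_div_assoc]
  have h4 := hd i j
  have h5 : |d i j - 2 * ((∑ j, Real.exp (β * v i j) * d i j) / rowSum β v i) +
      ∑ i, ∑ j, gibbs β v i j * d i j| ≤ 4 * M := by
    rw [abs_le] at *
    constructor <;> linarith
  calc _ ≤ 1 * (4 * M) := mul_le_mul h1 h5 (abs_nonneg _) zero_le_one
    _ = _ := one_mul _

lemma integrable_norm_stdGaussian : Integrable (fun x : E => ‖x‖) (stdGaussian E) :=
  (IsGaussian.memLp_id (stdGaussian E) 1 (by simp)).integrable (by simp) |>.norm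

lemma integral_inner_mul_gibbs {β : ℝ} (hβ : 0 < β) (z : I → J → E) (c : I → J → ℝ) (i : I) (j : J)
    (e : E) :
    ∫ ξ, inner ℝ e ξ * gibbs β (gaussField z c ξ) i j ∂(stdGaussian E) =
      ∫ ξ, gibbsDir β (gaussField z c ξ) (fun i j => inner ℝ (z i j) e) i j ∂(stdGaussian E) := by
  have hc := (continuous_gibbs β i j).comp (continuous_gaussField z c)
  have hb : ∀ ξ, ‖gibbs β (gaussField z c ξ) i j‖ ≤ 1 := fun ξ => by
    rw [Real.norm_eq_abs, abs_of_nonneg (gibbs_nonneg _ _ _ _)]; exact gibbs_le_one _ _ _ _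
  rw [stdGaussian_stein e _ (differentiable_gibbs_gaussField β z c i j)]
  · simp_rw [fderiv_gibbs_gaussField]
  · exact Integrable.of_bound hc.aestronglyMeasurable 1 (.of_forall hb)
  · refine (integrable_norm_stdGaussian.const_mul ‖e‖).mono'
      ((by fun_prop : Continuous fun ξ : E => (inner ℝ e ξ : ℝ)).mul hc).aestronglyMeasurable
      (.of_forall fun ξ => ?_)
    rw [norm_mul]
    exact (mul_le_mul (norm_inner_le_norm e ξ) (hb ξ) (norm_nonneg _) (by positivity)).trans_eq
      (mul_one _)
  · simp_rw [fderiv_gibbs_gaussField]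
    obtain ⟨M, hM⟩ := (Set.finite_range fun p : I × J => |(inner ℝ (z p.1 p.2) e : ℝ)|).bddAbove
    refine Integrable.of_bound ((continuous_gibbsDir β
      (fun i j => inner ℝ (z i j) e) i j).comp (continuous_gaussField z c)).aestronglyMeasurable (β * (4 * M)) (.of_forall fun ξ => ?_)
    exact abs_gibbsDir_le hβ _ _ (fun i j => hM ⟨(i, j), rfl⟩) i j

/-- The interpolating field. -/
def interp (x y : I → J → E) (θ : ℝ) (i : I) (j : J) : E := Real.cos θ • x i j + Real.sin θ • y i j

/-- The derivative of the interpolating field. -/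
def interp' (x y : I → J → E) (θ : ℝ) (i : I) (j : J) : E :=
  -Real.sin θ • x i j + Real.cos θ • y i j

lemma norm_interp'_le (x y : I → J → E) (θ : ℝ) (i : I) (j : J) :
    ‖interp' x y θ i j‖ ≤ ‖x i j‖ + ‖y i j‖ := by
  refine (norm_add_le _ _).trans ?_
  rw [norm_smul, norm_smul, norm_neg]
  exact add_le_add (mul_le_of_le_one_left (norm_nonneg _) (Real.abs_sin_le_one θ))
    (mul_le_of_le_one_left (norm_nonneg _) (Real.abs_cos_le_one θ))

lemma hasDerivAt_softMinMax_interp {β : ℝ} (hβ : 0 < β) (x y : I → J → E) (c : I → J → ℝ)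
    (θ : ℝ) (ξ : E) :
    HasDerivAt (fun θ => softMinMax β (gaussField (interp x y θ) c ξ))
      (∑ i, ∑ j, gibbs β (gaussField (interp x y θ) c ξ) i j * inner ℝ (interp' x y θ i j) ξ) θ := by
  refine hasDerivAt_softMinMax (v := fun i j θ => gaussField (interp x y θ) c ξ i j) hβ
    fun i j => ?_
  simp only [gaussField, interp, interp', inner_add_left, inner_smul_left]
  exact (((Real.hasDerivAt_cos θ).mul_const _).add
    ((Real.hasDerivAt_sin θ).mul_const _)).add_const _

lemma integrable_iInf_iSup_gaussField (z : I → J → E) (c : I → J → ℝ) :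
    Integrable (fun ξ => ⨅ i, ⨆ j, gaussField z c ξ i j) (stdGaussian E) := by
  have hm : Measurable (fun ξ => ⨅ i, ⨆ j, gaussField z c ξ i j) :=
    Measurable.iInf fun i => Measurable.iSup fun j => by unfold gaussField; fun_prop
  refine Integrable.mono' (g := fun ξ => ∑ i, ∑ j, (‖z i j‖ * ‖ξ‖ + |c i j|)) ?_
    hm.aestronglyMeasurable (.of_forall fun ξ => ?_)
  · exact integrable_finsetSum _ fun i _ => integrable_finsetSum _ fun j _ =>
      (integrable_norm_stdGaussian.const_mul _).add (integrable_const _)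
  · obtain ⟨i, hi⟩ := exists_eq_ciInf_of_finite (f := fun i => ⨆ j, gaussField z c ξ i j)
    obtain ⟨j, hj⟩ := exists_eq_ciSup_of_finite (f := fun j => gaussField z c ξ i j)
    rw [← hi, ← hj]
    refine le_trans ?_ ((Finset.single_le_sum (f := fun j => ‖z i j‖ * ‖ξ‖ + |c i j|)
      (fun j _ => by positivity) (Finset.mem_univ j)).trans (Finset.single_le_sum
      (f := fun i => ∑ j, (‖z i j‖ * ‖ξ‖ + |c i j|))
      (fun i _ => Finset.sum_nonneg fun j _ => by positivity) (Finset.mem_univ i)))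
    exact (norm_add_le _ _).trans (add_le_add (norm_inner_le_norm _ _) le_rfl)

lemma abs_softMinMax_sub_le {β : ℝ} (hβ : 0 < β) (v : I → J → ℝ) :
    |softMinMax β v - ⨅ i, ⨆ j, v i j| ≤
      (Real.log (Fintype.card I) + Real.log (Fintype.card J)) / β := by
  have h1 := softMinMax_le β hβ v
  have h2 := le_softMinMax β hβ v
  have h3 : 0 ≤ Real.log (Fintype.card J) / β := div_nonneg (Real.log_natCast_nonneg _) hβ.le
  have h4 : 0 ≤ Real.log (Fintype.card I) / β := div_nonneg (Real.log_natCast_nonneg _) hβ.le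
  rw [abs_le, add_div]
  constructor <;> linarith

lemma integrable_softMinMax {β : ℝ} (hβ : 0 < β) (z : I → J → E) (c : I → J → ℝ) :
    Integrable (fun ξ => softMinMax β (gaussField z c ξ)) (stdGaussian E) := by
  have h := integrable_iInf_iSup_gaussField z c
  have hc := (continuous_softMinMax β).comp (continuous_gaussField z c)
  have : Integrable (fun ξ => softMinMax β (gaussField z c ξ) -
      ⨅ i, ⨆ j, gaussField z c ξ i j) (stdGaussian E) :=
    Integrable.of_bound (hc.aestronglyMeasurable.sub h.aestronglyMeasurable) _
      (.of_forall fun ξ => abs_softMinMax_sub_le hβ _)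
  exact (this.add h).congr (.of_forall fun ξ => by simp)

/-- Derivative of the interpolated soft min-max is nonpositive under Gordon's conditions. -/
lemma hasDerivAt_integral_softMinMax {β : ℝ} (hβ : 0 < β) (x y : I → J → E) (c : I → J → ℝ) (θ : ℝ) :
    HasDerivAt (fun θ => ∫ ξ, softMinMax β (gaussField (interp x y θ) c ξ) ∂(stdGaussian E))
      (∑ i, ∑ j, ∫ ξ, gibbsDir β (gaussField (interp x y θ) c ξ)
        (fun i' j' => inner ℝ (interp x y θ i' j') (interp' x y θ i j)) i j ∂(stdGaussian E)) θ := by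
  have hcg : ∀ θ i j, Continuous fun ξ => gibbs β (gaussField (interp x y θ) c ξ) i j :=
    fun θ i j => (continuous_gibbs β i j).comp (continuous_gaussField _ c)
  have hterm : ∀ θ (ξ : E) i j, ‖gibbs β (gaussField (interp x y θ) c ξ) i j *
      inner ℝ (interp' x y θ i j) ξ‖ ≤ (‖x i j‖ + ‖y i j‖) * ‖ξ‖ := fun θ ξ i j => by
    rw [norm_mul, Real.norm_of_nonneg (gibbs_nonneg _ _ _ _)]
    refine (mul_le_of_le_one_left (norm_nonneg _) (gibbs_le_one _ _ _ _)).trans ?_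
    exact (norm_inner_le_norm _ _).trans
      (mul_le_mul_of_nonneg_right (norm_interp'_le x y θ i j) (norm_nonneg _))
  have hci : ∀ θ i j, Continuous fun ξ : E => gibbs β (gaussField (interp x y θ) c ξ) i j *
      inner ℝ (interp' x y θ i j) ξ := fun θ i j => (hcg θ i j).mul (by fun_prop)
  have key := (hasDerivAt_integral_of_dominated_loc_of_deriv_le (μ := stdGaussian E)
    (F := fun θ ξ => softMinMax β (gaussField (interp x y θ) c ξ))
    (F' := fun θ ξ => ∑ i, ∑ j, gibbs β (gaussField (interp x y θ) c ξ) i j *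
      inner ℝ (interp' x y θ i j) ξ) (x₀ := θ) (s := Set.univ)
    (bound := fun ξ => ∑ i, ∑ j, (‖x i j‖ + ‖y i j‖) * ‖ξ‖) Filter.univ_mem
    (.of_forall fun θ => ((continuous_softMinMax β).comp
      (continuous_gaussField _ c)).aestronglyMeasurable)
    (integrable_softMinMax hβ _ c)
    (continuous_finsetSum _ fun i _ => continuous_finsetSum _ fun j _ =>
      hci θ i j).aestronglyMeasurable
    (.of_forall fun ξ θ _ => (norm_sum_le _ _).trans (Finset.sum_le_sum fun i _ =>
      (norm_sum_le _ _).trans (Finset.sum_le_sum fun j _ => hterm θ ξ i j)))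
    (integrable_finsetSum _ fun i _ => integrable_finsetSum _ fun j _ =>
      integrable_norm_stdGaussian.const_mul _)
    (.of_forall fun ξ θ _ => hasDerivAt_softMinMax_interp hβ x y c θ ξ)).2
  refine key.congr_deriv ?_
  have hI : ∀ i j, Integrable (fun ξ : E => gibbs β (gaussField (interp x y θ) c ξ) i j *
      inner ℝ (interp' x y θ i j) ξ) (stdGaussian E) := fun i j =>
    (integrable_norm_stdGaussian.const_mul _).mono' (hci θ i j).aestronglyMeasurable
      (.of_forall fun ξ => hterm θ ξ i j)
  rw [integral_finsetSum _ fun i _ => integrable_finsetSum _ fun j _ => hI i j]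
  refine Finset.sum_congr rfl fun i _ => ?_
  rw [integral_finsetSum _ fun j _ => hI i j]
  refine Finset.sum_congr rfl fun j _ => ?_
  rw [← integral_inner_mul_gibbs hβ]
  simp_rw [mul_comm]

/-- **Gordon's comparison inequality** for finite index sets. -/
theorem gordon_finite (x y : I → J → E) (c : I → J → ℝ)
    (hxy : ∀ i j i' j', inner ℝ (x i j) (y i' j') = 0)
    (hrow : ∀ i j j', inner ℝ (x i j) (x i j') = inner ℝ (y i j) (y i j'))
    (hne : ∀ i i' j j', inner ℝ (y i j) (y i' j') ≤ inner ℝ (x i j) (x i' j')) :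
    ∫ ξ, (⨅ i, ⨆ j, gaussField y c ξ i j) ∂(stdGaussian E) ≤
      ∫ ξ, (⨅ i, ⨆ j, gaussField x c ξ i j) ∂(stdGaussian E) := by
  have hd : ∀ θ i j i' j', (inner ℝ (interp x y θ i' j') (interp' x y θ i j) : ℝ) =
      -(Real.sin θ * Real.cos θ) * (inner ℝ (x i j) (x i' j') - inner ℝ (y i j) (y i' j')) := by
    intro θ i j i' j'
    have h1 := hxy i' j' i j
    have h2 := hxy i j i' j'
    rw [real_inner_comm] at h2
    simp only [interp, interp', inner_add_left, inner_add_right, inner_smul_left, inner_smul_right,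
      h1, h2, real_inner_comm (x i' j'), real_inner_comm (y i' j')]
    simp
    ring
  have hsoft : ∀ β : ℝ, 0 < β → ∫ ξ, softMinMax β (gaussField y c ξ) ∂(stdGaussian E) ≤
      ∫ ξ, softMinMax β (gaussField x c ξ) ∂(stdGaussian E) := by
    intro β hβ
    have hanti : AntitoneOn (fun θ => ∫ ξ, softMinMax β (gaussField (interp x y θ) c ξ)
        ∂(stdGaussian E)) (Set.Icc 0 (Real.pi / 2)) := by
      refine antitoneOn_of_deriv_nonpos (convex_Icc _ _)
        (fun θ _ => (hasDerivAt_integral_softMinMax hβ x y c θ).continuousAt.continuousWithinAt)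
        (fun θ _ => (hasDerivAt_integral_softMinMax hβ x y c
          θ).differentiableAt.differentiableWithinAt) fun θ hθ => ?_
      rw [interior_Icc] at hθ
      have hs : 0 ≤ Real.sin θ * Real.cos θ := mul_nonneg
        (Real.sin_nonneg_of_nonneg_of_le_pi hθ.1.le (by linarith [hθ.2, Real.pi_pos]))
        (Real.cos_nonneg_of_mem_Icc ⟨by linarith [hθ.1, Real.pi_pos], hθ.2.le⟩)
      rw [(hasDerivAt_integral_softMinMax hβ x y c θ).deriv]
      refine Finset.sum_nonpos fun i _ => Finset.sum_nonpos fun j _ =>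
        integral_nonpos fun ξ => ?_
      have h0 : ∀ j', (inner ℝ (interp x y θ i j') (interp' x y θ i j) : ℝ) = 0 := fun j' => by
        rw [hd, hrow, sub_self, mul_zero]
      have h1 : ∀ i' j', (inner ℝ (interp x y θ i' j') (interp' x y θ i j) : ℝ) ≤ 0 :=
        fun i' j' => by
          rw [hd]; exact mul_nonpos_of_nonpos_of_nonneg (by linarith) (sub_nonneg.2 (hne _ _ _ _))
      simp only [gibbsDir, h0, mul_zero, Finset.sum_const_zero, zero_div, sub_zero, zero_add,
        Pi.zero_apply]
      exact mul_nonpos_of_nonneg_of_nonpos (mul_nonneg hβ.le (gibbs_nonneg _ _ _ _))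
        (Finset.sum_nonpos fun i' _ => Finset.sum_nonpos fun j' _ =>
          mul_nonpos_of_nonneg_of_nonpos (gibbs_nonneg _ _ _ _) (h1 i' j'))
    have hpi := Real.pi_pos
    have := hanti (Set.left_mem_Icc.2 (by linarith)) (Set.right_mem_Icc.2 (by linarith))
      (by linarith)
    have e0 : interp x y 0 = x := by ext i j; simp [interp]
    have e1 : interp x y (Real.pi / 2) = y := by ext i j; simp [interp]
    simpa only [e0, e1] using this
  have hclose : ∀ β : ℝ, 0 < β → ∀ z : I → J → E,
      |∫ ξ, softMinMax β (gaussField z c ξ) ∂(stdGaussian E) -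
        ∫ ξ, (⨅ i, ⨆ j, gaussField z c ξ i j) ∂(stdGaussian E)| ≤
      (Real.log (Fintype.card I) + Real.log (Fintype.card J)) / β := fun β hβ z => by
    rw [← integral_sub (integrable_softMinMax hβ z c) (integrable_iInf_iSup_gaussField z c)]
    have := norm_integral_le_of_norm_le_const (μ := stdGaussian E)
      (f := fun ξ => softMinMax β (gaussField z c ξ) - ⨅ i, ⨆ j, gaussField z c ξ i j)
      (.of_forall fun ξ : E => abs_softMinMax_sub_le hβ (gaussField z c ξ))
    simpa using this
  refine le_of_forall_pos_le_add fun ε hε => ?_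
  set L := Real.log (Fintype.card I) + Real.log (Fintype.card J)
  have hβ : 0 < 2 * (L + 1) / ε := by positivity
  have hb : L / (2 * (L + 1) / ε) ≤ ε / 2 := by
    rw [div_le_iff₀ hβ]
    field_simp
    linarith
  have h1 := abs_le.1 (hclose _ hβ x)
  have h2 := abs_le.1 (hclose _ hβ y)
  have h3 := hsoft _ hβ
  linarith [h1.1, h1.2, h2.1, h2.2]

end FiniteGordon

section Coordinates

variable {ι κ m P : Type*} [Fintype ι] [Fintype κ] [Fintype m] [Fintype P]

/-- Coordinate reindexing `x ↦ x ∘ f`. -/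
def reidx (f : κ → ι) : 𝔼 ι →L[ℝ] 𝔼 κ :=
  LinearMap.toContinuousLinearMap
    { toFun := fun x => WithLp.toLp 2 fun k => x (f k)
      map_add' := fun x y => by ext k; simp
      map_smul' := fun c x => by ext k; simp }

@[simp] lemma reidx_apply (f : κ → ι) (x : 𝔼 ι) (k : κ) : reidx f x k = x (f k) := rfl

lemma norm_reidx_le {f : κ → ι} (hf : Function.Injective f) (x : 𝔼 ι) :
    ‖reidx f x‖ ≤ ‖x‖ := by
  rw [EuclideanSpace.norm_eq, EuclideanSpace.norm_eq]
  refine Real.sqrt_le_sqrt ?_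
  refine (Finset.sum_map Finset.univ ⟨f, hf⟩ fun i => ‖x i‖ ^ 2).symm.trans_le ?_
  exact Finset.sum_le_sum_of_subset_of_nonneg (Finset.subset_univ _) fun _ _ _ => by positivity

lemma stdGaussian_map_reidx {f : κ → ι} (hf : Function.Injective f) :
    (stdGaussian (𝔼 ι)).map (reidx f) = stdGaussian (𝔼 κ) := by
  have : IsProbabilityMeasure ((stdGaussian (𝔼 ι)).map (reidx f)) :=
    Measure.isProbabilityMeasure_map (by fun_prop)
  refine Measure.ext_of_charFun (funext fun t => ?_)
  let s : 𝔼 ι := WithLp.toLp 2 (Function.extend f t 0)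
  have hs : ∀ x : 𝔼 ι, inner ℝ (reidx f x) t = (inner ℝ x s : ℝ) := fun x => by
    simp only [PiLp.inner_apply]
    refine Fintype.sum_of_injective f hf _ _ (fun i hi => ?_) fun k => ?_
    · have : s i = 0 := Function.extend_apply' t.ofLp (0 : ι → ℝ) i (by simpa using hi)
      simp [this]
    · have : s (f k) = t k := hf.extend_apply t.ofLp (0 : ι → ℝ) k
      simp [this]
  have hn : ‖s‖ = ‖t‖ := by
    have h1 := hs s
    have h2 : reidx f s = t := by
      ext k; exact hf.extend_apply t.ofLp (0 : ι → ℝ) k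
    rw [h2, real_inner_self_eq_norm_sq, real_inner_self_eq_norm_sq] at h1
    exact ((pow_left_inj₀ (norm_nonneg _) (norm_nonneg _) two_ne_zero).1 h1).symm
  rw [charFun_apply, integral_map (by fun_prop) (by fun_prop)]
  simp_rw [hs]
  rw [← charFun_apply, charFun_stdGaussian, charFun_stdGaussian, hn]

lemma integral_reidx {f : κ → ι} (hf : Function.Injective f) {g : 𝔼 κ → ℝ}
    (hg : AEStronglyMeasurable g (stdGaussian (𝔼 κ))) :
    ∫ x, g (reidx f x) ∂(stdGaussian (𝔼 ι)) =
      ∫ x, g x ∂(stdGaussian (𝔼 κ)) := by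
  have := hg
  rw [← stdGaussian_map_reidx hf] at this ⊢
  exact (integral_map (by fun_prop) this).symm

/-- Matrix-vector product between Euclidean spaces. -/
def matVec (A : 𝔼 (m × P)) (w : 𝔼 P) : 𝔼 m :=
  WithLp.toLp 2 fun a => ∑ b, A (a, b) * w b

/-- The rank one matrix `u wᵀ`. -/
def outer (u : 𝔼 m) (w : 𝔼 P) : 𝔼 (m × P) :=
  WithLp.toLp 2 fun q => u q.1 * w q.2

lemma inner_outer (u : 𝔼 m) (w : 𝔼 P) (A : 𝔼 (m × P)) :
    inner ℝ (outer u w) A = (inner ℝ u (matVec A w) : ℝ) := by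
  simp only [PiLp.inner_apply, outer, matVec, Fintype.sum_prod_type]
  refine Finset.sum_congr rfl fun a _ => ?_
  simp only [RCLike.inner_apply, conj_trivial, Finset.sum_mul]
  exact Finset.sum_congr rfl fun b _ => by ring

lemma inner_outer_outer (u u' : 𝔼 m) (w w' : 𝔼 P) :
    inner ℝ (outer u w) (outer u' w') = (inner ℝ u u' * inner ℝ w w' : ℝ) := by
  simp only [PiLp.inner_apply, outer, Fintype.sum_prod_type, Finset.sum_mul_sum]
  refine Finset.sum_congr rfl fun a _ => Finset.sum_congr rfl fun b _ => ?_
  simp only [RCLike.inner_apply, conj_trivial]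
  ring

lemma norm_outer (u : 𝔼 m) (w : 𝔼 P) :
    ‖outer u w‖ = ‖u‖ * ‖w‖ := by
  refine (pow_left_inj₀ (norm_nonneg _) (by positivity) two_ne_zero).1 ?_
  rw [← real_inner_self_eq_norm_sq, inner_outer_outer, real_inner_self_eq_norm_sq,
    real_inner_self_eq_norm_sq]
  ring

lemma matVec_sub (A B : 𝔼 (m × P)) (w : 𝔼 P) :
    matVec (A - B) w = matVec A w - matVec B w := by
  ext a; simp [matVec, sub_mul]

lemma matVec_sub_right (A : 𝔼 (m × P)) (w v : 𝔼 P) :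
    matVec A (w - v) = matVec A w - matVec A v := by
  ext a; simp [matVec, mul_sub]

lemma matVec_add_right (A : 𝔼 (m × P)) (w v : 𝔼 P) :
    matVec A (w + v) = matVec A w + matVec A v := by
  ext a; simp [matVec, mul_add, Finset.sum_add_distrib]

lemma matVec_smul_right (A : 𝔼 (m × P)) (c : ℝ) (w : 𝔼 P) :
    matVec A (c • w) = c • matVec A w := by
  ext a; simp only [matVec, PiLp.smul_apply, smul_eq_mul, Finset.mul_sum]
  exact Finset.sum_congr rfl fun b _ => by ring

lemma norm_matVec_le (A : 𝔼 (m × P)) (w : 𝔼 P) :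
    ‖matVec A w‖ ≤ ‖A‖ * ‖w‖ := by
  rcases (norm_nonneg (matVec A w)).eq_or_lt with h | h
  · rw [← h]; positivity
  · have h1 := inner_outer (matVec A w) w A
    rw [real_inner_self_eq_norm_sq] at h1
    have h2 := real_inner_le_norm (outer (matVec A w) w) A
    rw [h1, norm_outer] at h2
    nlinarith

end Coordinates

section GordonMatrix

variable {I J m P : Type*} [Fintype I] [Fintype J] [Nonempty I] [Nonempty J] [Fintype m] [Fintype P]

lemma iInf_iSup_le_add {a b : I → J → ℝ} {c : ℝ} (h : ∀ i j, a i j ≤ b i j + c) :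
    (⨅ i, ⨆ j, a i j) ≤ (⨅ i, ⨆ j, b i j) + c := by
  rw [← sub_le_iff_le_add]
  refine le_ciInf fun i => ?_
  rw [sub_le_iff_le_add]
  refine (ciInf_le (Set.finite_range _).bddBelow i).trans (ciSup_le fun j => (h i j).trans ?_)
  gcongr
  exact le_ciSup (Set.finite_range _).bddAbove j

lemma iInf_iSup_neg (a : I → J → ℝ) : (⨅ i, ⨆ j, -a i j) = -⨆ i, ⨅ j, a i j := by
  refine le_antisymm ?_ ?_
  · rw [le_neg]
    refine ciSup_le fun i => ?_
    rw [le_neg]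
    refine (ciInf_le (Set.finite_range _).bddBelow i).trans (ciSup_le fun j => ?_)
    exact neg_le_neg (ciInf_le (Set.finite_range _).bddBelow j)
  · refine le_ciInf fun i => ?_
    rw [neg_le]
    refine le_trans ?_ (le_ciSup (Set.finite_range _).bddAbove i)
    refine le_ciInf fun j => ?_
    rw [neg_le]
    exact le_ciSup (f := fun j => -a i j) (Set.finite_range _).bddAbove j

lemma integral_abs_inner_stdGaussian_le {E : Type*} [NormedAddCommGroup E] [InnerProductSpace ℝ E]
    [FiniteDimensional ℝ E] [MeasurableSpace E] [BorelSpace E] (v : E) :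
    ∫ x, |inner ℝ v x| ∂(stdGaussian E) ≤ ‖v‖ := by
  have h1 : Var[innerSL ℝ v; stdGaussian E] = ‖v‖ ^ 2 := by
    rw [variance_dual_stdGaussian, innerSL_apply_norm]
  have hm : MemLp (innerSL ℝ v) 2 (stdGaussian E) :=
    (innerSL ℝ v).comp_memLp' (IsGaussian.memLp_id (stdGaussian E) 2 (by simp))
  have h2 : Var[fun x => |innerSL ℝ v x|; stdGaussian E] =
      ∫ x, |innerSL ℝ v x| ^ 2 ∂(stdGaussian E) - (∫ x, |innerSL ℝ v x| ∂(stdGaussian E)) ^ 2 :=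
    variance_eq_sub hm.abs
  have h3 := variance_nonneg (fun x => |innerSL ℝ v x|) (stdGaussian E)
  rw [variance_eq_sub hm, integral_strongDual_stdGaussian] at h1
  simp only [Pi.pow_apply, sq_abs] at h1 h2
  refine abs_le_of_sq_le_sq' (a := ∫ x, |innerSL ℝ v x| ∂(stdGaussian E)) ?_ (norm_nonneg v) |>.2
  nlinarith

/-- The primary Gordon field. -/
def primaryField (W : I → 𝔼 P) (U : J → 𝔼 m) (c : I → J → ℝ)
    (A : 𝔼 (m × P)) (i : I) (j : J) : ℝ := inner ℝ (U j) (matVec A (W i)) + c i j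

/-- The decoupled Gordon field. -/
def auxField (W : I → 𝔼 P) (U : J → 𝔼 m) (c : I → J → ℝ)
    (q : 𝔼 (m ⊕ P)) (i : I) (j : J) : ℝ :=
  ‖W i‖ * inner ℝ (U j) (reidx Sum.inl q) + ‖U j‖ * inner ℝ (W i) (reidx Sum.inr q) + c i j

lemma inner_toLp_sumElim {α β : Type*} [Fintype α] [Fintype β] (a : α → ℝ) (b : β → ℝ)
    (x : 𝔼 (α ⊕ β)) :
    inner ℝ (WithLp.toLp 2 (Sum.elim a b)) x =
      (inner ℝ (WithLp.toLp 2 a) (reidx Sum.inl x) + inner ℝ (WithLp.toLp 2 b) (reidx Sum.inr x) : ℝ) := by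
  simp [PiLp.inner_apply, Fintype.sum_sum_type]

lemma gordon_matrix (W : I → 𝔼 P) (U : J → 𝔼 m) (c : I → J → ℝ)
    (s : ℝ) (hs : s ^ 2 = 1) {B : ℝ} (hB : ∀ i j, ‖U j‖ * ‖W i‖ ≤ B)
    {K L : Type*} [Fintype K] [Fintype L] [Nonempty K] [Nonempty L] (eI : K → L → I) (eJ : K → L → J)
    (hrow : ∀ k l l', eI k l = eI k l' ∨ eJ k l = eJ k l') :
    ∫ q, (⨅ k, ⨆ l, s * auxField W U c q (eI k l) (eJ k l)) ∂(stdGaussian (𝔼 (m ⊕ P))) ≤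
      ∫ A, (⨅ k, ⨆ l, s * primaryField W U c A (eI k l) (eJ k l))
        ∂(stdGaussian (𝔼 (m × P))) + B := by
  classical
  let x : K → L → 𝔼 (((m × P) ⊕ Unit) ⊕ (m ⊕ P)) := fun k l => WithLp.toLp 2 (Sum.elim (Sum.elim
    (fun a => s * outer (U (eJ k l)) (W (eI k l)) a)
    (fun _ => s * (‖U (eJ k l)‖ * ‖W (eI k l)‖))) 0)
  let y : K → L → 𝔼 (((m × P) ⊕ Unit) ⊕ (m ⊕ P)) := fun k l => WithLp.toLp 2 (Sum.elim 0
    (Sum.elim (fun a => s * (‖W (eI k l)‖ * U (eJ k l) a)) (fun b => s * (‖U (eJ k l)‖ * W (eI k l) b))))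
  let c' : K → L → ℝ := fun k l => s * c (eI k l) (eJ k l)
  have hxx : ∀ k l k' l', (inner ℝ (x k l) (x k' l') : ℝ) =
      inner ℝ (U (eJ k l)) (U (eJ k' l')) * inner ℝ (W (eI k l)) (W (eI k' l')) +
      ‖U (eJ k l)‖ * ‖W (eI k l)‖ * (‖U (eJ k' l')‖ * ‖W (eI k' l')‖) := fun k l k' l' => by
    rw [← inner_outer_outer]
    simp only [x, PiLp.inner_apply, Fintype.sum_sum_type, Sum.elim_inl, Sum.elim_inr,
      RCLike.inner_apply, conj_trivial, Pi.zero_apply, mul_zero, Finset.sum_const_zero, add_zero,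
      Finset.univ_unique, Finset.sum_singleton]
    congr 1
    · exact Finset.sum_congr rfl fun a _ => by
        linear_combination (outer (U (eJ k l)) (W (eI k l)) a * outer (U (eJ k' l')) (W (eI k' l')) a) * hs
    · linear_combination (‖U (eJ k l)‖ * ‖W (eI k l)‖ * (‖U (eJ k' l')‖ * ‖W (eI k' l')‖)) * hs
  have hyy : ∀ k l k' l', (inner ℝ (y k l) (y k' l') : ℝ) =
      ‖W (eI k l)‖ * ‖W (eI k' l')‖ * inner ℝ (U (eJ k l)) (U (eJ k' l')) +
      ‖U (eJ k l)‖ * ‖U (eJ k' l')‖ * inner ℝ (W (eI k l)) (W (eI k' l')) := fun k l k' l' => by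
    simp only [y, PiLp.inner_apply, Fintype.sum_sum_type, Sum.elim_inl, Sum.elim_inr,
      RCLike.inner_apply, conj_trivial, Pi.zero_apply, mul_zero, Finset.sum_const_zero, zero_add,
      Finset.mul_sum]
    congr 1
    · exact Finset.sum_congr rfl fun a _ => by
        linear_combination (‖W (eI k l)‖ * ‖W (eI k' l')‖ * (U (eJ k l) a * U (eJ k' l') a)) * hs
    · exact Finset.sum_congr rfl fun a _ => by
        linear_combination (‖U (eJ k l)‖ * ‖U (eJ k' l')‖ * (W (eI k l) a * W (eI k' l') a)) * hs
  have hg := gordon_finite x y c'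
    (fun k l k' l' => by simp [x, y, PiLp.inner_apply, Fintype.sum_sum_type])
    (fun k l l' => by
      rw [hxx, hyy]
      rcases hrow k l l' with h | h <;> rw [h, real_inner_self_eq_norm_sq] <;> ring)
    (fun k k' l l' => by
      rw [hxx, hyy]
      nlinarith [mul_nonneg
        (sub_nonneg.2 (real_inner_le_norm (U (eJ k l)) (U (eJ k' l'))))
        (sub_nonneg.2 (real_inner_le_norm (W (eI k l)) (W (eI k' l'))))])
  have hy : ∀ ξ : 𝔼 (((m × P) ⊕ Unit) ⊕ (m ⊕ P)), (fun k l => gaussField y c' ξ k l) = fun k l =>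
      s * auxField W U c (reidx Sum.inr ξ) (eI k l) (eJ k l) := fun ξ => by
    ext k l
    simp only [gaussField, y, c', auxField, inner_toLp_sumElim]
    simp only [PiLp.inner_apply, RCLike.inner_apply, conj_trivial, Pi.zero_apply, mul_zero,
      Finset.sum_const_zero, zero_add, Finset.mul_sum, mul_add]
    congr 1
    congr 1 <;> exact Finset.sum_congr rfl fun a _ => by ring
  have hx : ∀ ξ : 𝔼 (((m × P) ⊕ Unit) ⊕ (m ⊕ P)), ∀ k l, gaussField x c' ξ k l ≤
      s * primaryField W U c (reidx (Sum.inl ∘ Sum.inl) ξ) (eI k l) (eJ k l) +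
      B * |inner ℝ (EuclideanSpace.single (Sum.inl (Sum.inr ())) (1 : ℝ)) ξ| := fun ξ k l => by
    have h1 : gaussField x c' ξ k l = s * primaryField W U c (reidx (Sum.inl ∘ Sum.inl) ξ)
        (eI k l) (eJ k l) + s * (‖U (eJ k l)‖ * ‖W (eI k l)‖) * ξ (Sum.inl (Sum.inr ())) := by
      simp only [gaussField, x, c', primaryField, inner_toLp_sumElim, ← inner_outer]
      simp only [PiLp.inner_apply, RCLike.inner_apply, conj_trivial, Pi.zero_apply, mul_zero,
        Finset.sum_const_zero, add_zero, Finset.mul_sum, mul_add, Finset.univ_unique,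
        Finset.sum_singleton, reidx_apply, Function.comp_apply]
      have : ∑ q, ξ.ofLp (Sum.inl (Sum.inl q)) * (s * (outer (U (eJ k l)) (W (eI k l))).ofLp q) =
        ∑ q, s * (ξ.ofLp (Sum.inl (Sum.inl q)) * (outer (U (eJ k l)) (W (eI k l))).ofLp q) :=
        Finset.sum_congr rfl fun a _ => by ring
      rw [this]
      have hd : (default : Unit) = () := rfl
      rw [hd]
      ring
    have hs1 : |s| = 1 := by
      rw [← Real.sqrt_sq_eq_abs, hs, Real.sqrt_one]
    rw [h1, EuclideanSpace.inner_single_left]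
    refine add_le_add le_rfl ((le_abs_self _).trans ?_)
    rw [abs_mul, abs_mul, hs1, one_mul, abs_of_nonneg (by positivity : 0 ≤ ‖U (eJ k l)‖ * ‖W (eI k l)‖)]
    simp only [map_one, one_mul]
    exact mul_le_mul_of_nonneg_right (hB _ _) (abs_nonneg _)
  have hmy : AEStronglyMeasurable (fun q => ⨅ k, ⨆ l, s * auxField W U c q (eI k l) (eJ k l))
      (stdGaussian (𝔼 (m ⊕ P))) :=
    (Measurable.iInf fun k => Measurable.iSup fun l => by
      unfold auxField; fun_prop).aestronglyMeasurable
  have hix : Integrable (fun A => ⨅ k, ⨆ l, s * primaryField W U c A (eI k l) (eJ k l))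
      (stdGaussian (𝔼 (m × P))) := by
    refine (integrable_iInf_iSup_gaussField (fun k l => s • outer (U (eJ k l)) (W (eI k l))) c').congr
      (.of_forall fun A => ?_)
    simp only [gaussField, primaryField, inner_smul_left, inner_outer, c', mul_add]
    simp
  have hinj : Function.Injective ((Sum.inl ∘ Sum.inl : m × P → ((m × P) ⊕ Unit) ⊕ (m ⊕ P))) :=
    Sum.inl_injective.comp Sum.inl_injective
  rw [← integral_reidx (ι := ((m × P) ⊕ Unit) ⊕ (m ⊕ P)) (f := Sum.inr) Sum.inr_injective hmy]
  have hInt : Integrable (fun ξ => (⨅ k, ⨆ l, s * primaryField W U c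
      (reidx (Sum.inl ∘ Sum.inl) ξ) (eI k l) (eJ k l))) (stdGaussian (𝔼 (((m × P) ⊕ Unit) ⊕ (m ⊕ P)))) := by
    rw [← stdGaussian_map_reidx hinj] at hix
    exact hix.comp_measurable (by fun_prop)
  have hInt2 : Integrable (fun ξ : 𝔼 (((m × P) ⊕ Unit) ⊕ (m ⊕ P)) =>
      B * |inner ℝ (EuclideanSpace.single (Sum.inl (Sum.inr ())) (1 : ℝ)) ξ|)
      (stdGaussian (𝔼 (((m × P) ⊕ Unit) ⊕ (m ⊕ P)))) :=
    ((integrable_norm_stdGaussian.const_mul _).mono' (by fun_prop)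
      (.of_forall fun ξ => by
        rw [Real.norm_eq_abs, abs_abs]; exact abs_real_inner_le_norm _ _)).const_mul B
  calc _ = ∫ ξ, (⨅ k, ⨆ l, gaussField y c' ξ k l) ∂(stdGaussian (𝔼 (((m × P) ⊕ Unit) ⊕ (m ⊕ P)))) := by
        refine integral_congr_ae (.of_forall fun ξ => ?_)
        have h := hy ξ
        simp only [funext_iff] at h
        simp only [h]
    _ ≤ _ := hg
    _ ≤ ∫ ξ, ((⨅ k, ⨆ l, s * primaryField W U c (reidx (Sum.inl ∘ Sum.inl) ξ) (eI k l) (eJ k l)) +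
        B * |inner ℝ (EuclideanSpace.single (Sum.inl (Sum.inr ())) (1 : ℝ)) ξ|)
        ∂(stdGaussian (𝔼 (((m × P) ⊕ Unit) ⊕ (m ⊕ P)))) :=
      integral_mono (integrable_iInf_iSup_gaussField x c') (hInt.add hInt2) fun ξ =>
        iInf_iSup_le_add (hx ξ)
    _ ≤ _ := by
      rw [integral_add hInt hInt2, integral_const_mul]
      have hB0 : 0 ≤ B := by
        obtain ⟨k⟩ := ‹Nonempty K›
        obtain ⟨l⟩ := ‹Nonempty L›
        exact (by positivity : 0 ≤ ‖U (eJ k l)‖ * ‖W (eI k l)‖).trans (hB _ _)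
      gcongr
      · exact (integral_reidx hinj hix.aestronglyMeasurable).le
      · have := integral_abs_inner_stdGaussian_le
          (EuclideanSpace.single (Sum.inl (Sum.inr ())) (1 : ℝ) : 𝔼 (((m × P) ⊕ Unit) ⊕ (m ⊕ P)))
        rw [PiLp.norm_single, norm_one] at this
        exact mul_le_of_le_one_right hB0 this

end GordonMatrix

section MinVal

variable {α : Type*} [TopologicalSpace α]

/-- Minimum value of `f` on `K`. -/
def minVal (K : Set α) (f : α → ℝ) : ℝ := sInf (f '' K)

variable {K : Set α} {f g : α → ℝ}

lemma minVal_le (hK : IsCompact K) (hf : ContinuousOn f K) {x : α} (hx : x ∈ K) : minVal K f ≤ f x :=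
  csInf_le (hK.image_of_continuousOn hf).bddBelow ⟨x, hx, rfl⟩

lemma exists_eq_minVal (hK : IsCompact K) (hne : K.Nonempty) (hf : ContinuousOn f K) :
    ∃ x ∈ K, f x = minVal K f :=
  (hK.image_of_continuousOn hf).sInf_mem (hne.image f)

lemma le_minVal (hne : K.Nonempty) {c : ℝ} (h : ∀ x ∈ K, c ≤ f x) : c ≤ minVal K f :=
  le_csInf (hne.image f) (by rintro _ ⟨x, hx, rfl⟩; exact h x hx)

lemma minVal_le_add (hK : IsCompact K) (hne : K.Nonempty) (hf : ContinuousOn f K) {c : ℝ}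
    (h : ∀ x ∈ K, f x ≤ g x + c) : minVal K f ≤ minVal K g + c := by
  rw [← sub_le_iff_le_add]
  exact le_minVal hne fun x hx => by linarith [minVal_le hK hf hx, h x hx]

end MinVal

section Clip

/-- The positive part truncated at level `B`. -/
def clip (B t : ℝ) : ℝ := max 0 (min t B)

/-- `t ↦ max_{0 ≤ s ≤ B} (s t - s² / 2)`. -/
def psi (B t : ℝ) : ℝ := clip B t * t - clip B t ^ 2 / 2

variable {B : ℝ}

lemma clip_nonneg (t : ℝ) : 0 ≤ clip B t := le_max_left _ _

lemma clip_le (hB : 0 ≤ B) (t : ℝ) : clip B t ≤ B := max_le hB (min_le_right _ _)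

lemma le_psi {s : ℝ} (hs : 0 ≤ s) (hsB : s ≤ B) (t : ℝ) : s * t - s ^ 2 / 2 ≤ psi B t := by
  unfold psi clip
  rcases le_total t B with h | h
  · rw [min_eq_left h]
    rcases le_total 0 t with h0 | h0
    · rw [max_eq_right h0]; nlinarith [sq_nonneg (s - t)]
    · rw [max_eq_left h0]; nlinarith
  · rw [min_eq_right h, max_eq_right (hs.trans hsB)]; nlinarith

lemma psi_le_add (hB : 0 ≤ B) (t t' : ℝ) : psi B t ≤ psi B t' + B * |t - t'| := by
  have h1 := le_psi (clip_nonneg t) (clip_le hB t) t'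
  have h2 : clip B t * (t - t') ≤ B * |t - t'| :=
    (mul_le_mul_of_nonneg_left (le_abs_self _) (clip_nonneg t)).trans
      (mul_le_mul_of_nonneg_right (clip_le hB t) (abs_nonneg _))
  have h3 : psi B t = clip B t * t - clip B t ^ 2 / 2 := rfl
  linarith

lemma psi_le (t : ℝ) : psi B t ≤ t ^ 2 / 2 := by
  unfold psi; nlinarith [sq_nonneg (clip B t - t)]

lemma psi_eq {t : ℝ} (ht : t ≤ B) : psi B t = max 0 t ^ 2 / 2 := by
  unfold psi clip
  rw [min_eq_left ht]
  rcases le_total 0 t with h | h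
  · rw [max_eq_right h]; ring
  · rw [max_eq_left h]; ring

lemma continuous_psi : Continuous (psi B) := by unfold psi clip; fun_prop

end Clip

section CompactGordon

variable {m P : Type*} [Fintype m] [Fintype P]

/-- Primary cost at a shifted vector `W`. -/
def primCost (B κ : ℝ) (h : 𝔼 P → ℝ) (A : 𝔼 (m × P))
    (W : 𝔼 P) : ℝ := psi B (κ * ‖matVec A W‖) + h W

/-- Argument of the auxiliary cost. -/
def auxArg (q : 𝔼 (m ⊕ P)) (W : 𝔼 P) : ℝ :=
  ‖W‖ * ‖reidx Sum.inl q‖ + inner ℝ W (reidx Sum.inr q)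

/-- Auxiliary cost at a shifted vector `W`. -/
def auxCost (B κ : ℝ) (h : 𝔼 P → ℝ) (q : 𝔼 (m ⊕ P))
    (W : 𝔼 P) : ℝ := psi B (κ * auxArg q W) + h W

variable {B κ R : ℝ} {h : 𝔼 P → ℝ} {K : Set (𝔼 P)}

lemma continuous_matVec (A : 𝔼 (m × P)) : Continuous (matVec A) := by
  unfold matVec; fun_prop

lemma continuousOn_primCost (hh : ContinuousOn h K) (A : 𝔼 (m × P)) :
    ContinuousOn (primCost B κ h A) K :=
  ((continuous_psi.comp (continuous_const.mul (continuous_matVec A).norm)).continuousOn).add hh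

lemma continuousOn_auxCost (hh : ContinuousOn h K) (q : 𝔼 (m ⊕ P)) :
    ContinuousOn (auxCost B κ h q) K :=
  ((continuous_psi.comp (continuous_const.mul (by unfold auxArg; fun_prop))).continuousOn).add hh

lemma primCost_le_add (hB : 0 ≤ B) (hκ : 0 ≤ κ) (A A' : 𝔼 (m × P))
    (W : 𝔼 P) :
    primCost B κ h A W ≤ primCost B κ h A' W + B * κ * ‖W‖ * ‖A - A'‖ := by
  have h1 := psi_le_add hB (κ * ‖matVec A W‖) (κ * ‖matVec A' W‖)
  rw [← mul_sub, abs_mul, abs_of_nonneg hκ] at h1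
  have h2 : |‖matVec A W‖ - ‖matVec A' W‖| ≤ ‖A - A'‖ * ‖W‖ :=
    (abs_norm_sub_norm_le _ _).trans (by rw [← matVec_sub]; exact norm_matVec_le _ _)
  have h3 := mul_le_mul_of_nonneg_left h2 (mul_nonneg hB hκ)
  unfold primCost
  linarith

lemma auxArg_sub_le (q q' : 𝔼 (m ⊕ P)) (W : 𝔼 P) :
    |auxArg q W - auxArg q' W| ≤ 2 * ‖W‖ * ‖q - q'‖ := by
  have e : auxArg q W - auxArg q' W = ‖W‖ * (‖reidx Sum.inl q‖ - ‖reidx Sum.inl q'‖) +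
      inner ℝ W (reidx Sum.inr (q - q')) := by
    rw [map_sub, inner_sub_right]; unfold auxArg; ring
  rw [e]
  refine (abs_add_le _ _).trans ?_
  rw [abs_mul, abs_norm]
  have h1 : |‖reidx (Sum.inl : m → m ⊕ P) q‖ - ‖reidx Sum.inl q'‖| ≤ ‖q - q'‖ :=
    (abs_norm_sub_norm_le _ _).trans
      (by rw [← map_sub]; exact norm_reidx_le Sum.inl_injective _)
  have h2 := (abs_real_inner_le_norm W (reidx (Sum.inr : P → m ⊕ P) (q - q'))).trans
    (mul_le_mul_of_nonneg_left (norm_reidx_le Sum.inr_injective _) (norm_nonneg _))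
  have h3 := mul_le_mul_of_nonneg_left h1 (norm_nonneg W)
  linarith

lemma auxCost_le_add (hB : 0 ≤ B) (hκ : 0 ≤ κ) (q q' : 𝔼 (m ⊕ P))
    (W : 𝔼 P) :
    auxCost B κ h q W ≤ auxCost B κ h q' W + B * κ * (2 * ‖W‖) * ‖q - q'‖ := by
  have h1 := psi_le_add hB (κ * auxArg q W) (κ * auxArg q' W)
  rw [← mul_sub, abs_mul, abs_of_nonneg hκ] at h1
  have h3 := mul_le_mul_of_nonneg_left (auxArg_sub_le q q' W) (mul_nonneg hB hκ)
  unfold auxCost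
  linarith

lemma lipschitzWith_of_le_add {E : Type*} [SeminormedAddCommGroup E] {f : E → ℝ} {c : ℝ}
    (hc : 0 ≤ c) (hf : ∀ x y, f x ≤ f y + c * ‖x - y‖) : LipschitzWith c.toNNReal f :=
  LipschitzWith.of_le_add_mul _ fun x y => by
    rw [Real.coe_toNNReal _ hc, dist_eq_norm]; exact hf x y

lemma lipschitzWith_minVal_primCost (hB : 0 ≤ B) (hκ : 0 ≤ κ) (hK : IsCompact K) (hne : K.Nonempty)
    (hh : ContinuousOn h K) (hR : ∀ W ∈ K, ‖W‖ ≤ R) :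
    LipschitzWith (B * κ * R).toNNReal
      (fun A : 𝔼 (m × P) => minVal K (primCost B κ h A)) := by
  have hR0 : 0 ≤ R := (norm_nonneg _).trans (hR _ hne.some_mem)
  refine lipschitzWith_of_le_add (by positivity) fun A A' => minVal_le_add hK hne
    (continuousOn_primCost hh A) fun W hW => (primCost_le_add hB hκ A A' W).trans ?_
  gcongr
  exact hR W hW

lemma lipschitzWith_minVal_auxCost (hB : 0 ≤ B) (hκ : 0 ≤ κ) (hK : IsCompact K) (hne : K.Nonempty)
    (hh : ContinuousOn h K) (hR : ∀ W ∈ K, ‖W‖ ≤ R) :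
    LipschitzWith (B * κ * (2 * R)).toNNReal
      (fun q : 𝔼 (m ⊕ P) => minVal K (auxCost B κ h q)) := by
  have hR0 : 0 ≤ R := (norm_nonneg _).trans (hR _ hne.some_mem)
  refine lipschitzWith_of_le_add (by positivity) fun A A' => minVal_le_add hK hne
    (continuousOn_auxCost hh A) fun W hW => (auxCost_le_add hB hκ A A' W).trans ?_
  gcongr
  exact hR W hW

/-- Finite nets of a compact set, adapted to a continuous function. -/
lemma exists_finite_net {E : Type*} [PseudoMetricSpace E] {K : Set E} (hK : IsCompact K) {h : E → ℝ}
    (hh : ContinuousOn h K) {d : ℝ} (hd : 0 < d) :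
    ∃ T : Finset E, (T : Set E) ⊆ K ∧ ∀ x ∈ K, ∃ y ∈ T, dist x y ≤ d ∧ |h x - h y| ≤ d := by
  obtain ⟨T, hT, hcov⟩ := hK.elim_nhdsWithin_subcover
    (fun y => {x | dist x y ≤ d ∧ |h x - h y| ≤ d}) fun y hy => by
      refine Filter.inter_mem (mem_nhdsWithin_of_mem_nhds (Metric.closedBall_mem_nhds y hd)) ?_
      exact (hh y hy) (Metric.closedBall_mem_nhds (h y) hd)
  refine ⟨T, hT, fun x hx => ?_⟩
  obtain ⟨y, hy, hxy⟩ := Set.mem_iUnion₂.1 (hcov hx)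
  exact ⟨y, hy, hxy⟩

lemma exists_norm_eq_inner_eq {E : Type*} [NormedAddCommGroup E] [InnerProductSpace ℝ E]
    [Nontrivial E] (v : E) {s : ℝ} (hs : 0 ≤ s) : ∃ u : E, ‖u‖ = s ∧ inner ℝ u v = s * ‖v‖ := by
  rcases eq_or_ne v 0 with rfl | hv
  · obtain ⟨u, hu⟩ := exists_norm_eq E hs
    exact ⟨u, hu, by simp⟩
  · have h0 := norm_ne_zero_iff.2 hv
    refine ⟨(s / ‖v‖) • v, ?_, ?_⟩
    · rw [norm_smul, Real.norm_of_nonneg (by positivity)]; field_simp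
    · rw [real_inner_smul_left, real_inner_self_eq_norm_sq]; field_simp

lemma sq_norm_le_add {E : Type*} [SeminormedAddCommGroup E] {u v : E} {B d : ℝ} (hu : ‖u‖ ≤ B)
    (hv : ‖v‖ ≤ B) (hd : ‖u - v‖ ≤ d) : ‖u‖ ^ 2 / 2 ≤ ‖v‖ ^ 2 / 2 + B * d := by
  have h1 := norm_sub_norm_le u v
  have hd0 : 0 ≤ d := (norm_nonneg _).trans hd
  nlinarith [mul_nonneg (sub_nonneg.2 (h1.trans hd)) (add_nonneg (norm_nonneg u) (norm_nonneg v)),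
    mul_nonneg hd0 (by linarith : 0 ≤ 2 * B - (‖u‖ + ‖v‖))]

variable {I J : Type*} (u : J → 𝔼 m) (w : I → 𝔼 P)

/-- The offset `h (w i) - ‖u j‖² / 2` of the discretised saddle problem. -/
def saddleOffset (h : 𝔼 P → ℝ) (i : I) (j : J) : ℝ := h (w i) - ‖u j‖ ^ 2 / 2

lemma auxField_saddleOffset (hκ : 0 ≤ κ) (q : 𝔼 (m ⊕ P)) (i : I) (j : J) :
    auxField w (fun j => κ • u j) (saddleOffset u w h) q i j =
      κ * (‖w i‖ * inner ℝ (u j) (reidx Sum.inl q) +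
        ‖u j‖ * inner ℝ (w i) (reidx Sum.inr q)) - ‖u j‖ ^ 2 / 2 + h (w i) := by
  rw [auxField, saddleOffset, real_inner_smul_left, norm_smul, Real.norm_of_nonneg hκ]; ring

lemma primaryField_saddleOffset (A : 𝔼 (m × P)) (i : I) (j : J) :
    primaryField w (fun j => κ • u j) (saddleOffset u w h) A i j =
      κ * inner ℝ (u j) (matVec A (w i)) - ‖u j‖ ^ 2 / 2 + h (w i) := by
  rw [primaryField, saddleOffset, real_inner_smul_left]; ring

lemma minVal_auxCost_le_iInf_iSup [Finite J] [Nonempty I] [Nonempty m]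
    (hκ : 0 ≤ κ) (hB : 0 ≤ B) (hK : IsCompact K)
    (hh : ContinuousOn h K) (hR : ∀ W ∈ K, ‖W‖ ≤ R) (hw : ∀ i, w i ∈ K) (hu : ∀ j, ‖u j‖ ≤ B)
    {d : ℝ} (hd : 0 ≤ d) (hnet : ∀ v, ‖v‖ ≤ B → ∃ j, ‖v - u j‖ ≤ d)
    (q : 𝔼 (m ⊕ P)) :
    minVal K (auxCost B κ h q) ≤
      (⨅ i, ⨆ j, auxField w (fun j => κ • u j) (saddleOffset u w h) q i j) +
        d * (2 * κ * R * ‖q‖ + B) := by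
  rw [← sub_le_iff_le_add]
  refine le_ciInf fun i => ?_
  rw [sub_le_iff_le_add]
  refine (minVal_le hK (continuousOn_auxCost hh q) (hw i)).trans ?_
  set t := κ * auxArg q (w i) with ht
  obtain ⟨v, hv, hvg⟩ := exists_norm_eq_inner_eq (reidx Sum.inl q : 𝔼 m)
    (clip_nonneg (B := B) t)
  have hvB : ‖v‖ ≤ B := hv ▸ clip_le hB t
  obtain ⟨j, hj⟩ := hnet v hvB
  refine le_trans ?_ (add_le_add_left (le_ciSup (Set.finite_range _).bddAbove j) _)
  have e1 : auxCost B κ h q (w i) = κ * (‖w i‖ * inner ℝ v (reidx Sum.inl q) +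
      ‖v‖ * inner ℝ (w i) (reidx Sum.inr q)) - ‖v‖ ^ 2 / 2 + h (w i) := by
    rw [auxCost, ← ht, psi, hvg, hv, ht, auxArg]; ring
  have h1 : inner ℝ v (reidx Sum.inl q) ≤ inner ℝ (u j) (reidx Sum.inl q) + d * ‖q‖ := by
    have := real_inner_le_norm (v - u j) (reidx Sum.inl q)
    rw [inner_sub_left] at this
    have h' := mul_le_mul hj (norm_reidx_le (Sum.inl_injective (α := m) (β := P)) q) (norm_nonneg _) hd
    linarith
  have h2 : ‖v‖ * inner ℝ (w i) (reidx Sum.inr q) ≤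
      ‖u j‖ * inner ℝ (w i) (reidx Sum.inr q) + d * (R * ‖q‖) := by
    have a1 : |(inner ℝ (w i) (reidx Sum.inr q) : ℝ)| ≤ R * ‖q‖ :=
      (abs_real_inner_le_norm _ _).trans (mul_le_mul (hR _ (hw i))
        (norm_reidx_le Sum.inr_injective q) (norm_nonneg _) ((norm_nonneg _).trans (hR _ (hw i))))
    have a2 : |‖v‖ - ‖u j‖| ≤ d := (abs_norm_sub_norm_le _ _).trans hj
    have a3 := le_abs_self ((‖v‖ - ‖u j‖) * inner ℝ (w i) (reidx Sum.inr q))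
    rw [abs_mul] at a3
    have := mul_le_mul a2 a1 (abs_nonneg _) hd
    linarith
  have h3 := sq_norm_le_add (d := d) (hu j) hvB (by rwa [norm_sub_rev])
  have h4 := mul_le_mul_of_nonneg_left h1 (norm_nonneg (w i))
  have h5 : ‖w i‖ * (d * ‖q‖) ≤ R * (d * ‖q‖) :=
    mul_le_mul_of_nonneg_right (hR _ (hw i)) (by positivity)
  rw [e1, auxField_saddleOffset u w hκ]
  have h6 : κ * (‖w i‖ * inner ℝ v (reidx Sum.inl q) + ‖v‖ * inner ℝ (w i) (reidx Sum.inr q)) ≤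
    κ * (‖w i‖ * inner ℝ (u j) (reidx Sum.inl q) + ‖u j‖ * inner ℝ (w i) (reidx Sum.inr q) +
      2 * d * (R * ‖q‖)) := mul_le_mul_of_nonneg_left (by linarith) hκ
  nlinarith

lemma iInf_iSup_le_minVal_primCost [Finite I] [Nonempty J]
    (hκ : 0 ≤ κ) (hB : 0 ≤ B) (hK : IsCompact K) (hne : K.Nonempty)
    (hh : ContinuousOn h K) (hu : ∀ j, ‖u j‖ ≤ B)
    {d : ℝ} (hnet : ∀ x ∈ K, ∃ i, dist x (w i) ≤ d ∧ |h x - h (w i)| ≤ d)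
    (A : 𝔼 (m × P)) :
    (⨅ i, ⨆ j, primaryField w (fun j => κ • u j) (saddleOffset u w h) A i j) ≤
      minVal K (primCost B κ h A) + d * (B * κ * ‖A‖ + 1) := by
  obtain ⟨x, hx, hxe⟩ := exists_eq_minVal hK hne (continuousOn_primCost (B := B) (κ := κ) hh A)
  obtain ⟨i, hi, hi'⟩ := hnet x hx
  refine (ciInf_le (Set.finite_range _).bddBelow i).trans (ciSup_le fun j => ?_)
  have h1 := le_psi (norm_nonneg (u j)) (hu j) (κ * ‖matVec A (w i)‖)
  have h2 := mul_le_mul_of_nonneg_left (real_inner_le_norm (u j) (matVec A (w i))) hκ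
  have h3 := psi_le_add hB (κ * ‖matVec A (w i)‖) (κ * ‖matVec A x‖)
  rw [← mul_sub, abs_mul, abs_of_nonneg hκ] at h3
  have h4 : |‖matVec A (w i)‖ - ‖matVec A x‖| ≤ ‖A‖ * d := by
    refine (abs_norm_sub_norm_le _ _).trans ?_
    rw [← matVec_sub_right]
    refine (norm_matVec_le _ _).trans (mul_le_mul_of_nonneg_left ?_ (norm_nonneg _))
    rwa [← dist_eq_norm, dist_comm]
  have h5 := mul_le_mul_of_nonneg_left h4 (mul_nonneg hB hκ)
  have h6 := (abs_le.1 hi').1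
  rw [primaryField_saddleOffset, ← hxe, primCost]
  nlinarith

lemma exists_saddle [Nonempty m] (hB : 0 ≤ B) (hK : IsCompact K) (hne : K.Nonempty)
    (hh : ContinuousOn h K) (hconv : ConvexOn ℝ K h) (A : 𝔼 (m × P)) :
    ∃ v : 𝔼 m, ‖v‖ ≤ B ∧ ∀ W ∈ K, minVal K (primCost B κ h A) ≤
      κ * inner ℝ v (matVec A W) - ‖v‖ ^ 2 / 2 + h W := by
  have hlin : ∀ v : 𝔼 m, ∀ c : ℝ, ConvexOn ℝ K
      fun W => κ * inner ℝ v (matVec A W) - c + h W := fun v c => by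
    refine ConvexOn.add ⟨hconv.1, fun x _ y _ a b _ _ hab => le_of_eq ?_⟩ hconv
    simp only [matVec_add_right, matVec_smul_right, inner_add_right, real_inner_smul_right,
      smul_eq_mul]
    linear_combination c * hab
  have hconc : ∀ W, ConcaveOn ℝ (Metric.closedBall (0 : 𝔼 m) B)
      fun v => κ * inner ℝ v (matVec A W) - ‖v‖ ^ 2 / 2 + h W := fun W => by
    have h1 : ConvexOn ℝ (Metric.closedBall (0 : 𝔼 m) B) fun v => ‖v‖ ^ 2 / 2 := by
      have := ((convexOn_norm (convex_closedBall (0 : 𝔼 m) B)).pow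
        (fun _ _ => norm_nonneg _) 2).smul (c := (1 / 2 : ℝ)) (by norm_num)
      refine this.congr fun v _ => ?_
      simp; ring
    have h2 : ConcaveOn ℝ (Metric.closedBall (0 : 𝔼 m) B)
        fun v => κ * inner ℝ v (matVec A W) + h W :=
      ⟨convex_closedBall _ _, fun x _ y _ a b _ _ hab => le_of_eq (by
        simp only [inner_add_left, real_inner_smul_left, smul_eq_mul]
        linear_combination h W * hab)⟩
    exact (h2.sub h1).congr fun v _ => by simp only [Pi.sub_apply]; ring
  obtain ⟨a, ha, b, hb, hab⟩ := Sion.exists_isSaddlePointOn (X := K)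
    (Y := Metric.closedBall (0 : 𝔼 m) B)
    (f := fun W v => κ * inner ℝ v (matVec A W) - ‖v‖ ^ 2 / 2 + h W) hne hconv.1 hK
    (fun v _ => ContinuousOn.lowerSemicontinuousOn (by
      have := continuous_matVec A; fun_prop))
    (fun v _ => (hlin v _).quasiconvexOn) (convex_closedBall _ _) ⟨0, by simpa using hB⟩
    (isCompact_closedBall _ _)
    (fun W _ => Continuous.upperSemicontinuous (by fun_prop) |>.upperSemicontinuousOn _)
    (fun W _ => (hconc W).quasiconcaveOn)
  refine ⟨b, by simpa using hb, fun W hW => ?_⟩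
  obtain ⟨v, hv, hvA⟩ := exists_norm_eq_inner_eq (matVec A a)
    (clip_nonneg (B := B) (κ * ‖matVec A a‖))
  have h1 := hab W hW v (by simpa [hv] using clip_le hB _)
  refine (minVal_le hK (continuousOn_primCost hh A) ha).trans (le_trans (le_of_eq ?_) h1)
  simp only [primCost, psi, hvA, hv]; ring

lemma minVal_primCost_le_iSup_iInf [Finite J] [Nonempty I] [Nonempty m]
    (hκ : 0 ≤ κ) (hB : 0 ≤ B) (hK : IsCompact K) (hne : K.Nonempty)
    (hh : ContinuousOn h K) (hconv : ConvexOn ℝ K h) (hR : ∀ W ∈ K, ‖W‖ ≤ R)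
    (hw : ∀ i, w i ∈ K) (hu : ∀ j, ‖u j‖ ≤ B)
    {d : ℝ} (hd : 0 ≤ d) (hnet : ∀ v, ‖v‖ ≤ B → ∃ j, ‖v - u j‖ ≤ d)
    (A : 𝔼 (m × P)) :
    minVal K (primCost B κ h A) ≤
      (⨆ j, ⨅ i, primaryField w (fun j => κ • u j) (saddleOffset u w h) A i j) +
        d * (κ * R * ‖A‖ + B) := by
  obtain ⟨v, hv, hvm⟩ := exists_saddle (κ := κ) hB hK hne hh hconv A
  obtain ⟨j, hj⟩ := hnet v hv
  rw [← sub_le_iff_le_add]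
  refine le_trans ?_ (le_ciSup (Set.finite_range _).bddAbove j)
  refine le_ciInf fun i => ?_
  have h1 := hvm _ (hw i)
  have h2 := sq_norm_le_add (d := d) (hu j) hv (by rwa [norm_sub_rev])
  have h3 : inner ℝ v (matVec A (w i)) ≤ inner ℝ (u j) (matVec A (w i)) + d * (‖A‖ * R) := by
    have := real_inner_le_norm (v - u j) (matVec A (w i))
    rw [inner_sub_left] at this
    have h' := mul_le_mul hj ((norm_matVec_le A (w i)).trans
      (mul_le_mul_of_nonneg_left (hR _ (hw i)) (norm_nonneg A))) (norm_nonneg _) hd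
    linarith
  have h4 := mul_le_mul_of_nonneg_left h3 hκ
  rw [primaryField_saddleOffset]
  nlinarith

lemma iSup_iInf_le_minVal_auxCost [Finite I] [Nonempty J]
    (hκ : 0 ≤ κ) (hB : 0 ≤ B) (hK : IsCompact K) (hne : K.Nonempty)
    (hh : ContinuousOn h K) (hu : ∀ j, ‖u j‖ ≤ B)
    {d : ℝ} (hd : 0 ≤ d) (hnet : ∀ x ∈ K, ∃ i, dist x (w i) ≤ d ∧ |h x - h (w i)| ≤ d)
    (q : 𝔼 (m ⊕ P)) :
    (⨆ j, ⨅ i, auxField w (fun j => κ • u j) (saddleOffset u w h) q i j) ≤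
      minVal K (auxCost B κ h q) + d * (2 * B * κ * ‖q‖ + 1) := by
  obtain ⟨x, hx, hxe⟩ := exists_eq_minVal hK hne (continuousOn_auxCost (B := B) (κ := κ) hh q)
  obtain ⟨i, hi, hi'⟩ := hnet x hx
  refine ciSup_le fun j => (ciInf_le (Set.finite_range _).bddBelow i).trans ?_
  have h1 := le_psi (norm_nonneg (u j)) (hu j) (κ * auxArg q (w i))
  have h2 : κ * (‖w i‖ * inner ℝ (u j) (reidx Sum.inl q) +
      ‖u j‖ * inner ℝ (w i) (reidx Sum.inr q)) ≤ ‖u j‖ * (κ * auxArg q (w i)) := by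
    have := mul_le_mul_of_nonneg_left (real_inner_le_norm (u j) (reidx Sum.inl q)) (norm_nonneg (w i))
    have := mul_le_mul_of_nonneg_left this hκ
    rw [auxArg]; nlinarith
  have h3 := psi_le_add hB (κ * auxArg q (w i)) (κ * auxArg q x)
  rw [← mul_sub, abs_mul, abs_of_nonneg hκ] at h3
  have hxw : ‖w i - x‖ ≤ d := by rwa [← dist_eq_norm, dist_comm]
  have h4 : |auxArg q (w i) - auxArg q x| ≤ d * ‖q‖ + d * ‖q‖ := by
    have e : auxArg q (w i) - auxArg q x = (‖w i‖ - ‖x‖) * ‖(reidx Sum.inl q : 𝔼 m)‖ +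
      inner ℝ (w i - x) (reidx Sum.inr q) := by rw [inner_sub_left]; unfold auxArg; ring
    rw [e]
    refine (abs_add_le _ _).trans (add_le_add ?_ ?_)
    · rw [abs_mul, abs_norm]
      exact mul_le_mul ((abs_norm_sub_norm_le _ _).trans hxw) (norm_reidx_le Sum.inl_injective _)
        (norm_nonneg _) hd
    · exact (abs_real_inner_le_norm _ _).trans
        (mul_le_mul hxw (norm_reidx_le Sum.inr_injective _) (norm_nonneg _) hd)
  have h5 := mul_le_mul_of_nonneg_left h4 (mul_nonneg hB hκ)
  have h6 := (abs_le.1 hi').1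
  rw [auxField_saddleOffset u w hκ, ← hxe, auxCost]
  nlinarith

end CompactGordon

section CompactGordonIntegral

variable {m P : Type*} [Fintype m] [Fintype P] [Nonempty m]
  {B κ R : ℝ} {h : 𝔼 P → ℝ} {K : Set (𝔼 P)}

lemma le_of_forall_pos_le_add_mul {a b c : ℝ} (hc : 0 ≤ c) (hab : ∀ d, 0 < d → a ≤ b + d * c) :
    a ≤ b := by
  refine le_of_forall_pos_le_add fun ε hε => (hab (ε / (c + 1)) (by positivity)).trans ?_
  gcongr
  rw [div_mul_eq_mul_div, div_le_iff₀ (by positivity)]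
  nlinarith

lemma integrable_iInf_iSup {Ω I J : Type*} [MeasurableSpace Ω] {μ : Measure Ω} [Finite I] [Finite J]
    [Nonempty I] [Nonempty J] {F : Ω → I → J → ℝ} (hm : ∀ i j, Measurable (F · i j))
    (hF : ∀ i j, Integrable (F · i j) μ) : Integrable (fun ω => ⨅ i, ⨆ j, F ω i j) μ := by
  have := Fintype.ofFinite I
  have := Fintype.ofFinite J
  refine Integrable.mono' (g := fun ω => ∑ i, ∑ j, |F ω i j|)
    (integrable_finsetSum _ fun i _ => integrable_finsetSum _ fun j _ => (hF i j).abs)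
    (Measurable.iInf fun i => Measurable.iSup fun j => hm i j).aestronglyMeasurable
    (.of_forall fun ω => ?_)
  obtain ⟨i, hi⟩ := exists_eq_ciInf_of_finite (f := fun i => ⨆ j, F ω i j)
  obtain ⟨j, hj⟩ := exists_eq_ciSup_of_finite (f := fun j => F ω i j)
  rw [← hi, ← hj, Real.norm_eq_abs]
  exact (Finset.single_le_sum (f := fun j => |F ω i j|) (fun _ _ => abs_nonneg _)
    (Finset.mem_univ j)).trans (Finset.single_le_sum (f := fun i => ∑ j, |F ω i j|)
      (fun _ _ => Finset.sum_nonneg fun _ _ => abs_nonneg _) (Finset.mem_univ i))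

section

variable {I J : Type*} [Finite I] [Finite J] [Nonempty I] [Nonempty J]
  (w : I → 𝔼 P) (u : J → 𝔼 m) (c : I → J → ℝ)

lemma integrable_auxField (i : I) (j : J) :
    Integrable (fun q => auxField w u c q i j) (stdGaussian (𝔼 (m ⊕ P))) := by
  refine (((integrable_norm_stdGaussian.const_mul (‖w i‖ * ‖u j‖)).add
    (integrable_norm_stdGaussian.const_mul (‖w i‖ * ‖u j‖))).add
      (integrable_const |c i j|)).mono' (by unfold auxField; fun_prop) (.of_forall fun q => ?_)
  rw [auxField, Real.norm_eq_abs]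
  refine (abs_add_le _ _).trans (add_le_add ((abs_add_le _ _).trans (add_le_add ?_ ?_)) le_rfl)
  · simp only [abs_mul, abs_norm, mul_assoc]
    gcongr
    exact (abs_real_inner_le_norm _ _).trans
      (mul_le_mul_of_nonneg_left (norm_reidx_le Sum.inl_injective _) (norm_nonneg _))
  · simp only [abs_mul, abs_norm]
    rw [mul_comm ‖w i‖ ‖u j‖, mul_assoc]
    gcongr
    exact (abs_real_inner_le_norm _ _).trans
      (mul_le_mul_of_nonneg_left (norm_reidx_le Sum.inr_injective _) (norm_nonneg _))

lemma integrable_primaryField (i : I) (j : J) :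
    Integrable (fun A => primaryField w u c A i j) (stdGaussian (𝔼 (m × P))) := by
  refine ((integrable_norm_stdGaussian.const_mul ‖outer (u j) (w i)‖).add
      (integrable_const |c i j|)).mono'
    (by simp only [primaryField, ← inner_outer]; fun_prop) (.of_forall fun q => ?_)
  rw [primaryField, Real.norm_eq_abs, ← inner_outer]
  exact (abs_add_le _ _).trans (add_le_add (abs_real_inner_le_norm _ _) le_rfl)

lemma integrable_iInf_iSup_auxField :
    Integrable (fun q => ⨅ i, ⨆ j, auxField w u c q i j) (stdGaussian (𝔼 (m ⊕ P))) :=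
  integrable_iInf_iSup (fun _ _ => by unfold auxField; fun_prop) fun _ _ => integrable_auxField ..

lemma integrable_iInf_iSup_primaryField :
    Integrable (fun A => ⨅ i, ⨆ j, primaryField w u c A i j)
      (stdGaussian (𝔼 (m × P))) :=
  integrable_iInf_iSup (fun _ _ => by simp only [primaryField, ← inner_outer]; fun_prop)
    fun _ _ => integrable_primaryField ..

lemma integrable_iSup_iInf {Ω : Type*} [MeasurableSpace Ω] {μ : Measure Ω}
    {F : Ω → I → J → ℝ} (hm : ∀ i j, Measurable (F · i j))
    (hF : ∀ i j, Integrable (F · i j) μ) : Integrable (fun ω => ⨆ j, ⨅ i, F ω i j) μ := by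
  have := Fintype.ofFinite I
  have := Fintype.ofFinite J
  refine (integrable_iInf_iSup (F := fun ω j i => -F ω i j) (fun j i => (hm i j).neg)
    fun j i => (hF i j).neg).neg.congr (.of_forall fun ω => ?_)
  simp only [Pi.neg_apply]
  rw [iInf_iSup_neg, neg_neg]

lemma integrable_iSup_iInf_auxField :
    Integrable (fun q => ⨆ j, ⨅ i, auxField w u c q i j) (stdGaussian (𝔼 (m ⊕ P))) :=
  integrable_iSup_iInf (fun _ _ => by unfold auxField; fun_prop) fun _ _ => integrable_auxField ..

lemma integrable_iSup_iInf_primaryField :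
    Integrable (fun A => ⨆ j, ⨅ i, primaryField w u c A i j)
      (stdGaussian (𝔼 (m × P))) :=
  integrable_iSup_iInf (fun _ _ => by simp only [primaryField, ← inner_outer]; fun_prop)
    fun _ _ => integrable_primaryField ..

end

/-- Finite nets for the saddle problem on `K × closedBall 0 B`, with the Gordon error bound. -/
lemma exists_saddle_nets (hB : 0 ≤ B) (hK : IsCompact K) (hne : K.Nonempty)
    (hh : ContinuousOn h K) {d : ℝ} (hd : 0 < d) :
    ∃ (T : Finset (𝔼 P)) (S : Finset (𝔼 m)),
      Nonempty T ∧ Nonempty S ∧ (∀ i : T, i.1 ∈ K) ∧ (∀ j : S, ‖j.1‖ ≤ B) ∧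
      (∀ v : 𝔼 m, ‖v‖ ≤ B → ∃ j : S, ‖v - j.1‖ ≤ d) ∧
      ∀ x ∈ K, ∃ i : T, dist x i.1 ≤ d ∧ |h x - h i.1| ≤ d := by
  obtain ⟨T, hTK, hT⟩ := exists_finite_net hK hh hd
  obtain ⟨S, hSK, hS⟩ := exists_finite_net
    (isCompact_closedBall (0 : 𝔼 m) B) (continuousOn_const (c := (0 : ℝ))) hd
  refine ⟨T, S, ?_, ?_, fun i => hTK i.2, fun j => by simpa using hSK j.2, fun v hv => ?_,
    fun x hx => ?_⟩
  · obtain ⟨y, hy, -⟩ := hT _ hne.some_mem; exact ⟨⟨y, hy⟩⟩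
  · obtain ⟨y, hy, -⟩ := hS 0 (by simpa using hB); exact ⟨⟨y, hy⟩⟩
  · obtain ⟨y, hy, hd, -⟩ := hS v (by simpa using hv)
    exact ⟨⟨y, hy⟩, by rwa [← dist_eq_norm]⟩
  · obtain ⟨y, hy, hd⟩ := hT x hx
    exact ⟨⟨y, hy⟩, hd⟩

lemma integrable_minVal_auxCost (hκ : 0 ≤ κ) (hB : 0 ≤ B) (hK : IsCompact K) (hne : K.Nonempty)
    (hh : ContinuousOn h K) (hR : ∀ W ∈ K, ‖W‖ ≤ R) :
    Integrable (fun q => minVal K (auxCost B κ h q)) (stdGaussian (𝔼 (m ⊕ P))) :=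
  integrable_lipschitz (lipschitzWith_minVal_auxCost hB hκ hK hne hh hR)

lemma integrable_minVal_primCost (hκ : 0 ≤ κ) (hB : 0 ≤ B) (hK : IsCompact K) (hne : K.Nonempty)
    (hh : ContinuousOn h K) (hR : ∀ W ∈ K, ‖W‖ ≤ R) :
    Integrable (fun q => minVal K (primCost B κ h q)) (stdGaussian (𝔼 (m × P))) :=
  integrable_lipschitz (lipschitzWith_minVal_primCost hB hκ hK hne hh hR)

lemma integral_le_integral_add_of_le {Ω : Type*} [MeasurableSpace Ω] {μ : Measure Ω}
    [IsProbabilityMeasure μ] {f g r : Ω → ℝ} {d a b : ℝ} (hf : Integrable f μ) (hg : Integrable g μ)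
    (hr : Integrable r μ) (hfg : ∀ ω, f ω ≤ g ω + d * (a * r ω + b)) :
    ∫ ω, f ω ∂μ ≤ ∫ ω, g ω ∂μ + d * (a * ∫ ω, r ω ∂μ + b) := by
  have h1 : Integrable (fun ω => a * r ω + b) μ := (hr.const_mul a).add (integrable_const b)
  refine (integral_mono hf (hg.add (h1.const_mul d)) hfg).trans (le_of_eq ?_)
  simp only [Pi.add_apply]
  rw [integral_add hg (h1.const_mul d), integral_const_mul,
    integral_add (hr.const_mul a) (integrable_const b), integral_const_mul]
  simp

/-- Comparison of expected minima: primary above auxiliary. -/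
theorem integral_minVal_auxCost_le (hκ : 0 ≤ κ) (hB : 0 ≤ B) (hK : IsCompact K) (hne : K.Nonempty)
    (hh : ContinuousOn h K) (hR : ∀ W ∈ K, ‖W‖ ≤ R) :
    ∫ q, minVal K (auxCost B κ h q) ∂(stdGaussian (𝔼 (m ⊕ P))) ≤
      ∫ A, minVal K (primCost B κ h A) ∂(stdGaussian (𝔼 (m × P))) + κ * B * R := by
  have hR0 : 0 ≤ R := (norm_nonneg _).trans (hR _ hne.some_mem)
  set Q := ∫ q, ‖q‖ ∂(stdGaussian (𝔼 (m ⊕ P)))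
  set QA := ∫ q, ‖q‖ ∂(stdGaussian (𝔼 (m × P)))
  refine le_of_forall_pos_le_add_mul (c := (2 * κ * R * Q + B) + (B * κ * QA + 1)) (by positivity)
    fun d hd => ?_
  obtain ⟨T, S, hT, hS, hw, hu, hnetU, hnetW⟩ := exists_saddle_nets (m := m) hB hK hne hh hd
  let w : T → 𝔼 P := Subtype.val
  let u : S → 𝔼 m := Subtype.val
  have hg := gordon_matrix (m := m) w (fun j => κ • u j) (saddleOffset u w h) 1 (by norm_num)
    (B := κ * B * R) (fun i j => by
      rw [norm_smul, Real.norm_of_nonneg hκ]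
      exact mul_le_mul (mul_le_mul_of_nonneg_left (hu j) hκ) (hR _ (hw i)) (norm_nonneg _)
        (by positivity)) (fun i _ => i) (fun _ j => j) (fun k l l' => Or.inl rfl)
  simp only [one_mul] at hg
  have h1 := integral_le_integral_add_of_le (integrable_minVal_auxCost hκ hB hK hne hh hR)
    (integrable_iInf_iSup_auxField _ _ _) integrable_norm_stdGaussian
    (minVal_auxCost_le_iInf_iSup u w hκ hB hK hh hR hw hu hd.le hnetU)
  have h2 := integral_le_integral_add_of_le (integrable_iInf_iSup_primaryField _ _ _)
    (integrable_minVal_primCost (m := m) hκ hB hK hne hh hR) integrable_norm_stdGaussian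
    (iInf_iSup_le_minVal_primCost u w hκ hB hK hne hh hu hnetW)
  linarith

/-- Comparison of expected minima for convex problems: primary below auxiliary. -/
theorem integral_minVal_primCost_le (hκ : 0 ≤ κ) (hB : 0 ≤ B) (hK : IsCompact K) (hne : K.Nonempty)
    (hh : ContinuousOn h K) (hconv : ConvexOn ℝ K h) (hR : ∀ W ∈ K, ‖W‖ ≤ R) :
    ∫ A, minVal K (primCost B κ h A) ∂(stdGaussian (𝔼 (m × P))) ≤
      ∫ q, minVal K (auxCost B κ h q) ∂(stdGaussian (𝔼 (m ⊕ P))) + κ * B * R := by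
  have hR0 : 0 ≤ R := (norm_nonneg _).trans (hR _ hne.some_mem)
  set Q := ∫ q, ‖q‖ ∂(stdGaussian (𝔼 (m ⊕ P)))
  set QA := ∫ q, ‖q‖ ∂(stdGaussian (𝔼 (m × P)))
  refine le_of_forall_pos_le_add_mul (c := (κ * R * QA + B) + (2 * B * κ * Q + 1)) (by positivity)
    fun d hd => ?_
  obtain ⟨T, S, hT, hS, hw, hu, hnetU, hnetW⟩ := exists_saddle_nets (m := m) hB hK hne hh hd
  let w : T → 𝔼 P := Subtype.val
  let u : S → 𝔼 m := Subtype.val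
  have hg := gordon_matrix (m := m) w (fun j => κ • u j) (saddleOffset u w h) (-1) (by norm_num)
    (B := κ * B * R) (fun i j => by
      rw [norm_smul, Real.norm_of_nonneg hκ]
      exact mul_le_mul (mul_le_mul_of_nonneg_left (hu j) hκ) (hR _ (hw i)) (norm_nonneg _)
        (by positivity)) (fun _ i => i) (fun j _ => j) (fun k l l' => Or.inr rfl)
  simp only [neg_mul, one_mul] at hg
  simp_rw [iInf_iSup_neg] at hg
  rw [integral_neg, integral_neg] at hg
  have h1 := integral_le_integral_add_of_le (integrable_minVal_primCost hκ hB hK hne hh hR)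
    (integrable_iSup_iInf_primaryField _ _ _) integrable_norm_stdGaussian
    (minVal_primCost_le_iSup_iInf u w hκ hB hK hne hh hconv hR hw hu hd.le hnetU)
  have h2 := integral_le_integral_add_of_le (integrable_iSup_iInf_auxField _ _ _)
    (integrable_minVal_auxCost (m := m) hκ hB hK hne hh hR) integrable_norm_stdGaussian
    (iSup_iInf_le_minVal_auxCost u w hκ hB hK hne hh hu hd.le hnetW)
  linarith

end CompactGordonIntegral

section OperatorNorm

variable {m P : Type*} [Fintype m] [Fintype P]

/-- The continuous linear map of a matrix. -/
def matCLM (A : 𝔼 (m × P)) : 𝔼 P →L[ℝ] 𝔼 m :=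
  LinearMap.toContinuousLinearMap
    { toFun := matVec A
      map_add' := matVec_add_right A
      map_smul' := matVec_smul_right A }

@[simp] lemma matCLM_apply (A : 𝔼 (m × P)) (w : 𝔼 P) :
    matCLM A w = matVec A w := rfl

lemma norm_matVec_le_matCLM (A : 𝔼 (m × P)) (w : 𝔼 P) :
    ‖matVec A w‖ ≤ ‖matCLM A‖ * ‖w‖ := (matCLM A).le_opNorm w

lemma lipschitzWith_norm_matCLM :
    LipschitzWith 1 (fun A : 𝔼 (m × P) => ‖matCLM A‖) := by
  refine LipschitzWith.of_le_add fun A A' => ?_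
  refine (matCLM A).opNorm_le_bound (by positivity) fun w => ?_
  have h : matCLM A w = matCLM A' w + matVec (A - A') w := by
    rw [matVec_sub]; simp
  rw [h, add_mul, dist_eq_norm]
  exact (norm_add_le _ _).trans (add_le_add ((matCLM A').le_opNorm w) (norm_matVec_le _ _))

/-- Chevet's inequality for a standard Gaussian matrix. -/
theorem integral_norm_matCLM_le [Nonempty m] :
    ∫ A, ‖matCLM A‖ ∂(stdGaussian (𝔼 (m × P))) ≤
      ∫ g, ‖g‖ ∂(stdGaussian (𝔼 m)) +
        ∫ g, ‖g‖ ∂(stdGaussian (𝔼 P)) + 1 := by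
  set QA := ∫ q, ‖q‖ ∂(stdGaussian (𝔼 (m × P)))
  have hQA : 0 ≤ QA := integral_nonneg fun _ => norm_nonneg _
  refine le_of_forall_pos_le_add_mul (c := 2 * QA + 0) (by positivity) fun d hd => ?_
  obtain ⟨T, S, hT, hS, hw, hu, hnetU, hnetW⟩ := exists_saddle_nets (m := m)
    (K := Metric.closedBall (0 : 𝔼 P) 1) zero_le_one (isCompact_closedBall _ _)
    ⟨0, by simp⟩ (continuousOn_const (c := (0 : ℝ))) hd
  let w : T → 𝔼 P := Subtype.val
  let u : S → 𝔼 m := Subtype.val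
  have hw' : ∀ i, ‖w i‖ ≤ 1 := fun i => by simpa using hw i
  have hg := gordon_matrix (m := m) w u (fun _ _ => 0) (-1) (by norm_num)
    (B := 1) (fun i j => mul_le_one₀ (hu j) (norm_nonneg _) (hw' i))
    (K := T × S) (L := Unit) (fun k _ => k.1) (fun k _ => k.2) (fun k l l' => Or.inl rfl)
  simp only [neg_mul, one_mul, ciSup_unique] at hg
  have hneg : ∀ a : T × S → ℝ, (⨅ k, -a k) = -⨆ k, a k := fun a => by
    have := iInf_iSup_neg (I := T × S) (J := Unit) (fun k _ => a k)
    simpa using this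
  simp_rw [hneg] at hg
  rw [integral_neg, integral_neg] at hg
  have haux : Integrable (fun q => ⨆ k : T × S, auxField w u (fun _ _ => 0) q k.1 k.2)
      (stdGaussian (𝔼 (m ⊕ P))) := by
    have := integrable_iSup_iInf (I := Unit) (J := T × S)
      (F := fun q _ k => auxField w u (fun _ _ => 0) q k.1 k.2)
      (μ := stdGaussian (𝔼 (m ⊕ P)))
      (fun _ _ => by unfold auxField; fun_prop) fun _ _ => integrable_auxField ..
    simpa using this
  have hprim : Integrable (fun q => ⨆ k : T × S, primaryField w u (fun _ _ => 0) q k.1 k.2)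
      (stdGaussian (𝔼 (m × P))) := by
    have := integrable_iSup_iInf (I := Unit) (J := T × S)
      (F := fun q _ k => primaryField w u (fun _ _ => 0) q k.1 k.2)
      (μ := stdGaussian (𝔼 (m × P)))
      (fun _ _ => by simp only [primaryField, ← inner_outer]; fun_prop)
      fun _ _ => integrable_primaryField ..
    simpa using this
  have h1 := integral_le_integral_add_of_le (integrable_lipschitz lipschitzWith_norm_matCLM)
    hprim integrable_norm_stdGaussian (d := d) (a := 2) (b := 0) fun A => by
      have hsup : ∀ k : T × S, primaryField w u (fun _ _ => 0) A k.1 k.2 ≤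
          ⨆ k : T × S, primaryField w u (fun _ _ => 0) A k.1 k.2 :=
        fun k => le_ciSup (f := fun k : T × S => primaryField w u (fun _ _ => 0) A k.1 k.2)
          (Set.finite_range _).bddAbove k
      have key : ∀ x : 𝔼 P, ‖x‖ ≤ 1 → ‖matVec A x‖ ≤
          (⨆ k : T × S, primaryField w u (fun _ _ => 0) A k.1 k.2) + d * (2 * ‖A‖ + 0) := by
        intro x hx
        obtain ⟨v, hv, hvA⟩ := exists_norm_eq_inner_eq (matVec A x) zero_le_one
        obtain ⟨i, hi, -⟩ := hnetW x (by simpa using hx)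
        obtain ⟨j, hj⟩ := hnetU v hv.le
        have h3 := hsup (i, j)
        rw [show primaryField w u (fun _ _ => 0) A (i, j).1 (i, j).2 =
          inner ℝ (u j) (matVec A (w i)) from add_zero _] at h3
        replace hi : ‖x - w i‖ ≤ d := by rwa [← dist_eq_norm]
        replace hj : ‖v - u j‖ ≤ d := hj
        have h4 := (real_inner_le_norm (v - u j) (matVec A x)).trans
          (mul_le_mul hj (norm_matVec_le A x) (norm_nonneg _) hd.le)
        have h5 := (real_inner_le_norm (u j) (matVec A (x - w i))).trans
          (mul_le_mul (hu j) (norm_matVec_le A _) (norm_nonneg _) zero_le_one)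
        rw [matVec_sub_right, inner_sub_right] at h5
        rw [inner_sub_left, hvA] at h4
        have h6 := mul_le_mul_of_nonneg_left hi (norm_nonneg A)
        have h7 := mul_le_mul_of_nonneg_left hx (norm_nonneg A)
        have h8 := mul_le_mul_of_nonneg_left h7 hd.le
        linarith
      have h0 := (norm_nonneg _).trans (key 0 (by simp))
      refine (matCLM A).opNorm_le_of_unit_norm h0 fun x hx => key x hx.le
  have h2 : ∫ q, (⨆ k : T × S, auxField w u (fun _ _ => 0) q k.1 k.2)
        ∂(stdGaussian (𝔼 (m ⊕ P))) ≤
      ∫ g, ‖g‖ ∂(stdGaussian (𝔼 m)) +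
        ∫ g, ‖g‖ ∂(stdGaussian (𝔼 P)) := by
    rw [← integral_reidx (ι := m ⊕ P) (f := Sum.inl) Sum.inl_injective
      (g := fun g : 𝔼 m => ‖g‖) (by fun_prop),
      ← integral_reidx (ι := m ⊕ P) (f := Sum.inr) Sum.inr_injective
      (g := fun g : 𝔼 P => ‖g‖) (by fun_prop), ← integral_add]
    · refine integral_mono haux ?_ fun q => ?_
      · exact (integrable_norm_stdGaussian.mono' (by fun_prop) (.of_forall fun q => by
          simpa using norm_reidx_le Sum.inl_injective q)).add
          (integrable_norm_stdGaussian.mono' (by fun_prop) (.of_forall fun q => by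
          simpa using norm_reidx_le Sum.inr_injective q))
      · refine ciSup_le fun k => ?_
        rw [auxField, add_zero]
        have h3 := (real_inner_le_norm (u k.2) (reidx Sum.inl q)).trans
          (mul_le_of_le_one_left (norm_nonneg _) (hu k.2))
        have h4 := (real_inner_le_norm (w k.1) (reidx Sum.inr q)).trans
          (mul_le_of_le_one_left (norm_nonneg _) (hw' k.1))
        have h5 := mul_le_of_le_one_left (norm_nonneg (reidx Sum.inl q : 𝔼 m)) (hw' k.1)
        have h6 := mul_le_of_le_one_left (norm_nonneg (reidx Sum.inr q : 𝔼 P)) (hu k.2)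
        exact add_le_add ((mul_le_mul_of_nonneg_left h3 (norm_nonneg _)).trans h5)
          ((mul_le_mul_of_nonneg_left h4 (norm_nonneg _)).trans h6)
    · exact integrable_norm_stdGaussian.mono' (by fun_prop) (.of_forall fun q => by
          simpa using norm_reidx_le Sum.inl_injective q)
    · exact integrable_norm_stdGaussian.mono' (by fun_prop) (.of_forall fun q => by
          simpa using norm_reidx_le Sum.inr_injective q)
  linarith

end OperatorNorm

section NormMoments

variable {E : Type*} [NormedAddCommGroup E] [InnerProductSpace ℝ E] [FiniteDimensional ℝ E]
  [MeasurableSpace E] [BorelSpace E]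

lemma integrable_sq_lipschitz {f : E → ℝ} {K : ℝ≥0} (hf : LipschitzWith K f) :
    Integrable (fun x => f x ^ 2) (stdGaussian E) := by
  refine (((integrable_exp_lipschitz hf 1).add (integrable_exp_lipschitz hf (-1))).const_mul 2).mono'
    (hf.continuous.pow 2).aestronglyMeasurable (.of_forall fun x => ?_)
  have h1 := Real.quadratic_le_exp_of_nonneg (abs_nonneg (f x))
  have h2 : Real.exp |f x| ≤ Real.exp (1 * f x) + Real.exp (-1 * f x) := by
    rcases abs_cases (f x) with h | h <;> rw [h.1] <;>
      [rw [one_mul]; rw [neg_one_mul]] <;> linarith [Real.exp_pos (f x), Real.exp_pos (-1 * f x),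
        Real.exp_pos (1 * f x)]
  rw [Real.norm_of_nonneg (by positivity), Pi.add_apply, ← sq_abs]
  nlinarith [abs_nonneg (f x)]

lemma integral_sub_mean_sq {f : E → ℝ} {K : ℝ≥0} (hf : LipschitzWith K f) :
    Integrable (fun x => (f x - ∫ x, f x ∂(stdGaussian E)) ^ 2) (stdGaussian E) ∧
    ∫ x, (f x - ∫ x, f x ∂(stdGaussian E)) ^ 2 ∂(stdGaussian E) =
      ∫ x, f x ^ 2 ∂(stdGaussian E) - (∫ x, f x ∂(stdGaussian E)) ^ 2 := by
  set M := ∫ x, f x ∂(stdGaussian E) with hM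
  have hi := integrable_lipschitz hf
  have hi2 := integrable_sq_lipschitz hf
  have hi3 : Integrable (fun x => 2 * M * f x - M ^ 2) (stdGaussian E) :=
    (hi.const_mul _).sub (integrable_const _)
  have : (fun x => (f x - M) ^ 2) = fun x => f x ^ 2 - (2 * M * f x - M ^ 2) := by
    funext x; ring
  rw [this]
  refine ⟨hi2.sub hi3, ?_⟩
  rw [integral_sub hi2 hi3, integral_sub (hi.const_mul _) (integrable_const _), integral_const_mul]
  simp only [integral_const, probReal_univ, smul_eq_mul, one_mul]
  rw [← hM]; ring

/-- A Lipschitz function of a standard Gaussian vector has bounded variance. -/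
lemma integral_sq_le_lipschitz {f : E → ℝ} {K : ℝ≥0} (hf : LipschitzWith K f) :
    ∫ x, f x ^ 2 ∂(stdGaussian E) ≤
      (∫ x, f x ∂(stdGaussian E)) ^ 2 + 4 * Real.exp (5 / 4 * K ^ 2) := by
  set M := ∫ x, f x ∂(stdGaussian E)
  have hs := hasSubgaussianMGF_lipschitz hf
  have h1 := hs.mgf_le 1
  have h2 := hs.mgf_le (-1)
  have i1 := hs.integrable_exp_mul 1
  have i2 := hs.integrable_exp_mul (-1)
  obtain ⟨hi3, e⟩ := integral_sub_mean_sq hf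
  have h3 : ∫ x, (f x - M) ^ 2 ∂(stdGaussian E) ≤
      ∫ x, (2 * (Real.exp (1 * (f x - M)) + Real.exp (-1 * (f x - M)))) ∂(stdGaussian E) := by
    refine integral_mono hi3 ((i1.add i2).const_mul 2) fun x => ?_
    · have h1 := Real.quadratic_le_exp_of_nonneg (abs_nonneg (f x - M))
      have h2 : Real.exp |f x - M| ≤ Real.exp (1 * (f x - M)) + Real.exp (-1 * (f x - M)) := by
        rcases abs_cases (f x - M) with h | h <;> rw [h.1] <;>
          [rw [one_mul]; rw [neg_one_mul]] <;> linarith [Real.exp_pos (f x - M),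
            Real.exp_pos (-1 * (f x - M)), Real.exp_pos (1 * (f x - M))]
      simp only
      rw [← sq_abs]
      nlinarith [abs_nonneg (f x - M)]
  rw [integral_const_mul, integral_add i1 i2] at h3
  simp only [mgf] at h1 h2
  norm_num at h1 h2 h3
  have e2 : (5 / 2 * (K : ℝ) ^ 2 / 2) = 5 / 4 * K ^ 2 := by ring
  rw [e2] at h1 h2
  rw [e] at h3
  linarith

lemma integral_sq_inner_stdGaussian (v : E) : ∫ x, (inner ℝ v x : ℝ) ^ 2 ∂(stdGaussian E) = ‖v‖ ^ 2 := by
  have h1 : Var[innerSL ℝ v; stdGaussian E] = ‖v‖ ^ 2 := by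
    rw [variance_dual_stdGaussian, innerSL_apply_norm]
  have hm : MemLp (innerSL ℝ v) 2 (stdGaussian E) :=
    (innerSL ℝ v).comp_memLp' (IsGaussian.memLp_id (stdGaussian E) 2 (by simp))
  rw [variance_eq_sub hm, integral_strongDual_stdGaussian] at h1
  simpa using h1

lemma integral_sq_norm_stdGaussian {ι : Type*} [Fintype ι] :
    ∫ x, ‖x‖ ^ 2 ∂(stdGaussian (𝔼 ι)) = Fintype.card ι := by
  classical
  simp only [EuclideanSpace.norm_sq_eq, Real.norm_eq_abs, sq_abs]
  have h : ∀ i : ι, (fun x : 𝔼 ι => x i ^ 2) =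
      fun x => (inner ℝ (EuclideanSpace.single i (1 : ℝ)) x : ℝ) ^ 2 := fun i => by
    funext x; simp [EuclideanSpace.inner_single_left]
  rw [integral_finsetSum]
  · have : ∀ i : ι, ∫ x, x i ^ 2 ∂(stdGaussian (𝔼 ι)) = 1 := fun i => by
      rw [h i, integral_sq_inner_stdGaussian]; simp
    simp [this]
  · intro i _
    rw [h i]
    refine integrable_sq_lipschitz (K := ‖(EuclideanSpace.single i (1 : ℝ) : 𝔼 ι)‖₊)
      (f := fun x => inner ℝ (EuclideanSpace.single i (1 : ℝ)) x) ?_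
    refine LipschitzWith.of_dist_le_mul fun x y => ?_
    rw [Real.dist_eq, ← inner_sub_right, dist_eq_norm]
    exact abs_real_inner_le_norm _ _

lemma integral_le_sqrt_integral_sq {f : E → ℝ} {K : ℝ≥0} (hf : LipschitzWith K f) :
    ∫ x, f x ∂(stdGaussian E) ≤ √(∫ x, f x ^ 2 ∂(stdGaussian E)) := by
  refine Real.le_sqrt_of_sq_le ?_
  have h0 : 0 ≤ ∫ x, (f x - ∫ x, f x ∂(stdGaussian E)) ^ 2 ∂(stdGaussian E) :=
    integral_nonneg fun _ => sq_nonneg _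
  rw [(integral_sub_mean_sq hf).2] at h0
  linarith

lemma integral_norm_stdGaussian_le {ι : Type*} [Fintype ι] :
    ∫ x, ‖x‖ ∂(stdGaussian (𝔼 ι)) ≤ √(Fintype.card ι) := by
  rw [← integral_sq_norm_stdGaussian]
  exact integral_le_sqrt_integral_sq lipschitzWith_one_norm

lemma le_integral_norm_stdGaussian {ι : Type*} [Fintype ι] :
    √(Fintype.card ι) - 2 * Real.exp 1 ≤ ∫ x, ‖x‖ ∂(stdGaussian (𝔼 ι)) := by
  have h := integral_sq_le_lipschitz (E := 𝔼 ι) lipschitzWith_one_norm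
  rw [integral_sq_norm_stdGaussian] at h
  have h0 : 0 ≤ ∫ x, ‖x‖ ∂(stdGaussian (𝔼 ι)) := integral_nonneg fun _ => norm_nonneg _
  have he : 4 * Real.exp (5 / 4 * ((1 : ℝ≥0) : ℝ) ^ 2) ≤ (2 * Real.exp 1) ^ 2 := by
    have : Real.exp (5 / 4 * ((1 : ℝ≥0) : ℝ) ^ 2) ≤ Real.exp 1 ^ 2 := by
      rw [← Real.exp_nat_mul]; exact Real.exp_le_exp.2 (by norm_num)
    nlinarith
  rw [sub_le_iff_le_add]
  refine Real.sqrt_le_iff.2 ⟨by positivity, h.trans ?_⟩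
  nlinarith [Real.exp_pos 1]

end NormMoments

section Primal

variable {E F : Type*} [AddCommGroup E] [Module ℝ E] [NormedAddCommGroup F] [InnerProductSpace ℝ F]
  {e : E →ₗ[ℝ] F} {h : E → ℝ} {S : Set E} {l l' : ℝ} {w w' : E}

/-- The penalised least-squares cost. -/
def penCost (e : E →ₗ[ℝ] F) (h : E → ℝ) (l : ℝ) (w : E) : ℝ := ‖e w‖ ^ 2 / 2 + l * h w

lemma nonneg_of_forall_le_one {a b : ℝ} (h : ∀ t, 0 < t → t ≤ 1 → 0 ≤ t * a + t ^ 2 * b) : 0 ≤ a := by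
  by_contra! ha
  set t := min 1 (-a / (2 * (|b| + 1))) with ht
  have htp : 0 < t := lt_min one_pos (div_pos (by linarith) (by positivity))
  have h1 := h t htp (min_le_left _ _)
  have h2 : t * (2 * (|b| + 1)) ≤ -a := by
    rw [← le_div_iff₀ (by positivity)]; exact min_le_right _ _
  nlinarith [le_abs_self b]

lemma penCost_first_order (hh : ConvexOn ℝ S h) (hl : 0 ≤ l) (hw : w ∈ S)
    (hmin : IsMinOn (penCost e h l) S w) {v : E} (hv : v ∈ S) :
    0 ≤ inner ℝ (e w) (e v - e w) + l * (h v - h w) := by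
  refine nonneg_of_forall_le_one (b := ‖e v - e w‖ ^ 2 / 2) fun t ht ht1 => ?_
  have hm := hmin (hh.1 hw hv (sub_nonneg.2 ht1) ht.le (by ring))
  have hc := hh.2 hw hv (sub_nonneg.2 ht1) ht.le (by ring)
  have he : e ((1 - t) • w + t • v) = e w + t • (e v - e w) := by
    simp only [map_add, map_smul]; module
  simp only [Set.mem_ofPred_eq, penCost, he, smul_eq_mul] at hm hc
  rw [norm_add_sq_real, inner_smul_right, norm_smul, Real.norm_of_nonneg ht.le, mul_pow] at hm
  nlinarith [mul_le_mul_of_nonneg_left hc hl]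

/-- Tangent lower bound in the regularisation parameter. -/
lemma le_penCost_of_param (hh : ConvexOn ℝ S h) (hl : 0 < l) (hl' : 0 ≤ l') (hw : w ∈ S)
    (hmin : IsMinOn (penCost e h l) S w) {v : E} (hv : v ∈ S) :
    penCost e h l w + (l' - l) * h w - ((l' - l) / l) ^ 2 * ‖e w‖ ^ 2 / 2 ≤ penCost e h l' v := by
  have h1 := penCost_first_order hh hl.le hw hmin hv
  have h2 := norm_add_sq_real (e w) (e v - e w)
  have h3 : 0 ≤ l' / l * (inner ℝ (e w) (e v - e w) + l * (h v - h w)) := by positivity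
  have h4 : l' / l * (inner ℝ (e w) (e v - e w) + l * (h v - h w)) =
      l' / l * inner ℝ (e w) (e v - e w) + l' * (h v - h w) := by field_simp
  have h5 : (l' - l) / l = l' / l - 1 := by field_simp
  have h6 : 0 ≤ ‖e v - e w + (1 - l' / l) • e w‖ ^ 2 := by positivity
  rw [norm_add_sq_real, inner_smul_right, norm_smul, mul_pow, Real.norm_eq_abs, sq_abs,
    real_inner_comm] at h6
  rw [add_sub_cancel] at h2
  simp only [penCost, h5]
  nlinarith

/-- Tangent lower bound in the offset of the affine slice. -/
lemma le_penCost_of_shift (hh : ConvexOn ℝ S h) (hl : 0 ≤ l) (hw : w ∈ S)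
    (hmin : IsMinOn (penCost e h l) S w) {v u : E} (hv : v ∈ S) (hu : h (v + u) = h v) :
    penCost e h l w + inner ℝ (e w) (e u) ≤ penCost e h l (v + u) := by
  have h1 := penCost_first_order hh hl hw hmin hv
  have h2 : 0 ≤ ‖e v + e u - e w‖ ^ 2 := by positivity
  rw [norm_sub_sq_real, inner_add_left] at h2
  rw [inner_sub_right, real_inner_self_eq_norm_sq] at h1
  simp only [penCost, map_add, hu]
  linarith [real_inner_comm (e w) (e v), real_inner_comm (e w) (e u)]

lemma norm_sub_le_of_param (hh : ConvexOn ℝ S h) (hl : 0 < l) (hl' : 0 < l') (hw : w ∈ S)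
    (hmin : IsMinOn (penCost e h l) S w) (hw' : w' ∈ S) (hmin' : IsMinOn (penCost e h l') S w') :
    ‖e w' - e w‖ ≤ |l' - l| / l' * ‖e w'‖ := by
  have h1 := penCost_first_order hh hl.le hw hmin hw'
  have h2 := penCost_first_order hh hl'.le hw' hmin' hw
  have h3 : 0 ≤ l / l' * (inner ℝ (e w') (e w - e w') + l' * (h w - h w')) := by positivity
  have h4 : l / l' * (inner ℝ (e w') (e w - e w') + l' * (h w - h w')) =
      l / l' * inner ℝ (e w') (e w - e w') + l * (h w - h w') := by field_simp
  have h5 : inner ℝ (e w') (e w - e w') = -inner ℝ (e w') (e w' - e w) := by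
    rw [← inner_neg_right, neg_sub]
  have h6 : ‖e w' - e w‖ ^ 2 = inner ℝ (e w') (e w' - e w) - inner ℝ (e w) (e w' - e w) := by
    rw [← inner_sub_left, real_inner_self_eq_norm_sq]
  have h7 : ‖e w' - e w‖ ^ 2 ≤ (1 - l / l') * inner ℝ (e w') (e w' - e w) := by
    rw [h5] at h4 h3; nlinarith
  have h8 : 1 - l / l' = (l' - l) / l' := by field_simp
  have h9 : ‖e w' - e w‖ ^ 2 ≤ |l' - l| / l' * (‖e w'‖ * ‖e w' - e w‖) := by
    refine h7.trans ((le_abs_self _).trans ?_)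
    rw [abs_mul, h8, abs_div, abs_of_pos hl']
    gcongr
    exact abs_real_inner_le_norm _ _
  by_contra! hc
  have : 0 < ‖e w' - e w‖ := lt_of_le_of_lt (by positivity) hc
  nlinarith

lemma penCost_le_of_param (hh : ConvexOn ℝ S h) (hl : 0 < l) (hl' : 0 < l') (hw : w ∈ S)
    (hw' : w' ∈ S) (hmin' : IsMinOn (penCost e h l') S w') :
    penCost e h l w' ≤ penCost e h l w + ((l' - l) / l') ^ 2 * ‖e w'‖ ^ 2 / 2 := by
  have h1 := le_penCost_of_param hh hl' hl.le hw' hmin' hw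
  have h2 : (l - l') / l' = -((l' - l) / l') := by ring
  rw [h2, neg_sq] at h1
  simp only [penCost] at *
  linarith

end Primal

section AuxiliaryGeometry

variable {E : Type*} [NormedAddCommGroup E] [InnerProductSpace ℝ E] {o k v w : E} {γ s ρ : ℝ}

lemma norm_add_le_tangent (hw : w ≠ 0) (u : E) :
    ‖w + u‖ ≤ ‖w‖ + inner ℝ w u / ‖w‖ + ‖u‖ ^ 2 / (2 * ‖w‖) := by
  have h1 := norm_add_sq_real w u
  have h2 : ‖w‖ + inner ℝ w u / ‖w‖ + ‖u‖ ^ 2 / (2 * ‖w‖) = (‖w‖ ^ 2 + ‖w + u‖ ^ 2) / (2 * ‖w‖) := by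
    rw [h1]; field_simp; ring
  rw [h2, le_div_iff₀ (by positivity)]
  nlinarith [sq_nonneg (‖w‖ - ‖w + u‖)]

lemma inner_le_of_offset (ho : ‖o‖ = 1) (hw : inner ℝ o w = s) : |s| ≤ ‖w‖ := by
  rw [← hw]; simpa [ho] using abs_real_inner_le_norm o w

/-- The Euclidean norm is uniformly convex on bounded parts of an affine hyperplane missing the
origin. -/
lemma norm_tangent_add_le (ho : ‖o‖ = 1) (hs : 0 < s) (hw : inner ℝ o w = s) (hv : inner ℝ o v = s)
    (hwρ : ‖w‖ ≤ ρ) (hvρ : ‖v‖ ≤ ρ) :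
    ‖w‖ + inner ℝ w (v - w) / ‖w‖ + s ^ 2 / (2 * ρ ^ 3) * ‖v - w‖ ^ 2 ≤ ‖v‖ := by
  have ha : 0 < ‖w‖ := hs.trans_le ((le_abs_self s).trans (inner_le_of_offset ho hw))
  have hb : 0 < ‖v‖ := hs.trans_le ((le_abs_self s).trans (inner_le_of_offset ho hv))
  have hρ : 0 < ρ := ha.trans_le hwρ
  have hou : inner ℝ o (v - w) = 0 := by rw [inner_sub_right, hv, hw, sub_self]
  have h1 : inner ℝ w (v - w) = inner ℝ (w - s • o) (v - w) := by
    rw [inner_sub_left, real_inner_smul_left, hou, mul_zero, sub_zero]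
  have h2 : ‖w - s • o‖ ^ 2 = ‖w‖ ^ 2 - s ^ 2 := by
    rw [norm_sub_sq_real, inner_smul_right, real_inner_comm, hw, norm_smul, ho, Real.norm_eq_abs,
      mul_one, sq_abs]; ring
  have h3 : inner ℝ w (v - w) ^ 2 ≤ (‖w‖ ^ 2 - s ^ 2) * ‖v - w‖ ^ 2 := by
    rw [h1, ← h2, ← mul_pow, ← sq_abs]
    exact pow_le_pow_left₀ (abs_nonneg _) (abs_real_inner_le_norm _ _) 2
  have h4 := norm_add_sq_real w (v - w)
  rw [add_sub_cancel] at h4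
  have h5 : inner ℝ w (v - w) = inner ℝ w v - ‖w‖ ^ 2 := by
    rw [inner_sub_right, real_inner_self_eq_norm_sq]
  have h6 : inner ℝ w v ≤ ‖w‖ * ‖v‖ := real_inner_le_norm _ _
  have h7 : s ^ 2 * ‖v - w‖ ^ 2 ≤ (‖w‖ * ‖v‖ - inner ℝ w v) * (2 * (‖w‖ * ‖v‖)) := by
    have : s ^ 2 * ‖v - w‖ ^ 2 ≤ (‖w‖ * ‖v‖ - inner ℝ w v) * (‖w‖ * ‖v‖ + inner ℝ w v) := by
      rw [h5] at h3 h4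
      have : (‖w‖ * ‖v‖ - inner ℝ w v) * (‖w‖ * ‖v‖ + inner ℝ w v) =
        ‖w‖ ^ 2 * ‖v - w‖ ^ 2 - (inner ℝ w v - ‖w‖ ^ 2) ^ 2 := by rw [show ‖v - w‖ ^ 2 = ‖v‖ ^ 2 - ‖w‖ ^ 2 - 2 * (inner ℝ w v - ‖w‖ ^ 2) by linarith]; ring
      linarith
    refine this.trans ?_
    gcongr
    linarith
  have h8 : s ^ 2 / (2 * ρ ^ 3) * ‖v - w‖ ^ 2 ≤ (‖w‖ * ‖v‖ - inner ℝ w v) / ‖w‖ := by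
    calc s ^ 2 / (2 * ρ ^ 3) * ‖v - w‖ ^ 2 ≤ s ^ 2 * ‖v - w‖ ^ 2 / (2 * (‖w‖ * ‖w‖ * ‖v‖)) := by
          rw [div_mul_eq_mul_div]
          gcongr
          calc ‖w‖ * ‖w‖ * ‖v‖ ≤ ρ * ρ * ρ := by gcongr
            _ = ρ ^ 3 := by ring
      _ ≤ _ := by
          rw [div_le_div_iff₀ (by positivity) ha]
          nlinarith
  have h9 : ‖w‖ + inner ℝ w (v - w) / ‖w‖ + (‖w‖ * ‖v‖ - inner ℝ w v) / ‖w‖ = ‖v‖ := by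
    rw [h5]; field_simp; ring
  linarith

/-- The positively homogeneous part of the auxiliary objective. -/
def auxLin (γ : ℝ) (k w : E) : ℝ := γ * ‖w‖ + inner ℝ k w

/-- The slope of `auxLin` at `w` in the direction `u`. -/
def auxSlope (γ : ℝ) (k w u : E) : ℝ := γ * (inner ℝ w u / ‖w‖) + inner ℝ k u

/-- The quadratic error in the tangent bound for `auxObj`. -/
def auxQuad (γ : ℝ) (k w u : E) : ℝ :=
  (|auxSlope γ k w u| + γ * ‖u‖ ^ 2 / (2 * ‖w‖)) ^ 2 / 2 +
    auxLin γ k w * (γ * ‖u‖ ^ 2 / (2 * ‖w‖))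

/-- The auxiliary objective. -/
def auxObj (γ : ℝ) (k : E) (h : E → ℝ) (l : ℝ) (w : E) : ℝ := max 0 (auxLin γ k w) ^ 2 / 2 + l * h w

lemma half_sq_auxLin_le (hγ : 0 ≤ γ) (hw : w ≠ 0) (u : E) {t : ℝ}
    (ht : |t| ≤ 1) :
    max 0 (auxLin γ k (w + t • u)) ^ 2 / 2 ≤
      auxLin γ k w ^ 2 / 2 + t * (auxLin γ k w * auxSlope γ k w u) + t ^ 2 * auxQuad γ k w u := by
  have h1 := mul_le_mul_of_nonneg_left (norm_add_le_tangent hw (t • u)) hγ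
  rw [inner_smul_right, norm_smul, mul_pow, Real.norm_eq_abs, sq_abs] at h1
  set c := γ * ‖u‖ ^ 2 / (2 * ‖w‖) with hc
  have hc0 : 0 ≤ c := by positivity
  set D := auxSlope γ k w u with hD
  have h2 : auxLin γ k (w + t • u) ≤ auxLin γ k w + t * D + t ^ 2 * c := by
    have : auxLin γ k w + t * D + t ^ 2 * c = γ * (‖w‖ + t * inner ℝ w u / ‖w‖ +
        t ^ 2 * ‖u‖ ^ 2 / (2 * ‖w‖)) + inner ℝ k w + t * inner ℝ k u := by
      simp only [auxLin, hD, auxSlope, hc]; ring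
    rw [this, auxLin, inner_add_right, inner_smul_right]
    linarith
  have h3 : max 0 (auxLin γ k (w + t • u)) ^ 2 ≤ (auxLin γ k w + t * D + t ^ 2 * c) ^ 2 := by
    rw [← sq_abs (auxLin γ k w + t * D + t ^ 2 * c)]
    exact pow_le_pow_left₀ (le_max_left _ _) (max_le (abs_nonneg _) (h2.trans (le_abs_self _))) 2
  have h4 : (t * D + t ^ 2 * c) ^ 2 ≤ t ^ 2 * (|D| + c) ^ 2 := by
    rw [show t * D + t ^ 2 * c = t * (D + t * c) by ring, mul_pow]
    refine mul_le_mul_of_nonneg_left ?_ (sq_nonneg t)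
    rw [← sq_abs (D + t * c)]
    refine pow_le_pow_left₀ (abs_nonneg _) ((abs_add_le _ _).trans ?_) 2
    rw [abs_mul, abs_of_nonneg hc0]
    gcongr
    exact mul_le_of_le_one_left hc0 ht
  simp only [auxQuad, ← hc, ← hD]
  nlinarith

variable {S : Set E} {h : E → ℝ} {l : ℝ}

/-- Quadratic growth of the auxiliary objective around its minimiser. -/
lemma auxObj_growth (hS : Convex ℝ S) (hh : ConvexOn ℝ S h) (hl : 0 ≤ l) (hγ : 0 ≤ γ)
    (ho : ‖o‖ = 1) (hs : 0 < s) (hSs : ∀ w ∈ S, inner ℝ o w = s ∧ ‖w‖ ≤ ρ) (hw : w ∈ S)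
    (hF : 0 < auxLin γ k w) (hmin : IsMinOn (auxObj γ k h l) S w) (hv : v ∈ S) :
    auxObj γ k h l w + auxLin γ k w * γ * s ^ 2 / (2 * ρ ^ 3) * ‖v - w‖ ^ 2 ≤ auxObj γ k h l v := by
  have hw0 : w ≠ 0 := by
    rintro rfl
    have := (hSs 0 hw).1
    rw [inner_zero_right] at this
    exact hs.ne this
  have h1 : 0 ≤ auxLin γ k w * auxSlope γ k w (v - w) + l * (h v - h w) := by
    refine nonneg_of_forall_le_one (b := auxQuad γ k w (v - w)) fun t ht ht1 => ?_
    have hx : (1 - t) • w + t • v = w + t • (v - w) := by module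
    have h2 := hmin (hS hw hv (sub_nonneg.2 ht1) ht.le (by ring))
    have h3 := hh.2 hw hv (sub_nonneg.2 ht1) ht.le (by ring)
    have h4 := half_sq_auxLin_le hγ hw0 (k := k) (v - w) (t := t) (by rwa [abs_of_pos ht])
    simp only [Set.mem_ofPred_eq, auxObj, hx, smul_eq_mul, max_eq_right hF.le] at h2 h3
    nlinarith [mul_le_mul_of_nonneg_left h3 hl]
  have h5 := mul_le_mul_of_nonneg_left
    (norm_tangent_add_le ho hs (hSs w hw).1 (hSs v hv).1 (hSs w hw).2 (hSs v hv).2) hγ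
  have h6 : auxLin γ k w + auxSlope γ k w (v - w) + γ * s ^ 2 / (2 * ρ ^ 3) * ‖v - w‖ ^ 2 ≤
      auxLin γ k v := by
    simp only [auxLin, auxSlope, inner_sub_right] at h5 ⊢
    have : γ * s ^ 2 / (2 * ρ ^ 3) * ‖v - w‖ ^ 2 = γ * (s ^ 2 / (2 * ρ ^ 3) * ‖v - w‖ ^ 2) := by ring
    linarith
  have h7 : auxLin γ k w ^ 2 / 2 + auxLin γ k w * (auxLin γ k v - auxLin γ k w) ≤
      max 0 (auxLin γ k v) ^ 2 / 2 := by
    rcases le_total 0 (auxLin γ k v) with h8 | h8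
    · rw [max_eq_right h8]; nlinarith [sq_nonneg (auxLin γ k v - auxLin γ k w)]
    · rw [max_eq_left h8]; nlinarith
  have h8 := mul_le_mul_of_nonneg_left h6 hF.le
  simp only [auxObj, max_eq_right hF.le]
  have : auxLin γ k w * γ * s ^ 2 / (2 * ρ ^ 3) * ‖v - w‖ ^ 2 =
    auxLin γ k w * (γ * s ^ 2 / (2 * ρ ^ 3) * ‖v - w‖ ^ 2) := by ring
  nlinarith

end AuxiliaryGeometry

section Matching

/-- The part of an affine hyperplane orthogonal to `o` cut out by a ball. -/
def slab {E : Type*} [NormedAddCommGroup E] [InnerProductSpace ℝ E] (o : E) (R s : ℝ) : Set E :=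
  {w | inner ℝ o w = s ∧ ‖w‖ ^ 2 ≤ R ^ 2 + s ^ 2}

variable {E F : Type*} [NormedAddCommGroup E] [InnerProductSpace ℝ E] [NormedAddCommGroup F]
  [InnerProductSpace ℝ F] {e : E →ₗ[ℝ] F} {h : E → ℝ} {o k w v W : E}
  {R s γ l d P b c₀ : ℝ}

lemma add_smul_mem_slab (ho : ‖o‖ = 1) (hw : w ∈ slab o R s) (t : ℝ) :
    w + t • o ∈ slab o R (s + t) := by
  obtain ⟨h1, h2⟩ := hw
  refine ⟨by rw [inner_add_right, h1, inner_smul_right, real_inner_self_eq_norm_sq, ho]; ring, ?_⟩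
  rw [norm_add_sq_real, inner_smul_right, real_inner_comm, h1, norm_smul, ho, mul_one,
    Real.norm_eq_abs, sq_abs]
  linarith

lemma convex_slab : Convex ℝ (slab o R s) := by
  intro x hx y hy a b ha hb hab
  refine ⟨?_, ?_⟩
  · rw [inner_add_right, inner_smul_right, inner_smul_right, hx.1, hy.1, ← add_mul, hab, one_mul]
  · have h1 : ‖a • x + b • y‖ ≤ a * ‖x‖ + b * ‖y‖ := by
      refine (norm_add_le _ _).trans ?_
      rw [norm_smul, norm_smul, Real.norm_of_nonneg ha, Real.norm_of_nonneg hb]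
    have h2 : ‖a • x + b • y‖ ^ 2 ≤ (a * ‖x‖ + b * ‖y‖) ^ 2 := pow_le_pow_left₀ (norm_nonneg _) h1 2
    have h3 : (a * ‖x‖ + b * ‖y‖) ^ 2 ≤ a * ‖x‖ ^ 2 + b * ‖y‖ ^ 2 := by
      have hb' : b = 1 - a := by linarith
      subst hb'
      nlinarith [mul_nonneg (mul_nonneg ha hb) (sq_nonneg (‖x‖ - ‖y‖))]
    nlinarith [mul_le_mul_of_nonneg_left hx.2 ha, mul_le_mul_of_nonneg_left hy.2 hb]

lemma convex_offset : Convex ℝ {w : E | inner ℝ o w = s} := by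
  intro x hx y hy a b ha hb hab
  simp only [Set.mem_ofPred_eq] at *
  rw [inner_add_right, inner_smul_right, inner_smul_right, hx, hy, ← add_mul, hab, one_mul]

lemma abs_le_of_signed {x y d : ℝ} (hd : 0 < d) (h : ∀ t, |t| = d → t * x ≤ d * y) : |x| ≤ y := by
  have h1 := h d (abs_of_pos hd)
  have h2 := h (-d) (by rw [abs_neg, abs_of_pos hd])
  rw [abs_le]
  constructor
  · by_contra! hc; nlinarith
  · by_contra! hc; nlinarith

lemma penalty_matching (hh : ConvexOn ℝ Set.univ h) (hl : 0 < l) (hws : inner ℝ o w = s)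
    (hmin : IsMinOn (penCost e h l) {w | inner ℝ o w = s} w) (hd : 0 < d)
    (hM : |penCost e h l w - auxObj γ k h l v| ≤ d ^ 2)
    (hdl : d ≤ l) (hP : ‖e w‖ ≤ P)
    (hlam : ∀ t, |t| = d → ∃ V ∈ slab o R s, penCost e h (l + t) V ≤ auxObj γ k h (l + t) v + d ^ 2) :
    |h w - h v| ≤ (2 + P ^ 2 / (2 * l ^ 2)) * d := by
  refine abs_le_of_signed hd fun t ht => ?_
  obtain ⟨V, hV, hV2⟩ := hlam t ht
  have hlt : 0 ≤ l + t := by linarith [neg_abs_le t]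
  have h1 := le_penCost_of_param (hh.subset (Set.subset_univ _) convex_offset) hl hlt hws hmin hV.1
  have h2 : ((l + t - l) / l) ^ 2 * ‖e w‖ ^ 2 / 2 ≤ d ^ 2 * (P ^ 2 / (2 * l ^ 2)) := by
    rw [add_sub_cancel_left, div_pow, ← sq_abs t, ht]
    have : ‖e w‖ ^ 2 ≤ P ^ 2 := pow_le_pow_left₀ (norm_nonneg _) hP 2
    calc d ^ 2 / l ^ 2 * ‖e w‖ ^ 2 / 2 ≤ d ^ 2 / l ^ 2 * P ^ 2 / 2 := by gcongr
      _ = _ := by ring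
  have h3 := (abs_le.1 hM).1
  have h4 : auxObj γ k h (l + t) v = auxObj γ k h l v + t * h v := by simp only [auxObj]; ring
  rw [h4] at hV2
  rw [add_sub_cancel_left] at h1 h2
  nlinarith

lemma residual_sq_matching {a L : ℝ} (hl : 0 < l) (hM : |penCost e h l w - auxObj γ k h l v| ≤ d ^ 2)
    (hd : 0 < d) (hT : |h w - h v| ≤ a * d) (hL : l ≤ L) (hd1 : d ≤ 1) :
    |‖e w‖ ^ 2 - max 0 (auxLin γ k v) ^ 2| ≤ (2 + 2 * (L * a)) * d := by
  have h1 : ‖e w‖ ^ 2 - max 0 (auxLin γ k v) ^ 2 =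
      2 * (penCost e h l w - auxObj γ k h l v) - 2 * (l * (h w - h v)) := by
    simp only [penCost, auxObj]; ring
  rw [h1]
  refine (abs_sub _ _).trans ?_
  rw [abs_mul, abs_mul, abs_mul, abs_two, abs_of_pos hl]
  have h2 : l * |h w - h v| ≤ L * (a * d) := by gcongr; exact hl.le.trans hL
  nlinarith

lemma offset_slope_matching (hh : ConvexOn ℝ Set.univ h) (hl : 0 < l) (hws : inner ℝ o w = s)
    (hmin : IsMinOn (penCost e h l) {w | inner ℝ o w = s} w) (hd : 0 < d)
    (hM : |penCost e h l w - auxObj γ k h l v| ≤ d ^ 2)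
    (hhinv : ∀ (w : E) (t : ℝ), h (w + t • o) = h w) (ho : ‖o‖ = 1) (hv : v ≠ 0)
    (hγ : 0 ≤ γ) (hd1 : d ≤ 1) (hb : 0 < auxLin γ k v)
    (hsig : ∀ t, |t| = d → ∃ V ∈ slab o R (s + t), penCost e h l V ≤ auxObj γ k h l (v + t • o) + d ^ 2) :
    |inner ℝ (e w) (e o) - auxLin γ k v * auxSlope γ k v o| ≤ (2 + auxQuad γ k v o) * d := by
  refine abs_le_of_signed hd fun t ht => ?_
  obtain ⟨V, hV, hV2⟩ := hsig t ht
  have hV' : V + (-t) • o ∈ {w | inner ℝ o w = s} := by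
    have := (add_smul_mem_slab ho hV (-t)).1
    simpa using this
  have h1 := le_penCost_of_shift (u := t • o) (hh.subset (Set.subset_univ _) convex_offset) hl.le hws
    hmin hV' (hhinv _ _)
  rw [neg_smul, neg_add_cancel_right, map_smul, inner_smul_right] at h1
  have h2 := half_sq_auxLin_le hγ hv (k := k) o (ht.le.trans hd1)
  have h3 := (abs_le.1 hM).1
  have h4 : t ^ 2 = d ^ 2 := by rw [← sq_abs, ht]
  simp only [auxObj, hhinv, max_eq_right hb.le] at hV2 h3
  rw [h4] at h2
  nlinarith

lemma norm_sq_matching {μ ρ : ℝ} (hd : 0 < d)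
    (hM : |penCost e h l w - auxObj γ k h l v| ≤ d ^ 2) (hμ : 0 < μ) (hρ : ∀ w ∈ slab o R s, ‖w‖ ≤ ρ) (hv : v ∈ slab o R s)
    (hgrow : ∀ V ∈ slab o R s, auxObj γ k h l v + μ * ‖V - v‖ ^ 2 ≤ auxObj γ k h l V)
    (hWmin : penCost e h l W ≤ penCost e h l w + d ^ 2)
    (hquad : ∀ t, |t| = d → ∃ V ∈ slab o R s,
      auxObj γ k h l V + t / 2 * ‖V‖ ^ 2 ≤ penCost e h l W + t / 2 * ‖W‖ ^ 2 + d ^ 2) :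
    |‖W‖ ^ 2 - ‖v‖ ^ 2| ≤ (6 + ρ ^ 2 / (2 * μ)) * d := by
  refine abs_le_of_signed hd fun t' ht' => ?_
  obtain ⟨t, rfl⟩ : ∃ t, t' = -t := ⟨-t', by ring⟩
  rw [abs_neg] at ht'
  obtain ⟨V, hV, hV2⟩ := hquad t ht'
  have h1 := hgrow V hV
  have h2 : |‖V‖ ^ 2 - ‖v‖ ^ 2| ≤ ‖V - v‖ * (2 * ρ) := by
    have : ‖V‖ ^ 2 - ‖v‖ ^ 2 = (‖V‖ - ‖v‖) * (‖V‖ + ‖v‖) := by ring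
    rw [this, abs_mul]
    refine mul_le_mul (abs_norm_sub_norm_le _ _) ?_ (abs_nonneg _) (norm_nonneg _)
    rw [abs_of_nonneg (by positivity)]
    linarith [hρ V hV, hρ v hv]
  have h3 : t / 2 * (‖v‖ ^ 2 - ‖V‖ ^ 2) ≤ d * (‖V - v‖ * ρ) := by
    have h4 := le_abs_self (t / 2 * (‖v‖ ^ 2 - ‖V‖ ^ 2))
    rw [abs_mul, abs_div, ht', abs_sub_comm, abs_two] at h4
    nlinarith
  have h4 : d * (‖V - v‖ * ρ) ≤ μ * ‖V - v‖ ^ 2 + d ^ 2 * (ρ ^ 2 / (4 * μ)) := by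
    have : 0 ≤ (2 * μ * ‖V - v‖ - d * ρ) ^ 2 / (4 * μ) := by positivity
    have h5 : (2 * μ * ‖V - v‖ - d * ρ) ^ 2 / (4 * μ) =
      μ * ‖V - v‖ ^ 2 - d * (‖V - v‖ * ρ) + d ^ 2 * (ρ ^ 2 / (4 * μ)) := by field_simp; ring
    linarith
  have h5 := (abs_le.1 hM).2
  have h6 : ρ ^ 2 / (2 * μ) = 2 * (ρ ^ 2 / (4 * μ)) := by field_simp; ring
  rw [h6]
  nlinarith

set_option maxHeartbeats 1000000 in
/-- If the primal and auxiliary optimal values agree up to `d ^ 2` at the base point and under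
perturbations of size `d` of the penalty, of the offset and of a ridge term, then every near minimiser
of the primal objective satisfies the stationarity identity of the auxiliary one up to `O(d)`. -/
theorem exists_matching_const {σ R lmin lmax P c₀ : ℝ} (hσ : 0 < σ) (hlmin : 0 < lmin)
    (hlmax : lmin ≤ lmax) (hP : 0 < P) (hc₀ : 0 < c₀) :
    ∃ M d₀ : ℝ, 0 < M ∧ 0 < d₀ ∧ ∀ (E F : Type) [NormedAddCommGroup E] [InnerProductSpace ℝ E]
      [NormedAddCommGroup F] [InnerProductSpace ℝ F] (e : E →ₗ[ℝ] F) (h : E → ℝ) (o k w v : E)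
      (γ l d : ℝ), ConvexOn ℝ Set.univ h → (∀ (w : E) (t : ℝ), h (w + t • o) = h w) → ‖o‖ = 1 →
      lmin ≤ l → l ≤ lmax → 0 < d → d ≤ d₀ → |γ - 1| ≤ d ^ 2 → |inner ℝ k o| ≤ d ^ 2 →
      w ∈ slab o R σ → IsMinOn (penCost e h l) {w | inner ℝ o w = σ} w → ‖e w‖ ≤ P → c₀ ≤ ‖e w‖ →
      v ∈ slab o R σ → IsMinOn (auxObj γ k h l) (slab o R σ) v →
      |penCost e h l w - auxObj γ k h l v| ≤ d ^ 2 →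
      (∀ t, |t| = d → ∃ V ∈ slab o R σ,
        penCost e h (l + t) V ≤ auxObj γ k h (l + t) v + d ^ 2) →
      (∀ t, |t| = d → ∃ V ∈ slab o R (σ + t),
        penCost e h l V ≤ auxObj γ k h l (v + t • o) + d ^ 2) →
      (∀ t, |t| = d → ∀ W ∈ slab o R σ, ∃ V ∈ slab o R σ,
        auxObj γ k h l V + t / 2 * ‖V‖ ^ 2 ≤ penCost e h l W + t / 2 * ‖W‖ ^ 2 + d ^ 2) →
      ∀ W ∈ slab o R σ, penCost e h l W ≤ penCost e h l w + d ^ 2 →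
        |inner ℝ (e w) (e o) * ‖W‖ - σ * ‖e w‖| ≤ M * d := by
  set ρ := √(R ^ 2 + σ ^ 2) with hρ
  set a₁ := 2 + P ^ 2 / (2 * lmin ^ 2) with ha₁
  have hlmaxp : 0 < lmax := hlmin.trans_le hlmax
  set b₁ := 2 + 2 * (lmax * a₁) with hb₁
  have hb₁p : 0 < b₁ := by positivity
  set β₁ := P + b₁ / c₀ with hβ₁
  set c₁ := 2 + ((3 + 1 / σ) ^ 2 / 2 + β₁ * (1 / σ)) with hc₁
  have hc₁p : 0 < c₁ := by positivity
  set μ := c₀ / 2 * (1 / 2) * σ ^ 2 / (2 * ρ ^ 3) with hμ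
  have hμp : 0 < μ := by positivity
  set d₁ := (6 + ρ ^ 2 / (2 * μ)) with hd₁
  refine ⟨(β₁ * 3 + c₁) * (d₁ / σ) + c₁ * ρ + β₁ * (σ + ρ) + σ * (b₁ / c₀),
    min (min (1 / 2) lmin) (3 / 4 * c₀ ^ 2 / b₁), by positivity, by positivity, ?_⟩
  intro E F _ _ _ _ e h o k w v γ l d hh hinv ho hl1 hl2 hd hd0 hγ hk hw hmin hwP hwc hv hvmin hM
    hlam hsig hquad W hW hWmin
  have hd2 : d ≤ 1 / 2 := hd0.trans ((min_le_left _ _).trans (min_le_left _ _))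
  have hdl : d ≤ lmin := hd0.trans ((min_le_left _ _).trans (min_le_right _ _))
  have hdb : b₁ * d ≤ 3 / 4 * c₀ ^ 2 := by
    rw [← le_div_iff₀' hb₁p]; exact hd0.trans (min_le_right _ _)
  have hl : 0 < l := hlmin.trans_le hl1
  have hdd : d ^ 2 ≤ 1 / 2 := (pow_le_pow_left₀ hd.le hd2 2).trans (by norm_num)
  have hγ1 := abs_le.1 hγ
  have hk1 := abs_le.1 hk
  have hnorm : ∀ w ∈ slab o R σ, ‖w‖ ≤ ρ := fun w hw => Real.le_sqrt_of_sq_le hw.2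
  have hnormσ : ∀ w ∈ slab o R σ, σ ≤ ‖w‖ := fun w hw =>
    (le_abs_self σ).trans (inner_le_of_offset ho hw.1)
  have hT : |h w - h v| ≤ a₁ * d := by
    refine (penalty_matching hh hl hw.1 hmin hd hM (hdl.trans hl1) hwP hlam).trans ?_
    simp only [ha₁]; gcongr
  have hB := residual_sq_matching hl hM hd hT hl2 (hd2.trans (by norm_num))
  rw [← hb₁] at hB
  set β := auxLin γ k v with hβ
  have hβp : c₀ / 2 ≤ β := by
    have h1 := (abs_le.1 hB).2
    have h2 : c₀ ^ 2 ≤ ‖e w‖ ^ 2 := pow_le_pow_left₀ hc₀.le hwc 2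
    by_contra! hc
    have h3 : max 0 β < c₀ / 2 := max_lt (by positivity) hc
    have h4 : max 0 β ^ 2 < (c₀ / 2) ^ 2 := pow_lt_pow_left₀ h3 (le_max_left _ _) two_ne_zero
    linarith
  have hβ0 : 0 < β := by linarith
  rw [max_eq_right hβ0.le] at hB
  have hβe : |‖e w‖ - β| ≤ b₁ / c₀ * d := by
    have h1 : ‖e w‖ ^ 2 - β ^ 2 = (‖e w‖ - β) * (‖e w‖ + β) := by ring
    rw [h1, abs_mul, abs_of_pos (by linarith : 0 < ‖e w‖ + β)] at hB
    rw [div_mul_eq_mul_div, le_div_iff₀ hc₀]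
    refine le_trans ?_ hB
    gcongr
    linarith
  have hβle : β ≤ β₁ := by
    have h1 := (abs_le.1 hβe).1
    have h2 : b₁ / c₀ * d ≤ b₁ / c₀ * 1 := by gcongr; linarith
    simp only [hβ₁]; linarith
  have hv0 : v ≠ 0 := norm_pos_iff.1 (hσ.trans_le (hnormσ v hv))
  have hγ0 : 0 ≤ γ := by linarith
  have hvn := hnormσ v hv
  have hvp : 0 < ‖v‖ := hσ.trans_le hvn
  have hC := offset_slope_matching hh hl hw.1 hmin hd hM hinv ho hv0 hγ0 (by linarith) hβ0 hsig
  set x := auxSlope γ k v o with hx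
  have hxe : x = γ * (σ / ‖v‖) + inner ℝ k o := by
    rw [hx, auxSlope, real_inner_comm, hv.1]
  have hx3 : |x| ≤ 3 := by
    rw [hxe]
    have : σ / ‖v‖ ≤ 1 := div_le_one_of_le₀ hvn hvp.le
    have h1 : γ * (σ / ‖v‖) ≤ 3 / 2 * 1 := by gcongr; linarith
    have h2 : 0 ≤ γ * (σ / ‖v‖) := by positivity
    rw [abs_le]; constructor <;> linarith
  have hq : auxQuad γ k v o ≤ (3 + 1 / σ) ^ 2 / 2 + β₁ * (1 / σ) := by
    have h1 : γ * ‖o‖ ^ 2 / (2 * ‖v‖) ≤ 1 / σ := by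
      rw [ho, one_pow, mul_one, div_le_div_iff₀ (by positivity) hσ]
      linarith [mul_le_mul (by linarith : γ ≤ 2) hvn hσ.le zero_le_two]
    simp only [auxQuad, ← hx, ← hβ]
    gcongr
  have hC' : |inner ℝ (e w) (e o) - β * x| ≤ c₁ * d := hC.trans (by simp only [hc₁]; gcongr)
  have hgrow : ∀ V ∈ slab o R σ, auxObj γ k h l v + μ * ‖V - v‖ ^ 2 ≤ auxObj γ k h l V := by
    intro V hV
    refine le_trans ?_ (auxObj_growth convex_slab (hh.subset (Set.subset_univ _) convex_slab) hl.le
      hγ0 ho hσ (fun w hw => ⟨hw.1, hnorm w hw⟩) hv hβ0 hvmin hV)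
    simp only [hμ, ← hβ]
    gcongr
    linarith
  have hD := norm_sq_matching hd hM hμp hnorm hv hgrow hWmin (fun t ht => hquad t ht W hW)
  rw [← hd₁] at hD
  have hD' : |‖W‖ - ‖v‖| ≤ d₁ / σ * d := by
    have h1 : ‖W‖ ^ 2 - ‖v‖ ^ 2 = (‖W‖ - ‖v‖) * (‖W‖ + ‖v‖) := by ring
    rw [h1, abs_mul, abs_of_nonneg (by positivity : 0 ≤ ‖W‖ + ‖v‖)] at hD
    rw [div_mul_eq_mul_div, le_div_iff₀ hσ]
    refine le_trans ?_ hD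
    gcongr
    linarith [hnormσ W hW]
  have hI : |inner ℝ (e w) (e o)| ≤ β₁ * 3 + c₁ := by
    have h1 : |β * x| ≤ β₁ * 3 := by
      rw [abs_mul, abs_of_pos hβ0]; gcongr
    have h2 : c₁ * d ≤ c₁ := mul_le_of_le_one_right hc₁p.le (by linarith)
    have h3 := abs_sub_abs_le_abs_sub (inner ℝ (e w) (e o)) (β * x)
    linarith
  have hlast : |β * x * ‖v‖ - β * σ| ≤ β₁ * (σ + ρ) * d := by
    have h1 : β * x * ‖v‖ - β * σ = β * ((γ - 1) * σ + inner ℝ k o * ‖v‖) := by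
      rw [hxe]; field_simp; ring
    have h2 : |(γ - 1) * σ + inner ℝ k o * ‖v‖| ≤ d ^ 2 * σ + d ^ 2 * ρ := by
      refine (abs_add_le _ _).trans ?_
      rw [abs_mul, abs_mul, abs_of_pos hσ, abs_of_pos hvp]
      gcongr
      exact hnorm v hv
    rw [h1, abs_mul, abs_of_pos hβ0, mul_assoc]
    have h4 : d ^ 2 ≤ d := by rw [sq]; exact mul_le_of_le_one_left hd.le (by linarith)
    have h3 : d ^ 2 * σ + d ^ 2 * ρ ≤ (σ + ρ) * d := by
      rw [← mul_add, mul_comm]; gcongr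
    gcongr
    exact h2.trans h3
  have hsplit : inner ℝ (e w) (e o) * ‖W‖ - σ * ‖e w‖ = inner ℝ (e w) (e o) * (‖W‖ - ‖v‖) +
      (inner ℝ (e w) (e o) - β * x) * ‖v‖ + (β * x * ‖v‖ - β * σ) - σ * (‖e w‖ - β) := by ring
  rw [hsplit]
  refine (abs_sub _ _).trans ?_
  have e1 : |inner ℝ (e w) (e o) * (‖W‖ - ‖v‖)| ≤ (β₁ * 3 + c₁) * (d₁ / σ * d) := by
    rw [abs_mul]; gcongr
  have e2 : |(inner ℝ (e w) (e o) - β * x) * ‖v‖| ≤ c₁ * d * ρ := by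
    rw [abs_mul, abs_of_pos hvp]; gcongr; exact hnorm v hv
  have e3 : |σ * (‖e w‖ - β)| ≤ σ * (b₁ / c₀ * d) := by
    rw [abs_mul, abs_of_pos hσ]; gcongr
  have e4 := abs_add_three (inner ℝ (e w) (e o) * (‖W‖ - ‖v‖))
    ((inner ℝ (e w) (e o) - β * x) * ‖v‖) (β * x * ‖v‖ - β * σ)
  linarith

end Matching

section Deviation

lemma ofReal_exp_le {x y : ℝ} (h : y ≤ x) :
    ENNReal.ofReal (Real.exp (-x)) ≤ ENNReal.ofReal (Real.exp (-y)) :=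
  ENNReal.ofReal_le_ofReal (Real.exp_le_exp.2 (by linarith))

section
variable {E : Type*} [NormedAddCommGroup E] [InnerProductSpace ℝ E] [FiniteDimensional ℝ E]
  [MeasurableSpace E] [BorelSpace E]

lemma measure_ge_toNNReal {f : E → ℝ} {L t x : ℝ} (hL : 0 < L) (hf : LipschitzWith L.toNNReal f)
    (ht : 0 ≤ t) (hx : x ≤ t ^ 2 / (5 * L ^ 2)) :
    stdGaussian E {x | ∫ y, f y ∂(stdGaussian E) + t ≤ f x} ≤ ENNReal.ofReal (Real.exp (-x)) := by
  refine (measure_ge_lipschitz hf ht).trans ?_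
  rw [Real.coe_toNNReal _ hL.le, neg_div]
  exact ofReal_exp_le hx

lemma measure_le_toNNReal {f : E → ℝ} {L t x : ℝ} (hL : 0 < L) (hf : LipschitzWith L.toNNReal f)
    (ht : 0 ≤ t) (hx : x ≤ t ^ 2 / (5 * L ^ 2)) :
    stdGaussian E {x | f x ≤ ∫ y, f y ∂(stdGaussian E) - t} ≤ ENNReal.ofReal (Real.exp (-x)) := by
  refine (measure_le_lipschitz hf ht).trans ?_
  rw [Real.coe_toNNReal _ hL.le, neg_div]
  exact ofReal_exp_le hx

lemma measure_abs_dev_toNNReal {f : E → ℝ} {L t x : ℝ} (hL : 0 < L) (hf : LipschitzWith L.toNNReal f)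
    (ht : 0 ≤ t) (hx : x ≤ t ^ 2 / (5 * L ^ 2)) :
    stdGaussian E {x | t ≤ |f x - ∫ y, f y ∂(stdGaussian E)|} ≤
      2 * ENNReal.ofReal (Real.exp (-x)) := by
  rw [two_mul]
  refine (measure_mono ?_).trans ((measure_union_le _ _).trans
    (add_le_add (measure_ge_toNNReal hL hf ht hx) (measure_le_toNNReal hL hf ht hx)))
  intro y (hy : t ≤ |_|)
  rcases le_abs.1 hy with h | h
  · left; rw [Set.mem_ofPred_eq]; linarith
  · right; rw [Set.mem_ofPred_eq]; linarith

end

variable {m P : Type*} [Fintype m] [Fintype P]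

lemma isCompact_slab (o : 𝔼 P) (R s : ℝ) : IsCompact (slab o R s) := by
  refine Metric.isCompact_of_isClosed_isBounded ?_ ?_
  · exact (isClosed_eq (f := fun w => inner ℝ o w) (by fun_prop) continuous_const).inter
      (isClosed_le (f := fun w : 𝔼 P => ‖w‖ ^ 2) (by fun_prop) continuous_const)
  · refine (Metric.isBounded_closedBall : Bornology.IsBounded (Metric.closedBall (0 : 𝔼 P) √(R ^ 2 + s ^ 2))).subset fun w hw => ?_
    rw [mem_closedBall_zero_iff]
    exact Real.le_sqrt_of_sq_le hw.2

lemma smul_mem_slab {E : Type*} [NormedAddCommGroup E] [InnerProductSpace ℝ E] {o : E} {R : ℝ}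
    (ho : ‖o‖ = 1) (s : ℝ) : s • o ∈ slab o R s := by
  refine ⟨by rw [inner_smul_right, real_inner_self_eq_norm_sq, ho]; ring, ?_⟩
  rw [norm_smul, ho, mul_one, Real.norm_eq_abs, sq_abs]
  nlinarith [sq_nonneg R]

/-- Expected optimal value of the auxiliary problem. -/
def auxMean (m : Type*) [Fintype m] (B κ : ℝ) (h : 𝔼 P → ℝ) (K : Set (𝔼 P)) : ℝ :=
  ∫ q, minVal K (auxCost B κ h q) ∂(stdGaussian (𝔼 (m ⊕ P)))

variable {B κ R t x : ℝ} {h : 𝔼 P → ℝ} {K : Set (𝔼 P)}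

lemma measure_minVal_primCost_le [Nonempty m] (hκ : 0 < κ) (hB : 0 < B) (hR0 : 0 < R) (hK : IsCompact K)
    (hne : K.Nonempty) (hh : ContinuousOn h K) (hR : ∀ W ∈ K, ‖W‖ ≤ R) (ht : κ * B * R ≤ t)
    (hx : x ≤ t ^ 2 / (5 * (B * κ * R) ^ 2)) :
    stdGaussian (𝔼 (m × P))
      {A | minVal K (primCost B κ h A) ≤ auxMean m B κ h K - 2 * t} ≤
      ENNReal.ofReal (Real.exp (-x)) := by
  refine (measure_mono fun A hA => ?_).trans
    (measure_le_toNNReal (by positivity) (lipschitzWith_minVal_primCost (m := m) hB.le hκ.le hK hne hh hR)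
      (le_trans (by positivity) ht) hx)
  have := integral_minVal_auxCost_le (m := m) hκ.le hB.le hK hne hh hR
  rw [Set.mem_ofPred_eq] at hA ⊢
  unfold auxMean at hA
  linarith

lemma le_measure_minVal_primCost [Nonempty m] (hκ : 0 < κ) (hB : 0 < B) (hR0 : 0 < R) (hK : IsCompact K)
    (hne : K.Nonempty) (hh : ContinuousOn h K) (hconv : ConvexOn ℝ K h) (hR : ∀ W ∈ K, ‖W‖ ≤ R)
    (ht : κ * B * R ≤ t) (hx : x ≤ t ^ 2 / (5 * (B * κ * R) ^ 2)) :
    stdGaussian (𝔼 (m × P))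
      {A | auxMean m B κ h K + 2 * t ≤ minVal K (primCost B κ h A)} ≤
      ENNReal.ofReal (Real.exp (-x)) := by
  refine (measure_mono fun A hA => ?_).trans
    (measure_ge_toNNReal (by positivity) (lipschitzWith_minVal_primCost (m := m) hB.le hκ.le hK hne hh hR)
      (le_trans (by positivity) ht) hx)
  have := integral_minVal_primCost_le (m := m) hκ.le hB.le hK hne hh hconv hR
  rw [Set.mem_ofPred_eq] at hA ⊢
  unfold auxMean at hA
  linarith

/-- A penalty with a ridge term, indexed by (multiplier, offset, ridge). -/
def ridgePen (h : 𝔼 P → ℝ) (p : ℝ × ℝ × ℝ) (W : 𝔼 P) : ℝ :=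
  p.1 * h W + p.2.2 / 2 * ‖W‖ ^ 2

/-- The event that some perturbed primal problem has an atypical optimal value. -/
def primDev (m : Type*) [Fintype m] (B κ R t : ℝ) (o : 𝔼 P) (h : 𝔼 P → ℝ)
    (Q : Finset (ℝ × ℝ × ℝ)) : Set (𝔼 (m × P)) :=
  {A | ∃ p ∈ Q, minVal (slab o R p.2.1) (primCost B κ (ridgePen h p) A) ≤
      auxMean m B κ (ridgePen h p) (slab o R p.2.1) - 2 * t ∨
    (p.2.2 = 0 ∧ auxMean m B κ (ridgePen h p) (slab o R p.2.1) + 2 * t ≤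
      minVal (slab o R p.2.1) (primCost B κ (ridgePen h p) A))}

lemma measure_primDev_le [Nonempty m] {ρ : ℝ} {o : 𝔼 P} {Q : Finset (ℝ × ℝ × ℝ)}
    (ho : ‖o‖ = 1) (hκ : 0 < κ) (hB : 0 < B) (hρ0 : 0 < ρ) (hhc : Continuous h)
    (hh : ConvexOn ℝ Set.univ h)
    (hQ : ∀ p ∈ Q, 0 ≤ p.1 ∧ ∀ W ∈ slab o R p.2.1, ‖W‖ ≤ ρ)
    (ht : κ * B * ρ ≤ t) (hx : x ≤ t ^ 2 / (5 * (B * κ * ρ) ^ 2)) :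
    stdGaussian (𝔼 (m × P)) (primDev m B κ R t o h Q) ≤
      (2 * Q.card : ℕ) * ENNReal.ofReal (Real.exp (-x)) := by
  have hsub : primDev m B κ R t o h Q ⊆ ⋃ p ∈ Q,
      {A | minVal (slab o R p.2.1) (primCost B κ (ridgePen h p) A) ≤
        auxMean m B κ (ridgePen h p) (slab o R p.2.1) - 2 * t} ∪
      {A | p.2.2 = 0 ∧ auxMean m B κ (ridgePen h p) (slab o R p.2.1) + 2 * t ≤
        minVal (slab o R p.2.1) (primCost B κ (ridgePen h p) A)} := by
    rintro A ⟨p, hp, h⟩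
    exact Set.mem_biUnion hp h
  refine (measure_mono hsub).trans ((measure_biUnion_finset_le _ _).trans ?_)
  refine (Finset.sum_le_card_nsmul _ _ (2 * ENNReal.ofReal (Real.exp (-x))) fun p hp => ?_).trans
    (by rw [nsmul_eq_mul]; push_cast; rw [mul_left_comm, mul_assoc])
  have hc : Continuous (ridgePen h p) := by unfold ridgePen; fun_prop
  rw [two_mul (ENNReal.ofReal _)]
  refine (measure_union_le _ _).trans (add_le_add
    (measure_minVal_primCost_le (m := m) hκ hB hρ0 (isCompact_slab _ _ _) ⟨_, smul_mem_slab ho _⟩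
      hc.continuousOn (hQ p hp).2 ht hx) ?_)
  by_cases hp0 : p.2.2 = 0
  · refine (measure_mono fun A hA => hA.2).trans (le_measure_minVal_primCost hκ hB hρ0 (isCompact_slab _ _ _)
      ⟨_, smul_mem_slab ho _⟩ hc.continuousOn ?_ (hQ p hp).2 ht hx)
    have : ridgePen h p = fun W => p.1 * h W := by ext W; simp [ridgePen, hp0]
    rw [this]
    exact (hh.smul (hQ p hp).1).subset (Set.subset_univ _) convex_slab
  · simp [hp0]

/-- A realisation of the auxiliary randomness at which all relevant quantities are typical. -/
structure AuxTypical (m : Type*) [Fintype m] (B κ R kmax u : ℝ) (o : 𝔼 P)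
    (h : 𝔼 P → ℝ) (Q : Finset (ℝ × ℝ × ℝ)) (q : 𝔼 (m ⊕ P)) : Prop where
  value : ∀ p ∈ Q, |minVal (slab o R p.2.1) (auxCost B κ (ridgePen h p) q) -
    auxMean m B κ (ridgePen h p) (slab o R p.2.1)| < u
  radius : |κ * ‖reidx Sum.inl q‖ - 1| < u
  align : |inner ℝ (κ • reidx Sum.inr q) o| < u
  size : ‖κ • reidx Sum.inr q‖ < kmax

lemma measure_exists_le {α ι : Type*} [MeasurableSpace α] (μ : Measure α) (Q : Finset ι) (p : ι → α → Prop)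
    {c : ℝ≥0∞} (h : ∀ i ∈ Q, μ {a | p i a} ≤ c) : μ {a | ∃ i ∈ Q, p i a} ≤ Q.card * c := by
  have : {a | ∃ i ∈ Q, p i a} ⊆ ⋃ i ∈ Q, {a | p i a} := by
    rintro A ⟨p, hp, h⟩
    exact Set.mem_biUnion hp h
  refine (measure_mono this).trans ((measure_biUnion_finset_le _ _).trans ?_)
  exact (Finset.sum_le_card_nsmul _ _ c h).trans (by rw [nsmul_eq_mul])

lemma exists_auxTypical [Nonempty m] {ρ Γ kmax u : ℝ} {o : 𝔼 P} {Q : Finset (ℝ × ℝ × ℝ)}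
    (ho : ‖o‖ = 1) (hκ : κ = 1 / √(Fintype.card m)) (hB : 0 < B) (hρ0 : 0 < ρ) (hhc : Continuous h)
    (hQ : ∀ p ∈ Q, ∀ W ∈ slab o R p.2.1, ‖W‖ ≤ ρ) (hcard : Q.card ≤ 7) (hu : 0 < u)
    (hP : (Fintype.card P : ℝ) ≤ Γ * Fintype.card m) (hk : √Γ + 1 ≤ kmax)
    (h1 : 80 * (B * ρ) ^ 2 ≤ Fintype.card m * u ^ 2) (h2 : 144 ≤ Fintype.card m * u ^ 2)
    (h3 : (20 : ℝ) ≤ Fintype.card m) :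
    ∃ q, AuxTypical m B κ R kmax u o h Q q := by
  set n : ℝ := (Fintype.card m : ℝ) with hn
  have hn0 : 0 < n := by linarith
  have hκ0 : 0 < κ := by rw [hκ]; positivity
  have hκ2 : κ ^ 2 = 1 / n := by rw [hκ, div_pow, Real.sq_sqrt hn0.le, one_pow]
  by_contra! hcon
  set e := ENNReal.ofReal (Real.exp (-4)) with he
  have hv : stdGaussian (𝔼 (m ⊕ P)) {q | ∃ p ∈ Q,
      u ≤ |minVal (slab o R p.2.1) (auxCost B κ (ridgePen h p) q) -
        auxMean m B κ (ridgePen h p) (slab o R p.2.1)|} ≤ Q.card * (2 * e) := by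
    refine measure_exists_le _ _ _ fun p hp => ?_
    have hc : Continuous (ridgePen h p) := by unfold ridgePen; fun_prop
    refine measure_abs_dev_toNNReal (L := B * κ * (2 * ρ)) (by positivity)
      (lipschitzWith_minVal_auxCost hB.le hκ0.le (isCompact_slab o R p.2.1) ⟨_, smul_mem_slab ho _⟩
      hc.continuousOn (hQ p hp)) hu.le ?_
    rw [show (B * κ * (2 * ρ)) ^ 2 = 4 * (B * ρ) ^ 2 * κ ^ 2 by ring, hκ2, le_div_iff₀ (by positivity)]
    rw [show 4 * (5 * (4 * (B * ρ) ^ 2 * (1 / n))) = 80 * (B * ρ) ^ 2 / n by ring, div_le_iff₀ hn0]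
    linarith
  have hex : 4 ≤ (u / 2) ^ 2 / (5 * κ ^ 2) := by
    rw [hκ2, le_div_iff₀ (by positivity), show 4 * (5 * (1 / n)) = 20 / n by ring, div_le_iff₀ hn0]
    linarith
  have hLr : LipschitzWith (Real.toNNReal κ) fun q : 𝔼 (m ⊕ P) => κ * ‖reidx Sum.inl q‖ :=
    lipschitzWith_of_le_add hκ0.le fun x y => by
      have h4 := norm_sub_norm_le (reidx Sum.inl x) (reidx Sum.inl y)
      rw [← map_sub] at h4
      have h5 := mul_le_mul_of_nonneg_left (h4.trans (norm_reidx_le Sum.inl_injective (x - y))) hκ0.le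
      linarith
  have hLs : LipschitzWith (Real.toNNReal κ) fun q : 𝔼 (m ⊕ P) => ‖κ • reidx Sum.inr q‖ :=
    lipschitzWith_of_le_add hκ0.le fun x y => by
      have h4 := norm_sub_norm_le (reidx Sum.inr x) (reidx Sum.inr y)
      rw [← map_sub] at h4
      have h5 := mul_le_mul_of_nonneg_left (h4.trans (norm_reidx_le Sum.inr_injective (x - y))) hκ0.le
      simp only [norm_smul, Real.norm_eq_abs, abs_of_pos hκ0]
      linarith
  have hmr : ∫ q, κ * ‖reidx Sum.inl q‖ ∂(stdGaussian (𝔼 (m ⊕ P))) =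
      κ * ∫ g, ‖g‖ ∂(stdGaussian (𝔼 m)) := by
    rw [integral_const_mul, integral_reidx Sum.inl_injective
      (g := fun g : 𝔼 m => ‖g‖) (by fun_prop)]
  have hκn : κ * √n = 1 := by rw [hκ]; field_simp
  have hr : stdGaussian (𝔼 (m ⊕ P)) {q | u ≤ |κ * ‖reidx Sum.inl q‖ - 1|} ≤ 2 * e := by
    refine (measure_mono fun q hq => ?_).trans
      (measure_abs_dev_toNNReal (L := κ) (t := u / 2) hκ0 hLr (by positivity) hex)
    rw [Set.mem_ofPred_eq] at hq ⊢
    have h4 := mul_le_mul_of_nonneg_left (integral_norm_stdGaussian_le (ι := m)) hκ0.le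
    have h5 := mul_le_mul_of_nonneg_left (le_integral_norm_stdGaussian (ι := m)) hκ0.le
    rw [← hn, mul_sub, hκn] at h5
    rw [← hn, hκn] at h4
    have h6 : κ * (2 * Real.exp 1) ≤ u / 2 := by
      refine (sq_le_sq₀ (by positivity) (by positivity)).1 ?_
      rw [mul_pow, hκ2, one_div_mul_eq_div, div_le_iff₀ hn0]
      have := Real.exp_one_lt_d9
      have : (2 * Real.exp 1) ^ 2 ≤ 6 ^ 2 := by gcongr; linarith
      linarith
    rw [hmr]
    have h7 : |κ * ‖reidx Sum.inl q‖ - 1| ≤ |κ * ‖reidx Sum.inl q‖ - κ * ∫ g, ‖g‖ ∂(stdGaussian (𝔼 m))| +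
        |κ * ∫ g, ‖g‖ ∂(stdGaussian (𝔼 m)) - 1| := abs_sub_le _ _ _
    have h8 : |κ * ∫ g, ‖g‖ ∂(stdGaussian (𝔼 m)) - 1| ≤ u / 2 :=
      abs_le.2 ⟨by linarith, by linarith⟩
    linarith
  have ha : stdGaussian (𝔼 (m ⊕ P)) {q | u ≤ |inner ℝ (κ • reidx Sum.inr q) o|} ≤ 2 * e := by
    have hm := integral_strongDual_stdGaussian ((innerSL ℝ o).comp (κ • reidx (Sum.inr : P → m ⊕ P)))
    have hL : LipschitzWith (Real.toNNReal κ) ((innerSL ℝ o).comp (κ • reidx (Sum.inr : P → m ⊕ P))) :=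
      lipschitzWith_of_le_add hκ0.le fun x y => by
        rw [← sub_le_iff_le_add', ← map_sub]
        simp only [ContinuousLinearMap.comp_apply, smul_apply, map_smul, smul_eq_mul]
        gcongr
        rw [innerSL_apply_apply]
        refine (real_inner_le_norm _ _).trans ?_
        rw [ho, one_mul]
        exact norm_reidx_le Sum.inr_injective _
    refine (measure_mono fun q hq => ?_).trans
      (measure_abs_dev_toNNReal (L := κ) (t := u / 2) hκ0 hL (by positivity) hex)
    rw [Set.mem_ofPred_eq] at hq ⊢
    rw [hm, sub_zero, ContinuousLinearMap.comp_apply, innerSL_apply_apply, real_inner_comm]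
    refine le_trans (by linarith) hq
  have hs : stdGaussian (𝔼 (m ⊕ P)) {q | kmax ≤ ‖κ • reidx Sum.inr q‖} ≤ e := by
    refine (measure_mono fun q hq => ?_).trans
      (measure_ge_toNNReal (L := κ) (t := 1) hκ0 hLs (by positivity) (x := 4) ?_)
    · rw [Set.mem_ofPred_eq] at hq ⊢
      refine le_trans ?_ hq
      refine le_trans ?_ hk
      gcongr
      simp only [norm_smul, Real.norm_eq_abs, abs_of_pos hκ0]
      rw [integral_const_mul, integral_reidx Sum.inr_injective
        (g := fun g : 𝔼 P => ‖g‖) (by fun_prop)]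
      refine (mul_le_mul_of_nonneg_left integral_norm_stdGaussian_le hκ0.le).trans ?_
      rw [hκ, one_div_mul_eq_div, div_le_iff₀ (by positivity), ← Real.sqrt_mul' _ hn0.le]
      exact Real.sqrt_le_sqrt hP
    · rw [hκ2, le_div_iff₀ (by positivity), show 4 * (5 * (1 / n)) = 20 / n by ring, div_le_iff₀ hn0]
      linarith
  have hall : (Set.univ : Set (𝔼 (m ⊕ P))) ⊆ ({q | ∃ p ∈ Q,
      u ≤ |minVal (slab o R p.2.1) (auxCost B κ (ridgePen h p) q) -
        auxMean m B κ (ridgePen h p) (slab o R p.2.1)|} ∪ {q | u ≤ |κ * ‖reidx Sum.inl q‖ - 1|}) ∪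
      ({q | u ≤ |inner ℝ (κ • reidx Sum.inr q) o|} ∪ {q | kmax ≤ ‖κ • reidx Sum.inr q‖}) := by
    intro q _
    by_contra hq
    simp only [Set.mem_union, Set.mem_ofPred_eq, not_or, not_exists, not_and, not_le] at hq
    exact hcon q ⟨hq.1.1, hq.1.2, hq.2.1, hq.2.2⟩
  have hfin := (measure_mono hall).trans ((measure_union_le _ _).trans (add_le_add
    ((measure_union_le _ _).trans (add_le_add hv hr)) ((measure_union_le _ _).trans (add_le_add ha hs))))
  rw [measure_univ] at hfin
  have hcard' : (Q.card : ℝ≥0∞) ≤ 7 := by exact_mod_cast hcard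
  have hle : (Q.card : ℝ≥0∞) * (2 * e) + 2 * e + (2 * e + e) ≤ ENNReal.ofReal (19 * Real.exp (-4)) := by
    rw [ENNReal.ofReal_mul (by norm_num), ← he]
    calc (Q.card : ℝ≥0∞) * (2 * e) + 2 * e + (2 * e + e) ≤ 7 * (2 * e) + 2 * e + (2 * e + e) := by gcongr
      _ = ENNReal.ofReal 19 * e := by
        rw [show ENNReal.ofReal 19 = 19 by simp]; ring
  have h4 : (1 : ℝ) ≤ 19 * Real.exp (-4) := by
    have := hfin.trans hle
    rwa [ENNReal.one_le_ofReal] at this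
  have h5 : (20 : ℝ) < Real.exp 4 := by
    have := Real.add_one_lt_exp (show (1:ℝ) ≠ 0 by norm_num)
    have e1 : Real.exp 4 = Real.exp 1 ^ 4 := by rw [← Real.exp_nat_mul]; norm_num
    have := Real.exp_one_gt_d9
    rw [e1]
    calc (20 : ℝ) < 2.7 ^ 4 := by norm_num
      _ ≤ _ := by gcongr; linarith
  rw [Real.exp_neg] at h4
  have : 19 * (Real.exp 4)⁻¹ < 1 := by
    rw [← div_eq_mul_inv, div_lt_one (by positivity)]; linarith
  linarith

lemma primCost_eq_penCost {κ B l s a : ℝ} {A : 𝔼 (m × P)} {W : 𝔼 P}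
    {e : 𝔼 P →ₗ[ℝ] 𝔼 m} (he : ∀ w, e w = κ • matVec A w)
    (hκ : 0 ≤ κ) (hB : κ * ‖matVec A W‖ ≤ B) :
    primCost B κ (ridgePen h (l, s, a)) A W = penCost e h l W + a / 2 * ‖W‖ ^ 2 := by
  have h1 : ‖e W‖ = κ * ‖matVec A W‖ := by rw [he, norm_smul, Real.norm_eq_abs, abs_of_nonneg hκ]
  rw [primCost, psi_eq hB, penCost, h1, max_eq_right (by positivity)]
  simp only [ridgePen]
  ring

lemma auxCost_eq_auxObj {κ B l s a : ℝ} {q : 𝔼 (m ⊕ P)} {W : 𝔼 P}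
    (hB : auxLin (κ * ‖reidx Sum.inl q‖) (κ • reidx Sum.inr q) W ≤ B) :
    auxCost B κ (ridgePen h (l, s, a)) q W =
      auxObj (κ * ‖reidx Sum.inl q‖) (κ • reidx Sum.inr q) h l W + a / 2 * ‖W‖ ^ 2 := by
  have h1 : κ * auxArg q W = auxLin (κ * ‖reidx Sum.inl q‖) (κ • reidx Sum.inr q) W := by
    rw [auxArg, auxLin, real_inner_smul_left, real_inner_comm]; ring
  rw [auxCost, h1, psi_eq hB, auxObj]
  simp only [ridgePen]
  ring

lemma exists_le_of_notMem_primDev {κ B kmax u l s a : ℝ} {o : 𝔼 P}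
    {A : 𝔼 (m × P)} {e : 𝔼 P →ₗ[ℝ] 𝔼 m}
    {q : 𝔼 (m ⊕ P)} {Q : Finset (ℝ × ℝ × ℝ)} (ho : ‖o‖ = 1) (hhc : Continuous h)
    (he : ∀ w, e w = κ • matVec A w) (hκ : 0 ≤ κ)
    (hq : AuxTypical m B κ R kmax (u / 4) o h Q q) (hA : A ∉ primDev m B κ R (u / 4) o h Q) (hp : (l, s, a) ∈ Q)
    (hprim : ∀ W ∈ slab o R s, κ * ‖matVec A W‖ ≤ B)
    (haux : ∀ W ∈ slab o R s, auxLin (κ * ‖reidx Sum.inl q‖) (κ • reidx Sum.inr q) W ≤ B) :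
    (∀ W ∈ slab o R s, ∃ V ∈ slab o R s,
      auxObj (κ * ‖reidx Sum.inl q‖) (κ • reidx Sum.inr q) h l V + a / 2 * ‖V‖ ^ 2 ≤
        penCost e h l W + a / 2 * ‖W‖ ^ 2 + u) ∧
    (a = 0 → ∀ W ∈ slab o R s, ∃ V ∈ slab o R s,
      penCost e h l V ≤ auxObj (κ * ‖reidx Sum.inl q‖) (κ • reidx Sum.inr q) h l W + u) := by
  have h1 := abs_lt.1 (hq.value _ hp)
  simp only [primDev, Set.mem_ofPred_eq, not_exists, not_and, not_or, not_le] at hA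
  have h2 := hA _ hp
  have hu := (abs_nonneg _).trans_lt (hq.value _ hp)
  have hc : Continuous (ridgePen h (l, s, a)) := by unfold ridgePen; fun_prop
  have hne : (slab o R s).Nonempty := ⟨_, smul_mem_slab ho s⟩
  refine ⟨fun W hW => ?_, fun ha W hW => ?_⟩
  · obtain ⟨V, hV, hVe⟩ := exists_eq_minVal (isCompact_slab o R s) hne
      (continuousOn_auxCost (B := B) (κ := κ) hc.continuousOn q)
    have h3 := minVal_le (isCompact_slab o R s)
      (continuousOn_primCost (B := B) (κ := κ) hc.continuousOn A) hW
    rw [primCost_eq_penCost he hκ (hprim W hW)] at h3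
    rw [auxCost_eq_auxObj (haux V hV)] at hVe
    exact ⟨V, hV, by linarith [h2.1]⟩
  · subst ha
    obtain ⟨V, hV, hVe⟩ := exists_eq_minVal (isCompact_slab o R s) hne
      (continuousOn_primCost (B := B) (κ := κ) hc.continuousOn A)
    have h3 := minVal_le (isCompact_slab o R s)
      (continuousOn_auxCost (B := B) (κ := κ) hc.continuousOn q) hW
    rw [primCost_eq_penCost he hκ (hprim V hV)] at hVe
    rw [auxCost_eq_auxObj (haux W hW)] at h3
    exact ⟨V, hV, by linarith [h2.2 rfl]⟩

theorem exists_gordon_const {σ R lmin lmax Γ c₀ Λ : ℝ} (hσ : 0 < σ) (hlmin : 0 < lmin)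
    (hlmax : lmin ≤ lmax) (hc₀ : 0 < c₀) (hΛ : √Γ + 3 ≤ Λ) :
    ∃ M d₀ K c : ℝ, 0 < M ∧ 0 < d₀ ∧ 0 < c ∧ ∀ (m P : Type) [Fintype m] [Fintype P]
      (h : 𝔼 P → ℝ) (o : 𝔼 P) (l d : ℝ),
      (Fintype.card P : ℝ) ≤ Γ * Fintype.card m →
      Continuous h → ConvexOn ℝ Set.univ h → (∀ (w : 𝔼 P) (t : ℝ), h (w + t • o) = h w) →
      ‖o‖ = 1 → lmin ≤ l → l ≤ lmax → 0 < d → d ≤ d₀ → K ≤ Fintype.card m * d ^ 4 →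
      stdGaussian (𝔼 (m × P)) {A | 1 / √(Fintype.card m) * ‖matCLM A‖ ≤ Λ ∧
        ∃ e : 𝔼 P →ₗ[ℝ] 𝔼 m, (∀ w, e w = (1 / √(Fintype.card m)) • matVec A w) ∧
        ∃ w ∈ slab o R σ, IsMinOn (penCost e h l) {w | inner ℝ o w = σ} w ∧ c₀ ≤ ‖e w‖ ∧
        ∃ W ∈ slab o R σ, penCost e h l W ≤ penCost e h l w + d ^ 2 ∧
          M * d < |inner ℝ (e w) (e o) * ‖W‖ - σ * ‖e w‖|} ≤
      14 * ENNReal.ofReal (Real.exp (-(c * (Fintype.card m * d ^ 4)))) := by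
  set ρ := √(R ^ 2 + (σ + 1) ^ 2) with hρ
  have hρ0 : 0 < ρ := Real.sqrt_pos.2 (by positivity)
  have hΛ0 : 0 < Λ := by linarith [Real.sqrt_nonneg Γ]
  obtain ⟨M, d₀, hM, hd₀, hmatch⟩ := exists_matching_const (R := R) hσ hlmin hlmax
    (mul_pos hΛ0 hρ0) hc₀
  set B := Λ * ρ with hB
  have hB0 : 0 < B := by positivity
  set T := (B * ρ) ^ 2 with hT
  have hT0 : 0 < T := by positivity
  refine ⟨M, min d₀ (min (1 / 2) (min lmin σ)), 1280 * T + 2304, 1 / (80 * T), hM, by positivity, by positivity, ?_⟩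
  intro m P _ _ h o l d hP hhc hh hinv ho hl1 hl2 hd hd0 hK
  have hdd₀ := hd0.trans (min_le_left _ _)
  have hd1 : d ≤ 1 / 2 := hd0.trans ((min_le_right _ _).trans (min_le_left _ _))
  have hdl : d ≤ lmin := hd0.trans ((min_le_right _ _).trans ((min_le_right _ _).trans (min_le_left _ _)))
  have hdσ : d ≤ σ := hd0.trans ((min_le_right _ _).trans ((min_le_right _ _).trans (min_le_right _ _)))
  set n : ℝ := (Fintype.card m : ℝ) with hn
  have hd4 : d ^ 4 ≤ (1 / 2) ^ 4 := by gcongr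
  have hd4p : 0 < d ^ 4 := by positivity
  have hn20 : (20 : ℝ) ≤ n := by
    by_contra! hlt
    have : n * d ^ 4 ≤ 20 * (1 / 2) ^ 4 := by gcongr
    linarith
  have hn0 : 0 < n := by linarith
  have : Nonempty m := Fintype.card_pos_iff.1 (Nat.cast_pos.1 hn0)
  set κ := 1 / √n with hκ
  have hκ0 : 0 < κ := by positivity
  have hκ2 : κ ^ 2 = 1 / n := by rw [hκ, div_pow, Real.sq_sqrt hn0.le, one_pow]
  classical
  set Q : Finset (ℝ × ℝ × ℝ) := [(l, σ, 0), (l + d, σ, 0), (l - d, σ, 0), (l, σ + d, 0), (l, σ - d, 0),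
    (l, σ, d), (l, σ, -d)].toFinset with hQ
  have hQc : Q.card ≤ 7 := List.toFinset_card_le _
  have hQm : ∀ p ∈ Q, 0 ≤ p.1 ∧ |p.2.1| ≤ σ + 1 := by
    intro p hp
    simp only [hQ, List.mem_toFinset, List.mem_cons, List.not_mem_nil, or_false] at hp
    rcases hp with rfl | rfl | rfl | rfl | rfl | rfl | rfl <;>
      exact ⟨by simp only; linarith, abs_le.2 ⟨by simp only; linarith, by simp only; linarith⟩⟩
  have hnorm : ∀ s, |s| ≤ σ + 1 → ∀ W ∈ slab o R s, ‖W‖ ≤ ρ := fun s hs W hW =>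
    Real.le_sqrt_of_sq_le (hW.2.trans (by
      have := sq_le_sq' (abs_le.1 hs).1 (abs_le.1 hs).2
      linarith))
  have hQ2 : ∀ p ∈ Q, 0 ≤ p.1 ∧ ∀ W ∈ slab o R p.2.1, ‖W‖ ≤ ρ := fun p hp =>
    ⟨(hQm p hp).1, hnorm _ (hQm p hp).2⟩
  obtain ⟨q, hq⟩ := exists_auxTypical (m := m) (κ := κ) (R := R) (kmax := √Γ + 1) (u := d ^ 2 / 4) ho rfl hB0 hρ0 hhc
    (fun p hp => (hQ2 p hp).2) hQc (by positivity) hP le_rfl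
    (by rw [← hn, div_pow, ← pow_mul]; linarith) (by rw [← hn, div_pow, ← pow_mul]; linarith) hn20
  refine (measure_mono fun A hA => ?_).trans ((measure_primDev_le (m := m) (t := d ^ 2 / 4) (R := R) (Q := Q)
    (x := 1 / (80 * T) * (n * d ^ 4)) ho hκ0 hB0 hρ0 hhc hh hQ2 ?_ ?_).trans ?_)
  · by_contra hdev
    obtain ⟨hAΛ, e, he, w, hw, hmin, hwc, W, hW, hWmin, hlt⟩ := hA
    have hd2 : d ^ 2 ≤ 1 := by
      have : d ^ 2 ≤ (1 / 2) ^ 2 := by gcongr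
      linarith
    have hγ1 := abs_lt.1 hq.radius
    have hprimB : ∀ W, ‖W‖ ≤ ρ → κ * ‖matVec A W‖ ≤ B := fun W hW => by
      have h1 := mul_le_mul_of_nonneg_left (norm_matVec_le_matCLM A W) hκ0.le
      have h2 : κ * ‖matCLM A‖ * ‖W‖ ≤ B := by rw [hB]; gcongr
      linarith
    have hauxB : ∀ W, ‖W‖ ≤ ρ → auxLin (κ * ‖reidx Sum.inl q‖) (κ • reidx Sum.inr q) W ≤ B := fun W hW => by
      have h1 : κ * ‖reidx Sum.inl q‖ * ‖W‖ ≤ 2 * ρ := by gcongr; linarith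
      have h2 := (real_inner_le_norm (κ • reidx Sum.inr q) W).trans
        (mul_le_mul hq.size.le hW (norm_nonneg _) (by positivity))
      have h3 := mul_le_mul_of_nonneg_right hΛ hρ0.le
      rw [auxLin]; linarith
    have hlow : ∀ l' s a, (l', s, a) ∈ Q → _ := fun l' s a hp =>
      (exists_le_of_notMem_primDev ho hhc he hκ0.le hq hdev hp
        (fun W hW => hprimB W ((hQ2 _ hp).2 W hW)) (fun W hW => hauxB W ((hQ2 _ hp).2 W hW))).1
    have hupp : ∀ l' s, (l', s, 0) ∈ Q → _ := fun l' s hp =>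
      (exists_le_of_notMem_primDev ho hhc he hκ0.le hq hdev hp
        (fun W hW => hprimB W ((hQ2 _ hp).2 W hW)) (fun W hW => hauxB W ((hQ2 _ hp).2 W hW))).2 rfl
    have hQ0 : (l, σ, 0) ∈ Q := by simp [hQ]
    have hc : Continuous (ridgePen h (l, σ, 0)) := by unfold ridgePen; fun_prop
    obtain ⟨v, hv, hve⟩ := exists_eq_minVal (isCompact_slab o R σ) ⟨_, smul_mem_slab ho σ⟩
      (continuousOn_auxCost (B := B) (κ := κ) hc.continuousOn q)
    have hvmin : IsMinOn (auxObj (κ * ‖reidx Sum.inl q‖) (κ • reidx Sum.inr q) h l) (slab o R σ) v := fun V hV => by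
      have h1 := minVal_le (isCompact_slab o R σ)
        (continuousOn_auxCost (B := B) (κ := κ) hc.continuousOn q) hV
      rw [← hve, auxCost_eq_auxObj (hauxB v ((hQ2 _ hQ0).2 v hv)),
        auxCost_eq_auxObj (hauxB V ((hQ2 _ hQ0).2 V hV))] at h1
      rw [Set.mem_ofPred_eq]
      linarith
    have hpm : ∀ t, |t| = d → t = d ∨ t = -d := fun t ht => by
      rwa [abs_eq hd.le] at ht
    have hwB : ‖e w‖ ≤ B := by
      rw [he, norm_smul, Real.norm_eq_abs, abs_of_pos hκ0]; exact hprimB w ((hQ2 _ hQ0).2 w hw)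
    refine (hmatch _ _ e h o _ w v _ l d hh hinv ho hl1 hl2 hd hdd₀ (by linarith [hq.radius])
      (by linarith [hq.align]) hw hmin hwB hwc hv hvmin ?_ ?_ ?_ ?_ W hW hWmin).not_gt hlt
    · obtain ⟨V, hV, h1⟩ := hlow l σ 0 hQ0 w hw
      obtain ⟨W', hW', h2⟩ := hupp l σ hQ0 v hv
      have h3 := hmin hW'.1
      have h4 := hvmin hV
      rw [Set.mem_ofPred_eq] at h3 h4
      exact abs_le.2 ⟨by linarith, by linarith⟩
    · intro t ht
      refine hupp (l + t) σ ?_ v hv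
      rcases hpm t ht with rfl | rfl <;> simp [hQ, sub_eq_add_neg]
    · intro t ht
      refine hupp l (σ + t) ?_ _ (add_smul_mem_slab ho hv t)
      rcases hpm t ht with rfl | rfl <;> simp [hQ, sub_eq_add_neg]
    · intro t ht W hW
      refine hlow l σ t ?_ W hW
      rcases hpm t ht with rfl | rfl <;> simp [hQ]
  · refine (sq_le_sq₀ (by positivity) (by positivity)).1 ?_
    rw [show (κ * B * ρ) ^ 2 = κ ^ 2 * T by ring, hκ2, one_div_mul_eq_div, div_le_iff₀ hn0, div_pow, ← pow_mul]
    linarith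
  · rw [show 5 * (B * κ * ρ) ^ 2 = 5 * (κ ^ 2 * T) by ring, hκ2]
    refine le_of_eq ?_
    field_simp
    ring
  · gcongr
    have : 2 * Q.card ≤ 14 := by omega
    exact_mod_cast this

end Deviation

section APriori

lemma map_inner_stdGaussian {E : Type*} [NormedAddCommGroup E] [InnerProductSpace ℝ E]
    [FiniteDimensional ℝ E] [MeasurableSpace E] [BorelSpace E] (v : E) (hv : ‖v‖ = 1) :
    (stdGaussian E).map (fun x => inner ℝ v x) = gaussianReal 0 1 := by
  have := IsGaussian.map_eq_gaussianReal (μ := stdGaussian E) (innerSL ℝ v)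
  rw [integral_strongDual_stdGaussian, variance_dual_stdGaussian, innerSL_apply_norm, hv] at this
  simpa using this

lemma map_apply_stdGaussian {ι : Type*} [Fintype ι] (i : ι) :
    (stdGaussian (𝔼 ι)).map (fun x => x i) = gaussianReal 0 1 := by
  classical
  have := map_inner_stdGaussian (EuclideanSpace.single i (1 : ℝ)) (by simp)
  simpa [EuclideanSpace.inner_single_left] using this

lemma integral_apply_stdGaussian {ι : Type*} [Fintype ι] (i : ι) {f : ℝ → ℝ} (hf : Measurable f) :
    ∫ x, f (x i) ∂(stdGaussian (𝔼 ι)) = ∫ x, f x ∂(gaussianReal 0 1) := by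
  rw [← map_apply_stdGaussian i, integral_map (by fun_prop) hf.aestronglyMeasurable]

lemma integrable_apply_stdGaussian {ι : Type*} [Fintype ι] (i : ι) {f : ℝ → ℝ} (hf : Measurable f)
    (hfi : Integrable f (gaussianReal 0 1)) :
    Integrable (fun x => f (x i)) (stdGaussian (𝔼 ι)) := by
  rw [← map_apply_stdGaussian i, integrable_map_measure hf.aestronglyMeasurable (by fun_prop)] at hfi
  exact hfi

lemma integrable_sq_sub_gaussianReal (c : ℝ) : Integrable (fun x => (x - c) ^ 2) (gaussianReal 0 1) :=
  ((memLp_id_gaussianReal 2).sub (memLp_const c)).integrable_sq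

lemma integral_sq_sub_gaussianReal (c : ℝ) : ∫ x, (x - c) ^ 2 ∂(gaussianReal 0 1) = 1 + c ^ 2 := by
  have h1 := variance_id_gaussianReal (μ := 0) (v := 1)
  have h2 : MemLp id 2 (gaussianReal 0 1) := memLp_id_gaussianReal 2
  rw [variance_eq_sub h2] at h1
  have h3 : ∫ x, id x ∂(gaussianReal 0 1) = 0 := by simp
  have hi1 : Integrable (fun x : ℝ => x ^ 2) (gaussianReal 0 1) := h2.integrable_sq
  have hi2 : Integrable (fun x : ℝ => 2 * c * x - c ^ 2) (gaussianReal 0 1) :=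
    ((h2.integrable (by norm_num)).const_mul _).sub (integrable_const _)
  have e : (fun x : ℝ => (x - c) ^ 2) = fun x => x ^ 2 - (2 * c * x - c ^ 2) := by funext x; ring
  have hi3 : Integrable (fun x : ℝ => 2 * c * x) (gaussianReal 0 1) := (h2.integrable (by norm_num)).const_mul _
  rw [e, integral_sub hi1 hi2, integral_sub hi3 (integrable_const _), integral_const_mul]
  simp only [id, Pi.pow_apply] at h1 h3
  rw [h3] at h1 ⊢
  simp at h1 ⊢
  rw [h1]

/-- The second moment of the soft-thresholded Gaussian. -/
def tailSq (α : ℝ) : ℝ := ∫ x, max (|x| - α) 0 ^ 2 ∂(gaussianReal 0 1)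

lemma integrable_tailSq {α : ℝ} (hα : 0 ≤ α) :
    Integrable (fun x => max (|x| - α) 0 ^ 2) (gaussianReal 0 1) := by
  refine (integrable_sq_sub_gaussianReal 0).mono' (by fun_prop) (.of_forall fun x => ?_)
  rw [Real.norm_eq_abs, abs_of_nonneg (by positivity), sub_zero, ← sq_abs x]
  exact pow_le_pow_left₀ (le_max_right _ _) (max_le (by linarith) (abs_nonneg _)) 2

variable {ι : Type*} [Fintype ι]

/-- The Lasso penalty, relative to its value at `θ`, in rescaled error coordinates. -/
def lassoPen (κ : ℝ) (θ : ι → ℝ) (W : 𝔼 (Option ι)) : ℝ :=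
  κ ^ 2 * ∑ j, (|θ j - W (some j) / κ| - |θ j|)

lemma continuous_lassoPen (κ : ℝ) (θ : ι → ℝ) : Continuous (lassoPen κ θ) := by
  unfold lassoPen; fun_prop

lemma convexOn_lassoPen (κ : ℝ) (θ : ι → ℝ) : ConvexOn ℝ Set.univ (lassoPen κ θ) := by
  refine ⟨convex_univ, fun x _ y _ a b ha hb hab => ?_⟩
  simp only [lassoPen, smul_eq_mul]
  rw [mul_left_comm a, mul_left_comm b, ← mul_add, Finset.mul_sum (a := a), Finset.mul_sum (a := b),
    ← Finset.sum_add_distrib]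
  gcongr with j
  have h1 : θ j - (a • x + b • y) (some j) / κ = a * (θ j - x (some j) / κ) + b * (θ j - y (some j) / κ) := by
    simp only [PiLp.add_apply, PiLp.smul_apply, smul_eq_mul]
    linear_combination -θ j * hab
  have h2 := abs_add_le (a * (θ j - x (some j) / κ)) (b * (θ j - y (some j) / κ))
  rw [abs_mul, abs_mul, abs_of_nonneg ha, abs_of_nonneg hb] at h2
  rw [h1]
  have h3 : (a + b) * |θ j| = |θ j| := by rw [hab, one_mul]
  linarith

/-- The effective Gaussian coordinate in the a priori bound. -/
def effCoord (S : Finset ι) (α : ℝ) (θ : ι → ℝ) (j : ι) (x : ℝ) : ℝ :=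
  open Classical in if j ∈ S then x - α * Real.sign (θ j) else max (|x| - α) 0

lemma abs_sign_le (x : ℝ) : |Real.sign x| ≤ 1 := by
  rcases Real.sign_apply_eq x with h | h | h <;> simp [h]

lemma measurable_effCoord (S : Finset ι) (α : ℝ) (θ : ι → ℝ) (j : ι) : Measurable (effCoord S α θ j) := by
  unfold effCoord; split_ifs <;> fun_prop

lemma effCoord_sq {S : Finset ι} {α : ℝ} (hα : 0 ≤ α) (θ : ι → ℝ) (j : ι) :
    Integrable (fun x => effCoord S α θ j x ^ 2) (gaussianReal 0 1) ∧
    ∫ x, effCoord S α θ j x ^ 2 ∂(gaussianReal 0 1) ≤ (open Classical in if j ∈ S then 1 + α ^ 2 else tailSq α) := by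
  unfold effCoord
  split_ifs with h
  · refine ⟨integrable_sq_sub_gaussianReal _, ?_⟩
    rw [integral_sq_sub_gaussianReal, mul_pow]
    have : Real.sign (θ j) ^ 2 ≤ 1 := (sq_le_one_iff_abs_le_one _).2 (abs_sign_le _)
    nlinarith [sq_nonneg α]
  · exact ⟨integrable_tailSq hα, le_rfl⟩

lemma le_coord {S : Finset ι} {α b κ r a : ℝ} (hα : 0 ≤ α) (hb : 0 ≤ b) (hκ : 0 < κ) (hr : 0 < r) (ha : 0 < a)
    (θ : ι → ℝ) (j : ι) (x w : ℝ) :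
    -(b * κ / 2 * (r / a * effCoord S α θ j x ^ 2 + a / r * w ^ 2)) -
      (open Classical in if j ∈ S then 0 else 2 * (b * α) * κ ^ 2 * |θ j|) ≤
      b * κ * (x * w) + b * α * (κ ^ 2 * (|θ j - w / κ| - |θ j|)) := by
  have key : ∀ y w : ℝ, -(1 / 2 * (r / a * y ^ 2 + a / r * w ^ 2)) ≤ y * w := fun y w => by
    have h1 : 0 ≤ r / a * (y + a / r * w) ^ 2 := by positivity
    have h2 : r / a * (y + a / r * w) ^ 2 = r / a * y ^ 2 + 2 * (y * w) + a / r * w ^ 2 := by field_simp; ring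
    linarith
  have hbκ : 0 ≤ b * κ := by positivity
  unfold effCoord
  split_ifs with h
  · have h1 : -(Real.sign (θ j) * w) / κ ≤ |θ j - w / κ| - |θ j| := by
      have h2 : Real.sign (θ j) * (θ j - w / κ) ≤ |θ j - w / κ| := by
        refine (le_abs_self _).trans ?_
        rw [abs_mul]
        exact mul_le_of_le_one_left (abs_nonneg _) (abs_sign_le _)
      have h3 : Real.sign (θ j) * θ j = |θ j| := by
        rcases lt_trichotomy (θ j) 0 with h | h | h
        · rw [Real.sign_of_neg h, abs_of_neg h]; ring
        · simp [h]
        · rw [Real.sign_of_pos h, abs_of_pos h, one_mul]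
      have h4 : -(Real.sign (θ j) * w) / κ = Real.sign (θ j) * (θ j - w / κ) - Real.sign (θ j) * θ j := by ring
      linarith
    have h2 := mul_le_mul_of_nonneg_left h1 (show 0 ≤ b * α * κ ^ 2 by positivity)
    have h3 : b * α * κ ^ 2 * (-(Real.sign (θ j) * w) / κ) = -(b * κ * (α * Real.sign (θ j) * w)) := by
      field_simp
    have h4 := mul_le_mul_of_nonneg_left (key (x - α * Real.sign (θ j)) w) hbκ
    linarith
  · have h1 : |w| / κ - 2 * |θ j| ≤ |θ j - w / κ| - |θ j| := by
      have := abs_sub_abs_le_abs_sub (w / κ) (θ j)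
      rw [abs_div, abs_of_pos hκ, abs_sub_comm] at this
      linarith
    have h2 := mul_le_mul_of_nonneg_left h1 (show 0 ≤ b * α * κ ^ 2 by positivity)
    have h3 : b * α * κ ^ 2 * (|w| / κ - 2 * |θ j|) = b * κ * (α * |w|) - 2 * (b * α) * κ ^ 2 * |θ j| := by
      field_simp
    have h5 : max (|x| - α) 0 * (-|w|) ≤ x * w + α * |w| := by
      have := neg_abs_le (x * w)
      rw [abs_mul] at this
      have := mul_le_mul_of_nonneg_right (le_max_left (|x| - α) 0) (abs_nonneg w)
      linarith
    have h4 := mul_le_mul_of_nonneg_left (key (-max (|x| - α) 0) |w|) hbκ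
    rw [neg_sq, sq_abs, neg_mul, ← mul_neg] at h4
    have h6 := mul_le_mul_of_nonneg_left h5 hbκ
    linarith

variable {m : Type*} [Fintype m]

/-- A lower bound for the auxiliary cost on a sphere. -/
def sphereBound (S : Finset ι) (α b κ r a σ T : ℝ) (θ : ι → ℝ) (q : 𝔼 (m ⊕ Option ι)) : ℝ :=
  b * κ * (r * ‖reidx Sum.inl q‖ + σ * q (Sum.inr none) -
    (r / a * ∑ j, effCoord S α θ j (q (Sum.inr (some j))) ^ 2 + a * r) / 2) - 2 * (b * α) * κ ^ 2 * T - b ^ 2 / 2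

lemma sphereBound_le_auxCost {S : Finset ι} {B α b κ r a σ T : ℝ} (hα : 0 ≤ α) (hb : 0 ≤ b) (hbB : b ≤ B)
    (hκ : 0 < κ) (hr : 0 < r) (ha : 0 < a) {θ : ι → ℝ} (hT : ∑ j, (open Classical in if j ∈ S then 0 else |θ j|) ≤ T)
    (q : 𝔼 (m ⊕ Option ι)) {W : 𝔼 (Option ι)} (hW0 : W none = σ)
    (hW : ∑ j, W (some j) ^ 2 = r ^ 2) :
    sphereBound S α b κ r a σ T θ q ≤ auxCost B κ (fun W => b * α * lassoPen κ θ W) q W := by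
  have h1 := le_psi hb hbB (κ * auxArg q W)
  have h2 : r ≤ ‖W‖ := by
    refine (sq_le_sq₀ hr.le (norm_nonneg _)).1 ?_
    rw [EuclideanSpace.norm_sq_eq, Fintype.sum_option]
    simp only [Real.norm_eq_abs, sq_abs, hW]
    nlinarith [sq_nonneg (W none)]
  have h3 : inner ℝ W (reidx Sum.inr q) = q (Sum.inr none) * σ + ∑ j, q (Sum.inr (some j)) * W (some j) := by
    rw [PiLp.inner_apply, Fintype.sum_option]
    simp [reidx_apply, hW0]
  have h4 := Finset.sum_le_sum fun j (_ : j ∈ Finset.univ) =>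
    le_coord (S := S) hα hb hκ hr ha θ j (q (Sum.inr (some j))) (W (some j))
  rw [Finset.sum_sub_distrib, Finset.sum_neg_distrib, Finset.sum_add_distrib, ← Finset.mul_sum, ← Finset.mul_sum,
    ← Finset.mul_sum, ← Finset.mul_sum, Finset.sum_add_distrib, ← Finset.mul_sum, ← Finset.mul_sum, hW] at h4
  have h5 : ∑ j, (open Classical in if j ∈ S then 0 else 2 * (b * α) * κ ^ 2 * |θ j|) ≤ 2 * (b * α) * κ ^ 2 * T := by
    refine le_trans (le_of_eq ?_) (mul_le_mul_of_nonneg_left hT (by positivity))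
    rw [Finset.mul_sum]
    refine Finset.sum_congr rfl fun j _ => ?_
    split_ifs <;> ring
  have h6 : a / r * r ^ 2 = a * r := by field_simp
  have h7 : b * κ * (r * ‖reidx Sum.inl q‖) ≤ b * κ * (‖W‖ * ‖reidx Sum.inl q‖) := by gcongr
  simp only [auxCost, sphereBound, lassoPen]
  rw [auxArg, h3] at h1 ⊢
  rw [h6] at h4
  linarith

lemma le_integral_sphereBound {S : Finset ι} {α b κ r a σ T V : ℝ} (hα : 0 ≤ α) (hb : 0 ≤ b)
    (hκ : 0 < κ) (hr : 0 < r) (ha : 0 < a) (θ : ι → ℝ)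
    (hV : S.card * (1 + α ^ 2) + (Fintype.card ι - S.card) * tailSq α ≤ V) :
    Integrable (sphereBound S α b κ r a σ T θ) (stdGaussian (𝔼 (m ⊕ Option ι))) ∧
    b * κ * (r * (√(Fintype.card m) - 2 * Real.exp 1) - (r / a * V + a * r) / 2) - 2 * (b * α) * κ ^ 2 * T - b ^ 2 / 2
      ≤ ∫ q, sphereBound S α b κ r a σ T θ q ∂(stdGaussian (𝔼 (m ⊕ Option ι))) := by
  classical
  set μ := stdGaussian (𝔼 (m ⊕ Option ι))
  have i1 : Integrable (fun q => ‖reidx Sum.inl q‖) μ :=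
    integrable_norm_stdGaussian.mono' (by fun_prop) (.of_forall fun q => by
      simpa using norm_reidx_le Sum.inl_injective q)
  have i2 : Integrable (fun q => q (Sum.inr none)) μ :=
    integrable_apply_stdGaussian (f := fun x => x) _ measurable_id ((memLp_id_gaussianReal 1).integrable le_rfl)
  have i3 : ∀ j, Integrable (fun q => effCoord S α θ j (q (Sum.inr (some j))) ^ 2) μ := fun j =>
    integrable_apply_stdGaussian (f := fun x => effCoord S α θ j x ^ 2) _ ((measurable_effCoord S α θ j).pow_const 2)
      (effCoord_sq hα θ j).1
  have e1 : ∫ q, ‖reidx Sum.inl q‖ ∂μ = ∫ g, ‖g‖ ∂(stdGaussian (𝔼 m)) :=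
    integral_reidx Sum.inl_injective (g := fun g : 𝔼 m => ‖g‖) (by fun_prop)
  have e2 : ∫ q, q (Sum.inr none) ∂μ = 0 := by
    rw [integral_apply_stdGaussian (f := fun x => x) _ measurable_id]; simp
  have e3 : ∑ j, ∫ q, effCoord S α θ j (q (Sum.inr (some j))) ^ 2 ∂μ ≤ V := by
    calc ∑ j, ∫ q, effCoord S α θ j (q (Sum.inr (some j))) ^ 2 ∂μ
        ≤ ∑ j, (if j ∈ S then 1 + α ^ 2 else tailSq α) := Finset.sum_le_sum fun j _ => by
          rw [integral_apply_stdGaussian (f := fun x => effCoord S α θ j x ^ 2) _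
            ((measurable_effCoord S α θ j).pow_const 2)]
          convert (effCoord_sq hα θ j).2
      _ = S.card * (1 + α ^ 2) + (Fintype.card ι - S.card) * tailSq α := by
          rw [Finset.sum_ite, Finset.filter_not, Finset.filter_mem_eq_inter, Finset.univ_inter, Finset.sum_const,
            Finset.sum_const, nsmul_eq_mul, nsmul_eq_mul, ← Finset.compl_eq_univ_sdiff, Finset.card_compl,
            Nat.cast_sub (Finset.card_le_univ S)]
      _ ≤ V := hV
  have i4 : Integrable (fun q => r * ‖reidx Sum.inl q‖ + σ * q (Sum.inr none)) μ := (i1.const_mul _).add (i2.const_mul _)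
  have i5 : Integrable (fun q => ∑ j, effCoord S α θ j (q (Sum.inr (some j))) ^ 2) μ :=
    integrable_finsetSum _ fun j _ => i3 j
  have i6 : Integrable (fun q => (r / a * ∑ j, effCoord S α θ j (q (Sum.inr (some j))) ^ 2 + a * r) / 2) μ :=
    ((i5.const_mul _).add (integrable_const _)).div_const _
  have i7 : Integrable (fun q => b * κ * (r * ‖reidx Sum.inl q‖ + σ * q (Sum.inr none) -
      (r / a * ∑ j, effCoord S α θ j (q (Sum.inr (some j))) ^ 2 + a * r) / 2)) μ := (i4.sub i6).const_mul _
  have i8 : Integrable (fun q => b * κ * (r * ‖reidx Sum.inl q‖ + σ * q (Sum.inr none) -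
      (r / a * ∑ j, effCoord S α θ j (q (Sum.inr (some j))) ^ 2 + a * r) / 2) - 2 * (b * α) * κ ^ 2 * T) μ :=
    i7.sub (integrable_const _)
  have hI : Integrable (sphereBound S α b κ r a σ T θ) μ :=
    i8.sub (integrable_const _)
  refine ⟨hI, ?_⟩
  have hE : ∫ q, sphereBound S α b κ r a σ T θ q ∂μ =
      b * κ * (r * ∫ q, ‖reidx Sum.inl q‖ ∂μ + σ * ∫ q, q (Sum.inr none) ∂μ -
        (r / a * ∑ j, ∫ q, effCoord S α θ j (q (Sum.inr (some j))) ^ 2 ∂μ + a * r) / 2) -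
        2 * (b * α) * κ ^ 2 * T - b ^ 2 / 2 := by
    unfold sphereBound
    rw [integral_sub i8 (integrable_const _), integral_sub i7 (integrable_const _),
      integral_const_mul, integral_sub i4 i6, integral_div, integral_add (i5.const_mul _) (integrable_const _),
      integral_const_mul, integral_add (i1.const_mul _) (i2.const_mul _), integral_const_mul, integral_const_mul,
      integral_finsetSum _ fun j _ => i3 j]
    simp
  rw [hE, e1, e2]
  have h1 := le_integral_norm_stdGaussian (ι := m)
  have h2 : r / a * ∑ j, ∫ q, effCoord S α θ j (q (Sum.inr (some j))) ^ 2 ∂μ ≤ r / a * V := by gcongr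
  have h3 : r * (√(Fintype.card m) - 2 * Real.exp 1) ≤ r * ∫ x, ‖x‖ ∂(stdGaussian (𝔼 m)) := by gcongr
  gcongr b * κ * ?_ - _ - _
  linarith

lemma convexOn_penCost {E F : Type*} [AddCommGroup E] [Module ℝ E] [NormedAddCommGroup F] [InnerProductSpace ℝ F]
    (e : E →ₗ[ℝ] F) {h : E → ℝ} (hh : ConvexOn ℝ Set.univ h) {l : ℝ} (hl : 0 ≤ l) :
    ConvexOn ℝ Set.univ (penCost e h l) := by
  have h1 : ConvexOn ℝ Set.univ fun w => ‖e w‖ ^ 2 / 2 := by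
    have := ((convexOn_norm (convex_univ (𝕜 := ℝ) (E := F))).pow (fun _ _ => norm_nonneg _) 2).comp_linearMap e
    refine (this.smul (show (0 : ℝ) ≤ 1 / 2 by norm_num)).congr fun w _ => ?_
    simp
    ring
  exact h1.add (hh.smul hl)

/-- The error vectors with offset `σ` at a given distance. -/
def errSphere (ι : Type*) [Fintype ι] (r σ : ℝ) : Set (𝔼 (Option ι)) :=
  {W | W none = σ ∧ ∑ j, W (some j) ^ 2 = r ^ 2}

lemma norm_sq_option (W : 𝔼 (Option ι)) : ‖W‖ ^ 2 = W none ^ 2 + ∑ j, W (some j) ^ 2 := by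
  rw [EuclideanSpace.norm_sq_eq, Fintype.sum_option]
  simp

lemma norm_le_of_mem_errSphere {r σ : ℝ} {W : 𝔼 (Option ι)} (hW : W ∈ errSphere ι r σ) :
    ‖W‖ ≤ √(r ^ 2 + σ ^ 2) := by
  refine Real.le_sqrt_of_sq_le ?_
  rw [norm_sq_option, hW.1, hW.2, add_comm]

lemma isCompact_errSphere (r σ : ℝ) : IsCompact (errSphere ι r σ) := by
  refine Metric.isCompact_of_isClosed_isBounded ?_ ?_
  · exact (isClosed_eq (f := fun W : 𝔼 (Option ι) => W none) (by fun_prop) continuous_const).inter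
      (isClosed_eq (f := fun W : 𝔼 (Option ι) => ∑ j, W (some j) ^ 2) (by fun_prop) continuous_const)
  · refine (Metric.isBounded_closedBall (x := (0 : 𝔼 (Option ι)))
      (r := √(r ^ 2 + σ ^ 2))).subset fun W hW => ?_
    rw [mem_closedBall_zero_iff]
    exact norm_le_of_mem_errSphere hW

lemma errSphere_nonempty [Nonempty ι] (r σ : ℝ) : (errSphere ι r σ).Nonempty := by
  classical
  obtain ⟨i⟩ := ‹Nonempty ι›
  refine ⟨EuclideanSpace.single none σ + EuclideanSpace.single (some i) r, by simp, ?_⟩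
  rw [Finset.sum_eq_single i] <;> simp +contextual

/-- The coordinate direction of the noise. -/
def noiseDir (ι : Type*) [Fintype ι] : 𝔼 (Option ι) :=
  open Classical in EuclideanSpace.single none 1

lemma noiseDir_none : noiseDir ι none = 1 := by simp [noiseDir]

lemma noiseDir_some (j : ι) : noiseDir ι (some j) = 0 := by simp [noiseDir]

lemma norm_noiseDir : ‖noiseDir ι‖ = 1 := by simp [noiseDir]

lemma inner_noiseDir (W : 𝔼 (Option ι)) : inner ℝ (noiseDir ι) W = W none := by
  simp [noiseDir, EuclideanSpace.inner_single_left]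

lemma lassoPen_smul_noiseDir (κ s : ℝ) (θ : ι → ℝ) : lassoPen κ θ (s • noiseDir ι) = 0 := by
  simp [lassoPen, noiseDir_some]

lemma lassoPen_add_smul_noiseDir (κ : ℝ) (θ : ι → ℝ) (W : 𝔼 (Option ι)) (s : ℝ) :
    lassoPen κ θ (W + s • noiseDir ι) = lassoPen κ θ W := by
  simp [lassoPen, noiseDir_some]

lemma exists_mem_errSphere_le {F : Type*} [NormedAddCommGroup F] [InnerProductSpace ℝ F]
    {e : 𝔼 (Option ι) →ₗ[ℝ] F} {h : 𝔼 (Option ι) → ℝ} (hh : ConvexOn ℝ Set.univ h)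
    {l r σ : ℝ} (hl : 0 ≤ l) (hr : 0 ≤ r) {W : 𝔼 (Option ι)} (hW : inner ℝ (noiseDir ι) W = σ)
    (hns : W ∉ slab (noiseDir ι) r σ) (hmin : IsMinOn (penCost e h l) {w | inner ℝ (noiseDir ι) w = σ} W) :
    ∃ V ∈ errSphere ι r σ, penCost e h l V ≤ penCost e h l (σ • noiseDir ι) := by
  set o := noiseDir ι
  have h1 : r ^ 2 < ∑ j, W (some j) ^ 2 := by
    by_contra! hc
    refine hns ⟨hW, ?_⟩
    rw [norm_sq_option, ← inner_noiseDir, hW]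
    linarith
  set q := √(∑ j, W (some j) ^ 2)
  have hq : r < q := Real.lt_sqrt_of_sq_lt h1
  have hq0 : 0 < q := hr.trans_lt hq
  have hq2 : q ^ 2 = ∑ j, W (some j) ^ 2 := Real.sq_sqrt (Finset.sum_nonneg fun _ _ => sq_nonneg _)
  refine ⟨(1 - r / q) • (σ • o) + (r / q) • W, ⟨?_, ?_⟩, ?_⟩
  · rw [inner_noiseDir] at hW
    simp only [PiLp.add_apply, PiLp.smul_apply, smul_eq_mul, o, noiseDir_none, hW]
    ring
  · simp only [PiLp.add_apply, PiLp.smul_apply, smul_eq_mul, o, noiseDir_some, mul_zero, zero_add, mul_pow]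
    rw [← Finset.mul_sum, ← hq2]
    field_simp
  · have h2 := (convexOn_penCost e hh hl).2 (Set.mem_univ (σ • o)) (Set.mem_univ W)
      (show 0 ≤ 1 - r / q by rw [sub_nonneg, div_le_one hq0]; exact hq.le) (show 0 ≤ r / q by positivity) (by ring)
    have h3 : penCost e h l W ≤ penCost e h l (σ • o) := hmin (by
      rw [Set.mem_ofPred_eq, inner_smul_right, inner_noiseDir, noiseDir_none, mul_one])
    have h4 := mul_le_mul_of_nonneg_left h3 (show 0 ≤ r / q by positivity)
    simp only [smul_eq_mul] at h2
    linarith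

lemma le_auxMean_errSphere [Nonempty ι] [Nonempty m] {S : Finset ι} {B α b κ r σ T V : ℝ} (hα : 0 ≤ α) (hb : 0 ≤ b)
    (hbB : b ≤ B) (hκ : 0 < κ) (hr : 0 < r) (hV0 : 0 < V) {θ : ι → ℝ}
    (hT : ∑ j, (open Classical in if j ∈ S then 0 else |θ j|) ≤ T)
    (hV : S.card * (1 + α ^ 2) + (Fintype.card ι - S.card) * tailSq α ≤ V) :
    b * κ * r * (√(Fintype.card m) - 2 * Real.exp 1 - √V) - 2 * (b * α) * κ ^ 2 * T - b ^ 2 / 2 ≤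
      auxMean m B κ (fun W => b * α * lassoPen κ θ W) (errSphere ι r σ) := by
  have ha : 0 < √V := Real.sqrt_pos.2 hV0
  obtain ⟨h1, h2⟩ := le_integral_sphereBound (m := m) (σ := σ) (T := T) hα hb hκ hr ha θ hV
  have hc : ContinuousOn (fun W => b * α * lassoPen κ θ W) (errSphere ι r σ) :=
    ((continuous_lassoPen κ θ).const_mul _).continuousOn
  have h3 := integral_mono h1 (integrable_minVal_auxCost hκ.le (hb.trans hbB) (isCompact_errSphere r σ)
    (errSphere_nonempty r σ) hc fun W hW => norm_le_of_mem_errSphere hW) fun q =>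
      le_minVal (errSphere_nonempty r σ) fun W hW => sphereBound_le_auxCost hα hb hbB hκ hr ha hT q hW.1 hW.2
  have h4 : r / √V * V + √V * r = 2 * (r * √V) := by
    have := Real.sq_sqrt hV0.le
    field_simp
    rw [this]; ring
  rw [h4] at h2
  unfold auxMean
  linarith


/-- Vectors which are sparse up to an `ℓ¹`-small remainder, with sparsity below the threshold `t`. -/
def ApproxSparse (α t M : ℝ) (θ : ι → ℝ) : Prop :=
  ∃ S : Finset ι, S.card * (1 + α ^ 2) + (Fintype.card ι - S.card) * tailSq α ≤ t * Fintype.card ι ∧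
    ∑ j, (open Classical in if j ∈ S then 0 else |θ j|) ≤ M * Fintype.card ι

lemma measure_errSphere_le [Nonempty ι] [Nonempty m] {α t M δ B b r σ Q K : ℝ} (hα : 0 < α) (ht : 0 < t)
    (htδ : t < δ) (hb : 0 < b) (hbB : b ≤ B) (hr : 0 < r) {θ : ι → ℝ} (hθ : ApproxSparse α t M θ)
    (hδ : (Fintype.card m : ℝ) = δ * Fintype.card ι)
    (hQ : Q + b ^ 2 / 2 + 2 + 2 * (b * α) * M / δ ≤ b * r * ((1 - √(t / δ)) / 2))
    (hK1 : 2 * Real.exp 1 ≤ (1 - √(t / δ)) / 2 * √K) (hK2 : (B * √(r ^ 2 + σ ^ 2)) ^ 2 ≤ K)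
    (hK : K ≤ Fintype.card m) :
    stdGaussian (𝔼 (m × Option ι))
      {A | ∃ W ∈ errSphere ι r σ, (1 / √(Fintype.card m) * ‖matVec A W‖) ^ 2 / 2 + b * α * lassoPen (1 / √(Fintype.card m)) θ W ≤ Q}
      ≤ ENNReal.ofReal (Real.exp (-(1 / (5 * (B * √(r ^ 2 + σ ^ 2)) ^ 2) * Fintype.card m))) := by
  obtain ⟨S, hS, hT⟩ := hθ
  set n : ℝ := (Fintype.card m : ℝ) with hn
  have hn0 : 0 < n := Nat.cast_pos.2 Fintype.card_pos
  have hδ0 : 0 < δ := ht.trans htδ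
  have hB : 0 < B := hb.trans_le hbB
  set κ : ℝ := 1 / √n with hκdef
  have hκ : 0 < κ := by positivity
  have hκn : κ * √n = 1 := by rw [hκdef]; field_simp
  have hκ2 : κ ^ 2 * n = 1 := by
    have := congrArg (· ^ 2) hκn
    simpa only [mul_pow, Real.sq_sqrt hn0.le, one_pow] using this
  set ρ := √(r ^ 2 + σ ^ 2)
  have hρ : 0 < ρ := by positivity
  have hVpos : 0 < t * Fintype.card ι := by positivity
  have h1 := le_auxMean_errSphere (m := m) (σ := σ) hα.le hb.le hbB hκ hr hVpos hT hS
  rw [← hn] at h1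
  have h2 : √(t * Fintype.card ι) = √(t / δ) * √n := by
    rw [← Real.sqrt_mul (by positivity), hδ]
    congr 1
    field_simp
  have h3 : κ ^ 2 * (M * Fintype.card ι) = M / δ := by
    rw [eq_div_iff hδ0.ne']
    linear_combination M * hκ2 - κ ^ 2 * M * hδ
  have h4 : 2 * Real.exp 1 ≤ (1 - √(t / δ)) / 2 * √n := by
    have hpos : 0 ≤ (1 - √(t / δ)) / 2 := by
      have : √(t / δ) ≤ 1 := Real.sqrt_le_one.2 ((div_le_one hδ0).2 htδ.le)
      linarith
    exact hK1.trans (mul_le_mul_of_nonneg_left (Real.sqrt_le_sqrt hK) hpos)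
  have h5 : b * r * ((1 - √(t / δ)) / 2) ≤ b * κ * r * (√n - 2 * Real.exp 1 - √(t * Fintype.card ι)) := by
    have h6 := mul_le_mul_of_nonneg_left h4 (show 0 ≤ b * κ * r by positivity)
    rw [h2]
    have h7 : b * κ * r * ((1 - √(t / δ)) / 2 * √n) = b * r * ((1 - √(t / δ)) / 2) * (κ * √n) := by ring
    have h8 : b * κ * r * (√n - 2 * Real.exp 1 - √(t / δ) * √n) =
      2 * (b * r * ((1 - √(t / δ)) / 2) * (κ * √n)) - b * κ * r * (2 * Real.exp 1) := by ring
    rw [h8]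
    rw [h7] at h6
    rw [hκn] at h6 ⊢
    linarith
  have h9 : Q + 2 ≤ auxMean m B κ (fun W => b * α * lassoPen κ θ W) (errSphere ι r σ) := by
    refine le_trans ?_ h1
    have : 2 * (b * α) * κ ^ 2 * (M * Fintype.card ι) = 2 * (b * α) * M / δ := by
      rw [mul_assoc (2 * (b * α)), h3]; ring
    linarith
  have hc : ContinuousOn (fun W => b * α * lassoPen κ θ W) (errSphere ι r σ) :=
    ((continuous_lassoPen κ θ).const_mul _).continuousOn
  refine (measure_mono fun A hA => ?_).trans (measure_minVal_primCost_le (m := m) (t := 1) hκ hB hρ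
    (isCompact_errSphere r σ) (errSphere_nonempty r σ) hc (fun W hW => norm_le_of_mem_errSphere hW) ?_ ?_)
  · obtain ⟨W, hW, hle⟩ := hA
    rw [Set.mem_ofPred_eq]
    refine (minVal_le (isCompact_errSphere r σ) (continuousOn_primCost hc A) hW).trans ?_
    rw [primCost]
    linarith [psi_le (B := B) (κ * ‖matVec A W‖)]
  · refine (sq_le_sq₀ (by positivity) zero_le_one).1 ?_
    have : (κ * B * ρ) ^ 2 = κ ^ 2 * (B * ρ) ^ 2 := by ring
    rw [this, one_pow, ← hκ2]
    gcongr
    exact hK2.trans hK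
  · have : (B * κ * ρ) ^ 2 * n = (B * ρ) ^ 2 := by linear_combination (B * ρ) ^ 2 * hκ2
    rw [← this]
    apply le_of_eq
    field_simp

lemma exists_apriori_const {α t M δ σ Λ lmin lmax : ℝ} (hα : 0 < α) (ht : 0 < t) (htδ : t < δ) (hM : 0 ≤ M)
    (hlmin : 0 < lmin) (hlmax : lmin ≤ lmax) :
    ∃ R K c : ℝ, 0 < R ∧ 0 < c ∧ ∀ (m ι : Type) [Fintype m] [Fintype ι] [Nonempty m] [Nonempty ι] (θ : ι → ℝ),
      ApproxSparse α t M θ → (Fintype.card m : ℝ) = δ * Fintype.card ι → K ≤ Fintype.card m →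
      stdGaussian (𝔼 (m × Option ι)) {A | 1 / √(Fintype.card m) * ‖matCLM A‖ ≤ Λ ∧
        ∃ e : 𝔼 (Option ι) →ₗ[ℝ] 𝔼 m,
        (∀ w, e w = (1 / √(Fintype.card m)) • matVec A w) ∧
        ∃ l ∈ Set.Icc lmin lmax, ∃ W, inner ℝ (noiseDir ι) W = σ ∧ W ∉ slab (noiseDir ι) R σ ∧
          IsMinOn (penCost e (lassoPen (1 / √(Fintype.card m)) θ) l) {w | inner ℝ (noiseDir ι) w = σ} W} ≤
      2 * ENNReal.ofReal (Real.exp (-(c * Fintype.card m))) := by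
  have hδ0 : 0 < δ := ht.trans htδ
  have hlmax0 : 0 < lmax := hlmin.trans_le hlmax
  set g := (1 - √(t / δ)) / 2
  have hg : 0 < g := by
    have : √(t / δ) < 1 := (Real.sqrt_lt' one_pos).2 (by rw [one_pow, div_lt_one hδ0]; exact htδ)
    exact half_pos (by linarith)
  set Q := σ ^ 2 * Λ ^ 2 / 2
  have hQ0 : 0 ≤ Q := by positivity
  set B := lmax / α
  have hB : 0 < B := by positivity
  set R := ((Q + 2 + B ^ 2 / 2) / (lmin / α) + 2 * α * M / δ) / g
  have hR : 0 < R := by positivity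
  have hRb : ∀ l ∈ Set.Icc lmin lmax, Q + (l / α) ^ 2 / 2 + 2 + 2 * (l / α * α) * M / δ ≤ l / α * R * g := fun l hl => by
    have h0 : 0 < l := hlmin.trans_le hl.1
    have h1 : l / α * R * g = l / α * ((Q + 2 + B ^ 2 / 2) / (lmin / α)) + 2 * (l / α * α) * M / δ := by
      simp only [R]; field_simp
    have h2 : Q + 2 + B ^ 2 / 2 ≤ l / α * ((Q + 2 + B ^ 2 / 2) / (lmin / α)) := by
      rw [mul_div_assoc', le_div_iff₀ (by positivity), mul_comm]
      gcongr
      exact hl.1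
    have h3 : (l / α) ^ 2 ≤ B ^ 2 := by
      have := hl.2
      simp only [B]
      gcongr
    rw [h1]
    linarith
  set ρ := √(R ^ 2 + σ ^ 2)
  have hρ : 0 < ρ := by positivity
  refine ⟨R, max ((2 * Real.exp 1 / g) ^ 2) ((B * ρ) ^ 2), 1 / (5 * (B * ρ) ^ 2), hR, by positivity, ?_⟩
  intro m ι _ _ _ _ θ hθ hn hK
  set κ : ℝ := 1 / √(Fintype.card m)
  have hκ : 0 ≤ κ := by positivity
  have hK1 : 2 * Real.exp 1 ≤ g * √(max ((2 * Real.exp 1 / g) ^ 2) ((B * ρ) ^ 2)) := by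
    rw [← div_le_iff₀' hg]
    exact Real.le_sqrt_of_sq_le (le_max_left _ _)
  have main : ∀ l ∈ Set.Icc lmin lmax, stdGaussian (𝔼 (m × Option ι))
      {A | ∃ W ∈ errSphere ι R σ, (κ * ‖matVec A W‖) ^ 2 / 2 + l / α * α * lassoPen κ θ W ≤ Q} ≤
      ENNReal.ofReal (Real.exp (-(1 / (5 * (B * ρ) ^ 2) * Fintype.card m))) := fun l hl => by
    have h0 : 0 < l := hlmin.trans_le hl.1
    refine measure_errSphere_le hα ht htδ (by positivity) ?_ hR hθ hn (hRb l hl) hK1 (le_max_right _ _) hK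
    simp only [B]
    have := hl.2
    gcongr
  rw [two_mul]
  refine (measure_mono (t := {A | ∃ W ∈ errSphere ι R σ, (κ * ‖matVec A W‖) ^ 2 / 2 + lmin / α * α * lassoPen κ θ W ≤ Q} ∪
    {A | ∃ W ∈ errSphere ι R σ, (κ * ‖matVec A W‖) ^ 2 / 2 + lmax / α * α * lassoPen κ θ W ≤ Q}) ?_).trans
    ((measure_union_le _ _).trans (add_le_add (main lmin ⟨le_rfl, hlmax⟩) (main lmax ⟨hlmax, le_rfl⟩)))
  rintro A ⟨hΛ, e, he, l, hl, W, hW, hns, hmin⟩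
  have hl0 : 0 < l := hlmin.trans_le hl.1
  obtain ⟨V, hV, hle⟩ := exists_mem_errSphere_le (convexOn_lassoPen κ θ) hl0.le hR.le hW hns hmin
  have hnorm : ∀ w, ‖e w‖ = κ * ‖matVec A w‖ := fun w => by
    rw [he, norm_smul, Real.norm_eq_abs, abs_of_nonneg hκ]
  have h1 : penCost e (lassoPen κ θ) l (σ • noiseDir ι) ≤ Q := by
    rw [penCost, lassoPen_smul_noiseDir, mul_zero, add_zero, hnorm]
    have h2 : κ * ‖matVec A (σ • noiseDir ι)‖ ≤ Λ * |σ| := by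
      have h3 := norm_matVec_le_matCLM A (σ • noiseDir ι)
      rw [norm_smul, norm_noiseDir, mul_one, Real.norm_eq_abs] at h3
      have h4 := mul_le_mul_of_nonneg_left h3 hκ
      have h5 := mul_le_mul_of_nonneg_right hΛ (abs_nonneg σ)
      linarith
    have h3 := pow_le_pow_left₀ (by positivity) h2 2
    rw [mul_pow Λ, sq_abs] at h3
    simp only [Q]
    linarith
  have h2 : (κ * ‖matVec A V‖) ^ 2 / 2 + l * lassoPen κ θ V ≤ Q := by
    rw [← hnorm]
    exact hle.trans h1
  rcases le_total 0 (lassoPen κ θ V) with h | h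
  · left
    refine ⟨V, hV, le_trans ?_ h2⟩
    rw [div_mul_cancel₀ _ hα.ne']
    linarith [mul_le_mul_of_nonneg_right hl.1 h]
  · right
    refine ⟨V, hV, le_trans ?_ h2⟩
    rw [div_mul_cancel₀ _ hα.ne']
    linarith [mul_le_mul_of_nonpos_right hl.2 h]

lemma measure_matCLM_le [Nonempty m] {P : Type*} [Fintype P] {Γ Λ : ℝ} (hP : (Fintype.card P : ℝ) ≤ Γ * Fintype.card m)
    (hΛ : √Γ + 3 ≤ Λ) :
    stdGaussian (𝔼 (m × P)) {A | Λ < 1 / √(Fintype.card m) * ‖matCLM A‖} ≤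
      ENNReal.ofReal (Real.exp (-(1 / 5 * Fintype.card m))) := by
  set n : ℝ := (Fintype.card m : ℝ)
  have hn1 : 1 ≤ n := Nat.one_le_cast.2 Fintype.card_pos
  have hs1 : 1 ≤ √n := Real.one_le_sqrt.2 hn1
  refine (measure_mono fun A hA => ?_).trans (measure_ge_toNNReal (L := 1) (t := √n) one_pos
    (by simpa using lipschitzWith_norm_matCLM (m := m) (P := P)) (Real.sqrt_nonneg _) ?_)
  · rw [Set.mem_ofPred_eq] at hA ⊢
    have h1 := integral_norm_matCLM_le (m := m) (P := P)
    have h2 := integral_norm_stdGaussian_le (ι := m)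
    have h3 := integral_norm_stdGaussian_le (ι := P)
    have h4 : √(Fintype.card P) ≤ √Γ * √n := by
      rw [← Real.sqrt_mul' _ (by positivity)]
      exact Real.sqrt_le_sqrt hP
    rw [one_div_mul_eq_div, lt_div_iff₀ (by positivity)] at hA
    have h5 := mul_le_mul_of_nonneg_right hΛ (show 0 ≤ √n by positivity)
    linarith
  · rw [Real.sq_sqrt (by positivity)]
    norm_num
    linarith

end APriori

section Classes

lemma tailSq_nonneg (α : ℝ) : 0 ≤ tailSq α := integral_nonneg fun _ => sq_nonneg _

lemma tailSq_le_one {α : ℝ} (hα : 0 ≤ α) : tailSq α ≤ 1 := by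
  have h := integral_sq_sub_gaussianReal 0
  rw [zero_pow two_ne_zero, add_zero] at h
  rw [← h]
  refine integral_mono (integrable_tailSq hα) (integrable_sq_sub_gaussianReal 0) fun x => ?_
  rw [sub_zero, ← sq_abs x]
  exact pow_le_pow_left₀ (le_max_right _ _) (max_le (by linarith) (abs_nonneg _)) 2

lemma tailSq_mul_sq_le {α : ℝ} (hα : 0 < α) : tailSq α * α ^ 2 ≤ ∫ x, x ^ 4 ∂(gaussianReal 0 1) := by
  have hi : Integrable (fun x : ℝ => x ^ 4) (gaussianReal 0 1) := by
    refine ((memLp_id_gaussianReal (μ := 0) (v := 1) 4).integrable_norm_pow (by norm_num)).congr (.of_forall fun x => ?_)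
    simp [Even.pow_abs (show Even 4 by decide)]
  rw [tailSq, ← integral_mul_const]
  refine integral_mono ((integrable_tailSq hα.le).mul_const _) hi fun x => ?_
  have h1 : max (|x| - α) 0 * α ≤ x ^ 2 := by
    rcases le_total (|x|) α with h | h
    · rw [max_eq_right (by linarith), zero_mul]; positivity
    · rw [max_eq_left (by linarith), ← sq_abs]
      nlinarith
  have h2 := pow_le_pow_left₀ (by positivity) h1 2
  calc max (|x| - α) 0 ^ 2 * α ^ 2 = (max (|x| - α) 0 * α) ^ 2 := by ring
    _ ≤ (x ^ 2) ^ 2 := h2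
    _ = x ^ 4 := by ring

lemma gphi_eq (x : ℝ) : gphi x = gaussianPDFReal 0 1 x := by
  simp [gphi, gaussianPDFReal]
  ring_nf

lemma hasDerivAt_gphi (x : ℝ) : HasDerivAt gphi (-x * gphi x) x := by
  have h : HasDerivAt (fun x : ℝ => -x ^ 2 / 2) (-x) x :=
    ((hasDerivAt_pow 2 x).fun_neg.div_const 2).congr_deriv (by simp; ring)
  refine (h.exp.div_const (Real.sqrt (2 * Real.pi))).congr_deriv ?_
  unfold gphi
  ring

lemma integrable_gphi : Integrable gphi := by
  have := integrable_gaussianPDFReal 0 1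
  rwa [show gphi = gaussianPDFReal 0 1 from funext gphi_eq]

lemma integral_Ioi_gphi (α : ℝ) : ∫ x in Set.Ioi α, gphi x = gPhi (-α) := by
  rw [gPhi, ← integral_comp_neg_Ioi]
  simp [gphi]

lemma integrable_gphi_mul {f : ℝ → ℝ} (hf : Integrable f (gaussianReal 0 1)) : Integrable fun x => gphi x * f x := by
  rw [gaussianReal_of_var_ne_zero _ one_ne_zero, integrable_withDensity_iff_integrable_smul'
    (measurable_gaussianPDF _ _) (.of_forall fun _ => gaussianPDF_lt_top)] at hf
  refine hf.congr (.of_forall fun x => ?_)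
  simp [gphi_eq, gaussianPDF, gaussianPDFReal_nonneg]

lemma integral_Ioi_gphi_mul_sq (α : ℝ) :
    ∫ x in Set.Ioi α, gphi x * (x - α) ^ 2 = (1 + α ^ 2) * gPhi (-α) - α * gphi α := by
  have hx : Integrable (fun x : ℝ => x) (gaussianReal 0 1) := (memLp_id_gaussianReal 1).integrable le_rfl
  have i0 := integrable_gphi_mul ((integrable_const (2 * α)).sub hx)
  have i1 := integrable_gphi_mul (integrable_sq_sub_gaussianReal α)
  have i2 : Integrable (fun x => (1 + α ^ 2) * gphi x) := integrable_gphi.const_mul _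
  have hd : ∀ x, HasDerivAt (fun x => gphi x * (2 * α - x)) (gphi x * (x - α) ^ 2 - (1 + α ^ 2) * gphi x) x := fun x => by
    refine ((hasDerivAt_gphi x).fun_mul ((hasDerivAt_id x).const_sub (2 * α))).congr_deriv ?_
    simp only [id]
    ring
  have hlim := tendsto_zero_of_hasDerivAt_of_integrableOn_Ioi (a := α) (fun x _ => hd x) (i1.sub i2).integrableOn
    i0.integrableOn
  have h1 := integral_Ioi_of_hasDerivAt_of_tendsto' (a := α) (fun x _ => hd x) (i1.sub i2).integrableOn hlim
  rw [integral_sub i1.integrableOn i2.integrableOn, integral_const_mul, integral_Ioi_gphi] at h1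
  linarith

lemma tailSq_eq {α : ℝ} (hα : 0 ≤ α) : tailSq α = 2 * ((1 + α ^ 2) * gPhi (-α) - α * gphi α) := by
  have h0 : tailSq α = ∫ x, gphi x * max (|x| - α) 0 ^ 2 := by
    rw [tailSq, integral_gaussianReal_eq_integral_smul one_ne_zero]
    simp [gphi_eq]
  have h1 : tailSq α = 2 * ∫ x in Set.Ioi (0 : ℝ), gphi x * max (x - α) 0 ^ 2 := by
    rw [h0, ← integral_comp_abs (f := fun x => gphi x * max (x - α) 0 ^ 2)]
    refine integral_congr_ae (.of_forall fun x => ?_)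
    simp [gphi]
  have h2 : ∫ x in Set.Ioi (0 : ℝ), gphi x * max (x - α) 0 ^ 2 = ∫ x in Set.Ioi α, gphi x * (x - α) ^ 2 := by
    rw [← integral_indicator measurableSet_Ioi, ← integral_indicator measurableSet_Ioi]
    refine integral_congr_ae (.of_forall fun x => ?_)
    simp only [Set.indicator, Set.mem_Ioi]
    split_ifs with h h' h'
    · rw [max_eq_left (by linarith)]
    · rw [max_eq_right (by linarith)]; simp
    · exact absurd (hα.trans_lt h') h
    · rfl
  rw [h1, h2, integral_Ioi_gphi_mul_sq]

lemma approxSparse_of_l0_le {N : ℕ} {α s δ : ℝ} (hα : 0 ≤ α) {θ : Fin N → ℝ} (hθ : (l0 θ : ℝ) ≤ s * N)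
    (h : s * (1 + α ^ 2 - tailSq α) + tailSq α ≤ δ) : ApproxSparse α δ 0 θ := by
  refine ⟨Finset.univ.filter fun i => θ i ≠ 0, ?_, ?_⟩
  · rw [Fintype.card_fin]
    have h1 : 0 ≤ 1 + α ^ 2 - tailSq α := by nlinarith [tailSq_le_one hα, sq_nonneg α]
    have h2 := mul_le_mul_of_nonneg_right hθ h1
    have h3 := mul_le_mul_of_nonneg_right h (Nat.cast_nonneg (α := ℝ) N)
    rw [l0] at h2
    linarith
  · rw [Finset.sum_eq_zero, zero_mul]
    intro j _
    simp

lemma approxSparse_of_mem_Fball {N : ℕ} {p ξ M α δ : ℝ} (hp : 0 < p) (hM : 0 < M) (hα : tailSq α ≤ δ / 4)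
    (hMα : ξ ^ p * (1 + α ^ 2) ≤ δ / 4 * M ^ p) {θ : Fin N → ℝ} (hθ : θ ∈ Fball N p ξ) :
    ApproxSparse α (δ / 2) M θ := by
  rcases Nat.eq_zero_or_pos N with rfl | hN
  · exact ⟨∅, by simp⟩
  have hN' : (0 : ℝ) < N := Nat.cast_pos.2 hN
  have hs : ∑ i, |θ i| ^ p ≤ ξ ^ p * N := by
    rw [Fball, Set.mem_ofPred_eq, one_div_mul_eq_div, div_le_iff₀ hN'] at hθ
    exact hθ
  have hMp : 0 < M ^ p := Real.rpow_pos_of_pos hM p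
  set S := Finset.univ.filter fun i => M < |θ i|
  have hS : S.card * M ^ p ≤ ξ ^ p * N := by
    refine le_trans ?_ hs
    rw [← nsmul_eq_mul]
    refine (Finset.card_nsmul_le_sum S (fun i => |θ i| ^ p) (M ^ p) fun i hi => ?_).trans
      (Finset.sum_le_sum_of_subset_of_nonneg (Finset.subset_univ S) fun _ _ _ => by positivity)
    exact Real.rpow_le_rpow hM.le (Finset.mem_filter.1 hi).2.le hp.le
  refine ⟨S, ?_, ?_⟩
  · rw [Fintype.card_fin]
    have h1 : S.card * (1 + α ^ 2) ≤ δ / 4 * N := by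
      refine le_of_mul_le_mul_right ?_ hMp
      have h2 := mul_le_mul_of_nonneg_right hS (show 0 ≤ 1 + α ^ 2 by positivity)
      have h3 := mul_le_mul_of_nonneg_right hMα hN'.le
      linarith
    have h2 := mul_le_mul_of_nonneg_right hα hN'.le
    have h3 : 0 ≤ S.card * tailSq α := mul_nonneg (Nat.cast_nonneg _) (tailSq_nonneg α)
    linarith
  · refine (Finset.sum_le_card_nsmul _ _ M fun j _ => ?_).trans (by simp [mul_comm])
    split_ifs with h
    · exact hM.le
    · simpa [S] using h

lemma exists_approxSparse {δ q : ℝ} (hδ : 0 < δ) {Dfam : (M : ℕ) → Set (Fin M → ℝ)} (hD : DFamSpec δ Dfam q) :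
    0 ≤ q ∧ ∃ α t M : ℝ, 0 < α ∧ 0 < t ∧ t < δ ∧ 0 ≤ M ∧ ∀ N, ∀ θ ∈ Dfam N, ApproxSparse α t M θ := by
  rcases hD with ⟨p, ξ, hp, hξ, hD, rfl⟩ | ⟨s, hs0, hs, hD, rfl⟩
  · refine ⟨le_max_right _ _, ?_⟩
    set C := ∫ x, x ^ 4 ∂(gaussianReal 0 1)
    have hC : 0 ≤ C := integral_nonneg fun x => by positivity
    set α := √(4 * (C + 1) / δ)
    have hα : 0 < α := Real.sqrt_pos.2 (by positivity)
    have hα2 : α ^ 2 = 4 * (C + 1) / δ := Real.sq_sqrt (by positivity)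
    have hk : tailSq α ≤ δ / 4 := by
      have h1 := tailSq_mul_sq_le hα
      refine le_of_mul_le_mul_right (h1.trans ?_) (by positivity : 0 < α ^ 2)
      rw [hα2]
      have : δ / 4 * (4 * (C + 1) / δ) = C + 1 := by field_simp
      rw [this]
      linarith
    set M := (ξ ^ p * (1 + α ^ 2) / (δ / 4)) ^ (1 / p)
    have hM : 0 < M := Real.rpow_pos_of_pos (by positivity) _
    refine ⟨α, δ / 2, M, hα, by positivity, by linarith, hM.le, fun N θ hθ => ?_⟩
    rw [hD] at hθ
    refine approxSparse_of_mem_Fball hp hM hk ?_ hθ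
    have : M ^ p = ξ ^ p * (1 + α ^ 2) / (δ / 4) := by
      rw [← Real.rpow_mul (by positivity), one_div_mul_cancel hp.ne', Real.rpow_one]
    rw [this]
    apply le_of_eq
    field_simp
  · refine ⟨le_rfl, ?_⟩
    rw [smax, mul_comm, ← div_lt_iff₀ hδ] at hs
    obtain ⟨_, ⟨α, hα, rfl⟩, h⟩ := exists_lt_of_lt_csSup (Set.Nonempty.image _ ⟨0, Set.self_mem_Ici⟩) hs
    rw [Set.mem_Ici] at hα
    have hk := tailSq_eq hα
    have hk1 := tailSq_le_one hα
    have e1 : 2 / δ * ((1 + α ^ 2) * gPhi (-α) - α * gphi α) = tailSq α / δ := by rw [hk]; ring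
    simp only [e1, ← hk] at h
    have hden : 0 ≤ 1 + α ^ 2 - tailSq α := by linarith [sq_nonneg α]
    have hα0 : 0 < α := by
      rcases hα.eq_or_lt with h0 | h0
      · exfalso
        have h2 : tailSq 0 = 1 := by
          have := integral_sq_sub_gaussianReal 0
          simpa [tailSq] using this
        rw [← h0, h2] at h
        norm_num at h
        exact absurd h (not_lt.2 (by positivity))
      · exact h0
    have hden' : 0 < 1 + α ^ 2 - tailSq α := by have := sq_pos_of_pos hα0; linarith
    rw [div_lt_div_iff₀ hδ hden'] at h
    have h3 : s * (1 + α ^ 2 - tailSq α) + tailSq α < δ := by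
      have : (1 - tailSq α / δ) * δ = δ - tailSq α := by field_simp
      linarith
    set t₀ := s * (1 + α ^ 2 - tailSq α) + tailSq α
    have ht0 : 0 ≤ t₀ := add_nonneg (mul_nonneg hs0 hden) (tailSq_nonneg α)
    refine ⟨α, (t₀ + δ) / 2, 0, hα0, by linarith, by linarith, le_rfl, fun N θ hθ => ?_⟩
    rw [hD, F0ball, Set.mem_ofPred_eq] at hθ
    exact approxSparse_of_l0_le hα hθ (by simp only [t₀] at h3 ⊢; linarith)

end Classes

section MaskedSystem

open scoped Matrix

variable {m ι : Type*} [Fintype m] [Fintype ι] [DecidableEq ι]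

/-- The matrix keeping only the columns in the support of `s`. -/
def maskMat (A : Matrix m ι ℝ) (s : ι → ℝ) : Matrix m ι ℝ := Matrix.of fun i j => if s j = 0 then 0 else A i j

/-- The Gram matrix of the columns in the support of `s`, completed by the identity. -/
def maskGram (A : Matrix m ι ℝ) (s : ι → ℝ) : Matrix ι ι ℝ :=
  (maskMat A s)ᵀ * maskMat A s + Matrix.diagonal fun j => if s j = 0 then 1 else 0

/-- The coefficients of the Lasso solution with sign pattern `s`. -/
def patCoef (A : Matrix m ι ℝ) (s : ι → ℝ) (l : ℝ) (y : m → ℝ) : ι → ℝ :=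
  (maskGram A s)⁻¹ *ᵥ ((maskMat A s)ᵀ *ᵥ y - l • s)

/-- The residual of the Lasso solution with sign pattern `s`. -/
def patRes (A : Matrix m ι ℝ) (s : ι → ℝ) (l : ℝ) (y : m → ℝ) : m → ℝ :=
  y - maskMat A s *ᵥ patCoef A s l y

/-- The vector in the span of the active columns with prescribed correlations `s`. -/
def patDir (A : Matrix m ι ℝ) (s : ι → ℝ) : m → ℝ := maskMat A s *ᵥ ((maskGram A s)⁻¹ *ᵥ s)

variable {A : Matrix m ι ℝ} {s t : ι → ℝ} {l : ℝ} {y : m → ℝ}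

lemma maskMat_mulVec (ht : ∀ j, s j = 0 → t j = 0) : maskMat A s *ᵥ t = A *ᵥ t := by
  ext i
  refine Finset.sum_congr rfl fun j _ => ?_
  by_cases h : s j = 0 <;> simp [maskMat, h, ht]

lemma maskMat_transpose_mulVec (v : m → ℝ) (j : ι) :
    ((maskMat A s)ᵀ *ᵥ v) j = if s j = 0 then 0 else (Aᵀ *ᵥ v) j := by
  by_cases h : s j = 0 <;> simp [maskMat, Matrix.mulVec, dotProduct, h]

lemma maskGram_mulVec (v : ι → ℝ) :
    maskGram A s *ᵥ v = (maskMat A s)ᵀ *ᵥ (maskMat A s *ᵥ v) + fun j => if s j = 0 then v j else 0 := by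
  rw [maskGram, Matrix.add_mulVec, Matrix.mulVec_mulVec]
  congr 1
  ext j
  simp [Matrix.mulVec_diagonal]

lemma isUnit_det_maskGram (h : ∀ t : ι → ℝ, (∀ j, s j = 0 → t j = 0) → A *ᵥ t = 0 → t = 0) :
    IsUnit (maskGram A s).det := by
  rw [isUnit_iff_ne_zero]
  intro h0
  obtain ⟨v, hv0, hv⟩ := Matrix.exists_mulVec_eq_zero_iff.2 h0
  have hoff : ∀ j, s j = 0 → v j = 0 := fun j hj => by
    have := congrFun hv j
    rw [maskGram_mulVec, Pi.add_apply, maskMat_transpose_mulVec] at this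
    simpa [hj] using this
  refine hv0 (h v hoff ?_)
  have h2 : (maskMat A s)ᵀ *ᵥ (maskMat A s *ᵥ v) = 0 := by
    rw [maskGram_mulVec] at hv
    have : (fun j => if s j = 0 then v j else 0) = 0 := by
      ext j
      by_cases hj : s j = 0 <;> simp [hj, hoff]
    rwa [this, add_zero] at hv
  have h3 : (maskMat A s *ᵥ v) ⬝ᵥ (maskMat A s *ᵥ v) = 0 := by
    rw [Matrix.dotProduct_mulVec, ← Matrix.mulVec_transpose, h2, zero_dotProduct]
  rw [← maskMat_mulVec hoff]
  exact dotProduct_self_eq_zero.1 h3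

lemma maskGram_inv_mulVec_apply (hG : IsUnit (maskGram A s).det) (v : ι → ℝ) {j : ι} (hj : s j = 0) :
    ((maskGram A s)⁻¹ *ᵥ v) j = v j := by
  have h1 : maskGram A s *ᵥ ((maskGram A s)⁻¹ *ᵥ v) = v := by
    rw [Matrix.mulVec_mulVec, Matrix.mul_nonsing_inv _ hG, Matrix.one_mulVec]
  have := congrFun h1 j
  rw [maskGram_mulVec, Pi.add_apply, maskMat_transpose_mulVec] at this
  simpa [hj] using this

lemma maskMat_transpose_mulVec_inv (hG : IsUnit (maskGram A s).det) {v : ι → ℝ} (hv : ∀ j, s j = 0 → v j = 0) :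
    (maskMat A s)ᵀ *ᵥ (maskMat A s *ᵥ ((maskGram A s)⁻¹ *ᵥ v)) = v := by
  have h1 : maskGram A s *ᵥ ((maskGram A s)⁻¹ *ᵥ v) = v := by
    rw [Matrix.mulVec_mulVec, Matrix.mul_nonsing_inv _ hG, Matrix.one_mulVec]
  rw [maskGram_mulVec] at h1
  have : (fun j => if s j = 0 then ((maskGram A s)⁻¹ *ᵥ v) j else 0) = 0 := by
    ext j
    by_cases hj : s j = 0 <;> simp [hj, hv, maskGram_inv_mulVec_apply hG]
  rwa [this, add_zero] at h1

lemma maskRhs_apply (l : ℝ) (y : m → ℝ) {j : ι} (hj : s j = 0) : ((maskMat A s)ᵀ *ᵥ y - l • s) j = 0 := by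
  rw [Pi.sub_apply, maskMat_transpose_mulVec]
  simp [hj]

lemma patCoef_apply (hG : IsUnit (maskGram A s).det) {j : ι} (hj : s j = 0) : patCoef A s l y j = 0 := by
  rw [patCoef, maskGram_inv_mulVec_apply hG _ hj, maskRhs_apply _ _ hj]

lemma maskMat_transpose_mulVec_patRes (hG : IsUnit (maskGram A s).det) :
    (maskMat A s)ᵀ *ᵥ patRes A s l y = l • s := by
  rw [patRes, Matrix.mulVec_sub, patCoef, maskMat_transpose_mulVec_inv hG fun j hj => maskRhs_apply l y hj]
  exact sub_sub_cancel _ _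

lemma eq_patCoef (hG : IsUnit (maskGram A s).det) (ht : ∀ j, s j = 0 → t j = 0)
    (h : (maskMat A s)ᵀ *ᵥ (y - A *ᵥ t) = l • s) : t = patCoef A s l y := by
  have h1 : maskGram A s *ᵥ t = (maskMat A s)ᵀ *ᵥ y - l • s := by
    rw [maskGram_mulVec, maskMat_mulVec ht, ← h, Matrix.mulVec_sub]
    ext j
    by_cases hj : s j = 0 <;> simp [hj, ht]
  rw [patCoef, ← h1, Matrix.mulVec_mulVec, Matrix.nonsing_inv_mul _ hG, Matrix.one_mulVec]

lemma eq_patRes (hG : IsUnit (maskGram A s).det) (ht : ∀ j, s j = 0 → t j = 0)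
    (h : (maskMat A s)ᵀ *ᵥ (y - A *ᵥ t) = l • s) : y - A *ᵥ t = patRes A s l y := by
  rw [patRes, ← eq_patCoef hG ht h, maskMat_mulVec ht]

lemma maskMat_transpose_mulVec_patDir (hG : IsUnit (maskGram A s).det) :
    (maskMat A s)ᵀ *ᵥ patDir A s = s :=
  maskMat_transpose_mulVec_inv hG fun _ h => h

/-- The linear part of the residual map, as a perturbation of the identity, has an explicit determinant. -/
lemma det_one_add_smul_patProj [DecidableEq m] (hG : IsUnit (maskGram A s).det) {c : ℝ} (hc : c ≠ 0) :
    (1 + (c - 1) • (1 - maskMat A s * (maskGram A s)⁻¹ * (maskMat A s)ᵀ) : Matrix m m ℝ).det =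
      c ^ Fintype.card m * c⁻¹ ^ (Finset.univ.filter fun j => s j ≠ 0).card := by
  set B := maskMat A s
  set G := maskGram A s
  have h1 : (1 + (c - 1) • (1 - B * G⁻¹ * Bᵀ) : Matrix m m ℝ) = c • (1 + B * (((1 - c) / c) • (G⁻¹ * Bᵀ))) := by
    rw [Matrix.mul_smul, smul_add, smul_smul, mul_div_cancel₀ _ hc, smul_sub, ← Matrix.mul_assoc, sub_smul, sub_smul,
      sub_smul]
    simp only [one_smul]
    abel
  have h2 : (1 + (((1 - c) / c) • (G⁻¹ * Bᵀ)) * B : Matrix ι ι ℝ) = Matrix.diagonal fun j => if s j ≠ 0 then c⁻¹ else 1 := by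
    have h3 : G⁻¹ * (Bᵀ * B) = Matrix.diagonal fun j => if s j ≠ 0 then 1 else 0 := by
      have h4 : Bᵀ * B = G - Matrix.diagonal fun j => if s j = 0 then 1 else 0 := by
        simp [G, maskGram, B]
      have h5 : G⁻¹ * Matrix.diagonal (fun j => if s j = 0 then (1 : ℝ) else 0) =
          Matrix.diagonal fun j => if s j = 0 then 1 else 0 := by
        have h6 : G * Matrix.diagonal (fun j => if s j = 0 then (1 : ℝ) else 0) =
            Matrix.diagonal fun j => if s j = 0 then 1 else 0 := by
          ext i j
          rw [Matrix.mul_diagonal]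
          by_cases hj : s j = 0
          · simp [G, maskGram, Matrix.mul_apply, maskMat, hj, Matrix.diagonal_apply]
          · simp [hj, Matrix.diagonal_apply]
            intro h; rw [h]; exact hj
        conv_lhs => rw [← h6]
        rw [← Matrix.mul_assoc, Matrix.nonsing_inv_mul _ hG, Matrix.one_mul]
      rw [h4, Matrix.mul_sub, Matrix.nonsing_inv_mul _ hG, h5]
      ext i j
      by_cases hij : i = j <;> by_cases hj : s j = 0 <;> simp [hij, hj]
    rw [Matrix.smul_mul, Matrix.mul_assoc, h3]
    ext i j
    by_cases hij : i = j
    · subst hij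
      by_cases hj : s i = 0
      · simp [hj]
      · simp [hj]; field_simp; ring
    · simp [hij]
  rw [h1, Matrix.det_smul, Matrix.det_one_add_mul_comm, h2, Matrix.det_diagonal]
  congr 1
  rw [Finset.prod_ite]
  simp

end MaskedSystem

section LassoOptimality

open scoped Matrix

variable {m ι : Type*} [Fintype m] [Fintype ι]

/-- The Lasso objective without normalization. -/
def l1Cost (A : Matrix m ι ℝ) (l : ℝ) (y : m → ℝ) (t : ι → ℝ) : ℝ :=
  (y - A *ᵥ t) ⬝ᵥ (y - A *ᵥ t) / 2 + l * ∑ j, |t j|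

/-- The first-order optimality conditions of the Lasso. -/
def IsKKT (A : Matrix m ι ℝ) (l : ℝ) (y : m → ℝ) (t : ι → ℝ) : Prop :=
  ∀ j, (Aᵀ *ᵥ (y - A *ᵥ t)) j * t j = l * |t j| ∧ |(Aᵀ *ᵥ (y - A *ᵥ t)) j| ≤ l

variable {A B : Matrix m ι ℝ} {l k : ℝ} {y w : m → ℝ} {t u : ι → ℝ}

lemma kkt_of_scalar {g x c l : ℝ} (h : ∀ s, 0 ≤ -s * g + s ^ 2 * c + l * (|x + s| - |x|)) (hl : 0 ≤ l) :
    g * x = l * |x| ∧ |g| ≤ l := by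
  have h1 : ∀ s, s * g ≤ s ^ 2 * |c| + l * |s| := fun s => by
    have h2 := h s
    have h3 : l * (|x + s| - |x|) ≤ l * |s| := mul_le_mul_of_nonneg_left (by linarith [abs_add_le x s]) hl
    have h4 : s ^ 2 * c ≤ s ^ 2 * |c| := mul_le_mul_of_nonneg_left (le_abs_self c) (sq_nonneg s)
    linarith
  have hg : |g| ≤ l := by
    refine le_of_forall_pos_le_add fun δ hδ => ?_
    set v := δ / (|c| + 1)
    have hv : 0 < v := by positivity
    have hvc : v * |c| ≤ δ := by
      rw [div_mul_eq_mul_div, div_le_iff₀ (by positivity)]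
      nlinarith
    rw [abs_le]
    have ha := h1 v
    have hb := h1 (-v)
    rw [abs_neg, abs_of_pos hv] at hb
    rw [abs_of_pos hv] at ha
    constructor
    · refine le_of_mul_le_mul_left ?_ hv
      nlinarith
    · refine le_of_mul_le_mul_left ?_ hv
      nlinarith
  refine ⟨le_antisymm ?_ ?_, hg⟩
  · calc g * x ≤ |g * x| := le_abs_self _
      _ = |g| * |x| := abs_mul _ _
      _ ≤ l * |x| := mul_le_mul_of_nonneg_right hg (abs_nonneg x)
  · refine le_of_forall_pos_le_add fun δ hδ => ?_
    set v := min 1 (δ / (x ^ 2 * |c| + 1))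
    have hv : 0 < v := lt_min one_pos (by positivity)
    have hv1 : v ≤ 1 := min_le_left _ _
    have hvc : v * (x ^ 2 * |c|) ≤ δ := by
      calc v * (x ^ 2 * |c|) ≤ δ / (x ^ 2 * |c| + 1) * (x ^ 2 * |c|) := by
            gcongr
            exact min_le_right _ _
        _ ≤ δ := by
          rw [div_mul_eq_mul_div, div_le_iff₀ (by positivity)]
          nlinarith
    have h2 := h (-(v * x))
    have h3 : |x + -(v * x)| = (1 - v) * |x| := by
      rw [← sub_eq_add_neg, show x - v * x = (1 - v) * x by ring, abs_mul, abs_of_nonneg (by linarith)]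
    rw [h3] at h2
    have h4 : (-(v * x)) ^ 2 * c ≤ v * (v * (x ^ 2 * |c|)) := by
      have : (-(v * x)) ^ 2 * c ≤ (-(v * x)) ^ 2 * |c| := mul_le_mul_of_nonneg_left (le_abs_self c) (sq_nonneg _)
      linarith [show (-(v * x)) ^ 2 * |c| = v * (v * (x ^ 2 * |c|)) by ring]
    refine le_of_mul_le_mul_left ?_ hv
    nlinarith [mul_le_mul_of_nonneg_left hvc hv.le]

lemma isKKT_of_isMinOn (hl : 0 ≤ l) (h : IsMinOn (l1Cost A l y) Set.univ t) : IsKKT A l y t := by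
  classical
  intro j
  set r := y - A *ᵥ t with hr
  set a : m → ℝ := fun i => A i j
  have hg : (Aᵀ *ᵥ r) j = a ⬝ᵥ r := rfl
  refine kkt_of_scalar (c := a ⬝ᵥ a / 2) (fun s => ?_) hl
  have h1 : l1Cost A l y t ≤ l1Cost A l y (t + Pi.single j s) := h (Set.mem_univ _)
  have h2 : y - A *ᵥ (t + Pi.single j s) = r - s • a := by
    rw [Matrix.mulVec_add, hr]
    ext i
    simp [a, Matrix.mulVec_single]
    ring
  have h3 : ∑ k, |(t + (Pi.single j s : ι → ℝ)) k| = ∑ k, |t k| + (|t j + s| - |t j|) := by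
    rw [← Finset.add_sum_erase _ _ (Finset.mem_univ j), ← Finset.add_sum_erase _ (fun k => |t k|) (Finset.mem_univ j)]
    have : ∑ k ∈ Finset.univ.erase j, |(t + (Pi.single j s : ι → ℝ)) k| = ∑ k ∈ Finset.univ.erase j, |t k| :=
      Finset.sum_congr rfl fun k hk => by simp [Finset.ne_of_mem_erase hk]
    rw [this]
    simp
    ring
  rw [l1Cost, l1Cost, h2, h3, ← hr] at h1
  clear_value r
  simp only [sub_dotProduct, dotProduct_sub, smul_dotProduct, dotProduct_smul, smul_eq_mul, dotProduct_comm r a] at h1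
  rw [hg]
  linarith

lemma exists_isKKT (hl : 0 < l) (A : Matrix m ι ℝ) (y : m → ℝ) : ∃ t, IsKKT A l y t := by
  have hc : Continuous (l1Cost A l y) := by
    unfold l1Cost
    fun_prop
  have hlow : ∀ t, l * ‖t‖ ≤ l1Cost A l y t := fun t => by
    have h1 : 0 ≤ (y - A *ᵥ t) ⬝ᵥ (y - A *ᵥ t) := by
      simpa using dotProduct_star_self_nonneg (y - A *ᵥ t)
    have h2 : ‖t‖ ≤ ∑ j, |t j| := (pi_norm_le_iff_of_nonneg (by positivity)).2 fun j =>
      Finset.single_le_sum (f := fun j => |t j|) (fun _ _ => abs_nonneg _) (Finset.mem_univ j)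
    have := mul_le_mul_of_nonneg_left h2 hl.le
    rw [l1Cost]
    linarith
  have ht : Filter.Tendsto (l1Cost A l y) (Filter.cocompact _) Filter.atTop :=
    Filter.tendsto_atTop_mono hlow ((tendsto_norm_cocompact_atTop).const_mul_atTop hl)
  obtain ⟨t, ht⟩ := hc.exists_forall_le ht
  exact ⟨t, isKKT_of_isMinOn hl.le fun u _ => ht u⟩

lemma IsKKT.dotProduct_self (h : IsKKT A l y t) : (y - A *ᵥ t) ⬝ᵥ A *ᵥ t = l * ∑ j, |t j| := by
  rw [Matrix.dotProduct_mulVec, ← Matrix.mulVec_transpose, dotProduct, Finset.mul_sum]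
  exact Finset.sum_congr rfl fun j _ => (h j).1

lemma IsKKT.dotProduct_le (h : IsKKT A l y t) (u : ι → ℝ) : (y - A *ᵥ t) ⬝ᵥ A *ᵥ u ≤ l * ∑ j, |u j| := by
  rw [Matrix.dotProduct_mulVec, ← Matrix.mulVec_transpose, dotProduct, Finset.mul_sum]
  refine Finset.sum_le_sum fun j _ => (le_abs_self _).trans ?_
  rw [abs_mul]
  exact mul_le_mul_of_nonneg_right (h j).2 (abs_nonneg _)

/-- Residuals at two regularization levels are close. -/
lemma IsKKT.param (h : IsKKT A l y t) (h' : IsKKT A k y u) (hl : 0 < l) (hk : 0 < k) :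
    k * ((y - A *ᵥ t - (y - A *ᵥ u)) ⬝ᵥ (y - A *ᵥ t - (y - A *ᵥ u))) ≤
      (k - l) * ((y - A *ᵥ u) ⬝ᵥ (y - A *ᵥ u - (y - A *ᵥ t))) := by
  have h1 := h.dotProduct_self
  have h2 := h'.dotProduct_self
  have h3 := mul_le_mul_of_nonneg_left (h.dotProduct_le u) hk.le
  have h4 := mul_le_mul_of_nonneg_left (h'.dotProduct_le t) hl.le
  set r := y - A *ᵥ t with hr
  set q := y - A *ᵥ u with hq
  rw [show A *ᵥ t = y - r by rw [hr]; abel] at h1 h4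
  rw [show A *ᵥ u = y - q by rw [hq]; abel] at h2 h3
  simp only [dotProduct_sub, sub_dotProduct] at *
  rw [dotProduct_comm q r] at *
  nlinarith

/-- The residual is a firmly nonexpansive function of the response. -/
lemma IsKKT.firm (h : IsKKT A l y t) (h' : IsKKT A l w u) :
    (y - A *ᵥ t - (w - A *ᵥ u)) ⬝ᵥ (y - A *ᵥ t - (w - A *ᵥ u)) ≤ (y - A *ᵥ t - (w - A *ᵥ u)) ⬝ᵥ (y - w) := by
  have h1 := h.dotProduct_self
  have h2 := h'.dotProduct_self
  have h3 := h.dotProduct_le u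
  have h4 := h'.dotProduct_le t
  set r := y - A *ᵥ t with hr
  set q := w - A *ᵥ u with hq
  rw [show A *ᵥ t = y - r by rw [hr]; abel] at h1 h4
  rw [show A *ᵥ u = w - q by rw [hq]; abel] at h2 h3
  simp only [dotProduct_sub, sub_dotProduct] at *
  rw [dotProduct_comm q r] at *
  linarith

lemma IsKKT.residual_eq (h : IsKKT A l y t) (h' : IsKKT A l y u) : y - A *ᵥ t = y - A *ᵥ u := by
  have h1 := h.firm h'
  rw [sub_self y, dotProduct_zero] at h1
  have h2 := dotProduct_self_eq_zero.1 (le_antisymm h1 (by simpa using dotProduct_star_self_nonneg (y - A *ᵥ t - (y - A *ᵥ u))))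
  exact sub_eq_zero.1 h2

lemma IsKKT.residual_le (hl : 0 ≤ l) (h : IsKKT A l y t) : (y - A *ᵥ t) ⬝ᵥ (y - A *ᵥ t) ≤ y ⬝ᵥ y ∧ l * ∑ j, |t j| ≤ y ⬝ᵥ y := by
  have h1 := h.dotProduct_self
  have hn : 0 ≤ l * ∑ j, |t j| := by positivity
  set r := y - A *ᵥ t with hr
  have h2 : A *ᵥ t = y - r := by rw [hr]; abel
  rw [h2, dotProduct_sub] at h1
  have h3 : 0 ≤ (y - r) ⬝ᵥ (y - r) := by simpa using dotProduct_star_self_nonneg (y - r)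
  have h4 : 0 ≤ r ⬝ᵥ r := by simpa using dotProduct_star_self_nonneg r
  simp only [dotProduct_sub, sub_dotProduct, dotProduct_comm y r] at h3
  constructor <;> linarith

/-- The residual vector of the Lasso. -/
def lassoRes (l : ℝ) (A : Matrix m ι ℝ) (y : m → ℝ) : m → ℝ :=
  open Classical in if h : ∃ t, IsKKT A l y t then y - A *ᵥ h.choose else 0

lemma IsKKT.lassoRes_eq (h : IsKKT A l y t) : lassoRes l A y = y - A *ᵥ t := by
  rw [lassoRes, dif_pos ⟨t, h⟩]
  exact (Exists.choose_spec (⟨t, h⟩ : ∃ t, IsKKT A l y t)).residual_eq h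

lemma lassoRes_sub_bound (hl : 0 < l) (A B : Matrix m ι ℝ) (y w : m → ℝ) :
    (lassoRes l A y - lassoRes l B w) ⬝ᵥ (lassoRes l A y - lassoRes l B w) ≤
      (lassoRes l A y - lassoRes l B w) ⬝ᵥ (y - w) + (√(y ⬝ᵥ y) * (w ⬝ᵥ w / l) + √(w ⬝ᵥ w) * (y ⬝ᵥ y / l)) * ∑ i, ∑ j, |A i j - B i j| := by
  obtain ⟨t, h⟩ := exists_isKKT hl A y
  obtain ⟨u, h'⟩ := exists_isKKT hl B w
  rw [h.lassoRes_eq, h'.lassoRes_eq]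
  have h1 := h.dotProduct_self
  have h2 := h'.dotProduct_self
  have h3 := h.dotProduct_le u
  have h4 := h'.dotProduct_le t
  have key : ∀ (A B : Matrix m ι ℝ) (r y w : m → ℝ) (u : ι → ℝ), r ⬝ᵥ r ≤ y ⬝ᵥ y → l * ∑ j, |u j| ≤ w ⬝ᵥ w →
      r ⬝ᵥ B *ᵥ u - r ⬝ᵥ A *ᵥ u ≤ √(y ⬝ᵥ y) * (w ⬝ᵥ w / l) * ∑ i, ∑ j, |A i j - B i j| := fun A B r y w u hr hu => by
    rw [← dotProduct_sub, ← Matrix.sub_mulVec, Finset.mul_sum]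
    refine Finset.sum_le_sum fun i _ => ?_
    have hri : |r i| ≤ √(y ⬝ᵥ y) := by
      rw [← Real.sqrt_sq_eq_abs]
      refine Real.sqrt_le_sqrt (le_trans ?_ hr)
      rw [sq]
      exact Finset.single_le_sum (f := fun i => r i * r i) (fun i _ => mul_self_nonneg _) (Finset.mem_univ i)
    have huj : ∀ j, |u j| ≤ w ⬝ᵥ w / l := fun j => by
      rw [le_div_iff₀ hl, mul_comm]
      refine le_trans ?_ hu
      exact mul_le_mul_of_nonneg_left (Finset.single_le_sum (f := fun j => |u j|) (fun _ _ => abs_nonneg _) (Finset.mem_univ j)) hl.le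
    calc r i * ((B - A) *ᵥ u) i ≤ |r i| * |((B - A) *ᵥ u) i| := by rw [← abs_mul]; exact le_abs_self _
      _ ≤ √(y ⬝ᵥ y) * ∑ j, |A i j - B i j| * (w ⬝ᵥ w / l) := by
        gcongr
        refine (Finset.abs_sum_le_sum_abs _ _).trans (Finset.sum_le_sum fun j _ => ?_)
        rw [abs_mul, abs_sub_comm (A i j)]
        exact mul_le_mul_of_nonneg_left (huj j) (abs_nonneg _)
      _ = _ := by rw [← Finset.sum_mul]; ring
  have h5 := key A B _ y w u (h.residual_le hl.le).1 (h'.residual_le hl.le).2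
  have h6 := key B A _ w y t (h'.residual_le hl.le).1 (h.residual_le hl.le).2
  simp_rw [abs_sub_comm (B _ _)] at h6
  set r := y - A *ᵥ t with hr
  set q := w - B *ᵥ u with hq
  rw [show A *ᵥ t = y - r by rw [hr]; abel] at h1 h6
  rw [show B *ᵥ u = w - q by rw [hq]; abel] at h2 h5
  simp only [dotProduct_sub, sub_dotProduct] at *
  rw [dotProduct_comm q r] at *
  linarith

lemma continuous_lassoRes (hl : 0 < l) : Continuous fun p : Matrix m ι ℝ × (m → ℝ) => lassoRes l p.1 p.2 := by
  refine continuous_iff_continuousAt.2 fun p => ?_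
  have hbd : ∀ (A B : Matrix m ι ℝ) (y w : m → ℝ), (lassoRes l A y - lassoRes l B w) ⬝ᵥ (lassoRes l A y - lassoRes l B w) ≤
      (y - w) ⬝ᵥ (y - w) + 2 * ((√(y ⬝ᵥ y) * (w ⬝ᵥ w / l) + √(w ⬝ᵥ w) * (y ⬝ᵥ y / l)) * ∑ i, ∑ j, |A i j - B i j|) := fun A B y w => by
    have h1 := lassoRes_sub_bound hl A B y w
    generalize lassoRes l A y - lassoRes l B w = d at *
    generalize y - w = v at *
    have h2 : 0 ≤ (d - v) ⬝ᵥ (d - v) := by simpa using dotProduct_star_self_nonneg (d - v)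
    rw [sub_dotProduct, dotProduct_sub, dotProduct_sub, dotProduct_comm v d] at h2
    linarith
  rw [ContinuousAt, tendsto_pi_nhds]
  intro i
  rw [tendsto_iff_dist_tendsto_zero]
  have hlim : Filter.Tendsto (fun q : Matrix m ι ℝ × (m → ℝ) => √((q.2 - p.2) ⬝ᵥ (q.2 - p.2) +
      2 * ((√(q.2 ⬝ᵥ q.2) * (p.2 ⬝ᵥ p.2 / l) + √(p.2 ⬝ᵥ p.2) * (q.2 ⬝ᵥ q.2 / l)) * ∑ i, ∑ j, |q.1 i j - p.1 i j|))) (nhds p) (nhds 0) := by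
    have hc : Continuous fun q : Matrix m ι ℝ × (m → ℝ) => √((q.2 - p.2) ⬝ᵥ (q.2 - p.2) +
      2 * ((√(q.2 ⬝ᵥ q.2) * (p.2 ⬝ᵥ p.2 / l) + √(p.2 ⬝ᵥ p.2) * (q.2 ⬝ᵥ q.2 / l)) * ∑ i, ∑ j, |q.1 i j - p.1 i j|)) := by
      fun_prop
    simpa using hc.tendsto p
  refine squeeze_zero (fun _ => dist_nonneg) (fun q => ?_) hlim
  rw [Real.dist_eq, ← Real.sqrt_sq_eq_abs]
  refine Real.sqrt_le_sqrt (le_trans ?_ (hbd _ _ _ _))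
  rw [sq]
  exact Finset.single_le_sum (f := fun i => (lassoRes l q.1 q.2 - lassoRes l p.1 p.2) i * (lassoRes l q.1 q.2 - lassoRes l p.1 p.2) i)
    (fun i _ => mul_self_nonneg _) (Finset.mem_univ i)

end LassoOptimality

section GaussianVector

open scoped Matrix

variable {m : Type*} [Fintype m]

/-- The standard Gaussian measure on functions. -/
def vecGauss (m : Type*) [Fintype m] : Measure (m → ℝ) := Measure.pi fun _ => gaussianReal 0 1

instance : IsProbabilityMeasure (vecGauss m) := by unfold vecGauss; infer_instance

/-- The Gaussian density on functions. -/
def vecDens (z : m → ℝ) : ℝ := (2 * Real.pi) ^ (-(Fintype.card m : ℝ) / 2) * Real.exp (-(z ⬝ᵥ z) / 2)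

lemma gaussDens_toLp (z : m → ℝ) : gaussDens (𝔼 m) (WithLp.toLp 2 z) = vecDens z := by
  rw [gaussDens, vecDens, EuclideanSpace.real_norm_sq_eq]
  simp [dotProduct, sq]

lemma lintegral_vecGauss {f : (m → ℝ) → ℝ≥0∞} (hf : Measurable f) :
    ∫⁻ z, f z ∂(vecGauss m) = ∫⁻ z, ENNReal.ofReal (vecDens z) * f z := by
  have h1 : ∫⁻ z, f z ∂(vecGauss m) = ∫⁻ x, f (WithLp.ofLp x) ∂(stdGaussian (𝔼 m)) := by
    rw [← map_pi_eq_stdGaussian, lintegral_map (by fun_prop) (by fun_prop)]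
    rfl
  rw [h1, lintegral_stdGaussian_eq, ← (PiLp.volume_preserving_toLp m).lintegral_comp_emb
    (MeasurableEquiv.toLp 2 (m → ℝ)).measurableEmbedding]
  refine lintegral_congr fun z => ?_
  rw [gaussDens_toLp]

/-- A Gaussian probability on a bounded set changes by at most an exponential factor under translation. -/
lemma vecGauss_shift_le {B : Set (m → ℝ)} (hB : MeasurableSet B) (h : m → ℝ) {C : ℝ} (hC : ∀ z ∈ B, z ⬝ᵥ z ≤ C) :
    vecGauss m {z | z + h ∈ B} ≤ ENNReal.ofReal (Real.exp (C / 2)) * vecGauss m B := by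
  have hB' : MeasurableSet {z | z + h ∈ B} := hB.preimage (measurable_id.add_const h)
  rw [← lintegral_indicator_one hB', ← lintegral_indicator_one hB, lintegral_vecGauss (measurable_one.indicator hB'),
    lintegral_vecGauss (measurable_one.indicator hB), ← lintegral_const_mul' _ _ ENNReal.ofReal_ne_top,
    ← lintegral_sub_right_eq_self _ h]
  refine lintegral_mono fun z => ?_
  by_cases hz : z ∈ B
  · have h1 : z - h ∈ {z | z + h ∈ B} := by simpa using hz
    simp only [Set.indicator_of_mem hz, Set.indicator_of_mem h1, Pi.one_apply, mul_one]
    rw [← ENNReal.ofReal_mul (Real.exp_pos _).le]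
    refine ENNReal.ofReal_le_ofReal ?_
    rw [vecDens, vecDens, mul_left_comm, ← Real.exp_add]
    have h2 : 0 ≤ (z - h) ⬝ᵥ (z - h) := by simpa using dotProduct_star_self_nonneg (z - h)
    gcongr
    linarith [hC z hz]
  · have h1 : z - h ∉ {z | z + h ∈ B} := by simpa using hz
    simp [Set.indicator_of_notMem h1]

lemma map_dotProduct_vecGauss {v : m → ℝ} (hv : v ≠ 0) :
    (vecGauss m).map (fun a => a ⬝ᵥ v) = (gaussianReal 0 1).map (fun x => √(v ⬝ᵥ v) * x) := by
  have hpos : 0 < v ⬝ᵥ v := lt_of_le_of_ne (by simpa using dotProduct_star_self_nonneg v)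
    fun h => hv (dotProduct_self_eq_zero.1 h.symm)
  set u : 𝔼 m := WithLp.toLp 2 ((√(v ⬝ᵥ v))⁻¹ • v) with hu
  have hn : ‖u‖ = 1 := by
    have : ‖u‖ ^ 2 = 1 := by
      rw [EuclideanSpace.real_norm_sq_eq]
      have : ∀ i, u i ^ 2 = (v ⬝ᵥ v)⁻¹ * (v i * v i) := fun i => by
        simp only [hu, Pi.smul_apply, smul_eq_mul, mul_pow, inv_pow, Real.sq_sqrt hpos.le]
        ring
      simp_rw [this, ← Finset.mul_sum]
      exact inv_mul_cancel₀ hpos.ne'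
    nlinarith [norm_nonneg u]
  rw [← map_inner_stdGaussian u hn, ← map_pi_eq_stdGaussian, Measure.map_map (by fun_prop) (by fun_prop),
    Measure.map_map (by fun_prop) (by fun_prop)]
  congr 1
  ext a
  have h2 : inner ℝ u (WithLp.toLp 2 a) = (√(v ⬝ᵥ v))⁻¹ * (a ⬝ᵥ v) := by
    rw [PiLp.inner_apply, show a ⬝ᵥ v = ∑ i, a i * v i from rfl, Finset.mul_sum]
    refine Finset.sum_congr rfl fun i _ => ?_
    simp [hu]
    ring
  simp only [Function.comp_apply, h2]
  rw [← mul_assoc, mul_inv_cancel₀ (Real.sqrt_pos.2 hpos).ne', one_mul]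

lemma gaussianReal_Icc_le (a b : ℝ) : gaussianReal 0 1 (Set.Icc a b) ≤ ENNReal.ofReal (b - a) := by
  rw [gaussianReal_of_var_ne_zero _ one_ne_zero, withDensity_apply _ measurableSet_Icc]
  calc ∫⁻ x in Set.Icc a b, gaussianPDF 0 1 x ≤ ∫⁻ x in Set.Icc a b, 1 := by
        refine lintegral_mono fun x => ?_
        rw [gaussianPDF, ← ENNReal.ofReal_one]
        refine ENNReal.ofReal_le_ofReal ?_
        rw [gaussianPDFReal]
        have h1 : (1 : ℝ) ≤ √(2 * Real.pi * ((1 : ℝ≥0) : ℝ)) := by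
          rw [Real.one_le_sqrt]
          simp only [NNReal.coe_one, mul_one]
          linarith [Real.pi_gt_three]
        have h2 : Real.exp (-(x - 0) ^ 2 / (2 * ((1 : ℝ≥0) : ℝ))) ≤ 1 := by
          rw [Real.exp_le_one_iff]
          have : (0 : ℝ) ≤ (x - 0) ^ 2 / (2 * ((1 : ℝ≥0) : ℝ)) := by positivity
          rw [neg_div]
          linarith
        exact mul_le_one₀ (inv_le_one_of_one_le₀ h1) (Real.exp_pos _).le h2
    _ = _ := by simp

/-- Anticoncentration of a Gaussian linear form near two opposite levels. -/
lemma vecGauss_band_le {v : m → ℝ} {β l k : ℝ} (hβ : 0 < β) (hv : β ^ 2 ≤ v ⬝ᵥ v) (hk : 0 ≤ k) :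
    vecGauss m {a | |(|a ⬝ᵥ v| - l)| ≤ k} ≤ ENNReal.ofReal (4 * k / β) := by
  have hv0 : v ≠ 0 := fun h => by
    rw [h, zero_dotProduct] at hv
    nlinarith
  have hs : β ≤ √(v ⬝ᵥ v) := Real.le_sqrt_of_sq_le hv
  set s := √(v ⬝ᵥ v)
  have hs0 : 0 < s := hβ.trans_le hs
  have hmeas : MeasurableSet {x : ℝ | |(|x| - l)| ≤ k} := measurableSet_le (by fun_prop) (by fun_prop)
  have h1 : vecGauss m {a | |(|a ⬝ᵥ v| - l)| ≤ k} = gaussianReal 0 1 {x | |(|s * x| - l)| ≤ k} := by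
    have := congrArg (fun μ : Measure ℝ => μ {x : ℝ | |(|x| - l)| ≤ k}) (map_dotProduct_vecGauss hv0)
    rwa [Measure.map_apply (by unfold dotProduct; fun_prop) hmeas, Measure.map_apply (by fun_prop) hmeas] at this
  rw [h1]
  have hsub : {x | |(|s * x| - l)| ≤ k} ⊆ Set.Icc ((l - k) / s) ((l + k) / s) ∪ Set.Icc ((-l - k) / s) ((-l + k) / s) := by
    intro x hx
    rw [Set.mem_ofPred_eq, abs_le] at hx
    simp only [Set.mem_union, Set.mem_Icc, div_le_iff₀ hs0, le_div_iff₀ hs0, mul_comm x s]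
    rcases le_total 0 (s * x) with h | h
    · rw [abs_of_nonneg h] at hx
      left; constructor <;> linarith [hx.1, hx.2]
    · rw [abs_of_nonpos h] at hx
      right; constructor <;> linarith [hx.1, hx.2]
  refine (measure_mono hsub).trans ((measure_union_le _ _).trans ?_)
  refine (add_le_add (gaussianReal_Icc_le _ _) (gaussianReal_Icc_le _ _)).trans ?_
  have h2 : ∀ x : ℝ, (x + k) / s - (x - k) / s = 2 * k / s := fun x => by field_simp; ring
  rw [h2, h2, ← ENNReal.ofReal_add (by positivity) (by positivity)]
  refine ENNReal.ofReal_le_ofReal ?_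
  rw [← add_div, show 2 * k + 2 * k = 4 * k by ring]
  gcongr

end GaussianVector

section SignPatterns

open scoped Matrix

variable {m ι : Type*} [Fintype m] [Fintype ι] [DecidableEq ι]

/-- A sign pattern as a real vector. -/
def patVec (s : ι → SignType) : ι → ℝ := fun j => (s j : ℝ)

lemma patVec_eq_zero {s : ι → SignType} {j : ι} : patVec s j = 0 ↔ s j = 0 := by
  unfold patVec
  cases s j <;> simp

lemma abs_patVec {s : ι → SignType} {j : ι} (h : s j ≠ 0) : |patVec s j| = 1 := by
  unfold patVec
  revert h
  cases s j <;> simp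

/-- No column has a correlation of modulus one with the direction of a sign pattern that excludes it. -/
def GenericDesign (A : Matrix m ι ℝ) : Prop :=
  ∀ (s : ι → SignType) (i : ι), s i = 0 → |(Aᵀ *ᵥ patDir A (patVec s)) i| ≠ 1

variable {A : Matrix m ι ℝ} {l : ℝ} {y : m → ℝ} {t u : ι → ℝ}

lemma dotProduct_mulVec_eq (v : m → ℝ) (t : ι → ℝ) : v ⬝ᵥ A *ᵥ t = ∑ j, (Aᵀ *ᵥ v) j * t j := by
  rw [Matrix.dotProduct_mulVec, ← Matrix.mulVec_transpose]
  rfl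

lemma GenericDesign.eq_zero (hA : GenericDesign A) {s : ι → SignType} {v : m → ℝ}
    (hv : ∀ j, s j ≠ 0 → (Aᵀ *ᵥ v) j = patVec s j) (T : Finset ι) :
    ∀ t : ι → ℝ, (∀ j, j ∉ T ∨ s j = 0 → t j = 0) → A *ᵥ t = 0 → t = 0 := by
  induction T using Finset.induction_on with
  | empty => exact fun t ht _ => funext fun j => ht j (Or.inl (Finset.notMem_empty j))
  | insert i T hi ih =>
    intro t ht h0
    by_cases hti : t i = 0
    · refine ih t (fun j hj => ?_) h0
      rcases hj with hj | hj
      · by_cases hji : j = i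
        · rw [hji, hti]
        · exact ht j (Or.inl (by simp [hji, hj]))
      · exact ht j (Or.inr hj)
    exfalso
    have hsi : s i ≠ 0 := fun h => hti (ht i (Or.inr h))
    set sT : ι → SignType := fun j => if j ∈ T then s j else 0 with hsT
    have hunit : IsUnit (maskGram A (patVec sT)).det := by
      refine isUnit_det_maskGram fun t' ht' h0' => ih t' (fun j hj => ht' j ?_) h0'
      rw [patVec_eq_zero]
      rcases hj with hj | hj <;> simp [hsT, hj]
    have hq : ∀ j, sT j ≠ 0 → (Aᵀ *ᵥ patDir A (patVec sT)) j = patVec sT j := fun j hj => by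
      have := congrFun (maskMat_transpose_mulVec_patDir hunit) j
      rwa [maskMat_transpose_mulVec, if_neg (by rwa [patVec_eq_zero])] at this
    set q := patDir A (patVec sT)
    have h1 := dotProduct_mulVec_eq (A := A) q t
    have h2 := dotProduct_mulVec_eq (A := A) v t
    rw [h0, dotProduct_zero] at h1 h2
    have h3 : ∑ j, ((Aᵀ *ᵥ q) j - (Aᵀ *ᵥ v) j) * t j = 0 := by
      simp_rw [sub_mul, Finset.sum_sub_distrib]
      linarith
    rw [Finset.sum_eq_single i] at h3
    · rcases mul_eq_zero.1 h3 with h4 | h4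
      · refine hA sT i (by simp [hsT, hi]) ?_
        rw [show (Aᵀ *ᵥ q) i = patVec s i by rw [← hv i hsi]; linarith]
        exact abs_patVec hsi
      · exact hti h4
    · intro j _ hji
      by_cases hj : j ∉ T ∨ s j = 0
      · rw [ht j, mul_zero]
        rcases hj with hj | hj
        · exact Or.inl (by simp [hji, hj])
        · exact Or.inr hj
      · push Not at hj
        have hs : sT j = s j := by simp [hsT, hj.1]
        rw [hq j (by rw [hs]; exact hj.2), hv j hj.2, patVec, patVec, hs, sub_self, zero_mul]
    · simp

/-- The responses for which the Lasso solution has sign pattern `s`. -/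
def patSet (A : Matrix m ι ℝ) (l : ℝ) (s : ι → SignType) : Set (m → ℝ) :=
  {y | (maskGram A (patVec s)).det ≠ 0 ∧ (∀ j, |(Aᵀ *ᵥ patRes A (patVec s) l y) j| ≤ l) ∧
    ∀ j, SignType.sign (patCoef A (patVec s) l y j) = s j}

lemma IsKKT.corr_eq (h : IsKKT A l y t) {j : ι} (hj : t j ≠ 0) :
    (Aᵀ *ᵥ (y - A *ᵥ t)) j = l * (SignType.sign (t j) : ℝ) := by
  refine mul_right_cancel₀ hj ?_
  rw [(h j).1, mul_assoc, sign_mul_self]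

lemma GenericDesign.mem_patSet (hA : GenericDesign A) (hl : 0 < l) (h : IsKKT A l y t) :
    y ∈ patSet A l (fun j => SignType.sign (t j)) ∧ patCoef A (patVec fun j => SignType.sign (t j)) l y = t ∧
      patRes A (patVec fun j => SignType.sign (t j)) l y = y - A *ᵥ t := by
  set s : ι → SignType := fun j => SignType.sign (t j) with hs
  have hs0 : ∀ j, patVec s j = 0 ↔ t j = 0 := fun j => by rw [patVec_eq_zero, hs, sign_eq_zero_iff]
  have hunit : IsUnit (maskGram A (patVec s)).det := by
    refine isUnit_det_maskGram fun t' ht' h0' => hA.eq_zero (s := s) (v := l⁻¹ • (y - A *ᵥ t)) (fun j hj => ?_)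
      Finset.univ t' (fun j hj => ht' j ?_) h0'
    · rw [Matrix.mulVec_smul, Pi.smul_apply, h.corr_eq (by simpa [hs] using hj), smul_eq_mul,
        inv_mul_cancel_left₀ hl.ne']
      rfl
    · rw [patVec_eq_zero]
      simpa using hj
  have ht : ∀ j, patVec s j = 0 → t j = 0 := fun j hj => (hs0 j).1 hj
  have hcorr : (maskMat A (patVec s))ᵀ *ᵥ (y - A *ᵥ t) = l • patVec s := by
    ext j
    rw [maskMat_transpose_mulVec, Pi.smul_apply, smul_eq_mul]
    by_cases hj : patVec s j = 0
    · simp [hj]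
    · rw [if_neg hj, h.corr_eq fun h0 => hj ((hs0 j).2 h0)]
      rfl
  have h1 := (eq_patCoef hunit ht hcorr).symm
  have h2 := (eq_patRes hunit ht hcorr).symm
  refine ⟨⟨isUnit_iff_ne_zero.1 hunit, fun j => ?_, fun j => ?_⟩, h1, h2⟩
  · rw [h2]; exact (h j).2
  · rw [h1]

lemma isKKT_of_mem_patSet {s : ι → SignType} (h : y ∈ patSet A l s) :
    IsKKT A l y (patCoef A (patVec s) l y) ∧ patRes A (patVec s) l y = y - A *ᵥ patCoef A (patVec s) l y := by
  obtain ⟨h0, h1, h2⟩ := h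
  have hunit := isUnit_iff_ne_zero.2 h0
  have hr : patRes A (patVec s) l y = y - A *ᵥ patCoef A (patVec s) l y := by
    rw [patRes, maskMat_mulVec fun j hj => patCoef_apply hunit hj]
  refine ⟨fun j => ⟨?_, by rw [← hr]; exact h1 j⟩, hr⟩
  rw [← hr]
  by_cases hj : s j = 0
  · have : patCoef A (patVec s) l y j = 0 := patCoef_apply hunit (patVec_eq_zero.2 hj)
    simp [this]
  · have h3 := congrFun (maskMat_transpose_mulVec_patRes (l := l) (y := y) hunit) j
    rw [maskMat_transpose_mulVec, if_neg (by rwa [patVec_eq_zero])] at h3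
    rw [h3, Pi.smul_apply, smul_eq_mul, mul_assoc, patVec, ← h2 j, sign_mul_self]

lemma GenericDesign.patSet_unique (hA : GenericDesign A) (hl : 0 < l) {s s' : ι → SignType} (h : y ∈ patSet A l s)
    (h' : y ∈ patSet A l s') : s = s' := by
  obtain ⟨k, -⟩ := isKKT_of_mem_patSet h
  obtain ⟨k', -⟩ := isKKT_of_mem_patSet h'
  set t := patCoef A (patVec s) l y
  set t' := patCoef A (patVec s') l y
  have hres := k.residual_eq k'
  set r := y - A *ᵥ t with hr
  set e : ι → SignType := fun j => if |(Aᵀ *ᵥ r) j| = l then SignType.sign ((Aᵀ *ᵥ r) j) else 0 with he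
  have hv : ∀ j, e j ≠ 0 → (Aᵀ *ᵥ (l⁻¹ • r)) j = patVec e j := fun j hj => by
    have hj' : |(Aᵀ *ᵥ r) j| = l := by
      by_contra h0
      exact hj (by simp [he, h0])
    rw [Matrix.mulVec_smul, Pi.smul_apply, smul_eq_mul, inv_mul_eq_iff_eq_mul₀ hl.ne', patVec,
      show e j = SignType.sign ((Aᵀ *ᵥ r) j) by simp [he, hj'], ← hj', abs_mul_sign]
  have hact : ∀ t : ι → ℝ, IsKKT A l y t → y - A *ᵥ t = r → ∀ j, t j ≠ 0 → e j ≠ 0 := fun t ht htr j hj => by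
    have h1 := ht.corr_eq hj
    rw [htr] at h1
    have h2 : |(Aᵀ *ᵥ r) j| = l := by
      rw [h1, abs_mul, abs_of_pos hl]
      have : |((SignType.sign (t j) : SignType) : ℝ)| = 1 := abs_patVec (s := fun j => SignType.sign (t j)) (by simpa using hj)
      rw [this, mul_one]
    have h3 : (Aᵀ *ᵥ r) j ≠ 0 := fun h0 => by
      rw [h0, abs_zero] at h2
      exact hl.ne h2
    simpa [he, h2] using h3
  have hd : t - t' = 0 := by
    refine hA.eq_zero hv Finset.univ _ (fun j hj => ?_) ?_
    · have hj : e j = 0 := by simpa using hj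
      have h1 : t j = 0 := by_contra fun h0 => hact t k rfl j h0 hj
      have h2 : t' j = 0 := by_contra fun h0 => hact t' k' hres.symm j h0 hj
      simp [h1, h2]
    · rw [Matrix.mulVec_sub, sub_eq_zero]
      exact sub_right_injective (hr.symm.trans hres)
  funext j
  rw [← h.2.2 j, ← h'.2.2 j]
  exact congrArg SignType.sign (congrFun (sub_eq_zero.1 hd) j)

end SignPatterns

section ResidualDilation

open scoped Matrix

variable {m ι : Type*} [Fintype m] [Fintype ι] [DecidableEq ι] {A : Matrix m ι ℝ} {l σ c : ℝ}

lemma patRes_eq [DecidableEq m] (s : ι → ℝ) (l : ℝ) (y : m → ℝ) :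
    patRes A s l y = (1 - maskMat A s * (maskGram A s)⁻¹ * (maskMat A s)ᵀ) *ᵥ y + l • patDir A s := by
  simp only [patRes, patCoef, patDir, Matrix.mulVec_sub, Matrix.mulVec_smul, Matrix.sub_mulVec, Matrix.one_mulVec,
    ← Matrix.mulVec_mulVec]
  abel

/-- The map that dilates the residual by the factor `c`, on the piece with sign pattern `s`. -/
def dilMap (A : Matrix m ι ℝ) (l σ c : ℝ) (b : m → ℝ) (s : ι → SignType) (z : m → ℝ) : m → ℝ :=
  z + ((c - 1) / σ) • patRes A (patVec s) l (b + σ • z)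

/-- The logarithmic weight of the residual dilation. -/
def dilWeight (A : Matrix m ι ℝ) (l σ c : ℝ) (b : m → ℝ) (s : ι → SignType) (z : m → ℝ) : ℝ :=
  ((Fintype.card m : ℝ) - (Finset.univ.filter fun j => s j ≠ 0).card) * Real.log c -
    (c - 1) / σ * (patRes A (patVec s) l (b + σ • z) ⬝ᵥ z) -
    ((c - 1) / σ) ^ 2 / 2 * (patRes A (patVec s) l (b + σ • z) ⬝ᵥ patRes A (patVec s) l (b + σ • z))

lemma exists_fderiv_dilMap (hσ : σ ≠ 0) (hc : 0 < c) (b : m → ℝ) {s : ι → SignType}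
    (hs : (maskGram A (patVec s)).det ≠ 0) : ∃ L : (m → ℝ) →L[ℝ] (m → ℝ), (∀ z, HasFDerivAt (dilMap A l σ c b s) L z) ∧
      |L.det| = Real.exp (((Fintype.card m : ℝ) - (Finset.univ.filter fun j => s j ≠ 0).card) * Real.log c) := by
  classical
  set Q : Matrix m m ℝ := 1 + (c - 1) • (1 - maskMat A (patVec s) * (maskGram A (patVec s))⁻¹ * (maskMat A (patVec s))ᵀ)
    with hQ
  have hcard : (Finset.univ.filter fun j => patVec s j ≠ 0) = Finset.univ.filter fun j => s j ≠ 0 := by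
    ext j
    simp [patVec_eq_zero]
  refine ⟨LinearMap.toContinuousLinearMap (Matrix.toLin' Q), fun z => ?_, ?_⟩
  · have h1 : dilMap A l σ c b s = fun z => LinearMap.toContinuousLinearMap (Matrix.toLin' Q) z + dilMap A l σ c b s 0 := by
      funext z
      simp only [dilMap, patRes_eq, LinearMap.coe_toContinuousLinearMap', Matrix.toLin'_apply, hQ, Matrix.add_mulVec,
        Matrix.one_mulVec, Matrix.smul_mulVec, smul_zero, add_zero, zero_add, Matrix.mulVec_add, Matrix.mulVec_smul,
        smul_add, smul_smul, div_mul_cancel₀ _ hσ]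
      abel
    rw [h1]
    exact (ContinuousLinearMap.hasFDerivAt _).add_const _
  · rw [LinearMap.det_toContinuousLinearMap, LinearMap.det_toLin', hQ,
      det_one_add_smul_patProj (isUnit_iff_ne_zero.2 hs) hc.ne', hcard, abs_of_pos (by positivity), sub_mul, Real.exp_sub,
      Real.exp_nat_mul, Real.exp_nat_mul, Real.exp_log hc, inv_pow, div_eq_mul_inv]

lemma vecDens_dilMap (b : m → ℝ) (s : ι → SignType) (z : m → ℝ) :
    Real.exp (((Fintype.card m : ℝ) - (Finset.univ.filter fun j => s j ≠ 0).card) * Real.log c) *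
      vecDens (dilMap A l σ c b s z) = Real.exp (dilWeight A l σ c b s z) * vecDens z := by
  rw [vecDens, vecDens, mul_left_comm, mul_left_comm (Real.exp (dilWeight A l σ c b s z)), ← Real.exp_add, ← Real.exp_add]
  congr 2
  rw [dilWeight, dilMap]
  generalize patRes A (patVec s) l (b + σ • z) = r
  simp only [dotProduct_add, add_dotProduct, smul_dotProduct, dotProduct_smul, smul_eq_mul, dotProduct_comm z r]
  ring

section Measurability

variable {Ω κ : Type*} [MeasurableSpace Ω] [Fintype κ]

lemma measurable_mulVec {M : Ω → Matrix m κ ℝ} {v : Ω → κ → ℝ} (hM : ∀ i j, Measurable fun ω => M ω i j)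
    (hv : ∀ j, Measurable fun ω => v ω j) (i : m) : Measurable fun ω => (M ω *ᵥ v ω) i :=
  Finset.measurable_fun_sum _ fun j _ => (hM i j).mul (hv j)

lemma measurable_matrix_det {M : Ω → Matrix ι ι ℝ} (hM : ∀ i j, Measurable fun ω => M ω i j) :
    Measurable fun ω => (M ω).det := by
  simp_rw [Matrix.det_apply]
  exact Finset.measurable_fun_sum _ fun p _ => (Finset.measurable_fun_prod _ fun i _ => hM _ _).const_smul _

lemma measurable_matrix_inv {M : Ω → Matrix ι ι ℝ} (hM : ∀ i j, Measurable fun ω => M ω i j) (i j : ι) :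
    Measurable fun ω => (M ω)⁻¹ i j := by
  simp_rw [Matrix.inv_def, Ring.inverse_eq_inv', Matrix.smul_apply, smul_eq_mul, Matrix.adjugate_apply]
  refine (measurable_matrix_det hM).inv.mul (measurable_matrix_det fun a b => ?_)
  by_cases h : a = j <;> simp [Matrix.updateRow_apply, h, hM]

variable {X : Ω → Matrix m ι ℝ} {y : Ω → m → ℝ}

lemma measurable_maskMat (hX : ∀ i j, Measurable fun ω => X ω i j) (s : ι → ℝ) (i : m) (j : ι) :
    Measurable fun ω => maskMat (X ω) s i j := by
  by_cases h : s j = 0 <;> simp [maskMat, h, hX]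

lemma measurable_maskGram (hX : ∀ i j, Measurable fun ω => X ω i j) (s : ι → ℝ) (i j : ι) :
    Measurable fun ω => maskGram (X ω) s i j := by
  simp only [maskGram, Matrix.add_apply, Matrix.mul_apply, Matrix.transpose_apply]
  exact (Finset.measurable_fun_sum _ fun k _ => (measurable_maskMat hX s k i).mul (measurable_maskMat hX s k j)).add_const _

lemma measurable_patCoef (hX : ∀ i j, Measurable fun ω => X ω i j) (hy : ∀ i, Measurable fun ω => y ω i) (s : ι → ℝ)
    (l : ℝ) (j : ι) : Measurable fun ω => patCoef (X ω) s l (y ω) j :=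
  measurable_mulVec (measurable_matrix_inv (measurable_maskGram hX s))
    (fun k => (measurable_mulVec (fun a b => measurable_maskMat hX s b a) hy k).sub_const _) j

lemma measurable_patRes (hX : ∀ i j, Measurable fun ω => X ω i j) (hy : ∀ i, Measurable fun ω => y ω i) (s : ι → ℝ)
    (l : ℝ) (i : m) : Measurable fun ω => patRes (X ω) s l (y ω) i :=
  (hy i).sub (measurable_mulVec (M := fun ω => maskMat (X ω) s) (v := fun ω => patCoef (X ω) s l (y ω))
    (measurable_maskMat hX s) (measurable_patCoef hX hy s l) i)

lemma measurable_patDir (hX : ∀ i j, Measurable fun ω => X ω i j) (s : ι → ℝ) (i : m) :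
    Measurable fun ω => patDir (X ω) s i :=
  measurable_mulVec (M := fun ω => maskMat (X ω) s) (v := fun ω => (maskGram (X ω) s)⁻¹ *ᵥ s) (measurable_maskMat hX s)
    (measurable_mulVec (M := fun ω => (maskGram (X ω) s)⁻¹) (v := fun _ => s)
      (measurable_matrix_inv (measurable_maskGram hX s)) fun _ => measurable_const) i

lemma measurableSet_patSet (hX : ∀ i j, Measurable fun ω => X ω i j) (hy : ∀ i, Measurable fun ω => y ω i) (l : ℝ)
    (s : ι → SignType) : MeasurableSet {ω | y ω ∈ patSet (X ω) l s} := by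
  have h3 : ∀ j, Measurable fun ω => |((X ω)ᵀ *ᵥ patRes (X ω) (patVec s) l (y ω)) j| := fun j =>
    (measurable_mulVec (fun a b => hX b a) (measurable_patRes hX hy (patVec s) l) j).abs
  have h4 : ∀ j, MeasurableSet {ω | SignType.sign (patCoef (X ω) (patVec s) l (y ω) j) = s j} := fun j => by
    have h5 := measurable_patCoef hX hy (patVec s) l j
    rcases h : s j with _ | _ | _
    · simp only [SignType.zero_eq_zero, sign_eq_zero_iff]
      exact measurableSet_eq_fun h5 measurable_const
    · simp only [SignType.neg_eq_neg_one, sign_eq_neg_one_iff]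
      exact measurableSet_lt h5 measurable_const
    · simp only [SignType.pos_eq_one, sign_eq_one_iff]
      exact measurableSet_lt measurable_const h5
  have h6 : {ω | y ω ∈ patSet (X ω) l s} = {ω | (maskGram (X ω) (patVec s)).det ≠ 0} ∩
      ((⋂ j, {ω | |((X ω)ᵀ *ᵥ patRes (X ω) (patVec s) l (y ω)) j| ≤ l}) ∩
        ⋂ j, {ω | SignType.sign (patCoef (X ω) (patVec s) l (y ω) j) = s j}) := by
    ext ω
    simp [patSet]
  rw [h6]
  exact ((measurableSet_eq_fun (measurable_matrix_det (measurable_maskGram hX _)) measurable_const).compl).inter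
    ((MeasurableSet.iInter fun j => measurableSet_le (h3 j) measurable_const).inter (MeasurableSet.iInter h4))

lemma measurable_dotProduct {v w : Ω → κ → ℝ} (hv : ∀ j, Measurable fun ω => v ω j) (hw : ∀ j, Measurable fun ω => w ω j) :
    Measurable fun ω => v ω ⬝ᵥ w ω :=
  Finset.measurable_fun_sum _ fun j _ => (hv j).mul (hw j)

lemma measurable_dilWeight {b z : Ω → m → ℝ} (hX : ∀ i j, Measurable fun ω => X ω i j)
    (hb : ∀ i, Measurable fun ω => b ω i) (hz : ∀ i, Measurable fun ω => z ω i) (l σ c : ℝ) (s : ι → SignType) :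
    Measurable fun ω => dilWeight (X ω) l σ c (b ω) s (z ω) := by
  have hr := measurable_patRes (y := fun ω => b ω + σ • z ω) hX (fun i => (hb i).add ((hz i).const_mul σ)) (patVec s) l
  exact (((measurable_dotProduct hr hz).const_mul _).const_sub _).sub ((measurable_dotProduct hr hr).const_mul _)

end Measurability

/-- The event that the logarithmic weight of the residual dilation is large. -/
def dilSet (A : Matrix m ι ℝ) (l σ c : ℝ) (b : m → ℝ) (x : ℝ) : Set (m → ℝ) :=
  ⋃ s, {z | b + σ • z ∈ patSet A l s ∧ x ≤ dilWeight A l σ c b s z}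

lemma measurableSet_dilSet {Ω : Type*} [MeasurableSpace Ω] {X : Ω → Matrix m ι ℝ} {b z : Ω → m → ℝ}
    (hX : ∀ i j, Measurable fun ω => X ω i j) (hb : ∀ i, Measurable fun ω => b ω i)
    (hz : ∀ i, Measurable fun ω => z ω i) (l σ c x : ℝ) : MeasurableSet {ω | z ω ∈ dilSet (X ω) l σ c (b ω) x} := by
  have h : {ω | z ω ∈ dilSet (X ω) l σ c (b ω) x} =
      ⋃ s, {ω | b ω + σ • z ω ∈ patSet (X ω) l s} ∩ {ω | x ≤ dilWeight (X ω) l σ c (b ω) s (z ω)} := by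
    ext ω
    simp [dilSet]
  rw [h]
  exact MeasurableSet.iUnion fun s => (measurableSet_patSet (y := fun ω => b ω + σ • z ω) hX
    (fun i => (hb i).add ((hz i).const_mul σ)) l s).inter (measurableSet_le measurable_const (measurable_dilWeight hX hb hz l σ c s))

/-- Exponential moment bound obtained from the change of variables that dilates the residual. -/
theorem vecGauss_dilWeight_le (hA : GenericDesign A) (hl : 0 < l) (hσ : 0 < σ) (hc : 0 < c) (b : m → ℝ) (x : ℝ) :
    vecGauss m (dilSet A l σ c b x) ≤ ENNReal.ofReal (Real.exp (-x)) := by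
  set B : (ι → SignType) → Set (m → ℝ) := fun s => {z | b + σ • z ∈ patSet A l s ∧ x ≤ dilWeight A l σ c b s z}
  have hBm : ∀ s, MeasurableSet (B s) := fun s => by
    exact (measurableSet_patSet (X := fun _ => A) (y := fun z => b + σ • z) (fun _ _ => measurable_const)
      (fun i => by
        simp only [Pi.add_apply, Pi.smul_apply, smul_eq_mul]
        fun_prop) l s).inter (measurableSet_le measurable_const
        (measurable_dilWeight (X := fun _ => A) (b := fun _ => b) (z := fun z => z) (fun _ _ => measurable_const)
          (fun _ => measurable_const) (fun i => measurable_pi_apply i) l σ c s))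
  have hinj : ∀ s s' z z', z ∈ B s → z' ∈ B s' → dilMap A l σ c b s z = dilMap A l σ c b s' z' → z = z' := by
    intro s s' z z' hz hz' he
    obtain ⟨k, hk⟩ := isKKT_of_mem_patSet hz.1
    obtain ⟨k', hk'⟩ := isKKT_of_mem_patSet hz'.1
    have hf := k.firm k'
    rw [← hk, ← hk', add_sub_add_left_eq_sub, ← smul_sub] at hf
    rw [dilMap, dilMap] at he
    set r := patRes A (patVec s) l (b + σ • z)
    set r' := patRes A (patVec s') l (b + σ • z')
    have hd : z - z' = -(((c - 1) / σ) • (r - r')) := by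
      rw [smul_sub, neg_sub, sub_eq_sub_iff_add_eq_add, he]
      abel
    rw [hd, smul_neg, smul_smul, mul_div_cancel₀ _ hσ.ne', dotProduct_neg, dotProduct_smul, smul_eq_mul] at hf
    have h0 : 0 ≤ (r - r') ⬝ᵥ (r - r') := by simpa using dotProduct_star_self_nonneg (r - r')
    have h1 : r - r' = 0 := dotProduct_self_eq_zero.1 (le_antisymm (by nlinarith) h0)
    rw [h1, smul_zero, neg_zero] at hd
    exact sub_eq_zero.1 hd
  have hpiece : ∀ s, ENNReal.ofReal (Real.exp x) * vecGauss m (B s) ≤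
      ∫⁻ z in dilMap A l σ c b s '' B s, ENNReal.ofReal (vecDens z) ∧ MeasurableSet (dilMap A l σ c b s '' B s) := fun s => by
    by_cases hs : (maskGram A (patVec s)).det ≠ 0
    swap
    · have : B s = ∅ := Set.eq_empty_of_forall_notMem fun z hz => hs hz.1.1
      simp [this]
    obtain ⟨L, hL, hdet⟩ := exists_fderiv_dilMap (l := l) hσ.ne' hc b hs
    have hinjs : Set.InjOn (dilMap A l σ c b s) (B s) := fun z hz z' hz' h => hinj s s z z' hz hz' h
    refine ⟨?_, measurable_image_of_fderivWithin (hBm s) (fun z _ => (hL z).hasFDerivWithinAt) hinjs⟩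
    rw [lintegral_image_eq_lintegral_abs_det_fderiv_mul volume (hBm s) (fun z _ => (hL z).hasFDerivWithinAt) hinjs,
      ← lintegral_indicator_one (hBm s), lintegral_vecGauss (measurable_one.indicator (hBm s)),
      ← lintegral_const_mul' _ _ ENNReal.ofReal_ne_top, ← lintegral_indicator (hBm s)]
    refine lintegral_mono fun z => ?_
    by_cases hz : z ∈ B s
    · simp only [Set.indicator_of_mem hz, Pi.one_apply, mul_one]
      rw [hdet, ← ENNReal.ofReal_mul (Real.exp_pos _).le, ← ENNReal.ofReal_mul (Real.exp_pos _).le, vecDens_dilMap]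
      refine ENNReal.ofReal_le_ofReal ?_
      have : 0 ≤ vecDens z := by unfold vecDens; positivity
      gcongr
      exact hz.2
    · simp [Set.indicator_of_notMem hz]
  have hdisj : Pairwise (Function.onFun Disjoint fun s => dilMap A l σ c b s '' B s) := fun s s' hss => by
    refine Set.disjoint_left.2 ?_
    rintro _ ⟨z, hz, rfl⟩ ⟨z', hz', he⟩
    have := hinj s' s z' z hz' hz he
    subst this
    exact hss (hA.patSet_unique hl hz.1 hz'.1)
  change vecGauss m (⋃ s, B s) ≤ _
  have hsum : ENNReal.ofReal (Real.exp x) * vecGauss m (⋃ s, B s) ≤ 1 := by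
    calc ENNReal.ofReal (Real.exp x) * vecGauss m (⋃ s, B s) ≤ ENNReal.ofReal (Real.exp x) * ∑' s, vecGauss m (B s) := by
          gcongr
          exact measure_iUnion_le _
      _ = ∑' s, ENNReal.ofReal (Real.exp x) * vecGauss m (B s) := ENNReal.tsum_mul_left.symm
      _ ≤ ∑' s, ∫⁻ z in dilMap A l σ c b s '' B s, ENNReal.ofReal (vecDens z) := ENNReal.tsum_le_tsum fun s => (hpiece s).1
      _ = ∫⁻ z in ⋃ s, dilMap A l σ c b s '' B s, ENNReal.ofReal (vecDens z) :=
          (lintegral_iUnion (fun s => (hpiece s).2) hdisj _).symm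
      _ ≤ ∫⁻ z, ENNReal.ofReal (vecDens z) := setLIntegral_le_lintegral _ _
      _ = 1 := by
          have := lintegral_vecGauss (m := m) (f := fun _ => 1) measurable_const
          simpa using this.symm
  rw [Real.exp_neg, ENNReal.ofReal_inv_of_pos (Real.exp_pos x), ← one_div]
  rw [ENNReal.le_div_iff_mul_le (Or.inl (by simpa using Real.exp_pos x)) (Or.inl ENNReal.ofReal_ne_top), mul_comm]
  exact hsum

end ResidualDilation

section ProductConditioning

variable {ι E F : Type*} [Fintype ι] [DecidableEq ι] [MeasurableSpace E] (μ : Measure E) [IsProbabilityMeasure μ]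

/-- If the constraint sets for the coordinates in `J` depend only on the other coordinates and each has mass at most
`p`, then all constraints hold simultaneously with probability at most `p ^ #J`. -/
lemma measure_pi_constraint_le (J : Finset ι) {q : (ι → E) → F} (hq : ∀ a b, (∀ j, j ∉ J → a j = b j) → q a = q b)
    {G : Set F} {D : F → Set E} {p : ℝ≥0∞} (hD : ∀ f ∈ G, μ (D f) ≤ p)
    (hm : MeasurableSet {a : ι → E | q a ∈ G ∧ ∀ j ∈ J, a j ∈ D (q a)}) :
    Measure.pi (fun _ : ι => μ) {a | q a ∈ G ∧ ∀ j ∈ J, a j ∈ D (q a)} ≤ p ^ J.card := by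
  set S := {a : ι → E | q a ∈ G ∧ ∀ j ∈ J, a j ∈ D (q a)}
  let : Fintype {j // j ∈ J} := Subtype.fintype fun j => j ∈ J
  have hmp := measurePreserving_piEquivPiSubtypeProd (fun _ : ι => μ) (· ∈ J)
  set e := MeasurableEquiv.piEquivPiSubtypeProd (fun _ : ι => E) (· ∈ J) with he
  have h1 : Measure.pi (fun _ : ι => μ) S = ((Measure.pi fun _ : {j // j ∈ J} => μ).prod
      (Measure.pi fun _ : {j // j ∉ J} => μ)) (e.symm ⁻¹' S) :=
    ((hmp.symm e).measure_preimage hm.nullMeasurableSet).symm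
  rw [h1, Measure.prod_apply_symm (e.symm.measurable hm)]
  calc _ ≤ ∫⁻ _ : {j // j ∉ J} → E, p ^ J.card ∂(Measure.pi fun _ => μ) := by
        refine lintegral_mono fun b => ?_
        by_cases hb : ∃ a, (a, b) ∈ e.symm ⁻¹' S
        · obtain ⟨a₀, ha₀⟩ := hb
          set f := q (e.symm (a₀, b))
          have hsub : (fun a => (a, b)) ⁻¹' (e.symm ⁻¹' S) ⊆ Set.pi Set.univ fun _ => D f := by
            intro a ha j _
            have h2 : q (e.symm (a, b)) = f := hq _ _ fun j hj => by
              simp [he, MeasurableEquiv.piEquivPiSubtypeProd, Equiv.piEquivPiSubtypeProd, hj]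
            have h3 := ha.2 j j.2
            rw [h2] at h3
            simpa [he, MeasurableEquiv.piEquivPiSubtypeProd, Equiv.piEquivPiSubtypeProd] using h3
          calc _ ≤ _ := measure_mono hsub
            _ = ∏ _ : {j // j ∈ J}, μ (D f) := Measure.pi_pi _ _
            _ ≤ ∏ _ : {j // j ∈ J}, p := Finset.prod_le_prod' fun _ _ => hD f ha₀.1
            _ = p ^ J.card := by simp [Finset.prod_const, Fintype.card_subtype]
        · have : (fun a => (a, b)) ⁻¹' (e.symm ⁻¹' S) = ∅ := Set.eq_empty_of_forall_notMem fun a ha => hb ⟨a, ha⟩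
          simp only [this, measure_empty, zero_le]
    _ = p ^ J.card := by simp

end ProductConditioning

section GaussianData

open scoped Matrix

variable {m ι : Type*} [Fintype m] [Fintype ι] [DecidableEq ι]

/-- Independent standard Gaussian columns together with a standard Gaussian noise vector. -/
def dataGauss (m ι : Type*) [Fintype m] [Fintype ι] : Measure ((ι → m → ℝ) × (m → ℝ)) :=
  (Measure.pi fun _ => vecGauss m).prod (vecGauss m)

instance : IsProbabilityMeasure (dataGauss m ι) := by unfold dataGauss; infer_instance

/-- The design matrix with given columns, scaled by `κ`. -/
def colMat (κ : ℝ) (a : ι → m → ℝ) : Matrix m ι ℝ := Matrix.of fun i j => κ * a j i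

lemma measurable_colMat (κ : ℝ) (i : m) (j : ι) : Measurable fun a : ι → m → ℝ => colMat κ a i j := by
  simp only [colMat, Matrix.of_apply]
  fun_prop

lemma colMat_transpose_mulVec (κ : ℝ) (a : ι → m → ℝ) (v : m → ℝ) (j : ι) :
    ((colMat κ a)ᵀ *ᵥ v) j = a j ⬝ᵥ (κ • v) := by
  simp only [colMat, Matrix.mulVec, dotProduct, Matrix.transpose_apply, Matrix.of_apply, Pi.smul_apply, smul_eq_mul]
  exact Finset.sum_congr rfl fun i _ => by ring

lemma maskMat_congr {A B : Matrix m ι ℝ} {s : ι → ℝ} (h : ∀ i j, s j ≠ 0 → A i j = B i j) : maskMat A s = maskMat B s := by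
  ext i j
  by_cases hj : s j = 0 <;> simp [maskMat, hj, h]

lemma patDir_congr {A B : Matrix m ι ℝ} {s : ι → ℝ} (h : ∀ i j, s j ≠ 0 → A i j = B i j) : patDir A s = patDir B s := by
  rw [patDir, patDir, maskGram, maskGram, maskMat_congr h]

lemma vecGauss_level_eq_zero (v : m → ℝ) : vecGauss m {a | |a ⬝ᵥ v| = 1} = 0 := by
  by_cases hv : v = 0
  · simp [hv]
  have hpos : 0 < v ⬝ᵥ v := lt_of_le_of_ne (by simpa using dotProduct_star_self_nonneg v)
    fun h => hv (dotProduct_self_eq_zero.1 h.symm)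
  have h := vecGauss_band_le (l := 1) (k := 0) (Real.sqrt_pos.2 hpos) (Real.sq_sqrt hpos.le).le le_rfl
  simpa [sub_eq_zero] using h

lemma measure_not_genericDesign (κ : ℝ) :
    Measure.pi (fun _ : ι => vecGauss m) {a | ¬GenericDesign (colMat κ a)} = 0 := by
  have h1 : {a : ι → m → ℝ | ¬GenericDesign (colMat κ a)} ⊆ ⋃ s : ι → SignType, ⋃ i ∈ {i | s i = 0},
      {a | patDir (colMat κ a) (patVec s) ∈ Set.univ ∧ ∀ j ∈ ({i} : Finset ι),
        a j ∈ {x | |x ⬝ᵥ (κ • patDir (colMat κ a) (patVec s))| = 1}} := by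
    intro a ha
    simp only [Set.mem_ofPred_eq, GenericDesign, not_forall, not_not] at ha
    obtain ⟨s, i, hs, h⟩ := ha
    simp only [Set.mem_iUnion]
    refine ⟨s, i, hs, trivial, fun j hj => ?_⟩
    rw [Finset.mem_singleton] at hj
    rw [hj, Set.mem_ofPred_eq, ← colMat_transpose_mulVec]
    exact h
  refine measure_mono_null h1 (measure_iUnion_null fun s => measure_iUnion_null fun i => measure_iUnion_null fun hi => ?_)
  refine le_antisymm ?_ zero_le
  have hdir := measurable_patDir (X := fun a : ι → m → ℝ => colMat κ a) (measurable_colMat κ) (patVec s)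
  refine (measure_pi_constraint_le (vecGauss m) {i} (q := fun a => patDir (colMat κ a) (patVec s))
    (fun a b hab => patDir_congr fun k j hj => ?_) (G := Set.univ) (D := fun v => {x | |x ⬝ᵥ (κ • v)| = 1})
    (p := 0) (fun v _ => (vecGauss_level_eq_zero _).le) ?_).trans (by simp)
  · have : j ≠ i := fun h => hj (patVec_eq_zero.2 (h ▸ hi))
    simp [colMat, hab j (by simpa using this)]
  · have : Measurable fun a : ι → m → ℝ => |a i ⬝ᵥ (κ • patDir (colMat κ a) (patVec s))| :=
      (measurable_dotProduct (v := fun a : ι → m → ℝ => a i) (w := fun a => κ • patDir (colMat κ a) (patVec s))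
        (fun k => by fun_prop) (fun k => (hdir k).const_mul κ)).abs
    simpa using measurableSet_eq_fun this measurable_const

/-- The dilation bound for random design. -/
lemma dataGauss_dilSet_le {κ l σ c : ℝ} (hl : 0 < l) (hσ : 0 < σ) (hc : 0 < c) (θ : ι → ℝ) (x : ℝ) :
    dataGauss m ι {p | p.2 ∈ dilSet (colMat κ p.1) l σ c (colMat κ p.1 *ᵥ θ) x} ≤ ENNReal.ofReal (Real.exp (-x)) := by
  have hX : ∀ i j, Measurable fun p : (ι → m → ℝ) × (m → ℝ) => colMat κ p.1 i j := fun i j =>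
    (measurable_colMat κ i j).comp measurable_fst
  have hb : ∀ i, Measurable fun p : (ι → m → ℝ) × (m → ℝ) => (colMat κ p.1 *ᵥ θ) i :=
    measurable_mulVec (M := fun p : (ι → m → ℝ) × (m → ℝ) => colMat κ p.1) (v := fun _ => θ) hX fun _ => measurable_const
  have hz : ∀ i, Measurable fun p : (ι → m → ℝ) × (m → ℝ) => p.2 i := fun i =>
    (measurable_pi_apply i).comp measurable_snd
  have hm := measurableSet_dilSet (X := fun p : (ι → m → ℝ) × (m → ℝ) => colMat κ p.1)
    (b := fun p => colMat κ p.1 *ᵥ θ) (z := fun p => p.2) hX hb hz l σ c x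
  rw [dataGauss, Measure.prod_apply hm]
  have hae : ∀ᵐ a ∂(Measure.pi fun _ : ι => vecGauss m), GenericDesign (colMat κ a) := measure_not_genericDesign κ
  refine (lintegral_mono_ae (g := fun _ => ENNReal.ofReal (Real.exp (-x))) (hae.mono fun a ha => ?_)).trans ?_
  · exact vecGauss_dilWeight_le ha hl hσ hc (colMat κ a *ᵥ θ) x
  · rw [lintegral_const, measure_univ, mul_one]

lemma dataGauss_not_generic (κ : ℝ) : dataGauss m ι {p | ¬GenericDesign (colMat κ p.1)} = 0 := by
  have h : {p : (ι → m → ℝ) × (m → ℝ) | ¬GenericDesign (colMat κ p.1)} =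
      {a | ¬GenericDesign (colMat κ a)} ×ˢ Set.univ := by
    ext p
    simp
  rw [h, dataGauss, Measure.prod_prod, measure_not_genericDesign, zero_mul]

lemma log_one_add_mul_ge {u k K : ℝ} (hu : |u| ≤ 1 / 2) (hk : |k| ≤ K) : k * u - 2 * u ^ 2 * K ≤ k * Real.log (1 + u) := by
  rw [abs_le] at hu hk
  have hpos : 0 < 1 + u := by linarith
  have h1 : Real.log (1 + u) ≤ u := by linarith [Real.log_le_sub_one_of_pos hpos]
  have h2 : u - 2 * u ^ 2 ≤ Real.log (1 + u) := by
    have h3 := Real.one_sub_inv_le_log_of_pos hpos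
    refine le_trans ?_ h3
    rw [inv_eq_one_div, le_sub_iff_add_le, ← le_sub_iff_add_le', div_le_iff₀ hpos]
    nlinarith [mul_nonneg (sq_nonneg u) (show 0 ≤ 1 + 2 * u by linarith)]
  rcases le_total 0 k with h | h
  · nlinarith
  · nlinarith

/-- The residual-noise correlation determines the number of nonzero coefficients up to exponentially small
probability. -/
theorem measure_support_deviation_le {κ l σ C Γ t : ℝ} (hl : 0 < l) (hσ : 0 < σ) (hC : 0 ≤ C) (hΓ : 0 ≤ Γ) (ht : 0 < t)
    (ht1 : t ≤ 1) (hN : (Fintype.card ι : ℝ) ≤ Γ * Fintype.card m) (θ : ι → ℝ) :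
    dataGauss m ι {p | ∃ u, IsKKT (colMat κ p.1) l (colMat κ p.1 *ᵥ θ + σ • p.2) u ∧
      ∃ r, r = colMat κ p.1 *ᵥ θ + σ • p.2 - colMat κ p.1 *ᵥ u ∧ r ⬝ᵥ r ≤ C * Fintype.card m ∧
      t * Fintype.card m ≤ |Fintype.card m - (Finset.univ.filter fun j => u j ≠ 0).card - r ⬝ᵥ p.2 / σ|} ≤
      2 * ENNReal.ofReal (Real.exp (-(t ^ 2 / (4 * (2 * (1 + Γ) + C / (2 * σ ^ 2))) * Fintype.card m))) := by
  set n : ℝ := (Fintype.card m : ℝ) with hn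
  set K := 2 * (1 + Γ) + C / (2 * σ ^ 2) with hK
  have hK2 : 2 ≤ K := by
    have : 0 ≤ C / (2 * σ ^ 2) := by positivity
    linarith
  set w := t / (2 * K) with hw
  have hw0 : 0 < w := by positivity
  have hw1 : w ≤ 1 / 2 := by
    rw [hw, div_le_iff₀ (by positivity)]
    linarith
  set x := t ^ 2 / (4 * K) * n with hx
  have hxw : w * (t * n) - K * w ^ 2 * n = x := by
    rw [hw, hx]
    field_simp
    ring
  set B : ℝ → Set ((ι → m → ℝ) × (m → ℝ)) := fun c => {p | p.2 ∈ dilSet (colMat κ p.1) l σ c (colMat κ p.1 *ᵥ θ) x}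
    with hB
  have hkey : ∀ (p : (ι → m → ℝ) × (m → ℝ)) (u : ι → ℝ) (r : m → ℝ), GenericDesign (colMat κ p.1) →
      IsKKT (colMat κ p.1) l (colMat κ p.1 *ᵥ θ + σ • p.2) u → r = colMat κ p.1 *ᵥ θ + σ • p.2 - colMat κ p.1 *ᵥ u →
      r ⬝ᵥ r ≤ C * n → ∀ v : ℝ, |v| = w →
      w * (t * n) ≤ v * (n - (Finset.univ.filter fun j => u j ≠ 0).card - r ⬝ᵥ p.2 / σ) → p ∈ B (1 + v) := by
    intro p u r hg hk hr hrC v hv hdev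
    obtain ⟨h1, -, h3⟩ := hg.mem_patSet hl hk
    set s : ι → SignType := fun j => SignType.sign (u j) with hs
    refine Set.mem_iUnion.2 ⟨s, h1, ?_⟩
    rw [dilWeight, h3, ← hr]
    have hcard : (Finset.univ.filter fun j => s j ≠ 0) = Finset.univ.filter fun j => u j ≠ 0 := by
      ext j
      simp [hs]
    rw [hcard]
    set df : ℝ := ((Finset.univ.filter fun j => u j ≠ 0).card : ℝ) with hdf
    have hdfN : df ≤ Fintype.card ι := by
      rw [hdf]
      exact_mod_cast Finset.card_le_univ (Finset.univ.filter fun j => u j ≠ 0)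
    have hv2 : v ^ 2 = w ^ 2 := by rw [← sq_abs, hv]
    have h4 : |n - df| ≤ (1 + Γ) * n := by
      rw [abs_le]
      constructor <;> nlinarith
    have h5 := log_one_add_mul_ge (by rw [hv]; exact hw1) h4
    have h6 : ((1 + v - 1) / σ) ^ 2 / 2 * (r ⬝ᵥ r) ≤ w ^ 2 * (C / (2 * σ ^ 2) * n) := by
      rw [add_sub_cancel_left, div_pow, hv2]
      calc w ^ 2 / σ ^ 2 / 2 * (r ⬝ᵥ r) ≤ w ^ 2 / σ ^ 2 / 2 * (C * n) := by gcongr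
        _ = _ := by field_simp
    have h7 : (1 + v - 1) / σ * (r ⬝ᵥ p.2) = v * (r ⬝ᵥ p.2 / σ) := by ring
    change x ≤ (n - df) * Real.log (1 + v) - (1 + v - 1) / σ * (r ⬝ᵥ p.2) - _
    rw [h7, ← hxw]
    rw [hv2] at h5
    have h8 : K * w ^ 2 * n = 2 * w ^ 2 * ((1 + Γ) * n) + w ^ 2 * (C / (2 * σ ^ 2) * n) := by rw [hK]; ring
    rw [h8]
    linarith
  have hsub : {p | ∃ u, IsKKT (colMat κ p.1) l (colMat κ p.1 *ᵥ θ + σ • p.2) u ∧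
      ∃ r, r = colMat κ p.1 *ᵥ θ + σ • p.2 - colMat κ p.1 *ᵥ u ∧ r ⬝ᵥ r ≤ C * n ∧
      t * n ≤ |n - (Finset.univ.filter fun j => u j ≠ 0).card - r ⬝ᵥ p.2 / σ|} ⊆
      {p | ¬GenericDesign (colMat κ p.1)} ∪ (B (1 + w) ∪ B (1 + -w)) := by
    rintro p ⟨u, hk, r, hr, hrC, hdev⟩
    by_cases hg : GenericDesign (colMat κ p.1)
    swap
    · exact Or.inl hg
    right
    rcases le_total 0 (n - (Finset.univ.filter fun j => u j ≠ 0).card - r ⬝ᵥ p.2 / σ) with h | h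
    · rw [abs_of_nonneg h] at hdev
      exact Or.inl (hkey p u r hg hk hr hrC w (abs_of_pos hw0) (mul_le_mul_of_nonneg_left hdev hw0.le))
    · rw [abs_of_nonpos h] at hdev
      refine Or.inr (hkey p u r hg hk hr hrC (-w) (by rw [abs_neg, abs_of_pos hw0]) ?_)
      have := mul_le_mul_of_nonneg_left hdev hw0.le
      linarith
  refine (measure_mono hsub).trans ((measure_union_le _ _).trans ?_)
  rw [dataGauss_not_generic, zero_add, two_mul]
  exact (measure_union_le _ _).trans (add_le_add (dataGauss_dilSet_le hl hσ (by linarith) θ x)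
    (dataGauss_dilSet_le hl hσ (by linarith) θ x))

end GaussianData

section LeaveOut

open scoped Matrix

variable {m ι : Type*} [Fintype m] [Fintype ι] [DecidableEq ι]

/-- Delete the columns indexed by `J`. -/
def dropCols (J : Finset ι) (a : ι → m → ℝ) : ι → m → ℝ := fun j => if j ∈ J then 0 else a j

lemma measurable_dropCols (J : Finset ι) : Measurable (dropCols J : (ι → m → ℝ) → ι → m → ℝ) := by
  refine measurable_pi_lambda _ fun j => ?_
  by_cases hj : j ∈ J
  · simp only [dropCols, hj, if_true]
    exact measurable_const
  · simp only [dropCols, hj, if_false]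
    exact measurable_pi_apply j

lemma continuous_colMat (κ : ℝ) : Continuous (colMat κ : (ι → m → ℝ) → Matrix m ι ℝ) :=
  continuous_matrix fun i j => by
    simp only [colMat, Matrix.of_apply]
    fun_prop

/-- The residual of the fit without the columns in `J`. -/
def dropRes (κ l σ : ℝ) (θ : ι → ℝ) (J : Finset ι) (a : ι → m → ℝ) (ζ : m → ℝ) : m → ℝ :=
  lassoRes l (colMat κ (dropCols J a)) (colMat κ (dropCols J a) *ᵥ θ + σ • ζ)

lemma measurable_dropRes {l : ℝ} (hl : 0 < l) (κ σ : ℝ) (θ : ι → ℝ) (J : Finset ι) :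
    Measurable fun p : (ι → m → ℝ) × (m → ℝ) => dropRes κ l σ θ J p.1 p.2 := by
  have h1 : Continuous fun p : (ι → m → ℝ) × (m → ℝ) => colMat κ p.1 := (continuous_colMat κ).comp continuous_fst
  have h2 : Continuous fun p : (ι → m → ℝ) × (m → ℝ) => colMat κ p.1 *ᵥ θ + σ • p.2 :=
    (h1.matrix_mulVec continuous_const).add (continuous_snd.const_smul σ)
  have hc : Measurable fun p : (ι → m → ℝ) × (m → ℝ) => lassoRes l (colMat κ p.1) (colMat κ p.1 *ᵥ θ + σ • p.2) :=
    Continuous.measurable (Continuous.comp (g := fun q : Matrix m ι ℝ × (m → ℝ) => lassoRes l q.1 q.2)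
      (continuous_lassoRes hl) (h1.prodMk h2))
  have hd : Measurable fun p : (ι → m → ℝ) × (m → ℝ) => (dropCols J p.1, p.2) :=
    ((measurable_dropCols J).comp measurable_fst).prodMk measurable_snd
  have he : (fun p : (ι → m → ℝ) × (m → ℝ) => dropRes κ l σ θ J p.1 p.2) =
      (fun p : (ι → m → ℝ) × (m → ℝ) => lassoRes l (colMat κ p.1) (colMat κ p.1 *ᵥ θ + σ • p.2)) ∘
        fun p => (dropCols J p.1, p.2) := by
    funext p
    simp only [Function.comp_apply, dropRes]
  rw [he]
  exact hc.comp hd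

/-- The deleted columns, as a shift of the noise. -/
def dropNoise (κ σ : ℝ) (θ : ι → ℝ) (J : Finset ι) (a : ι → m → ℝ) : m → ℝ :=
  σ⁻¹ • (colMat κ a *ᵥ θ - colMat κ (dropCols J a) *ᵥ θ)

lemma measurable_dropNoise (κ σ : ℝ) (θ : ι → ℝ) (J : Finset ι) :
    Measurable (dropNoise κ σ θ J : (ι → m → ℝ) → m → ℝ) := by
  have h1 : Measurable fun a : ι → m → ℝ => colMat κ a *ᵥ θ :=
    ((continuous_colMat κ).matrix_mulVec continuous_const).measurable
  exact (h1.sub (h1.comp (measurable_dropCols J))).const_smul σ⁻¹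

/-- If `R` does not involve the columns in `J`, then these columns are unlikely to be simultaneously almost critically
correlated with `R`, even after a shift of the noise. -/
theorem dataGauss_shift_band_le {κ l k β C : ℝ} (hk : 0 ≤ k) (hβ : 0 < β) (J : Finset ι)
    {R : (ι → m → ℝ) → (m → ℝ) → m → ℝ} {g : (ι → m → ℝ) → m → ℝ}
    (hres : Measurable fun p : (ι → m → ℝ) × (m → ℝ) => R p.1 p.2) (hg : Measurable g)
    (hR : ∀ a b ζ, (∀ j, j ∉ J → a j = b j) → R a ζ = R b ζ) :
    dataGauss m ι {p | (p.2 + g p.1) ⬝ᵥ (p.2 + g p.1) ≤ C ∧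
      β ^ 2 ≤ (κ • R p.1 (p.2 + g p.1)) ⬝ᵥ (κ • R p.1 (p.2 + g p.1)) ∧
      ∀ j ∈ J, |(|p.1 j ⬝ᵥ (κ • R p.1 (p.2 + g p.1))| - l)| ≤ k} ≤
      ENNReal.ofReal (Real.exp (C / 2)) * ENNReal.ofReal (4 * k / β) ^ J.card := by
  set B : Set ((ι → m → ℝ) × (m → ℝ)) := {p | p.2 ⬝ᵥ p.2 ≤ C} ∩ {p | R p.1 p.2 ∈
    {v : m → ℝ | β ^ 2 ≤ (κ • v) ⬝ᵥ (κ • v)} ∧ ∀ j ∈ J, p.1 j ∈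
      {x : m → ℝ | |(|x ⬝ᵥ (κ • R p.1 p.2)| - l)| ≤ k}}
  have hresi : ∀ i, Measurable fun p : (ι → m → ℝ) × (m → ℝ) => (κ • R p.1 p.2) i := fun i =>
    (measurable_pi_apply i).comp (hres.const_smul κ)
  have hsnd : ∀ i, Measurable fun p : (ι → m → ℝ) × (m → ℝ) => p.2 i := fun i =>
    (measurable_pi_apply i).comp measurable_snd
  have hfst : ∀ j i, Measurable fun p : (ι → m → ℝ) × (m → ℝ) => p.1 j i := fun j i =>
    (measurable_pi_apply i).comp ((measurable_pi_apply j).comp measurable_fst)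
  set B₂ : Set ((ι → m → ℝ) × (m → ℝ)) := {p | R p.1 p.2 ∈
    {v : m → ℝ | β ^ 2 ≤ (κ • v) ⬝ᵥ (κ • v)} ∧ ∀ j ∈ J, p.1 j ∈
      {x : m → ℝ | |(|x ⬝ᵥ (κ • R p.1 p.2)| - l)| ≤ k}} with hB₂
  have hmB₂ : MeasurableSet B₂ := by
    have h : B₂ = {p | β ^ 2 ≤ (κ • R p.1 p.2) ⬝ᵥ (κ • R p.1 p.2)} ∩
        ⋂ j ∈ J, {p | |(|p.1 j ⬝ᵥ (κ • R p.1 p.2)| - l)| ≤ k} := by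
      ext p
      simp [hB₂]
    rw [h]
    refine MeasurableSet.inter (measurableSet_le measurable_const (measurable_dotProduct
      (v := fun p : (ι → m → ℝ) × (m → ℝ) => κ • R p.1 p.2) (w := fun p => κ • R p.1 p.2) hresi hresi)) ?_
    refine Finset.measurableSet_biInter J fun j _ => measurableSet_le ?_ measurable_const
    exact ((measurable_dotProduct (v := fun p : (ι → m → ℝ) × (m → ℝ) => p.1 j) (w := fun p => κ • R p.1 p.2)
      (hfst j) hresi).abs.sub_const l).abs
  have hmB : MeasurableSet B := MeasurableSet.inter (measurableSet_le (measurable_dotProduct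
    (v := fun p : (ι → m → ℝ) × (m → ℝ) => p.2) (w := fun p => p.2) hsnd hsnd) measurable_const) hmB₂
  have hshift : Measurable fun p : (ι → m → ℝ) × (m → ℝ) => (p.1, p.2 + g p.1) :=
    measurable_fst.prodMk (measurable_snd.add (hg.comp measurable_fst))
  change dataGauss m ι ((fun p : (ι → m → ℝ) × (m → ℝ) => (p.1, p.2 + g p.1)) ⁻¹' B) ≤ _
  rw [dataGauss, Measure.prod_apply (hshift hmB)]
  have hslice : ∀ a : ι → m → ℝ, MeasurableSet (Prod.mk a ⁻¹' B) := fun a => measurable_prodMk_left hmB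
  calc _ ≤ ∫⁻ a : ι → m → ℝ, ENNReal.ofReal (Real.exp (C / 2)) * vecGauss m (Prod.mk a ⁻¹' B)
        ∂(Measure.pi fun _ => vecGauss m) :=
        lintegral_mono fun a => vecGauss_shift_le (hslice a) (g a) fun z hz => hz.1
    _ = ENNReal.ofReal (Real.exp (C / 2)) * ∫⁻ ζ, Measure.pi (fun _ : ι => vecGauss m) ((fun a => (a, ζ)) ⁻¹' B)
        ∂(vecGauss m) := by
        rw [lintegral_const_mul _ (measurable_measure_prodMk_left hmB), ← Measure.prod_apply hmB,
          Measure.prod_apply_symm hmB]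
    _ ≤ ENNReal.ofReal (Real.exp (C / 2)) * ∫⁻ _ : m → ℝ, ENNReal.ofReal (4 * k / β) ^ J.card ∂(vecGauss m) := by
        gcongr with ζ
        have hm2 : MeasurableSet {a : ι → m → ℝ | R a ζ ∈ {v : m → ℝ | β ^ 2 ≤ (κ • v) ⬝ᵥ (κ • v)} ∧
            ∀ j ∈ J, a j ∈ {x : m → ℝ | |(|x ⬝ᵥ (κ • R a ζ)| - l)| ≤ k}} := measurable_prodMk_right (y := ζ) hmB₂
        refine (measure_mono fun a ha => ha.2).trans (measure_pi_constraint_le (vecGauss m) J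
          (q := fun a => R a ζ) (fun a b hab => ?_) (G := {v : m → ℝ | β ^ 2 ≤ (κ • v) ⬝ᵥ (κ • v)})
          (D := fun v => {x : m → ℝ | |(|x ⬝ᵥ (κ • v)| - l)| ≤ k}) (fun v hv => vecGauss_band_le hβ hv hk) hm2)
        exact hR a b ζ hab
    _ = _ := by rw [lintegral_const, measure_univ, mul_one]

/-- Deleted columns are unlikely to be simultaneously almost critically correlated with the residual of the fit
without them. -/
theorem dataGauss_band_le {κ l σ k β C : ℝ} (hl : 0 < l) (hk : 0 ≤ k) (hβ : 0 < β) (θ : ι → ℝ) (J : Finset ι) :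
    dataGauss m ι {p | (p.2 + dropNoise κ σ θ J p.1) ⬝ᵥ (p.2 + dropNoise κ σ θ J p.1) ≤ C ∧
      β ^ 2 ≤ (κ • dropRes κ l σ θ J p.1 (p.2 + dropNoise κ σ θ J p.1)) ⬝ᵥ
        (κ • dropRes κ l σ θ J p.1 (p.2 + dropNoise κ σ θ J p.1)) ∧
      ∀ j ∈ J, |(|p.1 j ⬝ᵥ (κ • dropRes κ l σ θ J p.1 (p.2 + dropNoise κ σ θ J p.1))| - l)| ≤ k} ≤
      ENNReal.ofReal (Real.exp (C / 2)) * ENNReal.ofReal (4 * k / β) ^ J.card := by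
  refine dataGauss_shift_band_le hk hβ J (R := dropRes κ l σ θ J) (g := dropNoise κ σ θ J)
    (measurable_dropRes hl κ σ θ J) (measurable_dropNoise κ σ θ J) fun a b ζ hab => ?_
  have : dropCols J a = dropCols J b := by
    ext j : 1
    by_cases hj : j ∈ J <;> simp [dropCols, hj, hab]
  simp only [dropRes, this]

end LeaveOut

section LassoAsPenalizedLeastSquares

open scoped Matrix

variable {m ι : Type*} [Fintype m] [Fintype ι]

/-- A vector of reals with the Euclidean norm. -/
abbrev euc (v : m → ℝ) : 𝔼 m := WithLp.toLp 2 v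

lemma inner_euc (v w : m → ℝ) : inner ℝ (euc v) (euc w) = v ⬝ᵥ w := by
  simp only [PiLp.inner_apply, dotProduct]
  exact Finset.sum_congr rfl fun i _ => by simp [mul_comm]

lemma norm_euc_sq (v : m → ℝ) : ‖euc v‖ ^ 2 = v ⬝ᵥ v := by rw [← real_inner_self_eq_norm_sq, inner_euc]

lemma norm_euc_smul (κ : ℝ) (v : m → ℝ) : ‖euc (κ • v)‖ = |κ| * ‖euc v‖ := by
  rw [euc, WithLp.toLp_smul, norm_smul, Real.norm_eq_abs]

lemma euc_sub (v w : m → ℝ) : euc (v - w) = euc v - euc w := WithLp.toLp_sub _ _ _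

/-- The noise and the columns of the design as one matrix. -/
def dataVec (p : (ι → m → ℝ) × (m → ℝ)) : 𝔼 (m × Option ι) :=
  WithLp.toLp 2 fun q => q.2.elim (p.2 q.1) fun j => p.1 j q.1

/-- The scaled matrix of noise and design, as a linear map. -/
def dataMap (κ : ℝ) (p : (ι → m → ℝ) × (m → ℝ)) : 𝔼 (Option ι) →ₗ[ℝ] 𝔼 m :=
  κ • (matCLM (dataVec p)).toLinearMap

lemma dataMap_eq (κ : ℝ) (p : (ι → m → ℝ) × (m → ℝ)) (W : 𝔼 (Option ι)) :
    dataMap κ p W = κ • matVec (dataVec p) W := rfl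

lemma dataMap_apply (κ : ℝ) (p : (ι → m → ℝ) × (m → ℝ)) (W : 𝔼 (Option ι)) :
    dataMap κ p W = euc (κ • (W none • p.2) + colMat κ p.1 *ᵥ fun j => W (some j)) := by
  ext i
  simp only [dataMap_eq, matVec, dataVec, PiLp.smul_apply, smul_eq_mul, Fintype.sum_option, Option.elim, Pi.add_apply,
    Pi.smul_apply, Matrix.mulVec, dotProduct, colMat, Matrix.of_apply, mul_add, Finset.mul_sum]
  congr 1
  · ring
  · exact Finset.sum_congr rfl fun j _ => by ring

/-- The noise level together with the scaled estimation error. -/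
def errVec (κ σ : ℝ) (θ u : ι → ℝ) : 𝔼 (Option ι) :=
  WithLp.toLp 2 fun o => o.elim σ fun j => κ * (θ j - u j)

lemma errVec_none (κ σ : ℝ) (θ u : ι → ℝ) : errVec κ σ θ u none = σ := rfl

lemma errVec_some (κ σ : ℝ) (θ u : ι → ℝ) (j : ι) : errVec κ σ θ u (some j) = κ * (θ j - u j) := rfl

lemma inner_noiseDir_errVec (κ σ : ℝ) (θ u : ι → ℝ) : inner ℝ (noiseDir ι) (errVec κ σ θ u) = σ := by
  rw [inner_noiseDir, errVec_none]

lemma norm_errVec_sq (κ σ : ℝ) (θ u : ι → ℝ) : ‖errVec κ σ θ u‖ ^ 2 = σ ^ 2 + κ ^ 2 * ∑ j, (u j - θ j) ^ 2 := by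
  rw [norm_sq_option, errVec_none, Finset.mul_sum]
  congr 1
  refine Finset.sum_congr rfl fun j _ => ?_
  rw [errVec_some]
  ring

lemma colMat_mulVec_smul (κ c : ℝ) (a : ι → m → ℝ) (v : ι → ℝ) :
    (colMat κ a *ᵥ fun j => c * v j) = c • (colMat κ a *ᵥ v) := by
  rw [← Matrix.mulVec_smul]
  rfl

lemma dataMap_errVec (κ σ : ℝ) (p : (ι → m → ℝ) × (m → ℝ)) (θ u : ι → ℝ) :
    dataMap κ p (errVec κ σ θ u) = euc (κ • (colMat κ p.1 *ᵥ θ + σ • p.2 - colMat κ p.1 *ᵥ u)) := by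
  rw [dataMap_apply, errVec_none]
  have h : (fun j => errVec κ σ θ u (some j)) = fun j => κ * (θ - u) j := rfl
  rw [h, colMat_mulVec_smul, Matrix.mulVec_sub, ← smul_add]
  congr 2
  abel

lemma dataMap_noiseDir (κ : ℝ) (p : (ι → m → ℝ) × (m → ℝ)) : dataMap κ p (noiseDir ι) = euc (κ • p.2) := by
  rw [dataMap_apply, noiseDir_none, one_smul]
  have h : (fun j : ι => noiseDir ι (some j)) = 0 := funext fun j => noiseDir_some j
  rw [h, Matrix.mulVec_zero, add_zero]

lemma penCost_dataMap {κ : ℝ} (hκ : κ ≠ 0) (p : (ι → m → ℝ) × (m → ℝ)) (θ u : ι → ℝ) (σ l : ℝ) :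
    penCost (dataMap κ p) (lassoPen κ θ) l (errVec κ σ θ u) =
      κ ^ 2 * (l1Cost (colMat κ p.1) l (colMat κ p.1 *ᵥ θ + σ • p.2) u - l * ∑ j, |θ j|) := by
  rw [penCost, dataMap_errVec, norm_euc_smul, mul_pow, sq_abs, norm_euc_sq, l1Cost, lassoPen, Finset.sum_sub_distrib]
  have h : ∀ j, θ j - errVec κ σ θ u (some j) / κ = u j := fun j => by
    rw [errVec_some]
    field_simp
    ring
  simp only [h]
  ring

lemma isMinOn_penCost {κ : ℝ} (hκ : κ ≠ 0) {p : (ι → m → ℝ) × (m → ℝ)} {θ u : ι → ℝ} {σ l : ℝ}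
    (h : IsMinOn (l1Cost (colMat κ p.1) l (colMat κ p.1 *ᵥ θ + σ • p.2)) Set.univ u) :
    IsMinOn (penCost (dataMap κ p) (lassoPen κ θ) l) {w | inner ℝ (noiseDir ι) w = σ} (errVec κ σ θ u) := by
  rw [isMinOn_iff]
  intro W hW
  rw [Set.mem_ofPred_eq, inner_noiseDir] at hW
  have hWe : W = errVec κ σ θ fun j => θ j - W (some j) / κ := by
    ext o
    rcases o with _ | j
    · exact hW
    · rw [errVec_some]
      field_simp
      ring
  rw [hWe, penCost_dataMap hκ, penCost_dataMap hκ]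
  have := isMinOn_iff.1 h (fun j => θ j - W (some j) / κ) (Set.mem_univ _)
  gcongr

/-- Operator norm bounds for the design follow from those of the combined matrix. -/
lemma norm_colMat_mulVec_le {κ Λ : ℝ} {p : (ι → m → ℝ) × (m → ℝ)} (hop : ∀ W, ‖dataMap κ p W‖ ≤ Λ * ‖W‖) (w : ι → ℝ) :
    ‖euc (colMat κ p.1 *ᵥ w)‖ ≤ Λ * ‖euc w‖ := by
  have h := hop (WithLp.toLp 2 fun o => o.elim 0 w)
  have hn : ‖(WithLp.toLp 2 fun o : Option ι => o.elim 0 w : 𝔼 (Option ι))‖ = ‖euc w‖ := by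
    rw [← sq_eq_sq₀ (norm_nonneg _) (norm_nonneg _), norm_sq_option, norm_euc_sq]
    simp [dotProduct, sq]
  rw [hn, dataMap_apply] at h
  simpa using h

lemma norm_colMat_transpose_mulVec_le {κ Λ : ℝ} {p : (ι → m → ℝ) × (m → ℝ)}
    (hop : ∀ W, ‖dataMap κ p W‖ ≤ Λ * ‖W‖) (r : m → ℝ) : ‖euc ((colMat κ p.1)ᵀ *ᵥ r)‖ ≤ Λ * ‖euc r‖ := by
  set c := (colMat κ p.1)ᵀ *ᵥ r with hc
  rcases (norm_nonneg (euc c)).eq_or_lt with h0 | h0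
  · rw [← h0]
    have h1 : 0 ≤ Λ := by
      have h2 := (norm_nonneg _).trans (hop (noiseDir ι))
      rwa [norm_noiseDir, mul_one] at h2
    positivity
  have h1 : ‖euc c‖ ^ 2 = inner ℝ (euc r) (euc (colMat κ p.1 *ᵥ c)) := by
    rw [norm_euc_sq, inner_euc, Matrix.dotProduct_mulVec r, ← Matrix.mulVec_transpose (colMat κ p.1) r, ← hc]
  have h2 := real_inner_le_norm (euc r) (euc (colMat κ p.1 *ᵥ c))
  have h3 := mul_le_mul_of_nonneg_left (norm_colMat_mulVec_le hop c) (norm_nonneg (euc r))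
  refine le_of_mul_le_mul_right ?_ h0
  calc ‖euc c‖ * ‖euc c‖ = ‖euc c‖ ^ 2 := (sq _).symm
    _ ≤ ‖euc r‖ * (Λ * ‖euc c‖) := h1.le.trans (h2.trans h3)
    _ = _ := by ring

lemma abs_colMat_transpose_mulVec_le {κ Λ : ℝ} {p : (ι → m → ℝ) × (m → ℝ)}
    (hop : ∀ W, ‖dataMap κ p W‖ ≤ Λ * ‖W‖) (r : m → ℝ) (j : ι) : |((colMat κ p.1)ᵀ *ᵥ r) j| ≤ Λ * ‖euc r‖ :=
  (PiLp.norm_apply_le (euc ((colMat κ p.1)ᵀ *ᵥ r)) j).trans (norm_colMat_transpose_mulVec_le hop r)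

end LassoAsPenalizedLeastSquares

section SupportStability

open scoped Matrix

variable {m ι : Type*} [Fintype m] [Fintype ι]

lemma IsKKT.norm_residual_sub_le {A : Matrix m ι ℝ} {l k : ℝ} {y : m → ℝ} {t u : ι → ℝ} (h : IsKKT A l y t)
    (h' : IsKKT A k y u) (hl : 0 < l) (hk : 0 < k) :
    ‖euc (y - A *ᵥ t) - euc (y - A *ᵥ u)‖ ≤ |k - l| / k * ‖euc (y - A *ᵥ u)‖ := by
  have h1 := h.param h' hl hk
  rw [← norm_euc_sq, ← inner_euc, euc_sub, euc_sub (y - A *ᵥ u)] at h1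
  generalize euc (y - A *ᵥ t) = a at h1 ⊢
  generalize euc (y - A *ᵥ u) = b at h1 ⊢
  rcases (norm_nonneg (a - b)).eq_or_lt with h0 | h0
  · rw [← h0]
    positivity
  have h2 : (k - l) * inner ℝ b (b - a) ≤ |k - l| * (‖b‖ * ‖a - b‖) := by
    refine (le_abs_self _).trans ?_
    rw [abs_mul, norm_sub_rev a b]
    gcongr
    exact abs_real_inner_le_norm b (b - a)
  rw [div_mul_eq_mul_div, le_div_iff₀ hk]
  refine le_of_mul_le_mul_right ?_ h0
  linarith

lemma IsKKT.dropCols {κ l : ℝ} [DecidableEq ι] {a : ι → m → ℝ} {y : m → ℝ} {u : ι → ℝ} (h : IsKKT (colMat κ a) l y u)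
    (hl : 0 ≤ l) {J : Finset ι} (hJ : ∀ j ∈ J, u j = 0) :
    colMat κ (dropCols J a) *ᵥ u = colMat κ a *ᵥ u ∧ IsKKT (colMat κ (dropCols J a)) l y u := by
  have h1 : colMat κ (_root_.dropCols J a) *ᵥ u = colMat κ a *ᵥ u := by
    ext i
    simp only [Matrix.mulVec, dotProduct]
    refine Finset.sum_congr rfl fun j _ => ?_
    by_cases hj : j ∈ J
    · simp [hJ j hj]
    · simp [colMat, _root_.dropCols, hj]
  refine ⟨h1, fun j => ?_⟩
  rw [h1, colMat_transpose_mulVec]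
  by_cases hj : j ∈ J
  · simp [_root_.dropCols, hj, hJ j hj, hl]
  · simpa [_root_.dropCols, hj, colMat_transpose_mulVec] using h j

/-- If the coefficients in `J` vanish for one solution and not for another one at a nearby level, then the columns in
`J` are almost critically correlated with the residual of the fit without them. -/
lemma band_of_support_change [DecidableEq ι] {κ σ l a b lmin h Λ R₁ k β : ℝ} {p : (ι → m → ℝ) × (m → ℝ)} {θ u v : ι → ℝ}
    {J : Finset ι} {y : m → ℝ} (hy : y = colMat κ p.1 *ᵥ θ + σ • p.2) (hκ : 0 < κ) (hσ : 0 < σ)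
    (hop : ∀ W, ‖dataMap κ p W‖ ≤ Λ * ‖W‖)
    (hlmin : 0 < lmin) (hl : lmin ≤ l) (ha : lmin ≤ a) (hb : lmin ≤ b) (hal : |a - l| ≤ h) (hbl : |b - l| ≤ h)
    (hu : IsKKT (colMat κ p.1) a y u) (hv : IsKKT (colMat κ p.1) b y v)
    (huJ : ∀ j ∈ J, u j = 0) (hvJ : ∀ j ∈ J, v j ≠ 0) (hR : ‖errVec κ σ θ u‖ ≤ R₁)
    (hβ0 : 0 ≤ β) (hβ : β + 3 * (h / lmin * (Λ * R₁)) ≤ κ * ‖euc (y - colMat κ p.1 *ᵥ v)‖)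
    (hk : Λ * (3 * (h / lmin * (Λ * R₁)) / κ) + h ≤ k) :
    (p.2 + dropNoise κ σ θ J p.1) ⬝ᵥ (p.2 + dropNoise κ σ θ J p.1) ≤ (Λ * R₁) ^ 2 / (σ ^ 2 * κ ^ 2) ∧
      β ^ 2 ≤ (κ • dropRes κ l σ θ J p.1 (p.2 + dropNoise κ σ θ J p.1)) ⬝ᵥ
        (κ • dropRes κ l σ θ J p.1 (p.2 + dropNoise κ σ θ J p.1)) ∧
      ∀ j ∈ J, |(|p.1 j ⬝ᵥ (κ • dropRes κ l σ θ J p.1 (p.2 + dropNoise κ σ θ J p.1))| - l)| ≤ k := by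
  have hl0 : 0 < l := hlmin.trans_le hl
  have ha0 : 0 < a := hlmin.trans_le ha
  have hb0 : 0 < b := hlmin.trans_le hb
  have hh : 0 ≤ h := (abs_nonneg _).trans hal
  have hΛ : 0 ≤ Λ := by
    have h2 := (norm_nonneg _).trans (hop (noiseDir ι))
    rwa [norm_noiseDir, mul_one] at h2
  obtain ⟨hXu, hKu⟩ := hu.dropCols ha0.le huJ
  have hζ : colMat κ (dropCols J p.1) *ᵥ θ + σ • (p.2 + dropNoise κ σ θ J p.1) = y := by
    rw [hy, dropNoise, smul_add, smul_smul, mul_inv_cancel₀ hσ.ne', one_smul]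
    abel
  obtain ⟨w, hw⟩ := exists_isKKT hl0 (colMat κ (dropCols J p.1)) y
  have hres : dropRes κ l σ θ J p.1 (p.2 + dropNoise κ σ θ J p.1) = y - colMat κ (dropCols J p.1) *ᵥ w := by
    rw [dropRes, hζ]
    exact hw.lassoRes_eq
  have hru : κ * ‖euc (y - colMat κ p.1 *ᵥ u)‖ ≤ Λ * R₁ := by
    have h1 := hop (errVec κ σ θ u)
    rw [dataMap_errVec, ← hy, norm_euc_smul, abs_of_pos hκ] at h1
    exact h1.trans (mul_le_mul_of_nonneg_left hR hΛ)
  have hru' : ‖euc (y - colMat κ p.1 *ᵥ u)‖ ≤ Λ * R₁ / κ := by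
    rw [le_div_iff₀ hκ]
    linarith
  have hd1 := hw.norm_residual_sub_le hKu hl0 ha0
  have hd2 := hv.norm_residual_sub_le hu hb0 ha0
  rw [hXu] at hd1
  rw [hres]
  set r := y - colMat κ (dropCols J p.1) *ᵥ w with hr
  set ru := y - colMat κ p.1 *ᵥ u with hru_def
  set rv := y - colMat κ p.1 *ᵥ v with hrv_def
  have hd1' : ‖euc r - euc ru‖ ≤ h / lmin * (Λ * R₁ / κ) :=
    hd1.trans (mul_le_mul (div_le_div₀ hh hal hlmin ha) hru' (norm_nonneg _) (by positivity))
  have hd2' : ‖euc rv - euc ru‖ ≤ (2 * h) / lmin * (Λ * R₁ / κ) := by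
    refine hd2.trans (mul_le_mul (div_le_div₀ (by positivity) ?_ hlmin ha) hru' (norm_nonneg _) (by positivity))
    have h1 := abs_sub_le a l b
    rw [abs_sub_comm l b] at h1
    linarith
  have hd : ‖euc r - euc rv‖ ≤ 3 * (h / lmin * (Λ * R₁)) / κ := by
    have h1 := norm_sub_le_norm_sub_add_norm_sub (euc r) (euc ru) (euc rv)
    rw [norm_sub_rev (euc ru)] at h1
    have h2 : h / lmin * (Λ * R₁ / κ) + (2 * h) / lmin * (Λ * R₁ / κ) = 3 * (h / lmin * (Λ * R₁)) / κ := by ring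
    linarith
  refine ⟨?_, ?_, fun j hj => ?_⟩
  · set W : 𝔼 (Option ι) :=
      WithLp.toLp 2 fun o => o.elim σ fun j => if j ∈ J then κ * (θ j - u j) else 0 with hW
    have hWn : ‖W‖ ≤ R₁ := by
      refine le_trans ?_ hR
      rw [← sq_le_sq₀ (norm_nonneg _) (norm_nonneg _), norm_sq_option, norm_sq_option]
      refine add_le_add le_rfl (Finset.sum_le_sum fun j _ => ?_)
      by_cases hj : j ∈ J
      · simp [hW, hj, errVec]
      · simp only [hW, hj, Option.elim, if_false]
        rw [zero_pow two_ne_zero]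
        exact sq_nonneg _
    have hWe : dataMap κ p W = euc (κ • σ • (p.2 + dropNoise κ σ θ J p.1)) := by
      rw [dataMap_apply, dropNoise, smul_add σ, smul_smul σ, mul_inv_cancel₀ hσ.ne', one_smul]
      have h1 : (colMat κ p.1 *ᵥ fun j => W (some j)) = κ • (colMat κ p.1 *ᵥ θ - colMat κ (dropCols J p.1) *ᵥ θ) := by
        ext i
        simp only [Matrix.mulVec, dotProduct, Pi.sub_apply, Pi.smul_apply, smul_eq_mul]
        rw [← Finset.sum_sub_distrib, Finset.mul_sum]
        refine Finset.sum_congr rfl fun j _ => ?_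
        by_cases hj : j ∈ J
        · simp only [hW, colMat, Matrix.of_apply, dropCols, hj, if_true, Option.elim, huJ j hj, Pi.zero_apply]
          ring
        · simp [hW, colMat, dropCols, hj]
      rw [h1, smul_add κ]
      rfl
    have h1 := hop W
    rw [hWe, norm_euc_smul, norm_euc_smul, abs_of_pos hκ, abs_of_pos hσ] at h1
    have h2 := h1.trans (mul_le_mul_of_nonneg_left hWn hΛ)
    rw [← norm_euc_sq, le_div_iff₀ (by positivity)]
    calc _ = (κ * (σ * ‖euc (p.2 + dropNoise κ σ θ J p.1)‖)) ^ 2 := by ring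
      _ ≤ _ := by gcongr
  · rw [← norm_euc_sq, norm_euc_smul, abs_of_pos hκ]
    gcongr
    have h1 := norm_sub_norm_le (euc rv) (euc r)
    rw [norm_sub_rev] at h1
    have h2 := mul_le_mul_of_nonneg_left (h1.trans hd) hκ.le
    rw [mul_div_cancel₀ _ hκ.ne'] at h2
    linarith
  · rw [← colMat_transpose_mulVec]
    have h1 : |((colMat κ p.1)ᵀ *ᵥ rv) j| = b := by
      rcases lt_or_gt_of_ne (hvJ j hj) with h2 | h2
      · rw [hv.corr_eq h2.ne, sign_neg h2]
        simp [abs_of_pos hb0]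
      · rw [hv.corr_eq h2.ne', sign_pos h2]
        simp [abs_of_pos hb0]
    have h4 := abs_colMat_transpose_mulVec_le hop (r - rv) j
    rw [Matrix.mulVec_sub, Pi.sub_apply, euc_sub] at h4
    have h5 := (abs_abs_sub_abs_le_abs_sub _ _).trans (h4.trans (mul_le_mul_of_nonneg_left hd hΛ))
    rw [h1] at h5
    have h6 := abs_sub_le (|((colMat κ p.1)ᵀ *ᵥ r) j|) b l
    linarith

end SupportStability

section NoiseLevel

open scoped Matrix

variable {m ι : Type} [Fintype m] [Fintype ι] [DecidableEq ι]

/-- The events on which the effective noise level is well estimated, for penalty levels in a finite set `Q`. -/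
structure GoodData (κ σ lmin lmax Λ R₁ c₀ s t ε k d : ℝ) (Q : Finset ℝ) (θ : ι → ℝ)
    (p : (ι → m → ℝ) × (m → ℝ)) : Prop where
  op : ∀ W, ‖dataMap κ p W‖ ≤ Λ * ‖W‖
  bdd : ∀ l ∈ Set.Icc lmin lmax, ∀ W, inner ℝ (noiseDir ι) W = σ →
    IsMinOn (penCost (dataMap κ p) (lassoPen κ θ) l) {w | inner ℝ (noiseDir ι) w = σ} W → ‖W‖ ≤ R₁
  supp : ∀ l ∈ Q, ∀ u, IsKKT (colMat κ p.1) l (colMat κ p.1 *ᵥ θ + σ • p.2) u →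
    ∀ r, r = colMat κ p.1 *ᵥ θ + σ • p.2 - colMat κ p.1 *ᵥ u → r ⬝ᵥ r ≤ (Λ * R₁) ^ 2 * Fintype.card m →
    |Fintype.card m - (Finset.univ.filter fun j => u j ≠ 0).card - r ⬝ᵥ p.2 / σ| ≤ t * Fintype.card m
  gordon : ∀ l ∈ Q, ∀ w, inner ℝ (noiseDir ι) w = σ → ‖w‖ ≤ R₁ →
    IsMinOn (penCost (dataMap κ p) (lassoPen κ θ) l) {w | inner ℝ (noiseDir ι) w = σ} w → c₀ ≤ ‖dataMap κ p w‖ →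
    ∀ W, inner ℝ (noiseDir ι) W = σ → ‖W‖ ≤ R₁ →
    penCost (dataMap κ p) (lassoPen κ θ) l W ≤ penCost (dataMap κ p) (lassoPen κ θ) l w + d ^ 2 →
    |inner ℝ (dataMap κ p w) (dataMap κ p (noiseDir ι)) * ‖W‖ - σ * ‖dataMap κ p w‖| ≤ s
  band : ∀ l ∈ Q, ∀ J : Finset ι, ε * Fintype.card m ≤ J.card →
    ¬((p.2 + dropNoise κ σ θ J p.1) ⬝ᵥ (p.2 + dropNoise κ σ θ J p.1) ≤ (Λ * R₁) ^ 2 / (σ ^ 2 * κ ^ 2) ∧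
      (c₀ / 2) ^ 2 ≤ (κ • dropRes κ l σ θ J p.1 (p.2 + dropNoise κ σ θ J p.1)) ⬝ᵥ
        (κ • dropRes κ l σ θ J p.1 (p.2 + dropNoise κ σ θ J p.1)) ∧
      ∀ j ∈ J, |(|p.1 j ⬝ᵥ (κ • dropRes κ l σ θ J p.1 (p.2 + dropNoise κ σ θ J p.1))| - l)| ≤ k)

variable {κ σ lmin lmax Λ R₁ c₀ s t ε k d h : ℝ} {Q : Finset ℝ} {θ : ι → ℝ} {p : (ι → m → ℝ) × (m → ℝ)} {l a : ℝ}
  {u v : ι → ℝ}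

/-- `u` solves the Lasso problem at level `l`. -/
abbrev IsLasso (κ σ : ℝ) (θ : ι → ℝ) (p : (ι → m → ℝ) × (m → ℝ)) (l : ℝ) (u : ι → ℝ) : Prop :=
  IsMinOn (l1Cost (colMat κ p.1) l (colMat κ p.1 *ᵥ θ + σ • p.2)) Set.univ u

lemma GoodData.norm_errVec_le (hg : GoodData κ σ lmin lmax Λ R₁ c₀ s t ε k d Q θ p) (hκ : 0 < κ)
    (hl : l ∈ Set.Icc lmin lmax) (hu : IsLasso κ σ θ p l u) : ‖errVec κ σ θ u‖ ≤ R₁ :=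
  hg.bdd l hl _ (inner_noiseDir_errVec κ σ θ u) (isMinOn_penCost hκ.ne' hu)

lemma GoodData.nonneg (hg : GoodData κ σ lmin lmax Λ R₁ c₀ s t ε k d Q θ p) : 0 ≤ Λ := by
  have h2 := (norm_nonneg _).trans (hg.op (noiseDir ι))
  rwa [norm_noiseDir, mul_one] at h2

lemma GoodData.norm_dataMap_le (hg : GoodData κ σ lmin lmax Λ R₁ c₀ s t ε k d Q θ p) (hκ : 0 < κ)
    (hl : l ∈ Set.Icc lmin lmax) (hu : IsLasso κ σ θ p l u) : ‖dataMap κ p (errVec κ σ θ u)‖ ≤ Λ * R₁ :=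
  (hg.op _).trans (mul_le_mul_of_nonneg_left (hg.norm_errVec_le hκ hl hu) hg.nonneg)

/-- Bounds on the residual at a level in `Q` and its relation to the number of nonzero coefficients. -/
lemma GoodData.supp_dataMap (hg : GoodData κ σ lmin lmax Λ R₁ c₀ s t ε k d Q θ p) (hκ : 0 < κ)
    (hlmin : 0 < lmin) (hκn : κ ^ 2 * Fintype.card m = 1) (hlQ : l ∈ Q) (hl : l ∈ Set.Icc lmin lmax)
    (hu : IsLasso κ σ θ p l u) :
    |(1 - κ ^ 2 * (Finset.univ.filter fun j => u j ≠ 0).card) -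
      inner ℝ (dataMap κ p (errVec κ σ θ u)) (dataMap κ p (noiseDir ι)) / σ| ≤ t := by
  set r := colMat κ p.1 *ᵥ θ + σ • p.2 - colMat κ p.1 *ᵥ u with hr
  have hkkt := isKKT_of_isMinOn (hlmin.le.trans hl.1) hu
  have hκ2 : 0 < κ ^ 2 := by positivity
  have hrr : r ⬝ᵥ r ≤ (Λ * R₁) ^ 2 * Fintype.card m := by
    have h1 := hg.norm_dataMap_le hκ hl hu
    rw [dataMap_errVec, ← hr, norm_euc_smul, abs_of_pos hκ] at h1
    rw [← norm_euc_sq]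
    refine le_of_mul_le_mul_left ?_ hκ2
    calc κ ^ 2 * ‖euc r‖ ^ 2 = (κ * ‖euc r‖) ^ 2 := by ring
      _ ≤ (Λ * R₁) ^ 2 := by gcongr
      _ = (Λ * R₁) ^ 2 * (κ ^ 2 * Fintype.card m) := by rw [hκn, mul_one]
      _ = _ := by ring
  have h1 := mul_le_mul_of_nonneg_left (hg.supp l hlQ u hkkt r hr hrr) hκ2.le
  rw [dataMap_errVec, ← hr, dataMap_noiseDir, inner_euc, smul_dotProduct, dotProduct_smul]
  have h2 : κ ^ 2 * (t * Fintype.card m) = t := by rw [mul_left_comm, hκn, mul_one]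
  rw [h2] at h1
  have h3 : (1 - κ ^ 2 * ((Finset.univ.filter fun j => u j ≠ 0).card : ℝ)) - κ • κ • (r ⬝ᵥ p.2) / σ =
      κ ^ 2 * (Fintype.card m - ((Finset.univ.filter fun j => u j ≠ 0).card : ℝ) - r ⬝ᵥ p.2 / σ) := by
    rw [mul_sub, mul_sub, hκn, smul_eq_mul, smul_eq_mul]
    ring
  rw [h3, abs_mul, abs_of_pos hκ2]
  exact h1

lemma IsKKT.sq_mul_card_le {A : Matrix m ι ℝ} {y : m → ℝ} (hu : IsKKT A l y u) :
    l ^ 2 * (Finset.univ.filter fun j => u j ≠ 0).card ≤ ‖euc (Aᵀ *ᵥ (y - A *ᵥ u))‖ ^ 2 := by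
  rw [EuclideanSpace.norm_sq_eq, mul_comm, ← nsmul_eq_mul, ← Finset.sum_const]
  refine (Finset.sum_le_sum fun j hj => ?_).trans
    (Finset.sum_le_sum_of_subset_of_nonneg (Finset.filter_subset _ _) fun j _ _ => sq_nonneg _)
  have hj : u j ≠ 0 := by simpa using hj
  change _ ≤ ‖(Aᵀ *ᵥ (y - A *ᵥ u)) j‖ ^ 2
  rw [hu.corr_eq hj, Real.norm_eq_abs, sq_abs, mul_pow]
  rcases lt_or_gt_of_ne hj with h2 | h2
  · simp [sign_neg h2]
  · simp [sign_pos h2]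

lemma GoodData.le_norm_dataMap (hg : GoodData κ σ lmin lmax Λ R₁ c₀ s t ε k d Q θ p) (hκ : 0 < κ) (hσ : 0 < σ)
    (hlmin : 0 < lmin) (hκn : κ ^ 2 * Fintype.card m = 1) (hΛ : 0 < Λ) (ht : t ≤ 1 / 4) (hc1 : c₀ ≤ σ / (4 * Λ))
    (hc2 : c₀ ≤ lmin / (2 * Λ)) (hlQ : l ∈ Q) (hl : l ∈ Set.Icc lmin lmax) (hu : IsLasso κ σ θ p l u) :
    c₀ ≤ ‖dataMap κ p (errVec κ σ θ u)‖ := by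
  have h1 := hg.supp_dataMap hκ hlmin hκn hlQ hl hu
  have hkkt := isKKT_of_isMinOn (hlmin.le.trans hl.1) hu
  set df : ℝ := ((Finset.univ.filter fun j => u j ≠ 0).card : ℝ)
  set ρ := ‖dataMap κ p (errVec κ σ θ u)‖ with hρ
  rcases le_total (κ ^ 2 * df) (1 / 2) with hd | hd
  · refine hc1.trans ?_
    have h2 : 1 / 4 ≤ inner ℝ (dataMap κ p (errVec κ σ θ u)) (dataMap κ p (noiseDir ι)) / σ := by
      have := (abs_le.1 h1).2
      linarith
    have h3 := real_inner_le_norm (dataMap κ p (errVec κ σ θ u)) (dataMap κ p (noiseDir ι))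
    have h4 := hg.op (noiseDir ι)
    rw [norm_noiseDir, mul_one] at h4
    have h5 := h3.trans (mul_le_mul_of_nonneg_left h4 (norm_nonneg _))
    rw [le_div_iff₀ hσ] at h2
    rw [div_le_iff₀ (by positivity)]
    linarith
  · refine hc2.trans ?_
    rw [div_le_iff₀ (by positivity), ← sq_le_sq₀ hlmin.le (by positivity)]
    have h2 := hkkt.sq_mul_card_le
    have h3 := norm_colMat_transpose_mulVec_le hg.op (colMat κ p.1 *ᵥ θ + σ • p.2 - colMat κ p.1 *ᵥ u)
    have h4 : ρ = κ * ‖euc (colMat κ p.1 *ᵥ θ + σ • p.2 - colMat κ p.1 *ᵥ u)‖ := by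
      rw [hρ, dataMap_errVec, norm_euc_smul, abs_of_pos hκ]
    have h5 := h2.trans (pow_le_pow_left₀ (norm_nonneg _) h3 2)
    have hl2 : lmin ^ 2 ≤ l ^ 2 := pow_le_pow_left₀ hlmin.le hl.1 2
    have h6 := mul_le_mul_of_nonneg_left h5 (sq_nonneg κ)
    have h7 : l ^ 2 * (1 / 2) ≤ l ^ 2 * (κ ^ 2 * df) := by gcongr
    have h8 : κ ^ 2 * (Λ * ‖euc (colMat κ p.1 *ᵥ θ + σ • p.2 - colMat κ p.1 *ᵥ u)‖) ^ 2 = (Λ * ρ) ^ 2 := by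
      rw [h4]
      ring
    have h9 : (ρ * (2 * Λ)) ^ 2 = 4 * (Λ * ρ) ^ 2 := by ring
    have h10 := sq_nonneg (Λ * ρ)
    rw [h9]
    linarith

lemma convexOn_lassoPen_slice (κ σ : ℝ) (θ : ι → ℝ) :
    ConvexOn ℝ {w | inner ℝ (noiseDir ι) w = σ} (lassoPen κ θ) :=
  (convexOn_lassoPen κ θ).subset (Set.subset_univ _) (convex_hyperplane (innerₛₗ ℝ (noiseDir ι)).isLinear σ)

/-- Change of the residual between nearby levels. -/
lemma GoodData.norm_dataMap_sub_le (hg : GoodData κ σ lmin lmax Λ R₁ c₀ s t ε k d Q θ p) (hκ : 0 < κ)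
    (hlmin : 0 < lmin) (hl : l ∈ Set.Icc lmin lmax) (hu : IsLasso κ σ θ p l u) (ha : a ∈ Set.Icc lmin lmax)
    (hv : IsLasso κ σ θ p a v) (hla : |l - a| ≤ h) :
    ‖dataMap κ p (errVec κ σ θ u) - dataMap κ p (errVec κ σ θ v)‖ ≤ h / lmin * (Λ * R₁) := by
  have h1 := norm_sub_le_of_param (e := dataMap κ p) (convexOn_lassoPen_slice κ σ θ)
    (hlmin.trans_le ha.1) (hlmin.trans_le hl.1) (inner_noiseDir_errVec κ σ θ v) (isMinOn_penCost hκ.ne' hv)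
    (inner_noiseDir_errVec κ σ θ u) (isMinOn_penCost hκ.ne' hu)
  exact h1.trans (mul_le_mul (div_le_div₀ ((abs_nonneg _).trans hla) hla hlmin hl.1) (hg.norm_dataMap_le hκ hl hu)
    (norm_nonneg _) (div_nonneg ((abs_nonneg _).trans hla) hlmin.le))

lemma GoodData.penCost_le (hg : GoodData κ σ lmin lmax Λ R₁ c₀ s t ε k d Q θ p) (hκ : 0 < κ)
    (hlmin : 0 < lmin) (hl : l ∈ Set.Icc lmin lmax) (hu : IsLasso κ σ θ p l u) (ha : a ∈ Set.Icc lmin lmax)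
    (hla : |l - a| ≤ h) (hd : h / lmin * (Λ * R₁) ≤ d) :
    penCost (dataMap κ p) (lassoPen κ θ) a (errVec κ σ θ u) ≤
      penCost (dataMap κ p) (lassoPen κ θ) a (errVec κ σ θ v) + d ^ 2 := by
  have h1 := penCost_le_of_param (e := dataMap κ p) (convexOn_lassoPen_slice κ σ θ)
    (hlmin.trans_le ha.1) (hlmin.trans_le hl.1) (inner_noiseDir_errVec κ σ θ v)
    (inner_noiseDir_errVec κ σ θ u) (isMinOn_penCost hκ.ne' hu)
  refine h1.trans (add_le_add_right ?_ _)
  have h2 : |l - a| / l * ‖dataMap κ p (errVec κ σ θ u)‖ ≤ d :=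
    (mul_le_mul (div_le_div₀ ((abs_nonneg _).trans hla) hla hlmin hl.1) (hg.norm_dataMap_le hκ hl hu)
      (norm_nonneg _) (div_nonneg ((abs_nonneg _).trans hla) hlmin.le)).trans hd
  have hl0 : 0 < l := hlmin.trans_le hl.1
  have h3 : ((l - a) / l) ^ 2 * ‖dataMap κ p (errVec κ σ θ u)‖ ^ 2 =
      (|l - a| / l * ‖dataMap κ p (errVec κ σ θ u)‖) ^ 2 := by
    rw [mul_pow, div_pow, div_pow, sq_abs]
  rw [h3]
  have h4 := pow_le_pow_left₀ (by positivity) h2 2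
  have h5 := sq_nonneg (|l - a| / l * ‖dataMap κ p (errVec κ σ θ u)‖)
  linarith

lemma GoodData.abs_slope_sub_le (hg : GoodData κ σ lmin lmax Λ R₁ c₀ s t ε k d Q θ p) (hκ : 0 < κ) (hσ : 0 < σ)
    (hlmin : 0 < lmin) (hκn : κ ^ 2 * Fintype.card m = 1) (hΛ : 0 < Λ) (ht : t ≤ 1 / 4) (hc1 : c₀ ≤ σ / (4 * Λ))
    (hc2 : c₀ ≤ lmin / (2 * Λ)) (hd : h / lmin * (Λ * R₁) ≤ d)
    (hl : l ∈ Set.Icc lmin lmax) (hu : IsLasso κ σ θ p l u) (haQ : a ∈ Q) (ha : a ∈ Set.Icc lmin lmax)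
    (hv : IsLasso κ σ θ p a v) (hla : |l - a| ≤ h) :
    |(1 - κ ^ 2 * (Finset.univ.filter fun j => v j ≠ 0).card) * ‖errVec κ σ θ u‖ - ‖dataMap κ p (errVec κ σ θ v)‖| ≤
      s / σ + t * R₁ := by
  have h1 := hg.supp_dataMap hκ hlmin hκn haQ ha hv
  have h2 := hg.gordon a haQ _ (inner_noiseDir_errVec κ σ θ v) (hg.norm_errVec_le hκ ha hv) (isMinOn_penCost hκ.ne' hv)
    (hg.le_norm_dataMap hκ hσ hlmin hκn hΛ ht hc1 hc2 haQ ha hv) _ (inner_noiseDir_errVec κ σ θ u)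
    (hg.norm_errVec_le hκ hl hu) (hg.penCost_le hκ hlmin hl hu ha hla hd)
  have hV := hg.norm_errVec_le hκ hl hu
  have hV0 := norm_nonneg (errVec κ σ θ u)
  generalize ‖errVec κ σ θ u‖ = V at h2 hV hV0 ⊢
  generalize ‖dataMap κ p (errVec κ σ θ v)‖ = ρ at h2 ⊢
  generalize inner ℝ (dataMap κ p (errVec κ σ θ v)) (dataMap κ p (noiseDir ι)) = I at h1 h2
  generalize 1 - κ ^ 2 * ((Finset.univ.filter fun j => v j ≠ 0).card : ℝ) = α at h1 ⊢
  have h3 : α * V - ρ = (I * V - σ * ρ) / σ + (α - I / σ) * V := by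
    field_simp
    ring
  rw [h3]
  refine (abs_add_le _ _).trans (add_le_add ?_ ?_)
  · rw [abs_div, abs_of_pos hσ]
    gcongr
  · rw [abs_mul, abs_of_nonneg hV0]
    exact mul_le_mul h1 hV hV0 ((abs_nonneg _).trans h1)

lemma GoodData.card_support_diff_lt (hg : GoodData κ σ lmin lmax Λ R₁ c₀ s t ε k d Q θ p) (hκ : 0 < κ) (hσ : 0 < σ)
    (hlmin : 0 < lmin) (hc₀ : 0 ≤ c₀) (haQ : a ∈ Q) (ha : a ∈ Set.Icc lmin lmax)
    (hk : Λ * (3 * (h / lmin * (Λ * R₁)) / κ) + h ≤ k) {b b' : ℝ} (hb : b ∈ Set.Icc lmin lmax)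
    (hb' : b' ∈ Set.Icc lmin lmax) (hba : |b - a| ≤ h) (hba' : |b' - a| ≤ h) (hu : IsLasso κ σ θ p b u)
    (hv : IsLasso κ σ θ p b' v) (hβ : c₀ / 2 + 3 * (h / lmin * (Λ * R₁)) ≤ ‖dataMap κ p (errVec κ σ θ v)‖) :
    (((Finset.univ.filter fun j => v j ≠ 0) \ Finset.univ.filter fun j => u j ≠ 0).card : ℝ) < ε * Fintype.card m := by
  by_contra! hJ
  refine hg.band a haQ _ hJ (band_of_support_change (u := u) (v := v) rfl hκ hσ hg.op hlmin ha.1 hb.1 hb'.1 hba hba'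
    (isKKT_of_isMinOn (hlmin.le.trans hb.1) hu) (isKKT_of_isMinOn (hlmin.le.trans hb'.1) hv) (fun j hj => ?_)
    (fun j hj => ?_) (hg.norm_errVec_le hκ hb hu) (by positivity) ?_ hk)
  · simp only [Finset.mem_sdiff, Finset.mem_filter, Finset.mem_univ, true_and, not_not] at hj
    exact hj.2
  · simp only [Finset.mem_sdiff, Finset.mem_filter, Finset.mem_univ, true_and, not_not] at hj
    exact hj.1
  · rwa [dataMap_errVec, norm_euc_smul, abs_of_pos hκ] at hβ

lemma abs_card_sub_card_le {α : Type*} [DecidableEq α] {S T : Finset α} {x : ℝ} (h1 : ((S \ T).card : ℝ) ≤ x)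
    (h2 : ((T \ S).card : ℝ) ≤ x) : |(S.card : ℝ) - T.card| ≤ x := by
  have h3 : ((S \ T).card : ℝ) + (S ∩ T).card = S.card := by exact_mod_cast Finset.card_sdiff_add_card_inter S T
  have h4 : ((T \ S).card : ℝ) + (T ∩ S).card = T.card := by exact_mod_cast Finset.card_sdiff_add_card_inter T S
  rw [Finset.inter_comm T S] at h4
  rw [abs_le]
  constructor <;> linarith

/-- On the good events, the estimator of the effective noise level is close to the norm of the error vector. -/
theorem GoodData.abs_noise_level_sub_le (hg : GoodData κ σ lmin lmax Λ R₁ c₀ s t ε k d Q θ p) (hκ : 0 < κ) (hσ : 0 < σ)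
    (hlmin : 0 < lmin) (hκn : κ ^ 2 * Fintype.card m = 1) (hΛ : 0 < Λ) (hR : 0 < R₁) (ht : t ≤ 1 / 4) (hc₀ : 0 < c₀)
    (hc1 : c₀ ≤ σ / (4 * Λ)) (hc2 : c₀ ≤ lmin / (2 * Λ)) (hd : h / lmin * (Λ * R₁) ≤ d)
    (hhc : 8 * (h / lmin * (Λ * R₁)) ≤ c₀) (hk : Λ * (3 * (h / lmin * (Λ * R₁)) / κ) + h ≤ k)
    (hη : s / σ + t * R₁ ≤ c₀ / 2) (hε : ε ≤ c₀ / (4 * R₁))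
    (hQ : ∀ l ∈ Set.Icc lmin lmax, ∃ a ∈ Q, a ∈ Set.Icc lmin lmax ∧ |l - a| ≤ h) {sol : ℝ → ι → ℝ}
    (hsol : ∀ l ∈ Set.Icc lmin lmax, IsLasso κ σ θ p l (sol l)) (hl : l ∈ Set.Icc lmin lmax) :
    |‖dataMap κ p (errVec κ σ θ (sol l))‖ / (1 - κ ^ 2 * (Finset.univ.filter fun j => sol l j ≠ 0).card) -
      ‖errVec κ σ θ (sol l)‖| ≤ (s / σ + t * R₁ + d + ε * R₁) / (c₀ / (4 * R₁)) := by
  obtain ⟨a, haQ, ha, hla⟩ := hQ l hl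
  have hu := hsol l hl
  have hv := hsol a ha
  have hh : 0 ≤ h := (abs_nonneg _).trans hla
  have h1 := hg.abs_slope_sub_le hκ hσ hlmin hκn hΛ ht hc1 hc2 hd hl hu haQ ha hv hla
  have h2 := hg.le_norm_dataMap hκ hσ hlmin hκn hΛ ht hc1 hc2 haQ ha hv
  have h3 := hg.norm_dataMap_sub_le hκ hlmin hl hu ha hv hla
  have h4 := (abs_norm_sub_norm_le _ _).trans h3
  have hV := hg.norm_errVec_le hκ hl hu
  have hV0 := norm_nonneg (errVec κ σ θ (sol l))
  have haa : |a - a| ≤ h := by rwa [sub_self, abs_zero]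
  have h4' := abs_le.1 h4
  have h5 := hg.card_support_diff_lt hκ hσ hlmin hc₀.le haQ ha hk hl ha hla haa hu hv (by linarith)
  have h6 := hg.card_support_diff_lt hκ hσ hlmin hc₀.le haQ ha hk ha hl haa hla hv hu (by linarith)
  have h7 := mul_le_mul_of_nonneg_left (abs_card_sub_card_le h5.le h6.le) (sq_nonneg κ)
  rw [← abs_of_pos (pow_pos hκ 2), ← abs_mul, abs_of_pos (pow_pos hκ 2), mul_left_comm, hκn, mul_one, mul_sub] at h7
  generalize ‖errVec κ σ θ (sol l)‖ = V at *
  generalize ‖dataMap κ p (errVec κ σ θ (sol a))‖ = ρ at *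
  generalize ‖dataMap κ p (errVec κ σ θ (sol l))‖ = ρ' at *
  generalize κ ^ 2 * ((Finset.univ.filter fun j => sol l j ≠ 0).card : ℝ) = f' at *
  generalize κ ^ 2 * ((Finset.univ.filter fun j => sol a j ≠ 0).card : ℝ) = f at *
  have h1' := abs_le.1 h1
  have h7' := abs_le.1 h7
  have h8 : c₀ / (2 * R₁) ≤ 1 - f := by
    rw [div_le_iff₀ (by positivity)]
    have h10 : 0 < 1 - f := by
      by_contra! hneg
      have := mul_nonpos_of_nonpos_of_nonneg hneg hV0
      linarith
    have h11 := mul_le_mul_of_nonneg_left hV h10.le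
    linarith
  have h12 : c₀ / (2 * R₁) = c₀ / (4 * R₁) + c₀ / (4 * R₁) := by ring
  have h13 : c₀ / (4 * R₁) ≤ 1 - f' := by linarith
  have h14 : 0 < c₀ / (4 * R₁) := by positivity
  have h15 : 0 < 1 - f' := h14.trans_le h13
  have h16 : |ρ' - (1 - f') * V| ≤ s / σ + t * R₁ + d + ε * R₁ := by
    have h17 : ρ' - (1 - f') * V = -((1 - f) * V - ρ) + (ρ' - ρ) + -((f - f') * V) := by ring
    rw [h17]
    refine (abs_add_le _ _).trans (add_le_add ((abs_add_le _ _).trans (add_le_add ?_ (h4.trans hd))) ?_)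
    · rwa [abs_neg]
    · rw [abs_neg, abs_mul, abs_of_nonneg hV0]
      exact mul_le_mul h7 hV hV0 ((abs_nonneg _).trans h7)
  have h18 : ρ' / (1 - f') - V = (ρ' - (1 - f') * V) / (1 - f') := by
    field_simp
  rw [h18, abs_div, abs_of_pos h15]
  exact div_le_div₀ ((abs_nonneg _).trans h16) h16 h14 h13

end NoiseLevel

section GoodDataProbability

open scoped Matrix

lemma measurable_dataVec {m ι : Type*} [Fintype m] [Fintype ι] :
    Measurable (dataVec : (ι → m → ℝ) × (m → ℝ) → 𝔼 (m × Option ι)) := by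
  refine (WithLp.measurable_toLp 2 _).comp (measurable_pi_lambda _ fun q => ?_)
  rcases q with ⟨i, _ | j⟩
  · exact (measurable_pi_apply i).comp measurable_snd
  · exact (measurable_pi_apply i).comp ((measurable_pi_apply j).comp measurable_fst)

lemma map_dataVec {m ι : Type*} [Fintype m] [Fintype ι] :
    (dataGauss m ι).map dataVec = stdGaussian (𝔼 (m × Option ι)) := by
  set f : (ι → m → ℝ) × (m → ℝ) → m × Option ι → ℝ := fun p q => q.2.elim (p.2 q.1) fun j => p.1 j q.1 with hf
  have hfm : Measurable f := (WithLp.measurable_ofLp 2 _).comp measurable_dataVec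
  have hpi : Measure.pi (fun _ : m × Option ι => gaussianReal 0 1) = (dataGauss m ι).map f := by
    refine Measure.pi_eq fun s hs => ?_
    have hpre : f ⁻¹' Set.univ.pi s = (Set.univ.pi fun j => Set.univ.pi fun i => s (i, some j)) ×ˢ
        (Set.univ.pi fun i => s (i, none)) := by
      ext p
      simp only [Set.mem_preimage, Set.mem_univ_pi, Set.mem_prod, hf, Prod.forall, Option.forall, Option.elim]
      exact ⟨fun h => ⟨fun j i => (h i).2 j, fun i => (h i).1⟩, fun h i => ⟨h.2 i, fun j => h.1 j i⟩⟩
    rw [Measure.map_apply hfm (MeasurableSet.univ_pi hs), hpre, dataGauss, Measure.prod_prod, Measure.pi_pi]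
    simp only [vecGauss, Measure.pi_pi]
    rw [Fintype.prod_prod_type_right, Fintype.prod_option, mul_comm]
  rw [← map_pi_eq_stdGaussian, hpi, Measure.map_map (WithLp.measurable_toLp 2 _) hfm]
  rfl

variable {m ι : Type} [Fintype m] [Fintype ι]

lemma dataGauss_preimage_le (S : Set (𝔼 (m × Option ι))) :
    dataGauss m ι {p | dataVec p ∈ S} ≤ stdGaussian (𝔼 (m × Option ι)) S := by
  rw [← map_dataVec]
  exact Measure.le_map_apply measurable_dataVec.aemeasurable S

lemma dataGauss_exists_band_le [DecidableEq ι] {κ l σ c₀ C ε C₄ δ : ℝ} (hl : 0 < l) (hc₀ : 0 < c₀) (hε : 0 < ε)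
    (hC : 0 ≤ C) (hδ : 0 < δ) (hcard : (Fintype.card m : ℝ) = δ * Fintype.card ι) (hC₄ : C / 2 + 1 / δ + 1 ≤ C₄) (θ : ι → ℝ) :
    dataGauss m ι {p | ∃ J : Finset ι, ε * Fintype.card m ≤ J.card ∧
      (p.2 + dropNoise κ σ θ J p.1) ⬝ᵥ (p.2 + dropNoise κ σ θ J p.1) ≤ C * Fintype.card m ∧
      (c₀ / 2) ^ 2 ≤ (κ • dropRes κ l σ θ J p.1 (p.2 + dropNoise κ σ θ J p.1)) ⬝ᵥ
        (κ • dropRes κ l σ θ J p.1 (p.2 + dropNoise κ σ θ J p.1)) ∧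
      ∀ j ∈ J, |(|p.1 j ⬝ᵥ (κ • dropRes κ l σ θ J p.1 (p.2 + dropNoise κ σ θ J p.1))| - l)| ≤
        c₀ / 8 * Real.exp (-(C₄ / ε))} ≤ ENNReal.ofReal (Real.exp (-Fintype.card m)) := by
  set n : ℝ := (Fintype.card m : ℝ)
  set B := ENNReal.ofReal (Real.exp (C / 2 * n - C₄ * n))
  have hband : ∀ J ∈ (Finset.univ : Finset ι).powerset.filter (fun J => ε * n ≤ J.card), dataGauss m ι {p |
      (p.2 + dropNoise κ σ θ J p.1) ⬝ᵥ (p.2 + dropNoise κ σ θ J p.1) ≤ C * n ∧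
      (c₀ / 2) ^ 2 ≤ (κ • dropRes κ l σ θ J p.1 (p.2 + dropNoise κ σ θ J p.1)) ⬝ᵥ
        (κ • dropRes κ l σ θ J p.1 (p.2 + dropNoise κ σ θ J p.1)) ∧
      ∀ j ∈ J, |(|p.1 j ⬝ᵥ (κ • dropRes κ l σ θ J p.1 (p.2 + dropNoise κ σ θ J p.1))| - l)| ≤
        c₀ / 8 * Real.exp (-(C₄ / ε))} ≤ B := by
    intro J hJ
    have hJ' := (Finset.mem_filter.1 hJ).2
    refine (dataGauss_band_le (κ := κ) (σ := σ) (C := C * n) hl (by positivity) (half_pos hc₀) θ J).trans ?_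
    rw [← ENNReal.ofReal_pow (by positivity), ← ENNReal.ofReal_mul (by positivity)]
    refine ENNReal.ofReal_le_ofReal ?_
    have h1 : 4 * (c₀ / 8 * Real.exp (-(C₄ / ε))) / (c₀ / 2) = Real.exp (-(C₄ / ε)) := by
      field_simp
      norm_num
    rw [h1, ← Real.exp_nat_mul, ← Real.exp_add, Real.exp_le_exp]
    have h2 : C₄ * n ≤ J.card * (C₄ / ε) := by
      have h0 : 0 ≤ C₄ := le_trans (by positivity) hC₄
      calc C₄ * n = ε * n * (C₄ / ε) := by field_simp
        _ ≤ _ := by gcongr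
    linarith
  refine (measure_mono ?_).trans ((measure_exists_le _ _ _ hband).trans ?_)
  · rintro p ⟨J, hJ, hp⟩
    exact ⟨J, Finset.mem_filter.2 ⟨Finset.mem_powerset.2 (Finset.subset_univ J), hJ⟩, hp⟩
  · have h3 : (((Finset.univ : Finset ι).powerset.filter fun J => ε * n ≤ J.card).card : ℝ) ≤ Real.exp (n / δ) := by
      calc (((Finset.univ : Finset ι).powerset.filter fun J => ε * n ≤ J.card).card : ℝ)
          ≤ (2 : ℝ) ^ Fintype.card ι := by
            exact_mod_cast (Finset.card_filter_le _ _).trans (by rw [Finset.card_powerset, Finset.card_univ])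
        _ ≤ Real.exp 1 ^ Fintype.card ι := by gcongr; linarith [Real.add_one_le_exp 1]
        _ = Real.exp (n / δ) := by rw [← Real.exp_nat_mul, mul_one, hcard, mul_div_cancel_left₀ _ hδ.ne']
    rw [← ENNReal.ofReal_natCast, ← ENNReal.ofReal_mul (by positivity)]
    refine ENNReal.ofReal_le_ofReal ((mul_le_mul_of_nonneg_right h3 (by positivity)).trans ?_)
    rw [← Real.exp_add, Real.exp_le_exp]
    have h4 := mul_le_mul_of_nonneg_right hC₄ (show 0 ≤ n by positivity)
    have h5 : 1 / δ * n = n / δ := by ring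
    linarith

/-- The data are good outside an event of exponentially small probability. -/
theorem exists_goodData_const {α t M δ σ lmin lmax Λ c₀ : ℝ} (hα : 0 < α) (ht : 0 < t) (htδ : t < δ) (hM : 0 ≤ M)
    (hσ : 0 < σ) (hlmin : 0 < lmin) (hlmax : lmin ≤ lmax) (hΛ : √(2 / δ) + 3 ≤ Λ) (hc₀ : 0 < c₀) :
    ∃ R₁ L d₀ K c C₄ : ℝ, 0 < R₁ ∧ 0 < L ∧ 0 < d₀ ∧ 0 ≤ K ∧ 0 < c ∧ 0 < C₄ ∧
      ∀ (m ι : Type) [Fintype m] [Fintype ι] [DecidableEq ι] [Nonempty m] [Nonempty ι] (θ : ι → ℝ) (Q : Finset ℝ) (d : ℝ),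
      ApproxSparse α t M θ → (Fintype.card m : ℝ) = δ * Fintype.card ι → (∀ l ∈ Q, l ∈ Set.Icc lmin lmax) →
      0 < d → d ≤ d₀ → K ≤ Fintype.card m * d ^ 4 →
      dataGauss m ι {p | ¬GoodData (1 / √(Fintype.card m)) σ lmin lmax Λ R₁ c₀ (L * d) d d
        (c₀ / 8 * Real.exp (-(C₄ / d))) d Q θ p} ≤
      20 * (1 + Q.card) * ENNReal.ofReal (Real.exp (-(c * (Fintype.card m * d ^ 4)))) := by
  have hδ : 0 < δ := ht.trans htδ
  have hΛ0 : 0 < Λ := by linarith [Real.sqrt_nonneg (2 / δ)]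
  obtain ⟨R, K₁, c₁, hR, hc₁, hapriori⟩ :=
    exists_apriori_const (σ := σ) (Λ := Λ) hα ht htδ hM hlmin hlmax
  obtain ⟨L, d₀, K₂, c₂, hL, hd₀, hc₂, hgordon⟩ :=
    exists_gordon_const (R := R) (Γ := 2 / δ) hσ hlmin hlmax hc₀ hΛ
  set R₁ := √(R ^ 2 + σ ^ 2)
  have hR₁ : 0 < R₁ := Real.sqrt_pos.2 (by positivity)
  have hR₁s : R₁ ^ 2 = R ^ 2 + σ ^ 2 := Real.sq_sqrt (by positivity)
  set S := 4 * (2 * (1 + 2 / δ) + (Λ * R₁) ^ 2 / (2 * σ ^ 2))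
  refine ⟨R₁, L, min d₀ 1, max K₁ (max K₂ 0), min (1 / 5) (min c₁ (min (1 / S) c₂)),
    (Λ * R₁) ^ 2 / σ ^ 2 / 2 + 1 / δ + 1, hR₁, hL, by positivity, by positivity, by positivity, by positivity, ?_⟩
  intro m ι _ _ _ _ _ θ Q d hθ hcard hQ hd hd0 hK
  set n : ℝ := (Fintype.card m : ℝ)
  set c := min (1 / 5) (min c₁ (min (1 / S) c₂))
  set κ := 1 / √n
  have hn : 0 < n := Nat.cast_pos.2 Fintype.card_pos
  have hκ : 0 < κ := by positivity
  have hκn : κ ^ 2 * n = 1 := by rw [div_pow, Real.sq_sqrt hn.le, one_pow, one_div_mul_cancel hn.ne']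
  have hd1 : d ≤ 1 := hd0.trans (min_le_right _ _)
  have hd4 : d ^ 4 ≤ 1 := pow_le_one₀ hd.le hd1
  have hnd : n * d ^ 4 ≤ n := mul_le_of_le_one_right hn.le hd4
  have hι : (1 : ℝ) ≤ Fintype.card ι := Nat.one_le_cast.2 Fintype.card_pos
  have hΓn : 2 / δ * n = 2 * Fintype.card ι := by rw [hcard]; field_simp
  have hcardO : (Fintype.card (Option ι) : ℝ) ≤ 2 / δ * n := by
    rw [Fintype.card_option, hΓn]
    push_cast
    linarith
  set B := ENNReal.ofReal (Real.exp (-(c * (n * d ^ 4))))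
  have hB : ∀ x, c * (n * d ^ 4) ≤ x → ENNReal.ofReal (Real.exp (-x)) ≤ B := fun x hx =>
    ENNReal.ofReal_le_ofReal (Real.exp_le_exp.2 (neg_le_neg hx))
  have hc : 0 < c := by positivity
  have hB' : ∀ a, c ≤ a → ENNReal.ofReal (Real.exp (-(a * n))) ≤ B := fun a ha =>
    hB _ (mul_le_mul ha hnd (by positivity) (hc.le.trans ha))
  have hop : dataGauss m ι {p | Λ < κ * ‖matCLM (dataVec p)‖} ≤ B :=
    (dataGauss_preimage_le _).trans ((measure_matCLM_le hcardO hΛ).trans (hB' _ (min_le_left _ _)))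
  have hap := (dataGauss_preimage_le _).trans
    ((hapriori m ι θ hθ hcard ((le_max_left _ _).trans (hK.trans hnd))).trans
      (mul_le_mul_right (hB' _ ((min_le_right _ _).trans (min_le_left _ _))) 2))
  have hc5 : c ≤ 1 / 5 := min_le_left _ _
  have hcS : c ≤ 1 / S := (min_le_right _ _).trans ((min_le_right _ _).trans (min_le_left _ _))
  have hc2 : c ≤ c₂ := (min_le_right _ _).trans ((min_le_right _ _).trans (min_le_right _ _))
  have hsupp := fun l (hl : l ∈ Q) => (measure_support_deviation_le (m := m) (κ := κ) (C := (Λ * R₁) ^ 2)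
    (Γ := 2 / δ) (hlmin.trans_le (hQ l hl).1) hσ (by positivity) (by positivity) hd hd1 (by linarith) θ).trans
      (mul_le_mul_right (hB _ (by
        have h1 : d ^ 4 ≤ d ^ 2 := pow_le_pow_of_le_one hd.le hd1 (by norm_num)
        calc c * (n * d ^ 4) ≤ 1 / S * (n * d ^ 2) := by gcongr
          _ = d ^ 2 / S * n := by ring)) 2)
  have hgor := fun l (hl : l ∈ Q) => (dataGauss_preimage_le _).trans
    ((hgordon m (Option ι) (lassoPen κ θ) (noiseDir ι) l d hcardO (continuous_lassoPen κ θ) (convexOn_lassoPen κ θ)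
      (lassoPen_add_smul_noiseDir κ θ) norm_noiseDir (hQ l hl).1 (hQ l hl).2 hd (hd0.trans (min_le_left _ _))
      ((le_max_left _ _).trans ((le_max_right _ _).trans hK))).trans (mul_le_mul_right (hB _ (by gcongr)) 14))
  have hband := fun l (hl : l ∈ Q) => (dataGauss_exists_band_le (κ := κ) (σ := σ) (C := (Λ * R₁) ^ 2 / σ ^ 2)
    (hlmin.trans_le (hQ l hl).1) hc₀ hd (by positivity) hδ hcard le_rfl θ).trans (hB n (by
      calc c * (n * d ^ 4) ≤ 1 * n := by gcongr; linarith
        _ = n := one_mul n))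
  have hall := (measure_union_le (μ := dataGauss m ι) _ _).trans (add_le_add hop
    ((measure_union_le (μ := dataGauss m ι) _ _).trans (add_le_add hap
    ((measure_union_le (μ := dataGauss m ι) _ _).trans (add_le_add (measure_exists_le (dataGauss m ι) Q _ hsupp)
    ((measure_union_le (μ := dataGauss m ι) _ _).trans (add_le_add (measure_exists_le (dataGauss m ι) Q _ hgor)
    (measure_exists_le (dataGauss m ι) Q _ hband))))))))
  refine (measure_mono ?_).trans (hall.trans ?_)
  · intro p hp
    by_contra hnot
    simp only [Set.mem_union, not_or] at hnot
    obtain ⟨h1, h2, h3, h4, h5⟩ := hnot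
    rw [Set.mem_ofPred_eq] at h1 h2 h3 h4 h5 hp
    rw [not_lt] at h1
    refine hp ⟨fun W => ?_, fun l hl W hW hmin => ?_, fun l hl u hu r hr hrr => ?_,
      fun l hl w hw hwR hmin hcw W hW hWR hle => ?_, fun l hl J hJ hev => ?_⟩
    · calc ‖dataMap κ p W‖ = κ * ‖matCLM (dataVec p) W‖ := by
            rw [← abs_of_pos hκ, ← Real.norm_eq_abs, ← norm_smul, Real.norm_eq_abs, abs_of_pos hκ]; rfl
        _ ≤ κ * (‖matCLM (dataVec p)‖ * ‖W‖) := by gcongr; exact ContinuousLinearMap.le_opNorm _ _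
        _ ≤ Λ * ‖W‖ := by rw [← mul_assoc]; gcongr
    · by_contra hlt
      exact h2 ⟨h1, dataMap κ p, dataMap_eq κ p, l, hl, W, hW,
        fun hslab => hlt ((Real.le_sqrt (norm_nonneg W) (by positivity)).2 hslab.2), hmin⟩
    · by_contra! hlt
      exact h3 ⟨l, hl, u, hu, r, hr, hrr, hlt.le⟩
    · have hsq : ∀ v : 𝔼 (Option ι), ‖v‖ ≤ R₁ → ‖v‖ ^ 2 ≤ R ^ 2 + σ ^ 2 := fun v hv =>
        hR₁s ▸ pow_le_pow_left₀ (norm_nonneg v) hv 2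
      by_contra! hlt
      exact h4 ⟨l, hl, h1, dataMap κ p, dataMap_eq κ p, w, ⟨hw, hsq w hwR⟩, hmin, hcw, W, ⟨hW, hsq W hWR⟩, hle, hlt⟩
    · have hC : (Λ * R₁) ^ 2 / (σ ^ 2 * κ ^ 2) = (Λ * R₁) ^ 2 / σ ^ 2 * n := by
        rw [← div_div, div_eq_iff (by positivity), mul_assoc, mul_comm n, hκn, mul_one]
      rw [hC] at hev
      exact h5 ⟨l, hl, J, hJ, hev⟩
  · calc _ = (3 + 17 * Q.card) * B := by ring
      _ ≤ (20 + 20 * Q.card) * B := by gcongr <;> norm_num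
      _ = 20 * (1 + Q.card) * B := by ring

end GoodDataProbability

section Model

open scoped Matrix

lemma map_uncurry_PX (n N : ℕ) :
    (PX n N).map (fun X (q : Fin n × Fin N) => X q.1 q.2) = Measure.pi fun _ => gaussianReal 0 (n : ℝ≥0)⁻¹ := by
  refine (Measure.pi_eq fun s hs => ?_).symm
  have hpre : (fun (X : Fin n → Fin N → ℝ) (q : Fin n × Fin N) => X q.1 q.2) ⁻¹' Set.univ.pi s =
      Set.univ.pi fun i => Set.univ.pi fun j => s (i, j) := by
    ext X
    simp only [Set.mem_preimage, Set.mem_univ_pi, Prod.forall]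
  rw [Measure.map_apply (by fun_prop) (MeasurableSet.univ_pi hs), hpre, PX, Measure.pi_pi, Fintype.prod_prod_type]
  simp only [Measure.pi_pi]

lemma gaussianReal_map_scale (n : ℕ) :
    (gaussianReal 0 1).map (fun x => 1 / √(n : ℝ) * x) = gaussianReal 0 (n : ℝ≥0)⁻¹ := by
  rw [gaussianReal_map_const_mul, mul_zero, mul_one]
  congr 1
  ext
  simp

lemma map_vecGauss_eq_PX (n N : ℕ) :
    (Measure.pi fun _ : Fin N => vecGauss (Fin n)).map (fun a i j => 1 / √(n : ℝ) * a j i) = PX n N := by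
  have h1 : (Measure.pi fun _ : Fin N => vecGauss (Fin n)).map (fun a (q : Fin n × Fin N) => 1 / √(n : ℝ) * a q.2 q.1) =
      Measure.pi fun _ => gaussianReal 0 (n : ℝ≥0)⁻¹ := by
    refine (Measure.pi_eq fun s hs => ?_).symm
    have hpre : (fun (a : Fin N → Fin n → ℝ) (q : Fin n × Fin N) => 1 / √(n : ℝ) * a q.2 q.1) ⁻¹' Set.univ.pi s =
        Set.univ.pi fun j => Set.univ.pi fun i => (fun x => 1 / √(n : ℝ) * x) ⁻¹' s (i, j) := by
      ext a
      simp only [Set.mem_preimage, Set.mem_univ_pi, Prod.forall]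
      exact forall_comm
    rw [Measure.map_apply (by fun_prop) (MeasurableSet.univ_pi hs), hpre, Measure.pi_pi, Fintype.prod_prod_type_right]
    simp only [vecGauss, Measure.pi_pi]
    refine Finset.prod_congr rfl fun j _ => Finset.prod_congr rfl fun i _ => ?_
    rw [← gaussianReal_map_scale, Measure.map_apply (by fun_prop) (hs _)]
  have hcurry : Measurable fun (x : Fin n × Fin N → ℝ) i j => x (i, j) := by fun_prop
  have h2 := congrArg (Measure.map fun (x : Fin n × Fin N → ℝ) i j => x (i, j)) (h1.trans (map_uncurry_PX n N).symm)
  rw [Measure.map_map hcurry (by fun_prop), Measure.map_map hcurry (by fun_prop)] at h2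
  exact h2.trans Measure.map_id

/-- Reading off design and noise from Gaussian columns. -/
def modelMap {n N : ℕ} (p : (Fin N → Fin n → ℝ) × (Fin n → ℝ)) : (Fin n → Fin N → ℝ) × (Fin n → ℝ) :=
  (fun i j => 1 / √(n : ℝ) * p.1 j i, p.2)

lemma dataGauss_modelMap_le (n N : ℕ) (S : Set ((Fin n → Fin N → ℝ) × (Fin n → ℝ))) :
    dataGauss (Fin n) (Fin N) {p | modelMap p ∈ S} ≤ Pmodel n N S := by
  have h : (dataGauss (Fin n) (Fin N)).map modelMap = Pmodel n N := by
    rw [Pmodel, ← map_vecGauss_eq_PX, Pz, ← vecGauss, dataGauss]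
    have h1 := Measure.map_prod_map (f := fun (a : Fin N → Fin n → ℝ) i j => 1 / √(n : ℝ) * a j i) (g := id)
      (Measure.pi fun _ => vecGauss (Fin n)) (vecGauss (Fin n)) (by fun_prop) measurable_id
    rw [Measure.map_id] at h1
    exact h1.symm
  have hm : Measurable (modelMap : _ → (Fin n → Fin N → ℝ) × (Fin n → ℝ)) := by
    unfold modelMap
    fun_prop
  rw [← h]
  exact Measure.le_map_apply hm.aemeasurable S

variable {n N : ℕ} {σ : ℝ} {θ u : Fin N → ℝ} {p : (Fin N → Fin n → ℝ) × (Fin n → ℝ)}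

lemma yvec_modelMap (σ : ℝ) (θ : Fin N → ℝ) (p : (Fin N → Fin n → ℝ) × (Fin n → ℝ)) :
    yvec σ θ (modelMap p).1 (modelMap p).2 = colMat (1 / √(n : ℝ)) p.1 *ᵥ θ + σ • p.2 := rfl

lemma sum_residual_sq (p : (Fin N → Fin n → ℝ) × (Fin n → ℝ)) (y : Fin n → ℝ) (u : Fin N → ℝ) :
    ∑ i, (y i - ∑ j, (modelMap p).1 i j * u j) ^ 2 =
      (y - colMat (1 / √(n : ℝ)) p.1 *ᵥ u) ⬝ᵥ (y - colMat (1 / √(n : ℝ)) p.1 *ᵥ u) :=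
  Finset.sum_congr rfl fun _ _ => sq _

lemma lassoCost_modelMap (p : (Fin N → Fin n → ℝ) × (Fin n → ℝ)) (y : Fin n → ℝ) (l : ℝ) (u : Fin N → ℝ) :
    lassoCost (modelMap p).1 y l u = (n : ℝ)⁻¹ * l1Cost (colMat (1 / √(n : ℝ)) p.1) l y u := by
  rw [lassoCost, sum_residual_sq, l1Cost]
  ring

lemma isLasso_of_isMinOn_lassoCost (hn : 0 < n) {l : ℝ}
    (h : IsMinOn (lassoCost (modelMap p).1 (yvec σ θ (modelMap p).1 (modelMap p).2) l) Set.univ u) :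
    IsLasso (1 / √(n : ℝ)) σ θ p l u := by
  intro v hv
  have h1 := h hv
  rw [Set.mem_ofPred_eq, lassoCost_modelMap, lassoCost_modelMap, yvec_modelMap] at h1
  exact le_of_mul_le_mul_left h1 (by positivity)

lemma tauHat_modelMap (hn : 0 < n) :
    tauHat (modelMap p).1 (yvec σ θ (modelMap p).1 (modelMap p).2) u =
      ‖dataMap (1 / √(n : ℝ)) p (errVec (1 / √(n : ℝ)) σ θ u)‖ /
        (1 - (1 / √(n : ℝ)) ^ 2 * (Finset.univ.filter fun j => u j ≠ 0).card) := by
  have hn' : (0 : ℝ) < n := Nat.cast_pos.2 hn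
  rw [tauHat, sum_residual_sq, dataMap_errVec, norm_euc_smul, abs_of_pos (by positivity), ← norm_euc_sq,
    Real.sqrt_sq (norm_nonneg _), yvec_modelMap, l0, div_pow, one_pow, Real.sq_sqrt hn'.le,
    ← mul_div_mul_left (1 / √(n : ℝ) * _) _ hn'.ne', mul_sub, mul_one, ← mul_assoc (n : ℝ) (1 / n),
    mul_one_div_cancel hn'.ne', one_mul, ← mul_assoc (n : ℝ), mul_one_div, Real.div_sqrt]

lemma mean_sq_error_eq {δ : ℝ} (hδ : 0 < δ) (hN : 0 < N) (hn : (n : ℝ) = δ * N) (σ : ℝ) (θ u : Fin N → ℝ) :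
    (1 / (N : ℝ)) * ∑ j, (u j - θ j) ^ 2 = δ * (‖errVec (1 / √(n : ℝ)) σ θ u‖ ^ 2 - σ ^ 2) := by
  rw [norm_errVec_sq, div_pow, Real.sq_sqrt (Nat.cast_nonneg n), add_sub_cancel_left, hn]
  field_simp

end Model

section NoiseLevelMinimization

lemma exists_finset_net {a b h : ℝ} (hh : 0 < h) :
    ∃ Q : Finset ℝ, (∀ x ∈ Q, x ∈ Set.Icc a b) ∧ (Q.card : ℝ) ≤ |b - a| / h + 1 ∧
      ∀ l ∈ Set.Icc a b, ∃ x ∈ Q, |l - x| ≤ h := by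
  refine ⟨((Finset.range (⌊|b - a| / h⌋₊ + 1)).image fun i : ℕ => a + i * h).filter (· ∈ Set.Icc a b),
    fun x hx => (Finset.mem_filter.1 hx).2, ?_, fun l hl => ?_⟩
  · calc _ ≤ ((⌊|b - a| / h⌋₊ + 1 : ℕ) : ℝ) := by
          exact_mod_cast (Finset.card_filter_le _ _).trans (Finset.card_image_le.trans (Finset.card_range _).le)
      _ ≤ _ := by
          push_cast
          gcongr
          exact Nat.floor_le (by positivity)
  · have h0 : 0 ≤ (l - a) / h := div_nonneg (sub_nonneg.2 hl.1) hh.le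
    have h1 := (le_div_iff₀ hh).1 (Nat.floor_le h0)
    have h2 := (div_lt_iff₀ hh).1 (Nat.lt_floor_add_one ((l - a) / h))
    have h3 : 0 ≤ (⌊(l - a) / h⌋₊ : ℝ) * h := by positivity
    refine ⟨a + ⌊(l - a) / h⌋₊ * h, Finset.mem_filter.2 ⟨Finset.mem_image.2 ⟨_, Finset.mem_range.2
      (Nat.lt_succ_of_le (Nat.floor_le_floor ?_)), rfl⟩, by linarith, by linarith [hl.2]⟩, abs_le.2 ⟨by linarith, by linarith⟩⟩
    gcongr
    exact (sub_le_sub_right hl.2 a).trans (le_abs_self _)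

/-- Polynomial and `exp (C₄ / ε)` prefactors are absorbed by weakening the rate from `ε ^ 4` to `ε ^ 6`. -/
lemma exists_absorption_const {D K c a C₄ : ℝ} (hD : 0 < D) (hc : 0 < c) (ha : 0 < a) :
    ∃ C' c' : ℝ, 0 < C' ∧ 0 < c' ∧ ∀ n ε : ℝ, 1 ≤ n → 0 < ε → ε ≤ 1 →
      1 ≤ C' / ε ^ 6 * Real.exp (-(c' * (n * ε ^ 6))) ∨
      K ≤ n * (a * ε) ^ 4 ∧ D * (√n * Real.exp (C₄ / (a * ε))) * Real.exp (-(c * (n * (a * ε) ^ 4))) ≤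
        C' / ε ^ 6 * Real.exp (-(c' * (n * ε ^ 6))) := by
  set b := c * a ^ 4 / 4 with hb
  have hb0 : 0 < b := by positivity
  set K' := max (K / a ^ 4) (C₄ / (2 * b * a))
  refine ⟨max (Real.exp (b * K')) (D / b), b, by positivity, hb0, fun n ε hn hε hε1 => ?_⟩
  set x := n * ε ^ 6 with hx
  have hx0 : 0 < x := by positivity
  have hε6 : ε ^ 6 ≤ 1 := pow_le_one₀ hε.le hε1
  rcases lt_or_ge x K' with hlt | hge
  · left
    calc (1 : ℝ) ≤ Real.exp (b * K') * Real.exp (-(b * x)) := by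
          rw [← Real.exp_add]
          exact Real.one_le_exp (by nlinarith)
      _ ≤ max (Real.exp (b * K')) (D / b) / ε ^ 6 * Real.exp (-(b * x)) := by
          gcongr
          exact (le_max_left _ _).trans (le_div_self (by positivity) (by positivity) hε6)
  · right
    have hy : x / ε ≤ n * ε ^ 4 := by
      rw [div_le_iff₀ hε, hx]
      calc n * ε ^ 6 ≤ n * ε ^ 5 := by gcongr ?_ * ?_; exact pow_le_pow_of_le_one hε.le hε1 (by norm_num)
        _ = n * ε ^ 4 * ε := by ring
    have hxy : x ≤ n * ε ^ 4 := (le_div_self hx0.le hε hε1).trans hy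
    constructor
    · have h1 := (le_max_left _ _).trans (hge.trans hxy)
      rw [div_le_iff₀ (by positivity)] at h1
      linarith
    · have h1 : C₄ / (a * ε) ≤ 2 * b * (n * ε ^ 4) := by
        have h2 := (le_max_right _ _).trans hge
        rw [div_le_iff₀ (by positivity)] at h2
        calc C₄ / (a * ε) ≤ x * (2 * b * a) / (a * ε) := by gcongr
          _ = 2 * b * (x / ε) := by field_simp
          _ ≤ _ := by gcongr
      have h2 : √n ≤ n := Real.sqrt_le_iff.2 ⟨by linarith, le_self_pow₀ hn two_ne_zero⟩
      have h3 : n = x / ε ^ 6 := by rw [hx]; field_simp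
      have h4 : x ≤ Real.exp (b * x) / b := by
        rw [le_div_iff₀ hb0]
        linarith [Real.add_one_le_exp (b * x)]
      have h5 : c * (n * (a * ε) ^ 4) = 4 * b * (n * ε ^ 4) := by rw [hb]; ring
      have h6 : b * x ≤ b * (n * ε ^ 4) := by gcongr
      calc _ = D * √n * Real.exp (C₄ / (a * ε) - c * (n * (a * ε) ^ 4)) := by
            rw [sub_eq_add_neg, Real.exp_add]; ring
        _ ≤ D * n * Real.exp (-(2 * (b * x))) := by
            gcongr
            linarith
        _ ≤ D * (Real.exp (b * x) / b / ε ^ 6) * Real.exp (-(2 * (b * x))) := by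
            gcongr
            rw [h3]
            gcongr
        _ = D / b / ε ^ 6 * Real.exp (-(b * x)) := by
            rw [show -(b * x) = b * x + -(2 * (b * x)) by ring, Real.exp_add]; ring
        _ ≤ _ := by gcongr; exact le_max_right _ _

/-- A finite set of penalty levels fine enough for good data to control all of them, of controlled size. -/
lemma exists_net_const {lmin lmax Λ R₁ c₀ C₄ : ℝ} (hlmin : 0 < lmin) (hΛ : 0 < Λ) (hR₁ : 0 < R₁)
    (hc₀ : 0 < c₀) (hC₄ : 0 < C₄) :
    ∃ D : ℝ, 0 < D ∧ ∀ κ d : ℝ, 0 < κ → κ ≤ 1 → 0 < d → ∃ (h : ℝ) (Q : Finset ℝ),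
      h / lmin * (Λ * R₁) ≤ d ∧ 8 * (h / lmin * (Λ * R₁)) ≤ c₀ ∧
      Λ * (3 * (h / lmin * (Λ * R₁)) / κ) + h ≤ c₀ / 8 * Real.exp (-(C₄ / d)) ∧
      (∀ l ∈ Q, l ∈ Set.Icc lmin lmax) ∧ (∀ l ∈ Set.Icc lmin lmax, ∃ a ∈ Q, a ∈ Set.Icc lmin lmax ∧ |l - a| ≤ h) ∧
      1 + (Q.card : ℝ) ≤ D * (1 / κ * Real.exp (C₄ / d)) := by
  set P := Λ * R₁ / lmin with hP
  have hP0 : 0 < P := by positivity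
  set b := min (c₀ / 8 / (3 * Λ * P + 1)) (min (c₀ / (8 * P)) (C₄ / P))
  have hb0 : 0 < b := by positivity
  refine ⟨2 + |lmax - lmin| / b, by positivity, fun κ d hκ hκ1 hd => ?_⟩
  set E := Real.exp (-(C₄ / d)) with hE
  have hE0 : 0 < E := Real.exp_pos _
  have hE1 : E ≤ 1 := Real.exp_le_one_iff.2 (neg_nonpos.2 (by positivity))
  have hEd : E ≤ d / C₄ := by
    rw [hE, Real.exp_neg, ← inv_div C₄ d]
    exact inv_anti₀ (by positivity) (by linarith [Real.add_one_le_exp (C₄ / d)])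
  set h := b * (κ * E) with hh
  have hh0 : 0 < h := by positivity
  have hhP : h / lmin * (Λ * R₁) = h * P := by rw [hP]; ring
  have hκE : κ * E ≤ E := mul_le_of_le_one_left hE0.le hκ1
  obtain ⟨Q, hQ, hcard, hnet⟩ := exists_finset_net (a := lmin) (b := lmax) hh0
  have hbP : b * P ≤ C₄ := (le_div_iff₀ hP0).1 ((min_le_right _ _).trans (min_le_right _ _))
  have hb8 : b * (8 * P) ≤ c₀ := (le_div_iff₀ (by positivity)).1 ((min_le_right _ _).trans (min_le_left _ _))
  have hb3 : b * (3 * Λ * P + 1) ≤ c₀ / 8 := (le_div_iff₀ (by positivity)).1 (min_le_left _ _)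
  refine ⟨h, Q, ?_⟩
  rw [hhP]
  refine ⟨?_, ?_, ?_, hQ, fun l hl => ?_, ?_⟩
  · calc h * P = b * P * (κ * E) := by rw [hh]; ring
      _ ≤ C₄ * (d / C₄) := by gcongr; exact hκE.trans hEd
      _ = d := mul_div_cancel₀ _ hC₄.ne'
  · calc 8 * (h * P) = b * (8 * P) * (κ * E) := by rw [hh]; ring
      _ ≤ b * (8 * P) := mul_le_of_le_one_right (by positivity) (hκE.trans hE1)
      _ ≤ c₀ := hb8
  · calc Λ * (3 * (h * P) / κ) + h = b * (3 * Λ * P) * E + b * (κ * E) := by rw [hh]; field_simp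
      _ ≤ b * (3 * Λ * P) * E + b * E := by gcongr
      _ = b * (3 * Λ * P + 1) * E := by ring
      _ ≤ c₀ / 8 * E := by gcongr
  · obtain ⟨x, hx, hlx⟩ := hnet l hl
    exact ⟨x, hx, hQ x hx, hlx⟩
  · have h1 : 1 / κ * Real.exp (C₄ / d) = (κ * E)⁻¹ := by
      rw [hE, Real.exp_neg, mul_inv, inv_inv, one_div]
    have h2 : 1 ≤ (κ * E)⁻¹ := (one_le_inv₀ (by positivity)).2 (hκE.trans hE1)
    rw [h1]
    calc 1 + (Q.card : ℝ) ≤ 2 + |lmax - lmin| / h := by linarith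
      _ = 2 + |lmax - lmin| / b * (κ * E)⁻¹ := by rw [hh, div_mul_eq_div_div, div_eq_mul_inv _ (κ * E)]
      _ ≤ 2 * (κ * E)⁻¹ + |lmax - lmin| / b * (κ * E)⁻¹ := by linarith
      _ = _ := by ring

/-- Except on an event of small probability, minimizing the noise level estimate nearly minimizes the error. -/
theorem exists_noise_level_const {α t M δ σ lmin lmax : ℝ} (hα : 0 < α) (ht : 0 < t) (htδ : t < δ) (hM : 0 ≤ M)
    (hσ : 0 < σ) (hlmin : 0 < lmin) (hlmax : lmin ≤ lmax) :
    ∃ C c : ℝ, 0 < C ∧ 0 < c ∧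
      ∀ (m ι : Type) [Fintype m] [Fintype ι] [DecidableEq ι] [Nonempty m] [Nonempty ι] (θ : ι → ℝ) (κ ε : ℝ),
      ApproxSparse α t M θ → (Fintype.card m : ℝ) = δ * Fintype.card ι → κ = 1 / √(Fintype.card m) → 0 < ε → ε ≤ 1 →
      dataGauss m ι {p | ¬∀ sol : ℝ → ι → ℝ, (∀ l ∈ Set.Icc lmin lmax, IsLasso κ σ θ p l (sol l)) →
        ∀ l ∈ Set.Icc lmin lmax, ∀ a ∈ Set.Icc lmin lmax,
        ‖dataMap κ p (errVec κ σ θ (sol l))‖ / (1 - κ ^ 2 * (Finset.univ.filter fun j => sol l j ≠ 0).card) ≤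
          ‖dataMap κ p (errVec κ σ θ (sol a))‖ / (1 - κ ^ 2 * (Finset.univ.filter fun j => sol a j ≠ 0).card) →
        δ * (‖errVec κ σ θ (sol l)‖ ^ 2 - σ ^ 2) ≤ δ * (‖errVec κ σ θ (sol a)‖ ^ 2 - σ ^ 2) + ε} ≤
      ENNReal.ofReal (C / ε ^ 6 * Real.exp (-(c * (Fintype.card m * ε ^ 6)))) := by
  have hδ : 0 < δ := ht.trans htδ
  set Λ := √(2 / δ) + 3
  have hΛ : 0 < Λ := by positivity
  set c₀ := min (σ / (4 * Λ)) (lmin / (2 * Λ))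
  have hc₀ : 0 < c₀ := by positivity
  obtain ⟨R₁, L, d₀, K, c, C₄, hR₁, hL, hd₀, hK, hc, hC₄, hgood⟩ :=
    exists_goodData_const hα ht htδ hM hσ hlmin hlmax (le_refl Λ) hc₀
  obtain ⟨D, hD, hnet⟩ := exists_net_const (lmax := lmax) hlmin hΛ hR₁ hc₀ hC₄
  set A := (L / σ + 2 * R₁ + 1) / (c₀ / (4 * R₁)) with hA
  set a := min d₀ (min (1 / 4) (min (c₀ / 2 / (L / σ + R₁)) (min (c₀ / (4 * R₁)) (1 / (4 * A * R₁ * δ)))))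
  have ha : 0 < a := by positivity
  have ha1 : a ≤ d₀ := min_le_left _ _
  have ha2 : a ≤ 1 / 4 := (min_le_right _ _).trans (min_le_left _ _)
  have ha3 : a ≤ c₀ / 2 / (L / σ + R₁) := (min_le_right _ _).trans ((min_le_right _ _).trans (min_le_left _ _))
  have ha4 : a ≤ c₀ / (4 * R₁) :=
    (min_le_right _ _).trans ((min_le_right _ _).trans ((min_le_right _ _).trans (min_le_left _ _)))
  have ha5 : a ≤ 1 / (4 * A * R₁ * δ) :=
    (min_le_right _ _).trans ((min_le_right _ _).trans ((min_le_right _ _).trans (min_le_right _ _)))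
  rw [le_div_iff₀ (by positivity)] at ha3 ha5
  have hc1 : c₀ ≤ σ / (4 * Λ) := min_le_left _ _
  have hc2 : c₀ ≤ lmin / (2 * Λ) := min_le_right _ _
  clear_value a c₀ Λ
  obtain ⟨C', c', hC', hc', habs⟩ := exists_absorption_const (C₄ := C₄) (mul_pos (by norm_num : (0 : ℝ) < 20) hD) hc ha
  refine ⟨C', c', hC', hc', fun m ι _ _ _ _ _ θ κ ε hθ hcard hκ' hε hε1 => ?_⟩
  have hn1 : (1 : ℝ) ≤ Fintype.card m := Nat.one_le_cast.2 Fintype.card_pos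
  set n : ℝ := (Fintype.card m : ℝ) with hn
  have hκ : 0 < κ := by rw [hκ']; positivity
  have hκ1 : 1 / κ = √n := by rw [hκ', one_div_one_div]
  have hκle : κ ≤ 1 := by rw [hκ', div_le_one (by positivity)]; exact Real.one_le_sqrt.2 hn1
  have hκn : κ ^ 2 * n = 1 := by
    rw [hκ', div_pow, Real.sq_sqrt (by positivity), one_pow, one_div_mul_cancel (by positivity)]
  rcases habs n ε hn1 hε hε1 with htriv | ⟨hKn, hbound⟩
  · exact prob_le_one.trans (ENNReal.one_le_ofReal.2 htriv)
  set d := a * ε with hd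
  have hd0 : 0 < d := mul_pos ha hε
  have hda : d ≤ a := mul_le_of_le_one_right ha.le hε1
  obtain ⟨h, Q, hh1, hh2, hh3, hQ, hQnet, hQcard⟩ := hnet κ d hκ hκle hd0
  have hbad := hgood m ι θ Q d hθ hcard hQ hd0 (hda.trans ha1) hKn
  rw [← hκ'] at hbad
  refine (measure_mono ?_).trans (hbad.trans ?_)
  · intro p hp hg
    refine hp fun sol hsol l hl x hx hle => ?_
    have hη : L * d / σ + d * R₁ ≤ c₀ / 2 := by
      calc L * d / σ + d * R₁ = d * (L / σ + R₁) := by ring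
        _ ≤ a * (L / σ + R₁) := by gcongr
        _ ≤ c₀ / 2 := ha3
    have hlev := fun y (hy : y ∈ Set.Icc lmin lmax) => abs_le.1 (hg.abs_noise_level_sub_le hκ hσ hlmin hκn hΛ hR₁
      (hda.trans ha2) hc₀ hc1 hc2 hh1 hh2 hh3 hη (hda.trans ha4) hQnet hsol hy)
    have hAd : (L * d / σ + d * R₁ + d + d * R₁) / (c₀ / (4 * R₁)) = A * d := by rw [hA]; ring
    have h1 := (hlev l hl).1
    have h2 := (hlev x hx).2
    have h3 := hg.norm_errVec_le hκ hl (hsol l hl)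
    have h4 := hg.norm_errVec_le hκ hx (hsol x hx)
    have h5 : δ * (2 * (A * d) * (2 * R₁)) ≤ ε := by
      calc δ * (2 * (A * d) * (2 * R₁)) = a * (4 * A * R₁ * δ) * ε := by rw [hd]; ring
        _ ≤ 1 * ε := by gcongr
        _ = ε := one_mul ε
    rw [hAd] at h1 h2
    set v := ‖errVec κ σ θ (sol l)‖
    set w := ‖errVec κ σ θ (sol x)‖
    have h6 : v ^ 2 - w ^ 2 ≤ 2 * (A * d) * (2 * R₁) := by
      calc v ^ 2 - w ^ 2 = (v - w) * (v + w) := by ring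
        _ ≤ 2 * (A * d) * (v + w) := by gcongr; linarith
        _ ≤ _ := by gcongr; linarith
    have h7 := mul_le_mul_of_nonneg_left h6 hδ.le
    linarith
  · have h1 : (20 * (1 + Q.card) : ℝ≥0∞) = ENNReal.ofReal (20 * (1 + Q.card)) := by
      rw [ENNReal.ofReal_mul (by norm_num), ENNReal.ofReal_add zero_le_one (by positivity)]
      simp
    rw [h1, ← ENNReal.ofReal_mul (by positivity)]
    refine ENNReal.ofReal_le_ofReal (le_trans ?_ hbound)
    rw [← hκ1, mul_assoc 20 D]
    gcongr

end NoiseLevelMinimization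

/-- Proposition (near-optimality of the choice λ̂ᴱˢᵀ minimizing τ̂). -/
theorem stmt8 (δ σ lmin lmax q : ℝ)
    (hδ : 0 < δ) (hσ : 0 < σ) (hl : 0 < lmin) (hll : lmin ≤ lmax)
    (Dfam : (M : ℕ) → Set (Fin M → ℝ))
    (hD : DFamSpec δ Dfam q) :
    ∃ C c : ℝ, 0 < C ∧ 0 < c ∧
      ∀ (N n : ℕ), 0 < N → (n : ℝ) = δ * N →
      ∀ θstar ∈ Dfam N,
      ∀ θhat : ℝ → (Fin n → Fin N → ℝ) → (Fin n → ℝ) → (Fin N → ℝ),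
      (∀ lam ∈ Set.Icc lmin lmax, ∀ (X : Fin n → Fin N → ℝ) (z : Fin n → ℝ),
        IsMinOn (lassoCost X (yvec σ θstar X z) lam) Set.univ (θhat lam X z)) →
      ∀ lamEST : ((Fin n → Fin N → ℝ) × (Fin n → ℝ)) → ℝ,
      (∀ ω, lamEST ω ∈ Set.Icc lmin lmax ∧
        IsMinOn (fun lam => tauHat ω.1 (yvec σ θstar ω.1 ω.2) (θhat lam ω.1 ω.2))
          (Set.Icc lmin lmax) (lamEST ω)) →
      ∀ ε : ℝ, ε ∈ Set.Ioc (0 : ℝ) 1 →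
      ENNReal.ofReal (1 - C / ε ^ 6 * (N : ℝ) ^ q * Real.exp (-c * N * ε ^ 6)) ≤
        Pmodel n N
          {ω | (1 / (N : ℝ)) * ∑ j, (θhat (lamEST ω) ω.1 ω.2 j - θstar j) ^ 2 ≤
            sInf ((fun lam => (1 / (N : ℝ)) *
                ∑ j, (θhat lam ω.1 ω.2 j - θstar j) ^ 2) '' Set.Icc lmin lmax)
              + ε} := by
  obtain ⟨hq, α, t, M, hα, ht, htδ, hM, hsparse⟩ := exists_approxSparse hδ hD
  obtain ⟨C, c, hC, hc, hmain⟩ := exists_noise_level_const hα ht htδ hM hσ hl hll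
  refine ⟨C, c * δ, hC, by positivity, fun N n hN hn θstar hθ θhat hmin lamEST hEST ε hε => ?_⟩
  have hN1 : (1 : ℝ) ≤ N := Nat.one_le_cast.2 hN
  have hn0 : 0 < n := Nat.cast_pos.1 (hn ▸ by positivity : (0 : ℝ) < n)
  have : Nonempty (Fin n) := ⟨⟨0, hn0⟩⟩
  have : Nonempty (Fin N) := ⟨⟨0, hN⟩⟩
  set κ := 1 / √(n : ℝ)
  have hbad := hmain (Fin n) (Fin N) θstar κ ε (hsparse N θstar hθ) (by simpa using hn) (by simp [κ]) hε.1 hε.2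
  refine le_trans ?_ (dataGauss_modelMap_le n N _)
  rw [Fintype.card_fin] at hbad
  have hB0 : 0 ≤ C / ε ^ 6 * (N : ℝ) ^ q * Real.exp (-(c * δ) * N * ε ^ 6) := by
    have := hε.1
    positivity
  rw [ENNReal.ofReal_sub _ hB0, ENNReal.ofReal_one, tsub_le_iff_right, ← measure_univ (μ := dataGauss (Fin n) (Fin N))]
  refine (measure_mono ?_).trans ((measure_union_le _ _).trans (add_le_add_right (hbad.trans ?_) _))
  · intro p _
    refine or_iff_not_imp_right.2 fun hp => ?_
    have hgood := not_not.1 hp (fun l => θhat l (modelMap p).1 (modelMap p).2)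
      fun l hl => isLasso_of_isMinOn_lassoCost hn0 (hmin l hl _ _)
    obtain ⟨hE, hEmin⟩ := hEST (modelMap p)
    have hinf : (1 / (N : ℝ)) * ∑ j, (θhat (lamEST (modelMap p)) (modelMap p).1 (modelMap p).2 j - θstar j) ^ 2 - ε ≤
        sInf ((fun lam => (1 / (N : ℝ)) *
          ∑ j, (θhat lam (modelMap p).1 (modelMap p).2 j - θstar j) ^ 2) '' Set.Icc lmin lmax) := by
      refine le_csInf ((Set.nonempty_Icc.2 hll).image _) ?_
      rintro _ ⟨a, ha, rfl⟩
      have h1 : tauHat _ _ _ ≤ tauHat _ _ _ := hEmin ha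
      rw [tauHat_modelMap hn0, tauHat_modelMap hn0] at h1
      simp only [mean_sq_error_eq hδ hN hn σ]
      linarith [hgood _ hE a ha h1]
    exact sub_le_iff_le_add.1 hinf
  · refine ENNReal.ofReal_le_ofReal ?_
    have h1 : -(c * (n * ε ^ 6)) = -(c * δ) * N * ε ^ 6 := by rw [hn]; ring
    have h2 : (1 : ℝ) ≤ (N : ℝ) ^ q := Real.one_le_rpow hN1 hq
    have := hε.1
    rw [h1]
    gcongr
    exact le_mul_of_one_le_right (by positivity) h2
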